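/- Let B = (B^{(0)},…,B^{(p)}), Q, α, λ, L be as in the context. Then there exist v ∈ ℂ^p and an injection Φ: M(B) ↪ M^reg_{λ+v̄}(Q,α) := μ⁻¹(λ+v̄)^irr/G whose image is exactly the set of classes of x ∈ μ⁻¹(λ+v̄)^irr satisfying the determinant conditions. In particular, if I_irr = {0} then one may take v = 0 and Φ is bijective. -/

import Mathlib

/-!
STATEMENT 10: there exist `v ∈ ℂ^p` and an injection `Φ : M(B) ↪ M^reg_{λ+v̄}(Q,α)`
whose image is exactly the locus where the determinant conditions hold; if
`I_irr = {0}` one may take `v = 0`, and then `Φ` is bijective.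
-/
open Matrix BigOperators

noncomputable section

/-! ### Formal Laurent series preliminaries -/

/-- Evaluation of a polynomial at `z⁻¹`. -/
def polyZinv (q : Polynomial ℂ) : LaurentSeries ℂ :=
  q.sum fun k c => HahnSeries.single (-(k : ℤ)) c

/-- A Laurent series lies in `ℂ[[z]]`. -/
def Tame (f : LaurentSeries ℂ) : Prop := ∀ k : ℤ, k < 0 → f.coeff k = 0

/-- A Laurent series is a principal part (class representative in `ℂ((z))/ℂ[[z]]`). -/
def IsPrincipal (f : LaurentSeries ℂ) : Prop := ∀ k : ℤ, 0 ≤ k → f.coeff k = 0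

/-- `GL(n, ℂ[[z]])`. -/
abbrev GLps (n : ℕ) := (Matrix (Fin n) (Fin n) (PowerSeries ℂ))ˣ

/-- `GL(n, ℂ)`. -/
abbrev GLc (n : ℕ) := (Matrix (Fin n) (Fin n) ℂ)ˣ

/-- The inclusion `GL(n, ℂ[[z]]) → GL(n, ℂ((z)))`. -/
def glMap {n : ℕ} : GLps n →* (Matrix (Fin n) (Fin n) (LaurentSeries ℂ))ˣ :=
  Units.map ((HahnSeries.ofPowerSeries ℤ ℂ).mapMatrix).toMonoidHom

/-- The inclusion `GL(n, ℂ) → GL(n, ℂ((z)))`. -/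
def glC {n : ℕ} : GLc n →* (Matrix (Fin n) (Fin n) (LaurentSeries ℂ))ˣ :=
  Units.map ((HahnSeries.C : ℂ →+* LaurentSeries ℂ).mapMatrix).toMonoidHom

/-- Conjugation of a matrix of Laurent series by `X ∈ GL(n, ℂ[[z]])`. -/
def conjPS {n : ℕ} (X : GLps n) (B : Matrix (Fin n) (Fin n) (LaurentSeries ℂ)) :
    Matrix (Fin n) (Fin n) (LaurentSeries ℂ) :=
  (glMap X).val * B * ((glMap X)⁻¹).val

/-- Conjugation by a constant invertible matrix. -/
def conjC {n : ℕ} (g : GLc n) (B : Matrix (Fin n) (Fin n) (LaurentSeries ℂ)) :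
    Matrix (Fin n) (Fin n) (LaurentSeries ℂ) :=
  (glC g).val * B * ((glC g)⁻¹).val

/-- The matrix of `z^k`-coefficients of a matrix of Laurent series. -/
def coeffM {n : ℕ} (M : Matrix (Fin n) (Fin n) (LaurentSeries ℂ)) (k : ℤ) :
    Matrix (Fin n) (Fin n) ℂ := fun a b => (M a b).coeff k

/-! ### Finite quivers and representations of double quivers -/

/-- A finite quiver. -/
structure FinQuiver where
  V : Type
  E : Type
  [fintypeV : Fintype V]
  [decEqV : DecidableEq V]
  [fintypeE : Fintype E]
  [decEqE : DecidableEq E]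
  src : E → V
  tgt : E → V

attribute [instance] FinQuiver.fintypeV FinQuiver.decEqV FinQuiver.fintypeE FinQuiver.decEqE

namespace FinQuiver

variable (Q : FinQuiver) (α : Q.V → ℕ)

/-- The representation space of the double quiver `Q̄` with dimension vector `α`. -/
abbrev Rep :=
  ∀ e : Q.E, Matrix (Fin (α (Q.tgt e))) (Fin (α (Q.src e))) ℂ ×
    Matrix (Fin (α (Q.src e))) (Fin (α (Q.tgt e))) ℂ

/-- The group `G = ∏_{a ∈ Q₀} GL(α_a, ℂ)`. -/
abbrev GGroup := ∀ a : Q.V, (Matrix (Fin (α a)) (Fin (α a)) ℂ)ˣ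

variable {Q α}

/-- The action of `G` on `Rep(Q̄,α)`. -/
def act (g : Q.GGroup α) (x : Q.Rep α) : Q.Rep α := fun e =>
  ((g (Q.tgt e)).val * (x e).1 * ((g (Q.src e))⁻¹).val,
   (g (Q.src e)).val * (x e).2 * ((g (Q.tgt e))⁻¹).val)

/-- The moment map `μ`. -/
def mu (x : Q.Rep α) (a : Q.V) : Matrix (Fin (α a)) (Fin (α a)) ℂ :=
  (∑ e : Q.E, if h : Q.tgt e = a then
      (Matrix.reindex (finCongr (congrArg α h)) (finCongr (congrArg α h))
        ((x e).1 * (x e).2)) else 0)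
  - ∑ e : Q.E, if h : Q.src e = a then
      (Matrix.reindex (finCongr (congrArg α h)) (finCongr (congrArg α h))
        ((x e).2 * (x e).1)) else 0

/-- A collection of subspaces invariant under all the components of `x`. -/
def InvFamily (x : Q.Rep α) (W : ∀ a : Q.V, Submodule ℂ (Fin (α a) → ℂ)) : Prop :=
  ∀ e : Q.E, (∀ v ∈ W (Q.src e), (x e).1.mulVec v ∈ W (Q.tgt e)) ∧
             (∀ v ∈ W (Q.tgt e), (x e).2.mulVec v ∈ W (Q.src e))

/-- `x` is an irreducible representation of the double quiver. -/
def Irred (x : Q.Rep α) : Prop :=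
  ∀ W : ∀ a : Q.V, Submodule ℂ (Fin (α a) → ℂ),
    InvFamily x W → (∀ a, W a = ⊥) ∨ (∀ a, W a = ⊤)

end FinQuiver

/-! ### The data of a collection of HTL normal forms -/

/-- A collection `B = (B^{(0)}, …, B^{(p)})` of unramified HTL normal forms of size `n`,
`B^{(i)} = diag(q^{(i)}_j(z⁻¹)I_{n^{(i)}_j} + R^{(i)}_j z⁻¹)_{j=1,…,m^{(i)}}`,
together with eigenvalue data `ξ^{[i,j]}_1, …, ξ^{[i,j]}_{e_{[i,j]}}` with
`∏_k (R^{(i)}_j − ξ^{[i,j]}_k) = 0`. -/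
structure ConnData where
  n : ℕ
  hn : 0 < n
  p : ℕ
  m : Fin (p+1) → ℕ
  hm : ∀ i, 0 < m i
  nb : (i : Fin (p+1)) → Fin (m i) → ℕ
  hnb : ∀ i j, 0 < nb i j
  hsum : ∀ i, ∑ j, nb i j = n
  q : (i : Fin (p+1)) → Fin (m i) → Polynomial ℂ
  hq0 : ∀ i j, (q i j).coeff 0 = 0
  hq1 : ∀ i j, (q i j).coeff 1 = 0
  hqd : ∀ i (j j' : Fin (m i)), j ≠ j' → q i j ≠ q i j'
  hreg : ∀ i, i ≠ 0 → m i = 1 → ∀ j, q i j = 0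
  R : (i : Fin (p+1)) → (j : Fin (m i)) → Matrix (Fin (nb i j)) (Fin (nb i j)) ℂ
  e : (i : Fin (p+1)) → Fin (m i) → ℕ
  he : ∀ i j, 0 < e i j
  xi : (i : Fin (p+1)) → (j : Fin (m i)) → Fin (e i j) → ℂ
  hxi : ∀ i j,
    (List.ofFn fun k => R i j - xi i j k • (1 : Matrix (Fin (nb i j)) (Fin (nb i j)) ℂ)).prod = 0

namespace ConnData

variable (D : ConnData)

/-- `i ∈ I_irr`. -/
def isIrr (i : Fin (D.p+1)) : Prop := 1 < D.m i ∨ i = 0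

instance : DecidablePred D.isIrr := fun _ => inferInstanceAs (Decidable (_ ∨ _))

/-- The set of indices of irregular type. -/
abbrev IrrIdx := {i : Fin (D.p+1) // D.isIrr i}

/-- The set of indices of irregular type other than `0`. -/
abbrev IrrNz := {i : Fin (D.p+1) // D.isIrr i ∧ i ≠ 0}

/-- The unique block index at a point. -/
def j1 (i : Fin (D.p+1)) : Fin (D.m i) := ⟨0, D.hm i⟩

/-- `d_i(j,j') = deg(q^{(i)}_j − q^{(i)}_{j'}) − 2`. -/
def dd (i : Fin (D.p+1)) (j j' : Fin (D.m i)) : ℕ := ((D.q i j) - (D.q i j')).natDegree - 2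

/-- The vertex set of the quiver: mid vertices `[i,j]` (for `i ∈ I_irr`) and leg
vertices `[i,j,k]`, `1 ≤ k ≤ e_{[i,j]}−1`. -/
abbrev Vq :=
  (Σ i : D.IrrIdx, Fin (D.m i.1)) ⊕ (Σ i : Fin (D.p+1), Σ j : Fin (D.m i), Fin (D.e i j - 1))

/-- The vertex `[i,j]`, `i ∈ I_irr`. -/
def vmid (i : D.IrrIdx) (j : Fin (D.m i.1)) : D.Vq := Sum.inl ⟨i, j⟩

/-- `0 ∈ I_irr`. -/
def irr0 : D.IrrIdx := ⟨0, Or.inr rfl⟩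

/-- The vertex `[0,j]`. -/
def vmid0 (j : Fin (D.m 0)) : D.Vq := Sum.inl ⟨D.irr0, j⟩

/-- The leg vertex `[i,j,k+1]` (`k` is 0-based). -/
def vleg (i : Fin (D.p+1)) (j : Fin (D.m i)) (k : Fin (D.e i j - 1)) : D.Vq :=
  Sum.inr ⟨i, j, k⟩

/-- Arrows `[0,j] → [i,j']`, `i ∈ I_irr \ {0}`. -/
abbrev Arr1 := Fin (D.m 0) × (Σ i : D.IrrNz, Fin (D.m i.1))
/-- `d_i(j,j')` arrows `[i,j] → [i,j']` for `i ∈ I_irr`, `j < j'`. -/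
abbrev Arr2 := Σ i : D.IrrIdx, Σ jj : {x : Fin (D.m i.1) × Fin (D.m i.1) // x.1 < x.2},
  Fin (D.dd i.1 jj.1.1 jj.1.2)
/-- Leg arrows `[i,j,k] → [i,j,k−1]`, `k ≥ 2`. -/
abbrev Arr3 := Σ i : Fin (D.p+1), Σ j : Fin (D.m i), Fin (D.e i j - 2)
/-- Arrows `[i,j,1] → [i,j]`, `i ∈ I_irr`. -/
abbrev Arr4 := Σ i : D.IrrIdx, {j : Fin (D.m i.1) // 2 ≤ D.e i.1 j}
/-- Arrows `[i,1,1] → [0,j]`, `i ∈ I_reg`. -/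
abbrev Arr5 := {i : Fin (D.p+1) // ¬ D.isIrr i ∧ 2 ≤ D.e i (D.j1 i)} × Fin (D.m 0)

/-- The arrow set of the quiver. -/
abbrev Arr := D.Arr1 ⊕ D.Arr2 ⊕ D.Arr3 ⊕ D.Arr4 ⊕ D.Arr5

/-- Sources of arrows. -/
def qsrc : D.Arr → D.Vq
  | .inl (j, ⟨_, _⟩) => D.vmid0 j
  | .inr (.inl ⟨i, jj, _⟩) => D.vmid i jj.1.1
  | .inr (.inr (.inl ⟨i, j, t⟩)) => D.vleg i j ⟨t.1 + 1, by have := t.isLt; omega⟩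
  | .inr (.inr (.inr (.inl ⟨i, j⟩))) => D.vleg i.1 j.1 ⟨0, by have := j.2; omega⟩
  | .inr (.inr (.inr (.inr (i, _)))) => D.vleg i.1 (D.j1 i.1) ⟨0, by have := i.2.2; omega⟩

/-- Targets of arrows. -/
def qtgt : D.Arr → D.Vq
  | .inl (_, ⟨i, j'⟩) => D.vmid ⟨i.1, i.2.1⟩ j'
  | .inr (.inl ⟨i, jj, _⟩) => D.vmid i jj.1.2
  | .inr (.inr (.inl ⟨i, j, t⟩)) => D.vleg i j ⟨t.1, by have := t.isLt; omega⟩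
  | .inr (.inr (.inr (.inl ⟨i, j⟩))) => D.vmid i j.1
  | .inr (.inr (.inr (.inr (_, j)))) => D.vmid0 j

/-- The quiver `Q` associated with `B`. -/
def quiv : FinQuiver := FinQuiver.mk (V := D.Vq) (E := D.Arr) D.qsrc D.qtgt

/-- The dimension vector `α`. -/
def alphaV : D.Vq → ℕ
  | .inl ⟨i, j⟩ => D.nb i.1 j
  | .inr ⟨i, j, k⟩ =>
      ((List.ofFn fun l : Fin (k.1 + 1) =>
          D.R i j - D.xi i j ⟨l.1, by have := l.isLt; have := k.isLt; omega⟩ •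
            (1 : Matrix (Fin (D.nb i j)) (Fin (D.nb i j)) ℂ)).prod).rank

/-- The dimension vector `α` as an integral vector. -/
def alphaZ : D.Vq → ℤ := fun a => (D.alphaV a : ℤ)

/-- `Σ_{i ∈ I_reg} ξ^{[i,1]}_1`. -/
def regSumXi : ℂ :=
  ∑ i : Fin (D.p+1), if D.isIrr i then 0 else D.xi i (D.j1 i) ⟨0, D.he _ _⟩

/-- The parameter `λ`. -/
def lamV : D.Vq → ℂ
  | .inl ⟨⟨i, _⟩, j⟩ =>
      if h : i = 0 then - D.xi 0 (h ▸ j) ⟨0, D.he _ _⟩ - D.regSumXi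
      else - D.xi i j ⟨0, D.he _ _⟩
  | .inr ⟨i, j, k⟩ =>
      D.xi i j ⟨k.1, by have := k.isLt; omega⟩ - D.xi i j ⟨k.1 + 1, by have := k.isLt; omega⟩

/-- The lattice `L ⊆ ℤ^{Q₀}`. -/
def latt : Set (D.Vq → ℤ) :=
  {β | ∀ i : D.IrrNz,
    (∑ j : Fin (D.m 0), β (D.vmid0 j)) = ∑ j : Fin (D.m i.1), β (D.vmid ⟨i.1, i.2.1⟩ j)}

/-- `L`-irreducibility of a representation: no nontrivial proper invariant collection
of subspaces whose dimension vector lies in `L`. -/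
def LIrred {αd : D.Vq → ℕ} (x : D.quiv.Rep αd) : Prop :=
  ∀ W : ∀ a : D.Vq, Submodule ℂ (Fin (αd a) → ℂ),
    FinQuiver.InvFamily x W →
    (fun a => (Module.finrank ℂ (W a) : ℤ)) ∈ D.latt →
    (∀ a, W a = ⊥) ∨ (∀ a, W a = ⊤)

/-- The block matrix formed by the components of `x` along the arrows `[0,j] → [i,j']`
for a fixed `i ∈ I_irr \ {0}`. -/
def detMat {αd : D.Vq → ℕ} (x : D.quiv.Rep αd) (i : D.IrrNz) :
    Matrix (Σ j' : Fin (D.m i.1), Fin (αd (D.vmid ⟨i.1, i.2.1⟩ j')))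
      (Σ j : Fin (D.m 0), Fin (αd (D.vmid0 j))) ℂ :=
  fun rc cc => (x (Sum.inl (cc.1, ⟨i, rc.1⟩))).1 rc.2 cc.2

/-- The determinant conditions: the block matrices along the arrows `[0,j] → [i,j']`
are invertible for all `i ∈ I_irr \ {0}`. -/
def DetCond {αd : D.Vq → ℕ} (x : D.quiv.Rep αd) : Prop :=
  ∀ i : D.IrrNz, Function.Bijective (Matrix.mulVecLin (D.detMat x i))

/-- The set underlying `M_λ(Q,α)^dif`. -/
def MdifSub (lam : D.Vq → ℂ) (αd : D.Vq → ℕ) :=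
  {x : D.quiv.Rep αd //
    (∀ a, FinQuiver.mu x a = lam a • (1 : Matrix (Fin (αd a)) (Fin (αd a)) ℂ)) ∧
    D.LIrred x ∧ D.DetCond x}

/-- `M_λ(Q,α)^dif`: the quotient of the `L`-irreducible locus (with the determinant
conditions) of `μ⁻¹(λ)` by `G`. -/
def Mdif (lam : D.Vq → ℂ) (αd : D.Vq → ℕ) :=
  Quot (fun x y : D.MdifSub lam αd => ∃ g : D.quiv.GGroup αd, FinQuiver.act g x.1 = y.1)

/-- Identification of the disjoint union of the blocks of `B^{(i)}` with `Fin n`. -/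
def sigmaEquiv (i : Fin (D.p+1)) : (Σ j : Fin (D.m i), Fin (D.nb i j)) ≃ Fin D.n :=
  Fintype.equivFinOfCardEq (by simpa using D.hsum i)

/-- The matrix of the HTL normal form `B^{(i)}`. -/
def BmatAt (i : Fin (D.p+1)) : Matrix (Fin D.n) (Fin D.n) (LaurentSeries ℂ) :=
  Matrix.reindex (D.sigmaEquiv i) (D.sigmaEquiv i)
    (Matrix.blockDiagonal' fun j =>
      (fun a b => (if a = b then polyZinv (D.q i j) else 0) +
        HahnSeries.single (-1 : ℤ) (D.R i j a b)))

/-- Membership in the moduli space data: a tuple of principal parts, lying in the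
truncated orbits of the `B^{(i)}`, with vanishing total residue, which is
irreducible. -/
def MBMem (A : Fin (D.p+1) → Matrix (Fin D.n) (Fin D.n) (LaurentSeries ℂ)) : Prop :=
  (∀ i a b, IsPrincipal (A i a b)) ∧
  (∀ i, ∃ X : GLps D.n, ∀ a b, Tame ((A i - conjPS X (D.BmatAt i)) a b)) ∧
  (∑ i, coeffM (A i) (-1)) = 0 ∧
  (∀ W : Submodule ℂ (Fin D.n → ℂ),
    (∀ i (k : ℤ), ∀ v ∈ W, (coeffM (A i) k).mulVec v ∈ W) → W = ⊥ ∨ W = ⊤)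

/-- The set underlying the moduli space `M(B)`. -/
def MBSub := {A : Fin (D.p+1) → Matrix (Fin D.n) (Fin D.n) (LaurentSeries ℂ) // D.MBMem A}

/-- The moduli space `M(B)` of stable meromorphic connections on trivial bundles with
formal types `B`: the quotient by simultaneous `GL(n,ℂ)`-conjugation. -/
def MB := Quot (fun A A' : D.MBSub => ∃ g : GLc D.n, ∀ i, conjC g (A.1 i) = A'.1 i)

/-- The shift `v̄ ∈ ℂ^{Q₀}` attached to `v = (v_1,…,v_p) ∈ ℂ^p`:
`v̄_{[i,j]} = v_i` for `i ∈ I_irr \ {0}`, `v̄_{[0,j]} = v_0 + Σ_{k ∈ I_reg} v_k`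
(where `v_0 := −Σ_{i=1}^p v_i`), and `v̄ = 0` on leg vertices. -/
def vbar (v : Fin D.p → ℂ) : D.Vq → ℂ
  | .inl ⟨⟨i, _⟩, _⟩ =>
      if h : i = 0 then
        (- ∑ i' : Fin D.p, v i') + ∑ i' : Fin D.p, (if ¬ D.isIrr i'.succ then v i' else 0)
      else v (i.pred h)
  | .inr _ => 0

/-- The stable (= irreducible) locus of `μ⁻¹(λ)`. -/
def MregSub (lam : D.Vq → ℂ) :=
  {x : D.quiv.Rep D.alphaV //
    (∀ a, FinQuiver.mu x a = lam a • (1 : Matrix (Fin (D.alphaV a)) (Fin (D.alphaV a)) ℂ)) ∧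
    FinQuiver.Irred x}

/-- The regular part `M^reg_λ(Q,α) = μ⁻¹(λ)^irr / G` of the quiver variety. -/
def Mreg (lam : D.Vq → ℂ) :=
  Quot (fun x y : D.MregSub lam => ∃ g : D.quiv.GGroup D.alphaV, FinQuiver.act g x.1 = y.1)

end ConnData

end

noncomputable section

open Matrix BigOperators

set_option linter.unusedSectionVars false

/-! ### Coefficients of matrices of Laurent series -/

section LaurentMatrix

variable {ι κ ν : Type}

/-- The matrix of `z^k`-coefficients. -/
def cf (f : Matrix ι κ (LaurentSeries ℂ)) (k : ℤ) : Matrix ι κ ℂ := fun a b => (f a b).coeff k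

theorem cf_ext {f g : Matrix ι κ (LaurentSeries ℂ)} (h : ∀ k, cf f k = cf g k) : f = g := by
  ext a b k
  exact congrFun (congrFun (h k) a) b

@[simp] theorem cf_add (f g : Matrix ι κ (LaurentSeries ℂ)) (k : ℤ) :
    cf (f + g) k = cf f k + cf g k := by
  ext a b; simp [cf]

@[simp] theorem cf_sub (f g : Matrix ι κ (LaurentSeries ℂ)) (k : ℤ) :
    cf (f - g) k = cf f k - cf g k := by
  ext a b; simp [cf]

@[simp] theorem cf_neg (f : Matrix ι κ (LaurentSeries ℂ)) (k : ℤ) :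
    cf (-f) k = - cf f k := by
  ext a b; simp [cf]

@[simp] theorem cf_zero (k : ℤ) : cf (0 : Matrix ι κ (LaurentSeries ℂ)) k = 0 := by
  ext a b; simp [cf]

@[simp] theorem cf_sum {A : Type*} (s : Finset A) (f : A → Matrix ι κ (LaurentSeries ℂ)) (k : ℤ) :
    cf (∑ t ∈ s, f t) k = ∑ t ∈ s, cf (f t) k := by
  classical
  induction s using Finset.induction_on with
  | empty => simp
  | insert a s ha ih => simp [Finset.sum_insert ha, ih]

/-- The monomial matrix `m z^k`. -/
def sg (k : ℤ) (m : Matrix ι κ ℂ) : Matrix ι κ (LaurentSeries ℂ) :=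
  m.map (HahnSeries.single k)

theorem cf_sg (k : ℤ) (m : Matrix ι κ ℂ) (l : ℤ) : cf (sg k m) l = if l = k then m else 0 := by
  ext a b
  simp only [cf, sg, Matrix.map_apply, HahnSeries.coeff_single]
  split_ifs <;> rfl

@[simp] theorem cf_sg_mul [Fintype κ] (k : ℤ) (m : Matrix ι κ ℂ)
    (f : Matrix κ ν (LaurentSeries ℂ)) (l : ℤ) : cf (sg k m * f) l = m * cf f (l - k) := by
  ext a b
  simp only [cf, sg, Matrix.mul_apply, Matrix.map_apply, HahnSeries.coeff_sum,
    HahnSeries.coeff_single_mul]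

@[simp] theorem cf_mul_sg [Fintype κ] (k : ℤ) (m : Matrix κ ν ℂ)
    (f : Matrix ι κ (LaurentSeries ℂ)) (l : ℤ) : cf (f * sg k m) l = cf f (l - k) * m := by
  ext a b
  simp only [cf, sg, Matrix.mul_apply, Matrix.map_apply, HahnSeries.coeff_sum,
    HahnSeries.coeff_mul_single]

theorem sg_mul_sg [Fintype κ] (k l : ℤ) (m : Matrix ι κ ℂ) (m' : Matrix κ ν ℂ) :
    sg k m * sg l m' = sg (k + l) (m * m') := by
  apply cf_ext
  intro r
  rw [cf_sg_mul, cf_sg, cf_sg]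
  by_cases h : r = k + l
  · rw [if_pos (by omega), if_pos h]
  · rw [if_neg (by omega), if_neg h, Matrix.mul_zero]

theorem sg_zero_one [DecidableEq ι] : sg 0 (1 : Matrix ι ι ℂ) = 1 := by
  ext a b : 2
  simp only [sg, Matrix.map_apply, Matrix.one_apply]
  split_ifs <;> simp

theorem sg_add (k : ℤ) (m m' : Matrix ι κ ℂ) : sg k (m + m') = sg k m + sg k m' := by
  apply cf_ext; intro l; simp only [cf_add, cf_sg]; split_ifs <;> simp

theorem sg_sum {A : Type*} (s : Finset A) (k : ℤ) (m : A → Matrix ι κ ℂ) :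
    sg k (∑ t ∈ s, m t) = ∑ t ∈ s, sg k (m t) := by
  apply cf_ext; intro l; simp only [cf_sum, cf_sg]; split_ifs <;> simp

theorem sg_zero (k : ℤ) : sg k (0 : Matrix ι κ ℂ) = 0 := by
  apply cf_ext; intro l; simp [cf_sg]

/-- `f ∈ z^d Mat(ℂ[[z]])`. -/
def Vge (d : ℤ) (f : Matrix ι κ (LaurentSeries ℂ)) : Prop := ∀ k < d, cf f k = 0

theorem Vge.add {d : ℤ} {f g : Matrix ι κ (LaurentSeries ℂ)} (hf : Vge d f) (hg : Vge d g) :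
    Vge d (f + g) := fun k hk => by simp [hf k hk, hg k hk]

theorem Vge.sub {d : ℤ} {f g : Matrix ι κ (LaurentSeries ℂ)} (hf : Vge d f) (hg : Vge d g) :
    Vge d (f - g) := fun k hk => by simp [hf k hk, hg k hk]

theorem Vge.neg {d : ℤ} {f : Matrix ι κ (LaurentSeries ℂ)} (hf : Vge d f) :
    Vge d (-f) := fun k hk => by simp [hf k hk]

theorem Vge.zero {d : ℤ} : Vge d (0 : Matrix ι κ (LaurentSeries ℂ)) := fun k _ => by simp

theorem Vge.mono {d d' : ℤ} {f : Matrix ι κ (LaurentSeries ℂ)} (hf : Vge d f) (h : d' ≤ d) :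
    Vge d' f := fun k hk => hf k (lt_of_lt_of_le hk h)

theorem Vge.sum {A : Type*} {s : Finset A} {d : ℤ} {f : A → Matrix ι κ (LaurentSeries ℂ)}
    (h : ∀ t ∈ s, Vge d (f t)) : Vge d (∑ t ∈ s, f t) := fun k hk => by
  rw [cf_sum]; exact Finset.sum_eq_zero fun t ht => h t ht k hk

theorem Vge.sg {d k : ℤ} (h : d ≤ k) (m : Matrix ι κ ℂ) : Vge d (sg k m) := fun l hl => by
  rw [cf_sg, if_neg (by omega)]

theorem coeff_mul_Icc {x y : LaurentSeries ℂ} {v w : ℤ} (hx : ∀ k < v, x.coeff k = 0)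
    (hy : ∀ k < w, y.coeff k = 0) (n : ℤ) :
    (x * y).coeff n = ∑ i ∈ Finset.Icc v (n - w), x.coeff i * y.coeff (n - i) := by
  rw [HahnSeries.coeff_mul]
  refine Finset.sum_bij_ne_zero (fun ij _ _ => ij.1) ?_ ?_ ?_ ?_
  · intro ij h hne
    have h1 : x.coeff ij.1 ≠ 0 := left_ne_zero_of_mul hne
    have h2 : y.coeff ij.2 ≠ 0 := right_ne_zero_of_mul hne
    have h3 : ij.1 + ij.2 = n := by
      have := h; rw [Finset.mem_antidiagonal] at this; exact this.2.2
    have h4 : v ≤ ij.1 := by by_contra hc; exact h1 (hx _ (by omega))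
    have h5 : w ≤ ij.2 := by by_contra hc; exact h2 (hy _ (by omega))
    rw [Finset.mem_Icc]; omega
  · intro a ha _ b hb _ hab
    rw [Finset.mem_antidiagonal] at ha hb
    have := ha.2.2; have := hb.2.2
    ext
    · exact hab
    · have : a.1 = b.1 := hab
      omega
  · intro i _ hne
    refine ⟨(i, n - i), ?_, hne, rfl⟩
    rw [Finset.mem_antidiagonal]
    exact ⟨left_ne_zero_of_mul hne, right_ne_zero_of_mul hne, by simp⟩
  · intro ij h _
    rw [Finset.mem_antidiagonal] at h
    have : ij.2 = n - ij.1 := by have := h.2.2; omega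
    rw [this]

theorem cf_mul [Fintype κ] {f : Matrix ι κ (LaurentSeries ℂ)} {g : Matrix κ ν (LaurentSeries ℂ)} {v w : ℤ}
    (hf : Vge v f) (hg : Vge w g) (n : ℤ) :
    cf (f * g) n = ∑ i ∈ Finset.Icc v (n - w), cf f i * cf g (n - i) := by
  ext a b
  simp only [cf, Matrix.mul_apply, HahnSeries.coeff_sum, Matrix.sum_apply]
  rw [Finset.sum_comm]
  refine Finset.sum_congr rfl fun c _ => ?_
  exact coeff_mul_Icc (fun k hk => congrFun (congrFun (hf k hk) a) c)
    (fun k hk => congrFun (congrFun (hg k hk) c) b) n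

theorem Vge.mul [Fintype κ] {f : Matrix ι κ (LaurentSeries ℂ)} {g : Matrix κ ν (LaurentSeries ℂ)} {v w : ℤ}
    (hf : Vge v f) (hg : Vge w g) : Vge (v + w) (f * g) := fun k hk => by
  rw [cf_mul hf hg, Finset.Icc_eq_empty (by omega), Finset.sum_empty]

/-- Truncation: keep only the coefficients of index `< N`. -/
def tr (N : ℤ) (f : Matrix ι κ (LaurentSeries ℂ)) : Matrix ι κ (LaurentSeries ℂ) :=
  f.map (HahnSeries.truncLT N)

theorem cf_tr (N : ℤ) (f : Matrix ι κ (LaurentSeries ℂ)) (k : ℤ) :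
    cf (tr N f) k = if k < N then cf f k else 0 := by
  ext a b
  simp only [cf, tr, Matrix.map_apply, HahnSeries.coeff_truncLT]
  split_ifs <;> rfl

theorem Vge_sub_tr (N : ℤ) (f : Matrix ι κ (LaurentSeries ℂ)) : Vge N (f - tr N f) :=
  fun k hk => by simp [cf_tr, hk]

theorem sg_mul_tr [Fintype ι] (m : Matrix ι ι ℂ) (N : ℤ) (f : Matrix ι κ (LaurentSeries ℂ)) :
    sg 0 m * tr N f = tr N (sg 0 m * f) := by
  apply cf_ext; intro k
  simp only [cf_sg_mul, cf_tr, sub_zero]; split_ifs <;> simp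

theorem tr_mul_sg [Fintype κ] (m : Matrix κ κ ℂ) (N : ℤ) (f : Matrix ι κ (LaurentSeries ℂ)) :
    tr N f * sg 0 m = tr N (f * sg 0 m) := by
  apply cf_ext; intro k
  simp only [cf_mul_sg, cf_tr, sub_zero]; split_ifs <;> simp

theorem cf_smul_sg (q : LaurentSeries ℂ) (m : Matrix ι κ ℂ) (k : ℤ) :
    cf (q • sg 0 m) k = q.coeff k • m := by
  ext a b
  simp [cf, sg, Matrix.smul_apply]

theorem Vge_smul {q : LaurentSeries ℂ} {w d : ℤ} (hq : ∀ k < w, q.coeff k = 0)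
    {f : Matrix ι κ (LaurentSeries ℂ)} (hf : Vge d f) : Vge (w + d) (q • f) := by
  intro k hk
  ext a b
  simp only [cf, Matrix.smul_apply, smul_eq_mul, Matrix.zero_apply]
  rw [coeff_mul_Icc hq (fun k hk => congrFun (congrFun (hf k hk) a) b),
    Finset.Icc_eq_empty (by omega), Finset.sum_empty]

/-! ### Invertible matrices of power series -/

variable [Fintype ι] [DecidableEq ι]

theorem exists_powerSeries_matrix {f : Matrix ι ι (LaurentSeries ℂ)} (hf : Vge 0 f) :
    ∃ F : Matrix ι ι (PowerSeries ℂ), (HahnSeries.ofPowerSeries ℤ ℂ).mapMatrix F = f := by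
  refine ⟨Matrix.of fun a b => PowerSeries.mk fun n => (f a b).coeff n, ?_⟩
  apply cf_ext
  intro k
  ext a b
  simp only [cf, RingHom.mapMatrix_apply, Matrix.map_apply, Matrix.of_apply]
  obtain ⟨n, rfl⟩ | hk : (∃ n : ℕ, k = n) ∨ k < 0 := by
    rcases lt_or_ge k 0 with h | h
    · exact Or.inr h
    · exact Or.inl ⟨k.toNat, by omega⟩
  · rw [HahnSeries.ofPowerSeries_apply_coeff, PowerSeries.coeff_mk]
  · rw [show (f a b).coeff k = 0 from congrFun (congrFun (hf k hk) a) b]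
    rw [HahnSeries.ofPowerSeries_apply]
    apply HahnSeries.embDomain_of_notMem_range
    rintro ⟨n, hn⟩
    simp at hn
    omega

theorem cf_mapMatrix (F : Matrix ι ι (PowerSeries ℂ)) (n : ℕ) :
    cf ((HahnSeries.ofPowerSeries ℤ ℂ).mapMatrix F) n = F.map (PowerSeries.coeff n) := by
  ext a b
  simp [cf, HahnSeries.ofPowerSeries_apply_coeff]

theorem Vge_mapMatrix (F : Matrix ι ι (PowerSeries ℂ)) :
    Vge 0 ((HahnSeries.ofPowerSeries ℤ ℂ).mapMatrix F) := by
  intro k hk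
  ext a b
  simp only [cf, RingHom.mapMatrix_apply, Matrix.map_apply, HahnSeries.ofPowerSeries_apply]
  apply HahnSeries.embDomain_of_notMem_range
  rintro ⟨n, hn⟩
  simp at hn
  omega

theorem cf_mul_zero_zero {f g : Matrix ι ι (LaurentSeries ℂ)} (hf : Vge 0 f) (hg : Vge 0 g) :
    cf (f * g) 0 = cf f 0 * cf g 0 := by
  rw [cf_mul hf hg]; simp

theorem Vge_one_iff {f : Matrix ι ι (LaurentSeries ℂ)} :
    Vge 1 (f - 1) ↔ Vge 0 f ∧ cf f 0 = 1 := by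
  have h1 : ∀ k, cf (1 : Matrix ι ι (LaurentSeries ℂ)) k = if k = 0 then 1 else 0 := by
    intro k; rw [← sg_zero_one, cf_sg]
  constructor
  · intro h
    refine ⟨fun k hk => ?_, ?_⟩
    · have := h k (by omega)
      rwa [cf_sub, h1, if_neg (by omega), sub_zero] at this
    · have := h 0 (by omega)
      rwa [cf_sub, h1, if_pos rfl, sub_eq_zero] at this
  · rintro ⟨h, h0⟩ k hk
    rw [cf_sub, h1]
    split_ifs with hk0
    · rw [hk0, h0, sub_self]
    · rw [h k (by omega), sub_zero]

/-- The group `1 + z Mat(ℂ[[z]])`. -/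
def Unip (u : (Matrix ι ι (LaurentSeries ℂ))ˣ) : Prop :=
  Vge 1 (u.val - 1) ∧ Vge 1 (u⁻¹.val - 1)

theorem exists_unit_of_cf_zero {f : Matrix ι ι (LaurentSeries ℂ)} (hf : Vge 0 f)
    (h0 : IsUnit (cf f 0)) : ∃ F : (Matrix ι ι (PowerSeries ℂ))ˣ,
      (HahnSeries.ofPowerSeries ℤ ℂ).mapMatrix F.val = f := by
  obtain ⟨F, hF⟩ := exists_powerSeries_matrix hf
  have hc : IsUnit F := by
    rw [Matrix.isUnit_iff_isUnit_det, PowerSeries.isUnit_iff_constantCoeff]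
    have : (PowerSeries.constantCoeff : PowerSeries ℂ →+* ℂ) F.det = (cf f 0).det := by
      rw [RingHom.map_det]
      congr 1
      rw [← hF, show (0 : ℤ) = ((0 : ℕ) : ℤ) from rfl, cf_mapMatrix]
      ext a b; simp
    rw [this]
    exact (Matrix.isUnit_iff_isUnit_det _).1 h0
  obtain ⟨F', rfl⟩ := hc
  exact ⟨F', hF⟩

theorem exists_unip {f : Matrix ι ι (LaurentSeries ℂ)} (hf : Vge 1 (f - 1)) :
    ∃ u : (Matrix ι ι (LaurentSeries ℂ))ˣ, u.val = f ∧ Unip u := by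
  obtain ⟨h0, h1⟩ := Vge_one_iff.1 hf
  obtain ⟨F, hF⟩ := exists_unit_of_cf_zero h0 (by rw [h1]; exact isUnit_one)
  refine ⟨Units.map ((HahnSeries.ofPowerSeries ℤ ℂ).mapMatrix).toMonoidHom F, ?_, ?_, ?_⟩
  · change (HahnSeries.ofPowerSeries ℤ ℂ).mapMatrix F.val = f
    exact hF
  · change Vge 1 ((HahnSeries.ofPowerSeries ℤ ℂ).mapMatrix F.val - 1)
    rw [hF]; exact hf
  · change Vge 1 ((HahnSeries.ofPowerSeries ℤ ℂ).mapMatrix F⁻¹.val - 1)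
    rw [Vge_one_iff]
    refine ⟨Vge_mapMatrix _, ?_⟩
    have : cf ((HahnSeries.ofPowerSeries ℤ ℂ).mapMatrix F.val *
        (HahnSeries.ofPowerSeries ℤ ℂ).mapMatrix F⁻¹.val) 0 = 1 := by
      rw [← map_mul, Units.mul_inv, map_one, ← sg_zero_one, cf_sg, if_pos rfl]
    rw [cf_mul_zero_zero (Vge_mapMatrix _) (Vge_mapMatrix _), hF, h1, one_mul] at this
    exact this

theorem Unip.vge {u : (Matrix ι ι (LaurentSeries ℂ))ˣ} (h : Unip u) : Vge 0 u.val :=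
  (Vge_one_iff.1 h.1).1

theorem Unip.vge_inv {u : (Matrix ι ι (LaurentSeries ℂ))ˣ} (h : Unip u) : Vge 0 u⁻¹.val :=
  (Vge_one_iff.1 h.2).1

theorem Unip.mul {u w : (Matrix ι ι (LaurentSeries ℂ))ˣ} (hu : Unip u) (hw : Unip w) :
    Unip (u * w) := by
  constructor
  · rw [Vge_one_iff, Units.val_mul]
    refine ⟨by simpa using hu.vge.mul hw.vge, ?_⟩
    rw [cf_mul_zero_zero hu.vge hw.vge, (Vge_one_iff.1 hu.1).2, (Vge_one_iff.1 hw.1).2, one_mul]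
  · rw [Vge_one_iff, _root_.mul_inv_rev, Units.val_mul]
    refine ⟨by simpa using hw.vge_inv.mul hu.vge_inv, ?_⟩
    rw [cf_mul_zero_zero hw.vge_inv hu.vge_inv, (Vge_one_iff.1 hu.2).2, (Vge_one_iff.1 hw.2).2,
      one_mul]

theorem Unip.inv {u : (Matrix ι ι (LaurentSeries ℂ))ˣ} (hu : Unip u) : Unip u⁻¹ :=
  ⟨hu.2, by simpa using hu.1⟩

/-- Multiplication by matrices of power series preserves congruences. -/
theorem Vge.conj {d : ℤ} {f g h : Matrix ι ι (LaurentSeries ℂ)} (hf : Vge 0 f) (hg : Vge d g)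
    (hh : Vge 0 h) : Vge d (f * g * h) := by
  have := (hf.mul hg).mul hh
  simpa using this

/-! ### Coefficients in a subalgebra -/

/-- Coefficients of index `< N` lie in `S`. -/
def RelLt (S : Subalgebra ℂ (Matrix ι ι ℂ × Matrix ι ι ℂ)) (N : ℤ)
    (f f' : Matrix ι ι (LaurentSeries ℂ)) : Prop := ∀ k < N, (cf f k, cf f' k) ∈ S

variable {S : Subalgebra ℂ (Matrix ι ι ℂ × Matrix ι ι ℂ)}

theorem RelLt.add {N : ℤ} {f f' g g' : Matrix ι ι (LaurentSeries ℂ)} (h : RelLt S N f f')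
    (h' : RelLt S N g g') : RelLt S N (f + g) (f' + g') := fun k hk => by
  simpa using add_mem (h k hk) (h' k hk)

theorem RelLt.sub {N : ℤ} {f f' g g' : Matrix ι ι (LaurentSeries ℂ)} (h : RelLt S N f f')
    (h' : RelLt S N g g') : RelLt S N (f - g) (f' - g') := fun k hk => by
  simpa using sub_mem (h k hk) (h' k hk)

theorem RelLt.mono {N N' : ℤ} {f f' : Matrix ι ι (LaurentSeries ℂ)} (h : RelLt S N f f')
    (hN : N' ≤ N) : RelLt S N' f f' := fun k hk => h k (by omega)

theorem RelLt.mul {A B v w N : ℤ} {f f' g g' : Matrix ι ι (LaurentSeries ℂ)} (h : RelLt S A f f')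
    (h' : RelLt S B g g') (hf : Vge v f) (hf' : Vge v f') (hg : Vge w g) (hg' : Vge w g')
    (hA : N ≤ A + w) (hB : N ≤ B + v) : RelLt S N (f * g) (f' * g') := fun k hk => by
  rw [cf_mul hf hg, cf_mul hf' hg']
  rw [show ((∑ i ∈ Finset.Icc v (k - w), cf f i * cf g (k - i),
    ∑ i ∈ Finset.Icc v (k - w), cf f' i * cf g' (k - i)) : Matrix ι ι ℂ × Matrix ι ι ℂ) =
    ∑ i ∈ Finset.Icc v (k - w), (cf f i, cf f' i) * (cf g (k - i), cf g' (k - i)) by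
      rw [Prod.ext_iff]; simp [Prod.fst_sum, Prod.snd_sum]]
  refine sum_mem fun i hi => ?_
  rw [Finset.mem_Icc] at hi
  exact mul_mem (h i (by omega)) (h' _ (by omega))

theorem RelLt.sg {m m' : Matrix ι ι ℂ} (h : (m, m') ∈ S) (k N : ℤ) :
    RelLt S N (sg k m) (sg k m') := fun l _ => by
  rw [cf_sg, cf_sg]; split_ifs
  · exact h
  · exact zero_mem S

theorem RelLt.sum {A : Type*} {s : Finset A} {N : ℤ} {f f' : A → Matrix ι ι (LaurentSeries ℂ)}
    (h : ∀ t ∈ s, RelLt S N (f t) (f' t)) : RelLt S N (∑ t ∈ s, f t) (∑ t ∈ s, f' t) := by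
  intro k hk
  rw [cf_sum, cf_sum]
  have := sum_mem (S := S) fun t ht => h t ht k hk
  convert this using 1
  rw [Prod.ext_iff]; simp [Prod.fst_sum, Prod.snd_sum]

end LaurentMatrix

/-! ### Polynomials in `z⁻¹` -/

theorem coeff_polyZinv (q : Polynomial ℂ) (k : ℤ) :
    (polyZinv q).coeff k = if k ≤ 0 then q.coeff (-k).toNat else 0 := by
  unfold polyZinv
  rw [Polynomial.sum_def, HahnSeries.coeff_sum]
  simp only [HahnSeries.coeff_single]
  split_ifs with hk
  · rw [Finset.sum_eq_single (-k).toNat]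
    · rw [if_pos (by omega)]
    · intro b _ hb
      rw [if_neg (by omega)]
    · intro h
      rw [if_pos (by omega)]
      simpa using h
  · apply Finset.sum_eq_zero
    intro b _
    rw [if_neg (by omega)]

theorem polyZinv_sub (p q : Polynomial ℂ) : polyZinv (p - q) = polyZinv p - polyZinv q := by
  ext k
  simp only [coeff_polyZinv, HahnSeries.coeff_sub]
  split_ifs <;> simp

theorem coeff_polyZinv_of_lt {q : Polynomial ℂ} {K : ℕ} (h : q.natDegree ≤ K) {k : ℤ}
    (hk : k < -K) : (polyZinv q).coeff k = 0 := by
  rw [coeff_polyZinv]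
  split_ifs
  · apply Polynomial.coeff_eq_zero_of_natDegree_lt; omega
  · rfl

theorem coeff_polyZinv_neg (q : Polynomial ℂ) (K : ℕ) :
    (polyZinv q).coeff (-K) = q.coeff K := by
  rw [coeff_polyZinv, if_pos (by omega)]; simp

theorem polyZinv_inv {q : Polynomial ℂ} (hq : q ≠ 0) :
    polyZinv q * (polyZinv q)⁻¹ = 1 ∧ ∀ k < (q.natDegree : ℤ), (polyZinv q)⁻¹.coeff k = 0 := by
  have h0 : (polyZinv q).coeff (-(q.natDegree : ℤ)) ≠ 0 := by
    rw [coeff_polyZinv_neg]; simpa using hq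
  have hne : polyZinv q ≠ 0 := fun h => h0 (by simp [h])
  have hm := mul_inv_cancel₀ hne
  refine ⟨hm, fun k hk => ?_⟩
  have ho : (polyZinv q).order = -(q.natDegree : ℤ) := by
    apply le_antisymm (HahnSeries.order_le_of_coeff_ne_zero h0)
    by_contra hlt
    push Not at hlt
    have := coeff_polyZinv_of_lt le_rfl hlt
    exact hne (HahnSeries.coeff_order_eq_zero.1 this)
  have hi : (polyZinv q)⁻¹ ≠ 0 := inv_ne_zero hne
  have := HahnSeries.order_mul hne hi
  rw [hm, HahnSeries.order_one, ho] at this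
  exact HahnSeries.coeff_eq_zero_of_lt_order (by omega)

section Blocks

variable {ι : Type} [Fintype ι] [DecidableEq ι]

theorem mul_laurent_smul (f g : Matrix ι ι (LaurentSeries ℂ)) (q : LaurentSeries ℂ) :
    f * q • g = q • (f * g) := Matrix.mul_smul f q g

theorem laurent_smul_mul (f g : Matrix ι ι (LaurentSeries ℂ)) (q : LaurentSeries ℂ) :
    (q • f) * g = q • (f * g) := Matrix.smul_mul q f g

theorem lmul_neg (f g : Matrix ι ι (LaurentSeries ℂ)) : f * -g = -(f * g) := Matrix.mul_neg f g

theorem lneg_mul (f g : Matrix ι ι (LaurentSeries ℂ)) : -f * g = -(f * g) := Matrix.neg_mul f g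

theorem sub_laurent_smul (f : Matrix ι ι (LaurentSeries ℂ)) (p q : LaurentSeries ℂ) :
    (p - q) • f = p • f - q • f := _root_.sub_smul p q f

/-- `f` lies in the block `e Mat(ℂ((z))) e'`. -/
def Blk (e e' : Matrix ι ι ℂ) (f : Matrix ι ι (LaurentSeries ℂ)) : Prop :=
  sg 0 e * f = f ∧ f * sg 0 e' = f

theorem Blk.add {e e' : Matrix ι ι ℂ} {f g : Matrix ι ι (LaurentSeries ℂ)}
    (hf : Blk e e' f) (hg : Blk e e' g) : Blk e e' (f + g) :=
  ⟨by rw [mul_add, hf.1, hg.1], by rw [add_mul, hf.2, hg.2]⟩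

theorem Blk.sub {e e' : Matrix ι ι ℂ} {f g : Matrix ι ι (LaurentSeries ℂ)}
    (hf : Blk e e' f) (hg : Blk e e' g) : Blk e e' (f - g) :=
  ⟨by rw [mul_sub, hf.1, hg.1], by rw [sub_mul, hf.2, hg.2]⟩

theorem Blk.sum {A : Type*} {s : Finset A} {e e' : Matrix ι ι ℂ}
    {f : A → Matrix ι ι (LaurentSeries ℂ)} (h : ∀ t ∈ s, Blk e e' (f t)) :
    Blk e e' (∑ t ∈ s, f t) :=
  ⟨by rw [Finset.mul_sum]; exact Finset.sum_congr rfl fun t ht => (h t ht).1,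
   by rw [Finset.sum_mul]; exact Finset.sum_congr rfl fun t ht => (h t ht).2⟩

theorem Blk.mul {e e' g g' : Matrix ι ι ℂ} {x y : Matrix ι ι (LaurentSeries ℂ)}
    (hx : Blk e e' x) (hy : Blk g g' y) : Blk e g' (x * y) :=
  ⟨by rw [← mul_assoc, hx.1], by rw [mul_assoc, hy.2]⟩

theorem Blk.mul_eq_zero {e e' g g' : Matrix ι ι ℂ} {x y : Matrix ι ι (LaurentSeries ℂ)}
    (hx : Blk e e' x) (hy : Blk g g' y) (h : e' * g = 0) : x * y = 0 := by
  rw [← hx.2, ← hy.1, mul_assoc, ← mul_assoc (sg 0 e'), sg_mul_sg, h, sg_zero, zero_mul, mul_zero]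

theorem Blk.sg {e e' m : Matrix ι ι ℂ} (k : ℤ) (h : e * m = m) (h' : m * e' = m) :
    Blk e e' (sg k m) :=
  ⟨by rw [sg_mul_sg, h, zero_add], by rw [sg_mul_sg, h', add_zero]⟩

theorem Blk.smul {e e' : Matrix ι ι ℂ} {f : Matrix ι ι (LaurentSeries ℂ)} (hf : Blk e e' f)
    (q : LaurentSeries ℂ) : Blk e e' (q • f) :=
  ⟨by rw [mul_laurent_smul, hf.1], by rw [laurent_smul_mul, hf.2]⟩

theorem Blk.tr {e e' : Matrix ι ι ℂ} {f : Matrix ι ι (LaurentSeries ℂ)} (hf : Blk e e' f)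
    (N : ℤ) : Blk e e' (tr N f) :=
  ⟨by rw [sg_mul_tr, hf.1], by rw [tr_mul_sg, hf.2]⟩

theorem Blk.cf {e e' : Matrix ι ι ℂ} {f : Matrix ι ι (LaurentSeries ℂ)} (hf : Blk e e' f)
    (k : ℤ) : e * cf f k = cf f k ∧ cf f k * e' = cf f k := by
  have h1 := congrArg (fun g => _root_.cf g k) hf.1
  have h2 := congrArg (fun g => _root_.cf g k) hf.2
  simp only [cf_sg_mul, cf_mul_sg, sub_zero] at h1 h2
  exact ⟨h1, h2⟩

theorem Blk.widen {e e' g g' : Matrix ι ι ℂ} {f : Matrix ι ι (LaurentSeries ℂ)} (hf : Blk e e' f)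
    (h : g * e = e) (h' : e' * g' = e') : Blk g g' f :=
  ⟨by rw [← hf.1, ← mul_assoc, sg_mul_sg, h, zero_add],
   by rw [← hf.2, mul_assoc, sg_mul_sg, h', zero_add]⟩

variable {m : ℕ} (q : Fin m → Polynomial ℂ) (blk : ι → Fin m)

/-- The projection onto the `j`-th block. -/
def eb (j : Fin m) : Matrix ι ι ℂ := Matrix.diagonal fun a => if blk a = j then 1 else 0

theorem eb_mul_eb (j j' : Fin m) : eb blk j * eb blk j' = if j = j' then eb blk j else 0 := by
  unfold eb
  rw [Matrix.diagonal_mul_diagonal]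
  split_ifs with h
  · subst h; congr 1; ext a; split_ifs <;> simp
  · rw [← Matrix.diagonal_zero]; congr 1; ext a
    by_cases h1 : blk a = j
    · rw [if_neg (fun h2 => h (h1.symm.trans h2)), mul_zero]
    · rw [if_neg h1, zero_mul]

theorem eb_mul_self (j : Fin m) : eb blk j * eb blk j = eb blk j := by
  rw [eb_mul_eb, if_pos rfl]

theorem sum_eb : ∑ j, eb blk j = 1 := by
  ext a b
  simp only [eb, Matrix.sum_apply, Matrix.diagonal_apply, Matrix.one_apply]
  by_cases h : a = b <;> simp [h]

/-- The projection onto the blocks in `J`. -/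
def eJ (J : Finset (Fin m)) : Matrix ι ι ℂ := ∑ j ∈ J, eb blk j

variable {blk}

theorem eJ_mul_eb {J : Finset (Fin m)} {j : Fin m} (h : j ∈ J) : eJ blk J * eb blk j = eb blk j := by
  unfold eJ
  rw [Finset.sum_mul, Finset.sum_eq_single j]
  · exact eb_mul_self blk j
  · intro b _ hb; rw [eb_mul_eb, if_neg hb]
  · exact fun h' => absurd h h'

theorem eb_mul_eJ {J : Finset (Fin m)} {j : Fin m} (h : j ∈ J) : eb blk j * eJ blk J = eb blk j := by
  unfold eJ
  rw [Finset.mul_sum, Finset.sum_eq_single j]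
  · exact eb_mul_self blk j
  · intro b _ hb; rw [eb_mul_eb, if_neg hb.symm]
  · exact fun h' => absurd h h'

theorem eb_mul_eJ_zero {J : Finset (Fin m)} {j : Fin m} (h : j ∉ J) : eb blk j * eJ blk J = 0 := by
  unfold eJ
  rw [Finset.mul_sum]
  exact Finset.sum_eq_zero fun b hb => by
    rw [eb_mul_eb, if_neg]; rintro rfl; exact h hb

theorem eJ_mul_eJ_subset {J J' : Finset (Fin m)} (h : J ⊆ J') : eJ blk J * eJ blk J' = eJ blk J := by
  rw [eJ, Finset.sum_mul]
  exact Finset.sum_congr rfl fun j hj => eb_mul_eJ (h hj)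

theorem eJ_mul_eJ_disjoint {J J' : Finset (Fin m)} (h : Disjoint J J') :
    eJ blk J * eJ blk J' = 0 := by
  rw [eJ, Finset.sum_mul]
  exact Finset.sum_eq_zero fun j hj => eb_mul_eJ_zero (Finset.disjoint_left.1 h hj)

theorem eJ_univ : eJ blk Finset.univ = 1 := sum_eb blk

theorem eJ_union {J J' : Finset (Fin m)} (h : Disjoint J J') :
    eJ blk (J ∪ J') = eJ blk J + eJ blk J' := Finset.sum_union h

variable (blk)

/-- The irregular type restricted to the blocks in `J`. -/
def Tm (J : Finset (Fin m)) : Matrix ι ι (LaurentSeries ℂ) :=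
  ∑ j ∈ J, polyZinv (q j) • sg 0 (eb blk j)

theorem cf_Tm (J : Finset (Fin m)) (k : ℤ) :
    cf (Tm q blk J) k = ∑ j ∈ J, (polyZinv (q j)).coeff k • eb blk j := by
  unfold Tm
  rw [cf_sum]
  exact Finset.sum_congr rfl fun j _ => cf_smul_sg _ _ _

theorem Blk_Tm (J : Finset (Fin m)) : Blk (eJ blk J) (eJ blk J) (Tm q blk J) :=
  Blk.sum fun _ hj => (Blk.sg 0 (eJ_mul_eb hj) (eb_mul_eJ hj)).smul _

theorem Tm_sub_eq (J : Finset (Fin m)) (j0 : Fin m) :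
    Tm q blk J - polyZinv (q j0) • sg 0 (eJ blk J) =
      ∑ j ∈ J, polyZinv (q j - q j0) • sg 0 (eb blk j) := by
  unfold Tm eJ
  rw [sg_sum, Finset.smul_sum, ← Finset.sum_sub_distrib]
  refine Finset.sum_congr rfl fun j _ => ?_
  rw [polyZinv_sub, sub_laurent_smul]

theorem Vge_Tm_sub {J : Finset (Fin m)} {j0 : Fin m} {K : ℕ}
    (hK : ∀ j ∈ J, (q j - q j0).natDegree ≤ K) :
    Vge (-K) (Tm q blk J - polyZinv (q j0) • sg 0 (eJ blk J)) := by
  rw [Tm_sub_eq]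
  refine Vge.sum fun j hj => ?_
  have := Vge_smul (fun k hk => coeff_polyZinv_of_lt (hK j hj) hk)
    (Vge.sg (le_refl 0) (eb blk j))
  simpa using this

/-- `u` lies in the unipotent group of power series supported on the corner `e`. -/
def CornerUnip (e : Matrix ι ι ℂ) (u : (Matrix ι ι (LaurentSeries ℂ))ˣ) : Prop :=
  Unip u ∧ Blk e e (u.val - 1)

variable {blk q}

theorem CornerUnip.inv {e : Matrix ι ι ℂ} {u : (Matrix ι ι (LaurentSeries ℂ))ˣ}
    (h : CornerUnip e u) : CornerUnip e u⁻¹ := by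
  refine ⟨h.1.inv, ?_⟩
  have h1 : u⁻¹.val - 1 = -((u.val - 1) * u⁻¹.val) := by
    rw [sub_mul, Units.mul_inv]; simp
  have h2 : u⁻¹.val - 1 = -(u⁻¹.val * (u.val - 1)) := by
    rw [mul_sub, Units.inv_mul]; simp
  constructor
  · rw [h1, lmul_neg, ← mul_assoc, h.2.1]
  · rw [h2, lneg_mul, mul_assoc, h.2.2]

theorem CornerUnip.blk_mul {e g g' : Matrix ι ι ℂ} {u : (Matrix ι ι (LaurentSeries ℂ))ˣ}
    (h : CornerUnip e u) {f : Matrix ι ι (LaurentSeries ℂ)} (hf : Blk g g' f) (he : g * e = e) :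
    Blk g g' (u.val * f) := by
  have : u.val * f = f + (u.val - 1) * f := by rw [sub_mul]; simp
  rw [this]
  refine hf.add ⟨?_, ?_⟩
  · rw [← h.2.1, ← mul_assoc, ← mul_assoc, sg_mul_sg, he]; simp
  · rw [mul_assoc, hf.2]

theorem CornerUnip.mul_blk {e g g' : Matrix ι ι ℂ} {u : (Matrix ι ι (LaurentSeries ℂ))ˣ}
    (h : CornerUnip e u) {f : Matrix ι ι (LaurentSeries ℂ)} (hf : Blk g g' f) (he : e * g' = e) :
    Blk g g' (f * u.val) := by
  have : f * u.val = f + f * (u.val - 1) := by rw [mul_sub]; simp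
  rw [this]
  refine hf.add ⟨?_, ?_⟩
  · rw [← mul_assoc, hf.1]
  · rw [← h.2.2, mul_assoc, mul_assoc, sg_mul_sg, he]; simp

theorem CornerUnip.mul_eq {e g g' : Matrix ι ι ℂ} {u : (Matrix ι ι (LaurentSeries ℂ))ˣ}
    (h : CornerUnip e u) {f : Matrix ι ι (LaurentSeries ℂ)} (hf : Blk g g' f) (he : e * g = 0) :
    u.val * f = f := by
  have := h.2.mul_eq_zero hf he
  rwa [sub_mul, one_mul, sub_eq_zero] at this

theorem CornerUnip.eq_mul {e g g' : Matrix ι ι ℂ} {u : (Matrix ι ι (LaurentSeries ℂ))ˣ}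
    (h : CornerUnip e u) {f : Matrix ι ι (LaurentSeries ℂ)} (hf : Blk g g' f) (he : g' * e = 0) :
    f * u.val = f := by
  have := hf.mul_eq_zero h.2 he
  rwa [mul_sub, mul_one, sub_eq_zero] at this

/-- Conjugation by a unipotent element does not change the leading coefficient up to a scalar
series. -/
theorem Vge_conj_sub {J : Finset (Fin m)} {j0 : Fin m} {K : ℕ}
    (hK : ∀ j ∈ J, (q j - q j0).natDegree ≤ K) {u : (Matrix ι ι (LaurentSeries ℂ))ˣ}
    (hu : CornerUnip (eJ blk J) u) :
    Vge (-K + 1) (u.val * Tm q blk J * u⁻¹.val - Tm q blk J) := by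
  set T' := Tm q blk J - polyZinv (q j0) • sg 0 (eJ blk J) with hT'
  have hV := Vge_Tm_sub q blk hK
  rw [← hT'] at hV
  have hT : Tm q blk J = T' + polyZinv (q j0) • sg 0 (eJ blk J) := by rw [hT']; abel
  have e1 : (u.val - 1) * Tm q blk J - Tm q blk J * (u.val - 1) =
      (u.val - 1) * T' - T' * (u.val - 1) := by
    rw [hT, mul_add, add_mul, mul_laurent_smul, laurent_smul_mul, hu.2.1, hu.2.2]; abel
  have e2 : u.val * Tm q blk J * u⁻¹.val - Tm q blk J =
      ((u.val - 1) * T' - T' * (u.val - 1)) * u⁻¹.val := by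
    rw [← e1]
    have : Tm q blk J = Tm q blk J * u.val * u⁻¹.val := by
      rw [mul_assoc, Units.mul_inv, mul_one]
    nth_rewrite 2 [this]
    rw [← sub_mul]
    congr 1
    rw [sub_mul, mul_sub, one_mul, mul_one]; abel
  rw [e2]
  have h1 : Vge (-K + 1) ((u.val - 1) * T') := (hu.1.1.mul hV).mono (by omega)
  have h2 : Vge (-K + 1) (T' * (u.val - 1)) := hV.mul hu.1.1
  have := (h1.sub h2).mul hu.1.vge_inv
  simpa using this

end Blocks

/-! ### Orthogonal idempotents in subalgebras -/

theorem sum_idempotents_mem {R A : Type*} [Ring R] [Algebra ℂ R] [DecidableEq A]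
    (S : Subalgebra ℂ R) (e : A → R) (he : ∀ i j, e i * e j = if i = j then e i else 0)
    (J : Finset A) (c : A → ℂ) (hc : ∀ j ∈ J, c j ≠ 0) (h : ∑ j ∈ J, c j • e j ∈ S) :
    ∑ j ∈ J, e j ∈ S := by
  set D := ∑ j ∈ J, c j • e j with hD
  have hpow : ∀ n : ℕ, D ^ (n + 1) = ∑ j ∈ J, c j ^ (n + 1) • e j := by
    intro n
    induction n with
    | zero => simp [hD]
    | succ n ih =>
      rw [pow_succ, ih, hD, Finset.sum_mul]
      refine Finset.sum_congr rfl fun j hj => ?_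
      rw [Finset.mul_sum, Finset.sum_eq_single j]
      · rw [smul_mul_smul_comm, he, if_pos rfl, ← pow_succ]
      · intro b _ hb; rw [smul_mul_smul_comm, he, if_neg hb.symm, smul_zero]
      · exact fun h' => absurd hj h'
  have hP : ∀ P : Polynomial ℂ, Polynomial.aeval D P =
      ∑ j ∈ J, P.eval (c j) • e j + P.eval 0 • (1 - ∑ j ∈ J, e j) := by
    intro P
    induction P using Polynomial.induction_on' with
    | add p r hp hr =>
      rw [map_add, hp, hr]
      simp only [Polynomial.eval_add, add_smul, Finset.sum_add_distrib]
      abel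
    | monomial n a =>
      rw [Polynomial.aeval_monomial]
      cases n with
      | zero =>
        simp only [pow_zero, mul_one, Polynomial.eval_monomial, ← Finset.smul_sum]
        rw [← smul_add, Algebra.algebraMap_eq_smul_one]; simp
      | succ n =>
        rw [hpow, Algebra.algebraMap_eq_smul_one, smul_mul_assoc, one_mul, Finset.smul_sum]
        simp [Polynomial.eval_monomial, mul_smul]
  have hmem := Algebra.adjoin_le (S := S) (Set.singleton_subset_iff.2 h)
    (Polynomial.aeval_mem_adjoin_singleton ℂ D (p := ∏ j ∈ J, (1 - Polynomial.C (c j)⁻¹ * Polynomial.X)))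
  rw [hP] at hmem
  rw [Finset.sum_eq_zero, zero_add] at hmem
  · simp only [Polynomial.eval_prod, Polynomial.eval_sub, Polynomial.eval_one, Polynomial.eval_mul,
      Polynomial.eval_C, Polynomial.eval_X, mul_zero, sub_zero, Finset.prod_const_one,
      one_smul] at hmem
    have := sub_mem (one_mem S) hmem
    simpa using this
  · intro j hj
    rw [Polynomial.eval_prod, Finset.prod_eq_zero hj, zero_smul]
    simp [hc j hj]

/-! ### Block triangular conjugation -/

section RingIdentities

variable {R : Type*} [Ring R]

/-- The four blocks of `(1 + b)(D₁ + D₂ + p)(1 - b)` for block matrices `D₁, D₂, p, b` of types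
`(1,1)`, `(2,2)`, `(1,2)`, `(2,1)`. -/
def FS (D1 D2 p b : R) : R := (D1 - p * b) + p + (b * D1 - D2 * b - b * p * b) + (D2 + b * p)

theorem FS_eq {D1 D2 p b : R} (h1 : D1 * b = 0) (h2 : b * D2 = 0) :
    (1 + b) * (D1 + D2 + p) * (1 - b) = FS D1 D2 p b := by
  have : (1 + b) * (D1 + D2 + p) * (1 - b) = FS D1 D2 p b - D1 * b + b * D2 - b * (D1 * b)
      - (b * D2) * b := by unfold FS; noncomm_ring
  rw [this, h1, h2]; simp

theorem one_add_conj_eq {D1 D2 a : R} (h1 : a * D1 = 0) (h2 : D2 * a = 0) :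
    (1 + a) * (D1 + D2) * (1 - a) = D1 + D2 + (a * D2 - D1 * a) := by
  have : (1 + a) * (D1 + D2) * (1 - a) = D1 + D2 + (a * D2 - D1 * a) + a * D1 - D2 * a
      - (a * D1) * a - a * (D2 * a) := by noncomm_ring
  rw [this, h1, h2]; simp

end RingIdentities

section Blocks

variable {ι : Type} [Fintype ι] [DecidableEq ι]

/-- Block data `D₁, D₂, p, b` whose leading terms are `q₀`, `q₀ + Δ z^{-K}`, as they occur when
splitting an irregular type by its leading coefficient. -/
structure Nrm (E1 E2 Δ : Matrix ι ι ℂ) (q0 : LaurentSeries ℂ) (K : ℕ)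
    (D1 D2 p b : Matrix ι ι (LaurentSeries ℂ)) : Prop where
  hD1 : Blk E1 E1 D1
  hD2 : Blk E2 E2 D2
  hp : Blk E1 E2 p
  hb : Blk E2 E1 b
  vD1 : Vge (-K + 1) (D1 - q0 • sg 0 E1)
  vD2 : Vge (-K + 1) (D2 - q0 • sg 0 E2 - sg (-K) Δ)
  vp : Vge (-K + 1) p
  vb : Vge 1 b

theorem Blk.corner {e e' : Matrix ι ι ℂ} {f : Matrix ι ι (LaurentSeries ℂ)} (h : Blk e e' f) :
    _root_.sg 0 e * f * _root_.sg 0 e' = f := by rw [h.1, h.2]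

theorem Blk.corner_left {e e' g g' : Matrix ι ι ℂ} {f : Matrix ι ι (LaurentSeries ℂ)}
    (h : Blk e e' f) (hg : g * e = 0) : _root_.sg 0 g * f * _root_.sg 0 g' = 0 := by
  rw [← h.1, ← mul_assoc, sg_mul_sg, hg, sg_zero, zero_mul, zero_mul]

theorem Blk.corner_right {e e' g g' : Matrix ι ι ℂ} {f : Matrix ι ι (LaurentSeries ℂ)}
    (h : Blk e e' f) (hg : e' * g' = 0) : _root_.sg 0 g * f * _root_.sg 0 g' = 0 := by
  rw [← h.2, mul_assoc, mul_assoc, sg_mul_sg, hg, sg_zero, mul_zero, mul_zero]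

theorem cf_corner (e e' : Matrix ι ι ℂ) (f : Matrix ι ι (LaurentSeries ℂ)) (k : ℤ) :
    cf (sg 0 e * f * sg 0 e') k = e * cf f k * e' := by
  rw [cf_mul_sg, cf_sg_mul]; simp

section SplitIdempotents

variable {E1 E2 Δ : Matrix ι ι ℂ} {q0 : LaurentSeries ℂ} {K : ℕ}
  {D1 D2 p b D1' D2' p' b' : Matrix ι ι (LaurentSeries ℂ)}

theorem Blk.fs11 (hD1 : Blk E1 E1 D1) (hp : Blk E1 E2 p) (hb : Blk E2 E1 b) :
    Blk E1 E1 (D1 - p * b) := hD1.sub (hp.mul hb)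

theorem Blk.fs22 (hD2 : Blk E2 E2 D2) (hp : Blk E1 E2 p) (hb : Blk E2 E1 b) :
    Blk E2 E2 (D2 + b * p) := hD2.add (hb.mul hp)

theorem Blk.fs21 (hD1 : Blk E1 E1 D1) (hD2 : Blk E2 E2 D2) (hp : Blk E1 E2 p)
    (hb : Blk E2 E1 b) : Blk E2 E1 (b * D1 - D2 * b - b * p * b) :=
  ((hb.mul hD1).sub (hD2.mul hb)).sub ((hb.mul hp).mul hb)

theorem fs_corners (h12 : E1 * E2 = 0) (h21 : E2 * E1 = 0) (hD1 : Blk E1 E1 D1) (hD2 : Blk E2 E2 D2) (hp : Blk E1 E2 p)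
    (hb : Blk E2 E1 b) :
    sg 0 E1 * FS D1 D2 p b * sg 0 E1 = D1 - p * b ∧ sg 0 E1 * FS D1 D2 p b * sg 0 E2 = p ∧
    sg 0 E2 * FS D1 D2 p b * sg 0 E1 = b * D1 - D2 * b - b * p * b ∧
    sg 0 E2 * FS D1 D2 p b * sg 0 E2 = D2 + b * p := by
  have f11 := Blk.fs11 hD1 hp hb
  have f22 := Blk.fs22 hD2 hp hb
  have f21 := Blk.fs21 hD1 hD2 hp hb
  unfold FS
  have hd : ∀ x y f g h k : Matrix ι ι (LaurentSeries ℂ),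
      x * (f + g + h + k) * y = x * f * y + x * g * y + x * h * y + x * k * y := by
    intros; simp only [mul_add, add_mul]
  simp only [hd]
  refine ⟨?_, ?_, ?_, ?_⟩
  · rw [f11.corner, hp.corner_right h21, f21.corner_left h12, f22.corner_left h12]; simp
  · rw [f11.corner_right h12, hp.corner, f21.corner_left h12, f22.corner_left h12]; simp
  · rw [f11.corner_left h21, hp.corner_left h21, f21.corner, f22.corner_right h21]; simp
  · rw [f11.corner_left h21, hp.corner_left h21, f21.corner_right h12, f22.corner]; simp

theorem fs_blk (h12 : E1 * E2 = 0) (h21 : E2 * E1 = 0) (h1 : E1 * E1 = E1) (h2 : E2 * E2 = E2)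
    (hD1 : Blk E1 E1 D1) (hD2 : Blk E2 E2 D2) (hp : Blk E1 E2 p)
    (hb : Blk E2 E1 b) : Blk (E1 + E2) (E1 + E2) (FS D1 D2 p b) := by
  have a1 : (E1 + E2) * E1 = E1 := by rw [add_mul, h1, h21, add_zero]
  have a2 : (E1 + E2) * E2 = E2 := by rw [add_mul, h2, h12, zero_add]
  have b1 : E1 * (E1 + E2) = E1 := by rw [mul_add, h1, h12, add_zero]
  have b2 : E2 * (E1 + E2) = E2 := by rw [mul_add, h2, h21, zero_add]
  exact ((((Blk.fs11 hD1 hp hb).widen a1 b1).add (hp.widen a1 b2)).add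
    ((Blk.fs21 hD1 hD2 hp hb).widen a2 b1)).add ((Blk.fs22 hD2 hp hb).widen a2 b2)

theorem Nrm.g21 (h : Nrm E1 E2 Δ q0 K D1 D2 p b) :
    b * D1 - D2 * b - b * p * b = b * (D1 - q0 • sg 0 E1)
      - (D2 - q0 • sg 0 E2 - sg (-K) Δ) * b - sg (-K) Δ * b - b * p * b := by
  rw [mul_sub, sub_mul, sub_mul, mul_laurent_smul, laurent_smul_mul, h.hb.1, h.hb.2]
  abel

theorem Nrm.vD2' (h : Nrm E1 E2 Δ q0 K D1 D2 p b) : Vge (-K) (D2 - q0 • sg 0 E2) := by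
  have := (h.vD2.mono (d' := -K) (by omega)).add (Vge.sg (le_refl (-K : ℤ)) Δ)
  simpa using this

theorem Nrm.vpb (h : Nrm E1 E2 Δ q0 K D1 D2 p b) : Vge (-K + 2) (p * b) :=
  (h.vp.mul h.vb).mono (by omega)

theorem Nrm.vbp (h : Nrm E1 E2 Δ q0 K D1 D2 p b) : Vge (-K + 2) (b * p) :=
  (h.vb.mul h.vp).mono (by omega)

theorem Nrm.sub_FS (h : Nrm E1 E2 Δ q0 K D1 D2 p b) (h' : Nrm E1 E2 Δ q0 K D1' D2' p' b') {s : ℤ}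
    (e1 : Vge s (D1 - D1')) (e2 : Vge s (D2 - D2')) (ep : Vge s (p - p'))
    (eb : Vge (K + s) (b - b')) : Vge s (FS D1 D2 p b - FS D1' D2' p' b') := by
  have key : FS D1 D2 p b - FS D1' D2' p' b' =
      (D1 - D1') - (p * (b - b') + (p - p') * b') + (p - p')
      + ((b - b') * (D1 - q0 • sg 0 E1) + b' * (D1 - D1')
        - ((D2 - q0 • sg 0 E2) * (b - b') + (D2 - D2') * b')
        - (b * p * (b - b') + b * (p - p') * b' + (b - b') * p' * b'))
      + ((D2 - D2') + (b * (p - p') + (b - b') * p')) := by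
    unfold FS
    have x1 : (b - b') * (q0 • sg 0 E1) = (q0 • sg 0 E2) * (b - b') := by
      rw [mul_laurent_smul, laurent_smul_mul, (h.hb.sub h'.hb).1, (h.hb.sub h'.hb).2]
    have x2 : (b - b') * (D1 - q0 • sg 0 E1) - (D2 - q0 • sg 0 E2) * (b - b') =
        (b - b') * D1 - D2 * (b - b') := by
      rw [mul_sub (b - b'), sub_mul D2, x1]; abel
    have x4 : ∀ u v w x y : Matrix ι ι (LaurentSeries ℂ),
        u + v - (w + x) - y = (u - w) + (v - x) - y := by
      intros; abel
    rw [x4, x2]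
    simp only [sub_mul, mul_sub, mul_assoc]
    abel
  rw [key]
  have a1 : Vge s (p * (b - b')) := (h.vp.mul eb).mono (by omega)
  have a2 : Vge s ((p - p') * b') := (ep.mul h'.vb).mono (by omega)
  have a3 : Vge s ((b - b') * (D1 - q0 • sg 0 E1)) := (eb.mul h.vD1).mono (by omega)
  have a4 : Vge s (b' * (D1 - D1')) := (h'.vb.mul e1).mono (by omega)
  have a5 : Vge s ((D2 - q0 • sg 0 E2) * (b - b')) := (h.vD2'.mul eb).mono (by omega)
  have a6 : Vge s ((D2 - D2') * b') := (e2.mul h'.vb).mono (by omega)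
  have a7 : Vge s (b * p * (b - b')) := (h.vbp.mul eb).mono (by omega)
  have a8 : Vge s (b * (p - p') * b') := ((h.vb.mul ep).mul h'.vb).mono (by omega)
  have a9 : Vge s ((b - b') * p' * b') := ((eb.mul h'.vp).mul h'.vb).mono (by omega)
  have a10 : Vge s (b * (p - p')) := (h.vb.mul ep).mono (by omega)
  have a11 : Vge s ((b - b') * p') := (eb.mul h'.vp).mono (by omega)
  exact (((e1.sub (a1.add a2)).add ep).add (((a3.add a4).sub (a5.add a6)).sub
    ((a7.add a8).add a9))).add (e2.add (a10.add a11))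

/-- Effect on the residue of the `(2,1)`-block of changing the top coefficient of `b`. -/
theorem Nrm.cf_g21 (h : Nrm E1 E2 Δ q0 K D1 D2 p b) (h' : Nrm E1 E2 Δ q0 K D1 D2 p b')
    {β : Matrix ι ι ℂ} (hb : b = b' + sg (K - 1) β) :
    cf (b * D1 - D2 * b - b * p * b) (-1) =
      cf (b' * D1 - D2 * b' - b' * p * b') (-1) - Δ * β := by
  have hs : Vge ((K : ℤ) - 1) (b - b') := by rw [hb, add_sub_cancel_left]; exact Vge.sg le_rfl β
  have key : (b * D1 - D2 * b - b * p * b) - (b' * D1 - D2 * b' - b' * p * b') =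
      ((b - b') * (D1 - q0 • sg 0 E1) - (D2 - q0 • sg 0 E2 - sg (-K) Δ) * (b - b')
        - (b * p * (b - b') + (b - b') * p * b')) - sg (-K) Δ * (b - b') := by
    rw [h.g21, h'.g21]
    simp only [sub_mul, mul_sub, mul_assoc]
    abel
  have hv : Vge 0 ((b - b') * (D1 - q0 • sg 0 E1) - (D2 - q0 • sg 0 E2 - sg (-K) Δ) * (b - b')
        - (b * p * (b - b') + (b - b') * p * b')) := by
    have a1 : Vge 0 ((b - b') * (D1 - q0 • sg 0 E1)) := (hs.mul h.vD1).mono (by omega)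
    have a2 : Vge 0 ((D2 - q0 • sg 0 E2 - sg (-K) Δ) * (b - b')) := (h.vD2.mul hs).mono (by omega)
    have a3 : Vge 0 (b * p * (b - b')) := (h.vbp.mul hs).mono (by omega)
    have a4 : Vge 0 ((b - b') * p * b') := ((hs.mul h.vp).mul h'.vb).mono (by omega)
    exact (a1.sub a2).sub (a3.add a4)
  have h2 : cf (sg (-K) Δ * (b - b')) (-1) = Δ * β := by
    rw [hb, add_sub_cancel_left, sg_mul_sg, cf_sg, if_pos (by ring)]
  have := congrArg (fun f => cf f (-1)) key
  rw [cf_sub, cf_sub _ (sg (-K) Δ * (b - b')), hv (-1) (by norm_num), h2, zero_sub] at this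
  rw [sub_eq_iff_eq_add] at this
  rw [this]; abel

/-! ### Units -/

/-- The unit `1 + b` for a square-zero `b`. -/
def oneAdd (b : Matrix ι ι (LaurentSeries ℂ)) (h : b * b = 0) : (Matrix ι ι (LaurentSeries ℂ))ˣ where
  val := 1 + b
  inv := 1 - b
  val_inv := by rw [add_mul, mul_sub, mul_sub, h]; simp
  inv_val := by rw [sub_mul, mul_add, mul_add, h]; simp

theorem unip_oneAdd {b : Matrix ι ι (LaurentSeries ℂ)} (h : b * b = 0) (hb : Vge 1 b) :
    Unip (oneAdd b h) := by
  constructor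
  · simpa [oneAdd] using hb
  · have : (oneAdd b h)⁻¹.val - 1 = -b := by
      change (1 - b) - 1 = -b
      abel
    rw [this]; exact hb.neg

theorem CornerUnip.mul {e : Matrix ι ι ℂ} {u w : (Matrix ι ι (LaurentSeries ℂ))ˣ}
    (hu : CornerUnip e u) (hw : CornerUnip e w) : CornerUnip e (u * w) := by
  refine ⟨hu.1.mul hw.1, ?_⟩
  have : (u * w).val - 1 = (u.val - 1) + (w.val - 1) + (u.val - 1) * (w.val - 1) := by
    rw [Units.val_mul, sub_mul, mul_sub, mul_sub]; simp
  rw [this]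
  exact (hu.2.add hw.2).add (hu.2.mul hw.2)

theorem CornerUnip.widen {e e' : Matrix ι ι ℂ} {u : (Matrix ι ι (LaurentSeries ℂ))ˣ}
    (hu : CornerUnip e u) (h : e' * e = e) (h' : e * e' = e) : CornerUnip e' u :=
  ⟨hu.1, hu.2.widen h h'⟩

end SplitIdempotents

end Blocks

section Blocks

variable {ι : Type} [Fintype ι] [DecidableEq ι] {m : ℕ} (q : Fin m → Polynomial ℂ) (blk : ι → Fin m)

/-- The number of free coefficients attached to a pair of blocks. -/
def dq (j j' : Fin m) : ℕ := (q j - q j').natDegree - 2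

/-- The sign recording the orientation of the arrows between two blocks. -/
def sgn (j j' : Fin m) : ℂ := if j < j' then 1 else -1

theorem sgn_swap {j j' : Fin m} (h : j ≠ j') : sgn j' j = -sgn j j' := by
  unfold sgn
  rcases lt_or_gt_of_ne h with h | h
  · rw [if_neg h.asymm, if_pos h]
  · rw [if_pos h, if_neg h.asymm]; simp

theorem sgn_mul_self (j j' : Fin m) : sgn j j' * sgn j j' = 1 := by
  unfold sgn; split_ifs <;> norm_num

/-- The quadratic expression in the off-diagonal blocks occurring in the moment map. -/
def mom (J : Finset (Fin m)) (x : ℕ → Matrix ι ι ℂ) (j : Fin m) : Matrix ι ι ℂ :=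
  ∑ j' ∈ J, sgn j' j • ∑ t ∈ Finset.range (dq q j j'),
    eb blk j * x t * eb blk j' * x t * eb blk j

/-- `Y` lies in the truncated orbit of the irregular type on the corner `J` under unipotent
conjugation. -/
def InOrb (J : Finset (Fin m)) (Y : Matrix ι ι (LaurentSeries ℂ)) : Prop :=
  ∃ u : (Matrix ι ι (LaurentSeries ℂ))ˣ, CornerUnip (eJ blk J) u ∧
    Vge 0 (Y - u.val * Tm q blk J * u⁻¹.val)

/-- `Ψ` parametrizes the irregular parts of the elements of the unipotent truncated orbit by
off-diagonal blocks. -/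
structure IsPara (J : Finset (Fin m))
    (Ψ : (ℕ → Matrix ι ι ℂ) → Matrix ι ι (LaurentSeries ℂ)) : Prop where
  supp : ∀ x k, -1 ≤ k → cf (Ψ x) k = 0
  corner : ∀ x, Blk (eJ blk J) (eJ blk J) (Ψ x)
  rel : ∀ S : Subalgebra ℂ (Matrix ι ι ℂ × Matrix ι ι ℂ), (eJ blk J, eJ blk J) ∈ S → ∀ x x',
    (∀ k, (cf (Ψ x) k, cf (Ψ x') k) ∈ S) ↔ (∀ j ∈ J, (eb blk j, eb blk j) ∈ S) ∧
      ∀ j ∈ J, ∀ j' ∈ J, j ≠ j' → ∀ t < dq q j j',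
        (eb blk j * x t * eb blk j', eb blk j * x' t * eb blk j') ∈ S
  orb : ∀ Y, (∀ k, 0 ≤ k → cf Y k = 0) → Blk (eJ blk J) (eJ blk J) Y →
    (InOrb q blk J Y ↔ ∃ x, (∀ k ≤ -2, cf Y k = cf (Ψ x) k) ∧
      ∀ j ∈ J, eb blk j * cf Y (-1) * eb blk j = mom q blk J x j)

variable {q blk}

theorem eb_mul_mom (J : Finset (Fin m)) (x : ℕ → Matrix ι ι ℂ) (j : Fin m) :
    eb blk j * mom q blk J x j = mom q blk J x j := by
  unfold mom
  simp only [Finset.mul_sum, Matrix.mul_smul, ← mul_assoc, eb_mul_self]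

theorem mom_mul_eb (J : Finset (Fin m)) (x : ℕ → Matrix ι ι ℂ) (j : Fin m) :
    mom q blk J x j * eb blk j = mom q blk J x j := by
  unfold mom
  simp only [Finset.sum_mul, Matrix.smul_mul, mul_assoc, eb_mul_self]

theorem IsPara.Vge_sub {J : Finset (Fin m)} {Ψ : (ℕ → Matrix ι ι ℂ) → Matrix ι ι (LaurentSeries ℂ)}
    (h : IsPara q blk J Ψ) {j0 : Fin m} {K : ℕ} (hK2 : 2 ≤ K)
    (hK : ∀ j ∈ J, (q j - q j0).natDegree ≤ K) (x : ℕ → Matrix ι ι ℂ) :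
    Vge (-K + 1) (Ψ x - Tm q blk J) := by
  set Y := Ψ x + sg (-1) (∑ j ∈ J, mom q blk J x j) with hY
  have hc : ∀ k, cf Y k = cf (Ψ x) k + if k = -1 then ∑ j ∈ J, mom q blk J x j else 0 := by
    intro k; rw [hY, cf_add, cf_sg]
  have h1 : InOrb q blk J Y := by
    refine (h.orb Y ?_ ?_).2 ⟨x, ?_, ?_⟩
    · intro k hk
      rw [hc, h.supp x k (by omega), if_neg (by omega), zero_add]
    · refine (h.corner x).add (Blk.sg _ ?_ ?_)
      · rw [Finset.mul_sum]
        refine Finset.sum_congr rfl fun j hj => ?_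
        rw [← eb_mul_mom, ← mul_assoc, eJ_mul_eb hj]
      · rw [Finset.sum_mul]
        refine Finset.sum_congr rfl fun j hj => ?_
        rw [← mom_mul_eb, mul_assoc, eb_mul_eJ hj]
    · intro k hk
      rw [hc, if_neg (by omega), add_zero]
    · intro j hj
      rw [hc, h.supp x (-1) le_rfl, if_pos rfl, zero_add, Finset.mul_sum, Finset.sum_mul,
        Finset.sum_eq_single j]
      · rw [eb_mul_mom, mom_mul_eb]
      · intro b _ hb
        rw [← eb_mul_mom, ← mul_assoc, eb_mul_eb, if_neg hb.symm, zero_mul, zero_mul]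
      · exact fun h' => absurd hj h'
  obtain ⟨u, hu, hv⟩ := h1
  have h2 := Vge_conj_sub hK hu
  have : Ψ x - Tm q blk J = (Y - u.val * Tm q blk J * u⁻¹.val) +
      (u.val * Tm q blk J * u⁻¹.val - Tm q blk J) - sg (-1) (∑ j ∈ J, mom q blk J x j) := by
    rw [hY]; abel
  rw [this]
  exact ((hv.mono (by omega)).add h2).sub (Vge.sg (by omega) _)

variable (q blk)

/-- A partition of the blocks according to the leading coefficients of the irregular type. -/
structure Split (J1 J2 : Finset (Fin m)) (j0 : Fin m) (K : ℕ) : Prop where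
  hK : 2 ≤ K
  mem : j0 ∈ J1
  disj : Disjoint J1 J2
  le1 : ∀ j ∈ J1, (q j - q j0).natDegree ≤ K - 1
  eq2 : ∀ j ∈ J1, ∀ j' ∈ J2, (q j - q j').natDegree = K

/-- The diagonal matrix `∑_{j ∈ J} f(c_j) e_j` where `c_j` is the coefficient of `z^{-K}` in
`q_j - q_{j₀}`. -/
def Dl (J : Finset (Fin m)) (j0 : Fin m) (K : ℕ) (f : ℂ → ℂ) : Matrix ι ι ℂ :=
  ∑ j ∈ J, f ((q j - q j0).coeff K) • eb blk j

theorem Dl_mul (J : Finset (Fin m)) (j0 : Fin m) (K : ℕ) (f g : ℂ → ℂ) :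
    Dl q blk J j0 K f * Dl q blk J j0 K g = Dl q blk J j0 K (fun c => f c * g c) := by
  unfold Dl
  rw [Finset.sum_mul]
  refine Finset.sum_congr rfl fun j hj => ?_
  rw [Finset.mul_sum, Finset.sum_eq_single j]
  · rw [smul_mul_smul_comm, eb_mul_self]
  · intro b _ hb; rw [smul_mul_smul_comm, eb_mul_eb, if_neg hb.symm, smul_zero]
  · exact fun h' => absurd hj h'

variable {q blk}

namespace Split

variable {J1 J2 : Finset (Fin m)} {j0 : Fin m} {K : ℕ} (s : Split q J1 J2 j0 K)
include s

theorem natDegree2 {j : Fin m} (hj : j ∈ J2) : (q j - q j0).natDegree = K := by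
  rw [← s.eq2 j0 s.mem j hj, ← Polynomial.natDegree_neg, neg_sub]

theorem coeff_ne {j : Fin m} (hj : j ∈ J2) : (q j - q j0).coeff K ≠ 0 := by
  have hd := s.natDegree2 hj
  rw [← hd]
  have : q j - q j0 ≠ 0 := by
    intro h; rw [h, Polynomial.natDegree_zero] at hd; have := s.hK; omega
  simpa using this

theorem Dl_one : Dl q blk J2 j0 K (fun _ => 1) = eJ blk J2 := by
  simp [Dl, eJ]

theorem Dl_mul_inv : Dl q blk J2 j0 K id * Dl q blk J2 j0 K (·⁻¹) = eJ blk J2 := by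
  rw [Dl_mul, ← s.Dl_one]
  exact Finset.sum_congr rfl fun j hj => by
    simp only [id, mul_inv_cancel₀ (s.coeff_ne hj)]

theorem Dl_inv_mul : Dl q blk J2 j0 K (·⁻¹) * Dl q blk J2 j0 K id = eJ blk J2 := by
  rw [Dl_mul, ← s.Dl_one]
  exact Finset.sum_congr rfl fun j hj => by
    simp only [id, inv_mul_cancel₀ (s.coeff_ne hj)]

theorem dq_eq {j j' : Fin m} (hj : j ∈ J1) (hj' : j' ∈ J2) : dq q j j' = K - 2 := by
  rw [dq, s.eq2 j hj j' hj']

theorem dq_eq' {j j' : Fin m} (hj : j ∈ J1) (hj' : j' ∈ J2) : dq q j' j = K - 2 := by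
  rw [dq, ← Polynomial.natDegree_neg, neg_sub, s.eq2 j hj j' hj']

theorem ne {j j' : Fin m} (hj : j ∈ J1) (hj' : j' ∈ J2) : j ≠ j' := by
  rintro rfl; exact Finset.disjoint_left.1 s.disj hj hj'

theorem e12 : eJ blk J1 * eJ blk J2 = 0 := eJ_mul_eJ_disjoint s.disj

theorem e21 : eJ blk J2 * eJ blk J1 = 0 := eJ_mul_eJ_disjoint s.disj.symm

theorem e11 : eJ blk J1 * eJ blk J1 = eJ blk J1 := eJ_mul_eJ_subset subset_rfl

theorem e22 : eJ blk J2 * eJ blk J2 = eJ blk J2 := eJ_mul_eJ_subset subset_rfl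

theorem vT1 : Vge (-K + 1) (Tm q blk J1 - polyZinv (q j0) • sg 0 (eJ blk J1)) := by
  have := Vge_Tm_sub q blk s.le1
  have hK := s.hK
  rw [show (-(K : ℤ) + 1) = -((K - 1 : ℕ) : ℤ) by omega]
  exact this

theorem vT2 : Vge (-K + 1) (Tm q blk J2 - polyZinv (q j0) • sg 0 (eJ blk J2)
    - sg (-K) (Dl q blk J2 j0 K id)) := by
  have h := Vge_Tm_sub (J := J2) q blk (j0 := j0) (K := K) fun j hj => (s.natDegree2 hj).le
  intro k hk
  rw [cf_sub, cf_sg]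
  split_ifs with hkK
  · subst hkK
    rw [Tm_sub_eq, cf_sum]
    simp only [cf_smul_sg, coeff_polyZinv_neg]
    exact sub_self _
  · rw [h k (by omega), sub_zero]

theorem le_K1 : ∀ j ∈ J1, (q j - q j0).natDegree ≤ K := fun j hj => (s.le1 j hj).trans (by omega)

theorem le_K2 : ∀ j ∈ J2, (q j - q j0).natDegree ≤ K := fun _ hj => (s.natDegree2 hj).le

/-- Block data whose diagonal blocks are close to the irregular type. -/
theorem nrm {D1 D2 p b : Matrix ι ι (LaurentSeries ℂ)}
    (hD1 : Blk (eJ blk J1) (eJ blk J1) D1) (hD2 : Blk (eJ blk J2) (eJ blk J2) D2)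
    (hp : Blk (eJ blk J1) (eJ blk J2) p) (hb : Blk (eJ blk J2) (eJ blk J1) b)
    (v1 : Vge (-K + 1) (D1 - Tm q blk J1)) (v2 : Vge (-K + 1) (D2 - Tm q blk J2))
    (vp : Vge (-K + 1) p) (vb : Vge 1 b) :
    Nrm (eJ blk J1) (eJ blk J2) (Dl q blk J2 j0 K id) (polyZinv (q j0)) K D1 D2 p b := by
  refine ⟨hD1, hD2, hp, hb, ?_, ?_, vp, vb⟩
  · have := v1.add (s.vT1 (blk := blk))
    rwa [sub_add_sub_cancel] at this
  · have := v2.add (s.vT2 (blk := blk))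
    rw [sub_sub] at this ⊢
    rwa [sub_add_sub_cancel] at this

end Split

/-! ### The inductive construction of the parametrization -/

variable (blk)

/-- The upper off-diagonal part built from the parameters. -/
def pS (J1 J2 : Finset (Fin m)) (n : ℕ) (x : ℕ → Matrix ι ι ℂ) : Matrix ι ι (LaurentSeries ℂ) :=
  ∑ t ∈ Finset.range n, sg (-2 - t) (eJ blk J1 * x t * eJ blk J2)

/-- The signed lower off-diagonal part of a matrix. -/
def bt (J1 J2 : Finset (Fin m)) (y : Matrix ι ι ℂ) : Matrix ι ι ℂ :=
  ∑ j ∈ J1, ∑ j' ∈ J2, sgn j j' • (eb blk j' * y * eb blk j)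

/-- The lower off-diagonal conjugator built from the parameters. -/
def bS (J1 J2 : Finset (Fin m)) (n : ℕ) (x : ℕ → Matrix ι ι ℂ) : Matrix ι ι (LaurentSeries ℂ) :=
  ∑ t ∈ Finset.range n, sg (t + 1) (bt blk J1 J2 (x t))

variable {blk}

theorem cf_pS (J1 J2 : Finset (Fin m)) (n : ℕ) (x : ℕ → Matrix ι ι ℂ) (k : ℤ) :
    cf (pS blk J1 J2 n x) k =
      if k ≤ -2 ∧ -2 - n < k then eJ blk J1 * x (-2 - k).toNat * eJ blk J2 else 0 := by
  unfold pS
  rw [cf_sum]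
  simp only [cf_sg]
  split_ifs with h
  · rw [Finset.sum_eq_single (-2 - k).toNat]
    · rw [if_pos (by omega)]
    · intro t _ ht; rw [if_neg (by omega)]
    · intro h'; rw [Finset.mem_range] at h'; omega
  · refine Finset.sum_eq_zero fun t ht => ?_
    rw [Finset.mem_range] at ht
    rw [if_neg (by omega)]

theorem cf_bS (J1 J2 : Finset (Fin m)) (n : ℕ) (x : ℕ → Matrix ι ι ℂ) (k : ℤ) :
    cf (bS blk J1 J2 n x) k = if 1 ≤ k ∧ k ≤ n then bt blk J1 J2 (x (k - 1).toNat) else 0 := by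
  unfold bS
  rw [cf_sum]
  simp only [cf_sg]
  split_ifs with h
  · rw [Finset.sum_eq_single (k - 1).toNat]
    · rw [if_pos (by omega)]
    · intro t _ ht; rw [if_neg (by omega)]
    · intro h'; rw [Finset.mem_range] at h'; omega
  · refine Finset.sum_eq_zero fun t ht => ?_
    rw [Finset.mem_range] at ht
    rw [if_neg (by omega)]

theorem cf_pS_of_lt {J1 J2 : Finset (Fin m)} {n t : ℕ} (x : ℕ → Matrix ι ι ℂ) (ht : t < n) :
    cf (pS blk J1 J2 n x) (-2 - t) = eJ blk J1 * x t * eJ blk J2 := by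
  rw [cf_pS, if_pos (by omega)]; simp

theorem cf_bS_of_lt {J1 J2 : Finset (Fin m)} {n t : ℕ} (x : ℕ → Matrix ι ι ℂ) (ht : t < n) :
    cf (bS blk J1 J2 n x) (t + 1) = bt blk J1 J2 (x t) := by
  rw [cf_bS, if_pos (by omega)]; simp

theorem Vge_pS (J1 J2 : Finset (Fin m)) (n : ℕ) (x : ℕ → Matrix ι ι ℂ) :
    Vge (-n - 1) (pS blk J1 J2 n x) := fun k hk => by rw [cf_pS, if_neg (by omega)]

theorem Vge_bS (J1 J2 : Finset (Fin m)) (n : ℕ) (x : ℕ → Matrix ι ι ℂ) :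
    Vge 1 (bS blk J1 J2 n x) := fun k hk => by rw [cf_bS, if_neg (by omega)]

theorem Blk_pS (J1 J2 : Finset (Fin m)) (n : ℕ) (x : ℕ → Matrix ι ι ℂ) :
    Blk (eJ blk J1) (eJ blk J2) (pS blk J1 J2 n x) :=
  Blk.sum fun _ _ => Blk.sg _ (by rw [← mul_assoc, ← mul_assoc, eJ_mul_eJ_subset subset_rfl])
    (by rw [mul_assoc, eJ_mul_eJ_subset subset_rfl])

theorem eJ_mul_bt (J1 J2 : Finset (Fin m)) (y : Matrix ι ι ℂ) :
    eJ blk J2 * bt blk J1 J2 y = bt blk J1 J2 y := by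
  unfold bt
  rw [Finset.mul_sum]
  refine Finset.sum_congr rfl fun j hj => ?_
  rw [Finset.mul_sum]
  refine Finset.sum_congr rfl fun j' hj' => ?_
  rw [Matrix.mul_smul, ← mul_assoc, ← mul_assoc, eJ_mul_eb hj']

theorem bt_mul_eJ (J1 J2 : Finset (Fin m)) (y : Matrix ι ι ℂ) :
    bt blk J1 J2 y * eJ blk J1 = bt blk J1 J2 y := by
  unfold bt
  rw [Finset.sum_mul]
  refine Finset.sum_congr rfl fun j hj => ?_
  rw [Finset.sum_mul]
  refine Finset.sum_congr rfl fun j' hj' => ?_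
  rw [Matrix.smul_mul, mul_assoc, eb_mul_eJ hj]

theorem Blk_bS (J1 J2 : Finset (Fin m)) (n : ℕ) (x : ℕ → Matrix ι ι ℂ) :
    Blk (eJ blk J2) (eJ blk J1) (bS blk J1 J2 n x) :=
  Blk.sum fun _ _ => Blk.sg _ (eJ_mul_bt _ _ _) (bt_mul_eJ _ _ _)

theorem eb_bt_eb {J1 J2 : Finset (Fin m)} {j j' : Fin m} (hj : j ∈ J1) (hj' : j' ∈ J2)
    (y : Matrix ι ι ℂ) :
    eb blk j' * bt blk J1 J2 y * eb blk j = sgn j j' • (eb blk j' * y * eb blk j) := by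
  unfold bt
  rw [Finset.mul_sum, Finset.sum_mul, Finset.sum_eq_single j]
  · rw [Finset.mul_sum, Finset.sum_mul, Finset.sum_eq_single j']
    · rw [Matrix.mul_smul, Matrix.smul_mul, ← mul_assoc, ← mul_assoc, eb_mul_self, mul_assoc,
        eb_mul_self]
    · intro i _ hi
      rw [Matrix.mul_smul, Matrix.smul_mul, ← mul_assoc, ← mul_assoc, eb_mul_eb, if_neg hi.symm]
      simp
    · exact fun h => absurd hj' h
  · intro i _ hi
    rw [Finset.mul_sum, Finset.sum_mul]
    refine Finset.sum_eq_zero fun i' _ => ?_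
    rw [Matrix.mul_smul, Matrix.smul_mul, mul_assoc, mul_assoc, eb_mul_eb, if_neg hi]
    simp
  · exact fun h => absurd hj h

variable (blk)

/-- The parametrization attached to a splitting `J = J₁ ⊔ J₂`. -/
def PsiStep (J1 J2 : Finset (Fin m)) (n : ℕ)
    (Ψ1 Ψ2 : (ℕ → Matrix ι ι ℂ) → Matrix ι ι (LaurentSeries ℂ)) (x : ℕ → Matrix ι ι ℂ) :
    Matrix ι ι (LaurentSeries ℂ) :=
  tr (-1) (FS (Ψ1 x) (Ψ2 x) (pS blk J1 J2 n x) (bS blk J1 J2 n x))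

end Blocks

theorem sum_inv_idempotents_mem {R A : Type*} [Ring R] [Algebra ℂ R] [DecidableEq A]
    (S : Subalgebra ℂ R) (e : A → R) (he : ∀ i j, e i * e j = if i = j then e i else 0)
    (J : Finset A) (c : A → ℂ) (hc : ∀ j ∈ J, c j ≠ 0) (h : ∑ j ∈ J, c j • e j ∈ S) :
    ∑ j ∈ J, (c j)⁻¹ • e j ∈ S := by
  have h1 := sum_idempotents_mem S e he J c hc h
  set D := ∑ j ∈ J, c j • e j with hD
  have hpow : ∀ n : ℕ, D ^ n * ∑ j ∈ J, e j = ∑ j ∈ J, c j ^ n • e j := by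
    intro n
    induction n with
    | zero => simp
    | succ n ih =>
      rw [pow_succ', mul_assoc, ih, hD, Finset.sum_mul]
      refine Finset.sum_congr rfl fun j hj => ?_
      rw [Finset.mul_sum, Finset.sum_eq_single j]
      · rw [smul_mul_smul_comm, he, if_pos rfl, ← pow_succ']
      · intro b _ hb; rw [smul_mul_smul_comm, he, if_neg hb.symm, smul_zero]
      · exact fun h' => absurd hj h'
  have hP : ∀ P : Polynomial ℂ, Polynomial.aeval D P * ∑ j ∈ J, e j =
      ∑ j ∈ J, P.eval (c j) • e j := by
    intro P
    induction P using Polynomial.induction_on' with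
    | add p r hp hr =>
      rw [map_add, add_mul, hp, hr]
      simp only [Polynomial.eval_add, add_smul, Finset.sum_add_distrib]
    | monomial n a =>
      rw [Polynomial.aeval_monomial, mul_assoc, hpow, Algebra.algebraMap_eq_smul_one,
        smul_mul_assoc, one_mul, Finset.smul_sum]
      simp [Polynomial.eval_monomial, mul_smul]
  set P0 : Polynomial ℂ := 1 - ∏ j ∈ J, (1 - Polynomial.C (c j)⁻¹ * Polynomial.X) with hP0
  have hdiv : P0 = Polynomial.X * P0.divX := by
    have := Polynomial.X_mul_divX_add P0
    have h0 : P0.coeff 0 = 0 := by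
      rw [Polynomial.coeff_zero_eq_eval_zero, hP0]
      simp [Polynomial.eval_prod]
    rw [h0, map_zero, add_zero] at this
    exact this.symm
  have hev : ∀ j ∈ J, P0.divX.eval (c j) = (c j)⁻¹ := by
    intro j hj
    have h2 : P0.eval (c j) = 1 := by
      rw [hP0, Polynomial.eval_sub, Polynomial.eval_prod, Finset.prod_eq_zero hj]
      · simp
      · simp [hc j hj]
    rw [hdiv, Polynomial.eval_mul, Polynomial.eval_X] at h2
    exact eq_inv_of_mul_eq_one_right h2
  have hmem : Polynomial.aeval D P0.divX ∈ S :=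
    Algebra.adjoin_le (S := S) (Set.singleton_subset_iff.2 h)
      (Polynomial.aeval_mem_adjoin_singleton ℂ D)
  have := S.mul_mem hmem h1
  rw [hP] at this
  convert this using 1
  exact Finset.sum_congr rfl fun j hj => by rw [hev j hj]

section Blocks

variable {ι : Type} [Fintype ι] [DecidableEq ι]

section

variable {E1 E2 Δ : Matrix ι ι ℂ} {q0 : LaurentSeries ℂ} {K : ℕ}
  {D1 D2 p b D1' D2' p' b' : Matrix ι ι (LaurentSeries ℂ)}

theorem Nrm.v_g21 (h : Nrm E1 E2 Δ q0 K D1 D2 p b) :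
    Vge (-K + 1) (b * D1 - D2 * b - b * p * b) := by
  rw [h.g21]
  have a1 : Vge (-K + 1) (b * (D1 - q0 • sg 0 E1)) := (h.vb.mul h.vD1).mono (by omega)
  have a2 : Vge (-K + 1) ((D2 - q0 • sg 0 E2 - sg (-K) Δ) * b) :=
    (h.vD2.mul h.vb).mono (by omega)
  have a3 : Vge (-K + 1) (sg (-K) Δ * b) := ((Vge.sg (le_refl (-K : ℤ)) Δ).mul h.vb).mono (by omega)
  have a4 : Vge (-K + 1) (b * p * b) := (h.vbp.mul h.vb).mono (by omega)
  exact ((a1.sub a2).sub a3).sub a4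

theorem laurent_smul_add (q : LaurentSeries ℂ) (f g : Matrix ι ι (LaurentSeries ℂ)) :
    q • (f + g) = q • f + q • g := Matrix.ext fun i j => mul_add q (f i j) (g i j)

theorem Nrm.v_FS (h : Nrm E1 E2 Δ q0 K D1 D2 p b) :
    Vge (-K + 1) (FS D1 D2 p b - q0 • sg 0 (E1 + E2) - sg (-K) Δ) := by
  have e : q0 • sg 0 (E1 + E2) = q0 • sg 0 E1 + q0 • sg 0 E2 := by
    rw [sg_add, laurent_smul_add]
  have : FS D1 D2 p b - q0 • sg 0 (E1 + E2) - sg (-K) Δ = (D1 - q0 • sg 0 E1) - p * b + p +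
      (b * D1 - D2 * b - b * p * b) + (D2 - q0 • sg 0 E2 - sg (-K) Δ) + b * p := by
    rw [e]; unfold FS; abel
  rw [this]
  exact ((((h.vD1.sub (h.vpb.mono (by omega))).add h.vp).add h.v_g21).add h.vD2).add
    (h.vbp.mono (by omega))

/-- Recursion determining `b` from the blocks of the conjugated matrix. -/
theorem Nrm.b_eq (h : Nrm E1 E2 Δ q0 K D1 D2 p b) {Δi : Matrix ι ι ℂ} (hi : Δi * Δ = E2) :
    b = sg K Δi * (b * ((D1 - p * b) - q0 • sg 0 E1) - ((D2 + b * p) - q0 • sg 0 E2 - sg (-K) Δ) * b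
      + b * p * b - (b * D1 - D2 * b - b * p * b)) := by
  have key : b * ((D1 - p * b) - q0 • sg 0 E1) - ((D2 + b * p) - q0 • sg 0 E2 - sg (-K) Δ) * b
      + b * p * b - (b * D1 - D2 * b - b * p * b) = sg (-K) Δ * b := by
    rw [h.g21]
    simp only [sub_mul, mul_sub, add_mul, mul_assoc]
    abel
  rw [key, ← mul_assoc, sg_mul_sg, hi, add_neg_cancel, h.hb.1]

variable {S : Subalgebra ℂ (Matrix ι ι ℂ × Matrix ι ι ℂ)}

theorem RelLt.smul_sg {e e' : Matrix ι ι ℂ} (h : (e, e') ∈ S) (q : LaurentSeries ℂ) (N : ℤ) :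
    RelLt S N (q • _root_.sg 0 e) (q • _root_.sg 0 e') := fun k _ => by
  rw [cf_smul_sg, cf_smul_sg]
  exact S.smul_mem h (q.coeff k)

theorem RelLt.corner {N : ℤ} {f f' : Matrix ι ι (LaurentSeries ℂ)} (h : RelLt S N f f')
    {e e' g g' : Matrix ι ι ℂ} (he : (e, e') ∈ S) (hg : (g, g') ∈ S) :
    RelLt S N (_root_.sg 0 e * f * _root_.sg 0 g) (_root_.sg 0 e' * f' * _root_.sg 0 g') :=
  fun k hk => by
    rw [cf_corner, cf_corner]
    exact S.mul_mem (S.mul_mem he (h k hk)) hg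

theorem RelLt.of_vge {N : ℤ} {f f' : Matrix ι ι (LaurentSeries ℂ)} (h : Vge N f) (h' : Vge N f') :
    RelLt S N f f' := fun k hk => by rw [h k hk, h' k hk]; exact S.zero_mem

/-- From a relation between the irregular parts of two conjugated matrices to relations between
the block data. -/
theorem Nrm.rel_of_FS (h : Nrm E1 E2 Δ q0 K D1 D2 p b) (h' : Nrm E1 E2 Δ q0 K D1' D2' p' b')
    (hK : 2 ≤ K) {Δi : Matrix ι ι ℂ} (hi : Δi * Δ = E2) (h12 : E1 * E2 = 0) (h21 : E2 * E1 = 0)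
    (hE1 : (E1, E1) ∈ S) (hE2 : (E2, E2) ∈ S) (hΔ : (Δ, Δ) ∈ S) (hΔi : (Δi, Δi) ∈ S)
    (hF : RelLt S (-1) (FS D1 D2 p b) (FS D1' D2' p' b')) :
    RelLt S (-1) D1 D1' ∧ RelLt S (-1) D2 D2' ∧ RelLt S (-1) p p' ∧ RelLt S (K - 1) b b' := by
  obtain ⟨c11, c12, c21, c22⟩ := fs_corners h12 h21 h.hD1 h.hD2 h.hp h.hb
  obtain ⟨c11', c12', c21', c22'⟩ := fs_corners h12 h21 h'.hD1 h'.hD2 h'.hp h'.hb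
  have r11 := hF.corner hE1 hE1
  have rp := hF.corner hE1 hE2
  have r21 := hF.corner hE2 hE1
  have r22 := hF.corner hE2 hE2
  rw [c11, c11'] at r11
  rw [c12, c12'] at rp
  rw [c21, c21'] at r21
  rw [c22, c22'] at r22
  have s11 := r11.sub (RelLt.smul_sg hE1 q0 (-1))
  have s22 := (r22.sub (RelLt.smul_sg hE2 q0 (-1))).sub (RelLt.sg hΔ (-K) (-1))
  have v11 : ∀ {D1 D2 p b : Matrix ι ι (LaurentSeries ℂ)}, Nrm E1 E2 Δ q0 K D1 D2 p b →
      Vge (-K + 1) (D1 - p * b - q0 • sg 0 E1) := fun {D1 D2 p b} h => by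
    have := h.vD1.sub (h.vpb.mono (by omega))
    rwa [sub_right_comm] at this
  have v22 : ∀ {D1 D2 p b : Matrix ι ι (LaurentSeries ℂ)}, Nrm E1 E2 Δ q0 K D1 D2 p b →
      Vge (-K + 1) (D2 + b * p - q0 • sg 0 E2 - sg (-K) Δ) := fun {D1 D2 p b} h => by
    have := h.vD2.add (h.vbp.mono (d' := -K + 1) (by omega))
    have e : D2 + b * p - q0 • sg 0 E2 - sg (-K) Δ =
      D2 - q0 • sg 0 E2 - sg (-K) Δ + b * p := by abel
    rwa [e]
  have rb : ∀ i : ℕ, (i : ℤ) ≤ K - 2 → RelLt S (i + 1) b b' := by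
    intro i
    induction i with
    | zero => intro _; exact RelLt.of_vge (by simpa using h.vb) (by simpa using h'.vb)
    | succ i ih =>
      intro hiK
      have ihb := ih (by push_cast at hiK; omega)
      push_cast at hiK ⊢
      rw [h.b_eq hi, h'.b_eq hi]
      have a1 := RelLt.mul (N := -K + (i + 1) + 1) ihb s11 h.vb h'.vb (v11 h) (v11 h')
        (by omega) (by omega)
      have a2 := RelLt.mul (N := -K + (i + 1) + 1) s22 ihb (v22 h) (v22 h') h.vb h'.vb
        (by omega) (by omega)
      have a3 := RelLt.mul (N := -K + (i + 1) + 1) ihb rp h.vb h'.vb h.vp h'.vp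
        (by omega) (by omega)
      have a4 := RelLt.mul (N := -K + (i + 1) + 1) a3 ihb h.vbp h'.vbp h.vb h'.vb
        (by omega) (by omega)
      have a5 := ((a1.sub a2).add a4).sub (r21.mono (N' := -K + (i + 1) + 1) (by omega))
      intro k hk
      rw [cf_sg_mul, cf_sg_mul]
      exact S.mul_mem hΔi (a5 _ (by omega))
  have rb' := rb (K - 2) (by omega)
  have hbK : RelLt S (K - 1) b b' := rb'.mono (by omega)
  have rpb := RelLt.mul (N := -1) rp hbK h.vp h'.vp h.vb h'.vb (by omega) (by omega)
  have rbp := RelLt.mul (N := -1) hbK rp h.vb h'.vb h.vp h'.vp (by omega) (by omega)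
  refine ⟨?_, ?_, rp, hbK⟩
  · simpa using r11.add rpb
  · simpa using r22.sub rbp

end

section Step

variable {m : ℕ} {q : Fin m → Polynomial ℂ} {blk : ι → Fin m} {J1 J2 : Finset (Fin m)} {j0 : Fin m}
  {K : ℕ} {Ψ1 Ψ2 : (ℕ → Matrix ι ι ℂ) → Matrix ι ι (LaurentSeries ℂ)}

theorem Split.nrmS (s : Split q J1 J2 j0 K) (h1 : IsPara q blk J1 Ψ1) (h2 : IsPara q blk J2 Ψ2)
    (x : ℕ → Matrix ι ι ℂ) :
    Nrm (eJ blk J1) (eJ blk J2) (Dl q blk J2 j0 K id) (polyZinv (q j0)) K (Ψ1 x) (Ψ2 x)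
      (pS blk J1 J2 (K - 2) x) (bS blk J1 J2 (K - 2) x) :=
  s.nrm (h1.corner x) (h2.corner x) (Blk_pS _ _ _ _) (Blk_bS _ _ _ _)
    (h1.Vge_sub s.hK s.le_K1 x) (h2.Vge_sub s.hK s.le_K2 x)
    ((Vge_pS J1 J2 (K - 2) x).mono (by have := s.hK; omega)) (Vge_bS _ _ _ _)

theorem mk_sum_mem_iff {A : Type*} (S : Subalgebra ℂ (Matrix ι ι ℂ × Matrix ι ι ℂ)) (J : Finset A)
    (f g : A → Matrix ι ι ℂ) :
    (∑ j ∈ J, f j, ∑ j ∈ J, g j) ∈ S ↔ ∑ j ∈ J, (f j, g j) ∈ S := by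
  rw [show (∑ j ∈ J, f j, ∑ j ∈ J, g j) = ∑ j ∈ J, (f j, g j) from
    Prod.ext (by simp [Prod.fst_sum]) (by simp [Prod.snd_sum])]

theorem pair_eb_mul (j j' : Fin m) : ((eb blk j, eb blk j) : Matrix ι ι ℂ × Matrix ι ι ℂ) *
    (eb blk j', eb blk j') = if j = j' then (eb blk j, eb blk j) else 0 := by
  rw [Prod.mk_mul_mk, eb_mul_eb]; split_ifs <;> rfl

theorem Split.rel_mp (s : Split q J1 J2 j0 K) (h1 : IsPara q blk J1 Ψ1) (h2 : IsPara q blk J2 Ψ2)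
    {S : Subalgebra ℂ (Matrix ι ι ℂ × Matrix ι ι ℂ)}
    (hE : (eJ blk (J1 ∪ J2), eJ blk (J1 ∪ J2)) ∈ S) {x x' : ℕ → Matrix ι ι ℂ}
    (h : ∀ k, (cf (PsiStep blk J1 J2 (K - 2) Ψ1 Ψ2 x) k, cf (PsiStep blk J1 J2 (K - 2) Ψ1 Ψ2 x') k) ∈ S) :
    (∀ j ∈ J1 ∪ J2, (eb blk j, eb blk j) ∈ S) ∧
      ∀ j ∈ J1 ∪ J2, ∀ j' ∈ J1 ∪ J2, j ≠ j' → ∀ t < dq q j j',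
        (eb blk j * x t * eb blk j', eb blk j * x' t * eb blk j') ∈ S := by
  have n1 := s.nrmS h1 h2 x
  have n2 := s.nrmS h1 h2 x'
  have hK := s.hK
  have hF : RelLt S (-1) (FS (Ψ1 x) (Ψ2 x) (pS blk J1 J2 (K - 2) x) (bS blk J1 J2 (K - 2) x))
      (FS (Ψ1 x') (Ψ2 x') (pS blk J1 J2 (K - 2) x') (bS blk J1 J2 (K - 2) x')) := by
    intro k hk
    have := h k
    unfold PsiStep at this
    rwa [cf_tr, cf_tr, if_pos hk, if_pos hk] at this
  rw [eJ_union s.disj] at hE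
  have hΔ : (Dl q blk J2 j0 K id, Dl q blk J2 j0 K id) ∈ S := by
    have h0 := (hF.sub (RelLt.smul_sg hE (polyZinv (q j0)) (-1))) (-K) (by omega)
    have e1 := n1.v_FS (-K) (by omega)
    have e2 := n2.v_FS (-K) (by omega)
    rw [cf_sub _ (sg _ _), cf_sg, if_pos rfl, sub_eq_zero] at e1 e2
    rwa [e1, e2] at h0
  have hΔ' : ∑ j ∈ J2, (q j - q j0).coeff K • ((eb blk j, eb blk j) : Matrix ι ι ℂ × Matrix ι ι ℂ)
      ∈ S := by
    unfold Dl at hΔ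
    rw [mk_sum_mem_iff] at hΔ
    simpa using hΔ
  have hE2 : (eJ blk J2, eJ blk J2) ∈ S := by
    unfold eJ
    rw [mk_sum_mem_iff]
    exact sum_idempotents_mem S _ pair_eb_mul J2 _ (fun j hj => s.coeff_ne hj) hΔ'
  have hΔi : (Dl q blk J2 j0 K (·⁻¹), Dl q blk J2 j0 K (·⁻¹)) ∈ S := by
    unfold Dl
    rw [mk_sum_mem_iff]
    have := sum_inv_idempotents_mem S _ pair_eb_mul J2 _ (fun j hj => s.coeff_ne hj) hΔ'
    simpa using this
  have hE1 : (eJ blk J1, eJ blk J1) ∈ S := by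
    have := S.sub_mem hE hE2
    simpa using this
  obtain ⟨rD1, rD2, rp, rb⟩ := n1.rel_of_FS n2 hK s.Dl_inv_mul s.e12 s.e21 hE1 hE2 hΔ hΔi hF
  have all : ∀ {J : Finset (Fin m)} {Ψ : (ℕ → Matrix ι ι ℂ) → Matrix ι ι (LaurentSeries ℂ)},
      IsPara q blk J Ψ → RelLt S (-1) (Ψ x) (Ψ x') → ∀ k, (cf (Ψ x) k, cf (Ψ x') k) ∈ S := by
    intro J Ψ hp hr k
    rcases lt_or_ge k (-1) with hk | hk
    · exact hr k hk
    · rw [hp.supp x k hk, hp.supp x' k hk]; exact S.zero_mem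
  obtain ⟨m1, b1⟩ := (h1.rel S hE1 x x').1 (all h1 rD1)
  obtain ⟨m2, b2⟩ := (h2.rel S hE2 x x').1 (all h2 rD2)
  have hm : ∀ j ∈ J1 ∪ J2, (eb blk j, eb blk j) ∈ S := fun j hj =>
    (Finset.mem_union.1 hj).elim (m1 j) (m2 j)
  refine ⟨hm, fun j hj j' hj' hne t ht => ?_⟩
  rcases Finset.mem_union.1 hj with hj1 | hj2 <;> rcases Finset.mem_union.1 hj' with hj1' | hj2'
  · exact b1 j hj1 j' hj1' hne t ht
  · rw [s.dq_eq hj1 hj2'] at ht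
    have := rp (-2 - t) (by omega)
    rw [cf_pS_of_lt _ ht, cf_pS_of_lt _ ht] at this
    have := S.mul_mem (S.mul_mem (m1 j hj1) this) (m2 j' hj2')
    simp only [Prod.mk_mul_mk] at this
    have e : ∀ y : Matrix ι ι ℂ, eb blk j * (eJ blk J1 * y * eJ blk J2) * eb blk j' =
        eb blk j * y * eb blk j' := fun y => by
      rw [← mul_assoc, ← mul_assoc, eb_mul_eJ hj1, mul_assoc, eJ_mul_eb hj2']
    rwa [e, e] at this
  · rw [s.dq_eq' hj1' hj2] at ht
    have := rb (t + 1) (by omega)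
    rw [cf_bS_of_lt _ ht, cf_bS_of_lt _ ht] at this
    have := S.mul_mem (S.mul_mem (m2 j hj2) this) (m1 j' hj1')
    simp only [Prod.mk_mul_mk] at this
    rw [eb_bt_eb hj1' hj2, eb_bt_eb hj1' hj2] at this
    have := S.smul_mem this (sgn j' j)
    simpa [smul_smul, sgn_mul_self] using this
  · exact b2 j hj2 j' hj2' hne t ht

theorem Split.rel_mpr (s : Split q J1 J2 j0 K) (h1 : IsPara q blk J1 Ψ1) (h2 : IsPara q blk J2 Ψ2)
    {S : Subalgebra ℂ (Matrix ι ι ℂ × Matrix ι ι ℂ)} {x x' : ℕ → Matrix ι ι ℂ}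
    (hm : ∀ j ∈ J1 ∪ J2, (eb blk j, eb blk j) ∈ S)
    (hb : ∀ j ∈ J1 ∪ J2, ∀ j' ∈ J1 ∪ J2, j ≠ j' → ∀ t < dq q j j',
        (eb blk j * x t * eb blk j', eb blk j * x' t * eb blk j') ∈ S) (k : ℤ) :
    (cf (PsiStep blk J1 J2 (K - 2) Ψ1 Ψ2 x) k, cf (PsiStep blk J1 J2 (K - 2) Ψ1 Ψ2 x') k) ∈ S := by
  have n1 := s.nrmS h1 h2 x
  have n2 := s.nrmS h1 h2 x'
  have l1 : ∀ j ∈ J1, j ∈ J1 ∪ J2 := fun j hj => Finset.mem_union_left _ hj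
  have l2 : ∀ j ∈ J2, j ∈ J1 ∪ J2 := fun j hj => Finset.mem_union_right _ hj
  have hE1 : (eJ blk J1, eJ blk J1) ∈ S := by
    unfold eJ; rw [mk_sum_mem_iff]; exact S.sum_mem fun j hj => hm j (l1 j hj)
  have hE2 : (eJ blk J2, eJ blk J2) ∈ S := by
    unfold eJ; rw [mk_sum_mem_iff]; exact S.sum_mem fun j hj => hm j (l2 j hj)
  have rD1 : ∀ N, RelLt S N (Ψ1 x) (Ψ1 x') := fun N k _ =>
    (h1.rel S hE1 x x').2 ⟨fun j hj => hm j (l1 j hj),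
      fun j hj j' hj' => hb j (l1 j hj) j' (l1 j' hj')⟩ k
  have rD2 : ∀ N, RelLt S N (Ψ2 x) (Ψ2 x') := fun N k _ =>
    (h2.rel S hE2 x x').2 ⟨fun j hj => hm j (l2 j hj),
      fun j hj j' hj' => hb j (l2 j hj) j' (l2 j' hj')⟩ k
  have rp : ∀ N, RelLt S N (pS blk J1 J2 (K - 2) x) (pS blk J1 J2 (K - 2) x') := fun N => by
    unfold pS
    refine RelLt.sum fun t ht => RelLt.sg ?_ _ _
    have e : ∀ y : Matrix ι ι ℂ, eJ blk J1 * y * eJ blk J2 =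
        ∑ j ∈ J1, ∑ j' ∈ J2, eb blk j * y * eb blk j' := fun y => by
      unfold eJ; rw [Finset.sum_mul, Finset.sum_mul]
      exact Finset.sum_congr rfl fun j _ => Finset.mul_sum _ _ _
    rw [e, e, mk_sum_mem_iff]
    refine S.sum_mem fun j hj => ?_
    rw [mk_sum_mem_iff]
    refine S.sum_mem fun j' hj' => ?_
    exact hb j (l1 j hj) j' (l2 j' hj') (s.ne hj hj') t
      (by rw [s.dq_eq hj hj']; exact Finset.mem_range.1 ht)
  have rb : ∀ N, RelLt S N (bS blk J1 J2 (K - 2) x) (bS blk J1 J2 (K - 2) x') := fun N => by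
    unfold bS
    refine RelLt.sum fun t ht => RelLt.sg ?_ _ _
    unfold bt
    rw [mk_sum_mem_iff]
    refine S.sum_mem fun j hj => ?_
    rw [mk_sum_mem_iff]
    refine S.sum_mem fun j' hj' => ?_
    exact S.smul_mem (hb j' (l2 j' hj') j (l1 j hj) (s.ne hj hj').symm t
      (by rw [s.dq_eq' hj hj']; exact Finset.mem_range.1 ht)) (sgn j j')
  unfold PsiStep
  rw [cf_tr, cf_tr]
  split_ifs with hk
  swap
  · exact S.zero_mem
  have big : ∀ {f f' g g' : Matrix ι ι (LaurentSeries ℂ)} {v w : ℤ}, (∀ N, RelLt S N f f') →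
      (∀ N, RelLt S N g g') → Vge v f → Vge v f' → Vge w g → Vge w g' →
      ∀ N, RelLt S N (f * g) (f' * g') := fun hf hg v1 v2 w1 w2 N =>
    RelLt.mul (hf _) (hg _) v1 v2 w1 w2 (sub_add_cancel N _).ge (sub_add_cancel N _).ge
  have rpb := big rp rb n1.vp n2.vp n1.vb n2.vb
  have rbp := big rb rp n1.vb n2.vb n1.vp n2.vp
  have rbpb := big rbp rb n1.vbp n2.vbp n1.vb n2.vb
  obtain ⟨v, hv⟩ : ∃ v, ∀ y, Vge v (Ψ1 y) ∧ Vge v (Ψ2 y) := by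
    have hT : ∀ J : Finset (Fin m), ∃ v, Vge v (Tm q blk J) := fun J => by
      refine ⟨-(∑ j ∈ J, (q j).natDegree : ℕ), Vge.sum fun j hj => ?_⟩
      have := Vge_smul (fun k hk => coeff_polyZinv_of_lt (Finset.single_le_sum
        (f := fun j => (q j).natDegree) (fun _ _ => Nat.zero_le _) hj) hk)
        (Vge.sg (le_refl 0) (eb blk j))
      simpa using this
    obtain ⟨v1, hv1⟩ := hT J1
    obtain ⟨v2, hv2⟩ := hT J2
    refine ⟨min (min v1 v2) (-K + 1), fun y => ⟨?_, ?_⟩⟩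
    · have := ((h1.Vge_sub s.hK s.le_K1 y).mono (min_le_right (min v1 v2) _)).add
        (hv1.mono ((min_le_left _ (-(K : ℤ) + 1)).trans (min_le_left _ _)))
      simpa using this
    · have := ((h2.Vge_sub s.hK s.le_K2 y).mono (min_le_right (min v1 v2) _)).add
        (hv2.mono ((min_le_left _ (-(K : ℤ) + 1)).trans (min_le_right _ _)))
      simpa using this
  have rbD := big rb rD1 n1.vb n2.vb (hv x).1 (hv x').1
  have rDb := big rD2 rb (hv x).2 (hv x').2 n1.vb n2.vb
  exact ((((rD1 (-1)).sub (rpb _)).add (rp _)).add (((rbD _).sub (rDb _)).sub (rbpb _))).add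
    ((rD2 _).add (rbp _)) k hk

end Step

end Blocks

section Blocks

variable {ι : Type} [Fintype ι] [DecidableEq ι]

section Units

variable {E1 E2 : Matrix ι ι ℂ} {a b T1 T2 : Matrix ι ι (LaurentSeries ℂ)}
  {u1 u2 u : (Matrix ι ι (LaurentSeries ℂ))ˣ}

theorem unit_conj_eq {R : Type*} [Ring R] {A B : Rˣ} {T : R} :
    (A * B).val * T * (A * B)⁻¹.val = A.val * (B.val * T * B⁻¹.val) * A⁻¹.val := by
  rw [_root_.mul_inv_rev, Units.val_mul, Units.val_mul]
  simp only [mul_assoc]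

theorem CornerUnip.blk_conj {e : Matrix ι ι ℂ} (he : e * e = e) {T : Matrix ι ι (LaurentSeries ℂ)}
    (hu : CornerUnip e u) (hT : Blk e e T) : Blk e e (u.val * T * u⁻¹.val) :=
  hu.inv.mul_blk (hu.blk_mul hT he) he

/-- A product of block triangular unipotent elements conjugates a block diagonal matrix into a
matrix of the form `FS`. -/
theorem CornerUnip.conj_eq_FS (h11 : E1 * E1 = E1) (h22 : E2 * E2 = E2) (h12 : E1 * E2 = 0)
    (h21 : E2 * E1 = 0)
    (hu1 : CornerUnip E1 u1) (hu2 : CornerUnip E2 u2) (ha : Blk E1 E2 a) (va : Vge 1 a)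
    (hb : Blk E2 E1 b) (vb : Vge 1 b) (hT1 : Blk E1 E1 T1) (hT2 : Blk E2 E2 T2)
    (hu : u.val = (1 + b) * ((1 + a) * (u1.val * u2.val))) :
    CornerUnip (E1 + E2) u ∧ u.val * (T1 + T2) * u⁻¹.val =
      FS (u1.val * T1 * u1⁻¹.val) (u2.val * T2 * u2⁻¹.val)
        (a * (u2.val * T2 * u2⁻¹.val) - u1.val * T1 * u1⁻¹.val * a) b := by
  have a1 : (E1 + E2) * E1 = E1 := by rw [add_mul, h11, h21, add_zero]
  have a2 : (E1 + E2) * E2 = E2 := by rw [add_mul, h22, h12, zero_add]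
  have b1 : E1 * (E1 + E2) = E1 := by rw [mul_add, h11, h12, add_zero]
  have b2 : E2 * (E1 + E2) = E2 := by rw [mul_add, h22, h21, zero_add]
  have haa : a * a = 0 := ha.mul_eq_zero ha h21
  have hbb : b * b = 0 := hb.mul_eq_zero hb h12
  have hu' : u = oneAdd b hbb * (oneAdd a haa * (u1 * u2)) := Units.ext hu
  set D1 := u1.val * T1 * u1⁻¹.val with hD1
  set D2 := u2.val * T2 * u2⁻¹.val with hD2
  have k1 : Blk E1 E1 D1 := hu1.blk_conj h11 hT1
  have k2 : Blk E2 E2 D2 := hu2.blk_conj h22 hT2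
  have c1 : (u1 * u2).val * (T1 + T2) * (u1 * u2)⁻¹.val = D1 + D2 := by
    rw [unit_conj_eq, mul_add u2.val, add_mul _ _ u2⁻¹.val, ← hD2, hu2.mul_eq hT1 h21,
      hu2.inv.eq_mul hT1 h12, mul_add u1.val, add_mul _ _ u1⁻¹.val, ← hD1, hu1.mul_eq k2 h12,
      hu1.inv.eq_mul k2 h21]
  have c2 : (oneAdd a haa).val * (D1 + D2) * (oneAdd a haa)⁻¹.val = D1 + D2 + (a * D2 - D1 * a) :=
    one_add_conj_eq (ha.mul_eq_zero k1 h21) (k2.mul_eq_zero ha h21)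
  have kp : Blk E1 E2 (a * D2 - D1 * a) := (ha.mul k2).sub (k1.mul ha)
  have c3 : (oneAdd b hbb).val * (D1 + D2 + (a * D2 - D1 * a)) * (oneAdd b hbb)⁻¹.val =
      FS D1 D2 (a * D2 - D1 * a) b :=
    FS_eq (k1.mul_eq_zero hb h12) (hb.mul_eq_zero k2 h12)
  have ua : CornerUnip (E1 + E2) (oneAdd a haa) := by
    refine ⟨unip_oneAdd haa va, ?_⟩
    have : (oneAdd a haa).val - 1 = a := add_sub_cancel_left 1 a
    rw [this]; exact ha.widen a1 b2
  have ub : CornerUnip (E1 + E2) (oneAdd b hbb) := by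
    refine ⟨unip_oneAdd hbb vb, ?_⟩
    have : (oneAdd b hbb).val - 1 = b := add_sub_cancel_left 1 b
    rw [this]; exact hb.widen a2 b1
  refine ⟨?_, ?_⟩
  · rw [hu']
    exact ub.mul (ua.mul ((hu1.widen a1 b1).mul (hu2.widen a2 b2)))
  · rw [hu', unit_conj_eq, unit_conj_eq, c1, c2, c3]

/-- Block triangular factorization of unipotent elements. -/
theorem CornerUnip.exists_factor (h11 : E1 * E1 = E1) (h22 : E2 * E2 = E2) (h12 : E1 * E2 = 0)
    (h21 : E2 * E1 = 0) (hu : CornerUnip (E1 + E2) u) :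
    ∃ (u1 u2 : (Matrix ι ι (LaurentSeries ℂ))ˣ) (a b : Matrix ι ι (LaurentSeries ℂ)),
      CornerUnip E1 u1 ∧ CornerUnip E2 u2 ∧ Blk E1 E2 a ∧ Vge 1 a ∧ Blk E2 E1 b ∧ Vge 1 b ∧
      u.val = (1 + b) * ((1 + a) * (u1.val * u2.val)) := by
  set n := u.val - 1 with hn
  have vn : Vge 1 n := hu.1.1
  have cor : ∀ {e e' : Matrix ι ι ℂ}, e * e = e → e' * e' = e' →
      Blk e e' (sg 0 e * n * sg 0 e') ∧ Vge 1 (sg 0 e * n * sg 0 e') := by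
    intro e e' he he'
    refine ⟨⟨?_, ?_⟩, (Vge.sg le_rfl _).conj vn (Vge.sg le_rfl _)⟩
    · rw [← mul_assoc, ← mul_assoc, sg_mul_sg, he]; simp
    · rw [mul_assoc, sg_mul_sg, he']; simp
  obtain ⟨k11, v11⟩ := cor h11 h11
  obtain ⟨k12, v12⟩ := cor h11 h22
  obtain ⟨k21, v21⟩ := cor h22 h11
  obtain ⟨k22, v22⟩ := cor h22 h22
  set n11 := sg 0 E1 * n * sg 0 E1
  set n12 := sg 0 E1 * n * sg 0 E2
  set n21 := sg 0 E2 * n * sg 0 E1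
  set n22 := sg 0 E2 * n * sg 0 E2
  have hsum : n = n11 + n12 + (n21 + n22) := by
    have : sg 0 (E1 + E2) * n * sg 0 (E1 + E2) = n := hu.2.corner
    rw [sg_add, add_mul, add_mul, mul_add, mul_add] at this
    exact this.symm
  obtain ⟨u1, e1, hu1⟩ := exists_unip (f := 1 + n11) (by rw [add_sub_cancel_left]; exact v11)
  have hu1 : CornerUnip E1 u1 := ⟨hu1, by rw [e1, add_sub_cancel_left]; exact k11⟩
  set b := n21 * u1⁻¹.val with hb
  have kb : Blk E2 E1 b := hu1.inv.mul_blk k21 h11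
  have vb : Vge 1 b := by exact v21.mul hu1.inv.1.vge
  have kw : Blk E2 E2 (n22 - b * n12) := k22.sub (kb.mul k12)
  have vw : Vge 1 (n22 - b * n12) := v22.sub ((vb.mul v12).mono (by omega))
  obtain ⟨u2, e2, hu2⟩ := exists_unip (f := 1 + (n22 - b * n12))
    (by rw [add_sub_cancel_left]; exact vw)
  have hu2 : CornerUnip E2 u2 := ⟨hu2, by rw [e2, add_sub_cancel_left]; exact kw⟩
  set a := n12 * u2⁻¹.val with ha
  have ka : Blk E1 E2 a := hu2.inv.mul_blk k12 h22
  have va : Vge 1 a := by exact v12.mul hu2.inv.1.vge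
  refine ⟨u1, u2, a, b, hu1, hu2, ka, va, kb, vb, ?_⟩
  have hau1 : a * u1.val = a := hu1.eq_mul ka h21
  have hau2 : a * u2.val = n12 := by rw [ha, mul_assoc, Units.inv_mul, mul_one]
  have hbu1 : b * u1.val = n21 := by rw [hb, mul_assoc, Units.inv_mul, mul_one]
  have hbw : b * (n22 - b * n12) = 0 := kb.mul_eq_zero kw h12
  have h1w : n11 * (n22 - b * n12) = 0 := k11.mul_eq_zero kw h12
  have s1 : u1.val * u2.val = u1.val + (n22 - b * n12) := by
    rw [e2, mul_add u1.val, mul_one, e1, add_mul, h1w, one_mul, add_zero]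
  have s2 : (1 + a) * (u1.val * u2.val) = u1.val + (n22 - b * n12) + n12 := by
    rw [add_mul, one_mul, ← mul_assoc, hau1, hau2, s1]
  rw [s2, add_mul 1 b, one_mul, mul_add b _ n12, mul_add b, hbu1, hbw, e1]
  have : u.val = 1 + n := by rw [hn]; abel
  rw [this, hsum]; abel

end Units

section Step

variable {m : ℕ} {q : Fin m → Polynomial ℂ} {blk : ι → Fin m} {J1 J2 : Finset (Fin m)} {j0 : Fin m}
  {K : ℕ} {Ψ1 Ψ2 : (ℕ → Matrix ι ι ℂ) → Matrix ι ι (LaurentSeries ℂ)}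

theorem Tm_union (h : Disjoint J1 J2) : Tm q blk (J1 ∪ J2) = Tm q blk J1 + Tm q blk J2 :=
  Finset.sum_union h

/-- The Sylvester equation `a D₂ - D₁ a = p` is solvable. -/
theorem Split.exists_sylvester (s : Split q J1 J2 j0 K)
    {u1 u2 : (Matrix ι ι (LaurentSeries ℂ))ˣ}
    (hu1 : CornerUnip (eJ blk J1) u1) (hu2 : CornerUnip (eJ blk J2) u2)
    {p : Matrix ι ι (LaurentSeries ℂ)} (hp : Blk (eJ blk J1) (eJ blk J2) p) (vp : Vge (-K + 1) p) :
    ∃ a, Blk (eJ blk J1) (eJ blk J2) a ∧ Vge 1 a ∧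
      a * (u2.val * Tm q blk J2 * u2⁻¹.val) - u1.val * Tm q blk J1 * u1⁻¹.val * a = p := by
  set w := u1⁻¹.val * p * u2.val with hw
  have kw : Blk (eJ blk J1) (eJ blk J2) w :=
    hu2.mul_blk (hu1.inv.blk_mul hp s.e11) s.e22
  have vw : Vge (-K + 1) w := hu1.1.vge_inv.conj vp hu2.1.vge
  set a' : Matrix ι ι (LaurentSeries ℂ) := ∑ j ∈ J1, ∑ j' ∈ J2,
    (polyZinv (q j' - q j))⁻¹ • (sg 0 (eb blk j) * w * sg 0 (eb blk j')) with ha'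
  have hne : ∀ j ∈ J1, ∀ j' ∈ J2, q j' - q j ≠ 0 ∧ (q j' - q j).natDegree = K := by
    intro j hj j' hj'
    have hd : (q j' - q j).natDegree = K := by
      rw [← s.eq2 j hj j' hj', ← Polynomial.natDegree_neg, neg_sub]
    refine ⟨fun h => ?_, hd⟩
    rw [h, Polynomial.natDegree_zero] at hd
    have := s.hK; omega
  have ka' : Blk (eJ blk J1) (eJ blk J2) a' := by
    refine Blk.sum fun j hj => Blk.sum fun j' hj' => Blk.smul ⟨?_, ?_⟩ _
    · rw [← mul_assoc, ← mul_assoc, sg_mul_sg, eJ_mul_eb hj]; simp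
    · rw [mul_assoc, sg_mul_sg, eb_mul_eJ hj']; simp
  have va' : Vge 1 a' := by
    refine Vge.sum fun j hj => Vge.sum fun j' hj' => ?_
    obtain ⟨h1, h2⟩ := hne j hj j' hj'
    have h3 := (polyZinv_inv h1).2
    rw [h2] at h3
    have := Vge_smul h3 ((Vge.sg le_rfl (eb blk j)).conj vw (Vge.sg le_rfl (eb blk j')))
    exact this.mono (by omega)
  have hsyl : a' * Tm q blk J2 - Tm q blk J1 * a' = w := by
    have r1 : a' * Tm q blk J2 = ∑ j ∈ J1, ∑ j' ∈ J2,
        (polyZinv (q j') * (polyZinv (q j' - q j))⁻¹) •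
          (sg 0 (eb blk j) * w * sg 0 (eb blk j')) := by
      rw [ha', Finset.sum_mul]
      refine Finset.sum_congr rfl fun j hj => ?_
      rw [Finset.sum_mul]
      refine Finset.sum_congr rfl fun j' hj' => ?_
      rw [laurent_smul_mul]
      unfold Tm
      rw [Finset.mul_sum, Finset.sum_eq_single j']
      · rw [mul_laurent_smul, mul_assoc (sg 0 (eb blk j) * w), sg_mul_sg, eb_mul_self, smul_smul, add_zero]
        rw [mul_comm]
      · intro b _ hb
        rw [mul_laurent_smul, mul_assoc (sg 0 (eb blk j) * w), sg_mul_sg, eb_mul_eb, if_neg hb.symm, sg_zero, mul_zero]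
        exact smul_zero _
      · exact fun h => absurd hj' h
    have r2 : Tm q blk J1 * a' = ∑ j ∈ J1, ∑ j' ∈ J2,
        (polyZinv (q j) * (polyZinv (q j' - q j))⁻¹) •
          (sg 0 (eb blk j) * w * sg 0 (eb blk j')) := by
      rw [ha', Finset.mul_sum]
      refine Finset.sum_congr rfl fun j hj => ?_
      rw [Finset.mul_sum]
      refine Finset.sum_congr rfl fun j' hj' => ?_
      rw [mul_laurent_smul]
      unfold Tm
      rw [Finset.sum_mul, Finset.sum_eq_single j]
      · rw [laurent_smul_mul, ← mul_assoc, ← mul_assoc, sg_mul_sg, eb_mul_self, smul_smul, add_zero]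
        rw [mul_comm]
      · intro b _ hb
        rw [laurent_smul_mul, ← mul_assoc, ← mul_assoc, sg_mul_sg, eb_mul_eb, if_neg hb, sg_zero,
          zero_mul, zero_mul]
        exact smul_zero _
      · exact fun h => absurd hj h
    rw [r1, r2, ← Finset.sum_sub_distrib]
    have r3 : w = ∑ j ∈ J1, ∑ j' ∈ J2, sg 0 (eb blk j) * w * sg 0 (eb blk j') := by
      conv_lhs => rw [← kw.corner]
      unfold eJ
      rw [sg_sum, sg_sum, Finset.sum_mul, Finset.sum_mul]
      exact Finset.sum_congr rfl fun j _ => Finset.mul_sum _ _ _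
    conv_rhs => rw [r3]
    refine Finset.sum_congr rfl fun j hj => ?_
    rw [← Finset.sum_sub_distrib]
    refine Finset.sum_congr rfl fun j' hj' => ?_
    obtain ⟨h1, h2⟩ := hne j hj j' hj'
    rw [← sub_laurent_smul, ← sub_mul, ← polyZinv_sub, (polyZinv_inv h1).1]
    exact one_smul _ _
  refine ⟨u1.val * a' * u2⁻¹.val, hu2.inv.mul_blk (hu1.blk_mul ka' s.e11) s.e22,
    hu1.1.vge.conj va' hu2.1.vge_inv, ?_⟩
  have e1 : u1.val * a' * u2⁻¹.val * (u2.val * Tm q blk J2 * u2⁻¹.val) =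
      u1.val * (a' * Tm q blk J2) * u2⁻¹.val := by
    simp only [mul_assoc, Units.inv_mul_cancel_left]
  have e2 : u1.val * Tm q blk J1 * u1⁻¹.val * (u1.val * a' * u2⁻¹.val) =
      u1.val * (Tm q blk J1 * a') * u2⁻¹.val := by
    simp only [mul_assoc, Units.inv_mul_cancel_left]
  rw [e1, e2, ← sub_mul, ← mul_sub, hsyl, hw]
  simp only [mul_assoc, Units.mul_inv_cancel_left, Units.mul_inv, mul_one]

theorem cf_pS_mul_bS (n : ℕ) (x : ℕ → Matrix ι ι ℂ) :
    cf (pS blk J1 J2 n x * bS blk J1 J2 n x) (-1) =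
      ∑ t ∈ Finset.range n, eJ blk J1 * x t * eJ blk J2 * bt blk J1 J2 (x t) := by
  have e : cf (pS blk J1 J2 n x * bS blk J1 J2 n x) (-1) =
      ∑ t ∈ Finset.range n, cf (sg (-2 - t) (eJ blk J1 * x t * eJ blk J2) * bS blk J1 J2 n x) (-1) := by
    rw [← cf_sum, ← Finset.sum_mul, pS]
  rw [e]
  refine Finset.sum_congr rfl fun t ht => ?_
  rw [cf_sg_mul, show (-1 - (-2 - (t : ℤ))) = t + 1 by ring, cf_bS_of_lt _ (Finset.mem_range.1 ht)]

theorem cf_bS_mul_pS (n : ℕ) (x : ℕ → Matrix ι ι ℂ) :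
    cf (bS blk J1 J2 n x * pS blk J1 J2 n x) (-1) =
      ∑ t ∈ Finset.range n, bt blk J1 J2 (x t) * (eJ blk J1 * x t * eJ blk J2) := by
  have e : cf (bS blk J1 J2 n x * pS blk J1 J2 n x) (-1) =
      ∑ t ∈ Finset.range n, cf (bS blk J1 J2 n x * sg (-2 - t) (eJ blk J1 * x t * eJ blk J2)) (-1) := by
    rw [← cf_sum, ← Finset.mul_sum, pS]
  rw [e]
  refine Finset.sum_congr rfl fun t ht => ?_
  rw [cf_mul_sg, show (-1 - (-2 - (t : ℤ))) = t + 1 by ring, cf_bS_of_lt _ (Finset.mem_range.1 ht)]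

theorem Split.mom_left (s : Split q J1 J2 j0 K) (x : ℕ → Matrix ι ι ℂ) {j : Fin m} (hj : j ∈ J1) :
    mom q blk (J1 ∪ J2) x j = mom q blk J1 x j - eb blk j *
      cf (pS blk J1 J2 (K - 2) x * bS blk J1 J2 (K - 2) x) (-1) * eb blk j := by
  rw [cf_pS_mul_bS, Finset.mul_sum, Finset.sum_mul]
  have e : ∀ t, eb blk j * (eJ blk J1 * x t * eJ blk J2 * bt blk J1 J2 (x t)) * eb blk j =
      ∑ j' ∈ J2, sgn j j' • (eb blk j * x t * eb blk j' * x t * eb blk j) := by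
    intro t
    rw [← mul_assoc, ← mul_assoc, ← mul_assoc, eb_mul_eJ hj]
    rw [show eJ blk J2 = ∑ j' ∈ J2, eb blk j' * eb blk j' by simp only [eb_mul_self]; rfl]
    rw [Finset.mul_sum, Finset.sum_mul, Finset.sum_mul]
    refine Finset.sum_congr rfl fun j' hj' => ?_
    have := eb_bt_eb (blk := blk) hj hj' (x t)
    rw [show eb blk j * x t * (eb blk j' * eb blk j') * bt blk J1 J2 (x t) * eb blk j =
      eb blk j * x t * eb blk j' * (eb blk j' * bt blk J1 J2 (x t) * eb blk j) by
        simp only [mul_assoc], this, Matrix.mul_smul]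
    simp only [mul_assoc]
    rw [← mul_assoc (eb blk j') (eb blk j'), eb_mul_self]
  simp only [e]
  unfold mom
  rw [Finset.sum_union s.disj, Finset.sum_comm (s := Finset.range (K - 2)), sub_eq_add_neg,
    ← Finset.sum_neg_distrib]
  congr 1
  refine Finset.sum_congr rfl fun j' hj' => ?_
  rw [s.dq_eq hj hj', sgn_swap (s.ne hj hj'), ← Finset.smul_sum, neg_smul]

theorem Split.mom_right (s : Split q J1 J2 j0 K) (x : ℕ → Matrix ι ι ℂ) {j : Fin m} (hj : j ∈ J2) :
    mom q blk (J1 ∪ J2) x j = mom q blk J2 x j + eb blk j *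
      cf (bS blk J1 J2 (K - 2) x * pS blk J1 J2 (K - 2) x) (-1) * eb blk j := by
  rw [cf_bS_mul_pS, Finset.mul_sum, Finset.sum_mul]
  have e : ∀ t, eb blk j * (bt blk J1 J2 (x t) * (eJ blk J1 * x t * eJ blk J2)) * eb blk j =
      ∑ j' ∈ J1, sgn j' j • (eb blk j * x t * eb blk j' * x t * eb blk j) := by
    intro t
    rw [show eb blk j * (bt blk J1 J2 (x t) * (eJ blk J1 * x t * eJ blk J2)) * eb blk j =
      eb blk j * bt blk J1 J2 (x t) * eJ blk J1 * x t * (eJ blk J2 * eb blk j) by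
        simp only [mul_assoc], eJ_mul_eb hj]
    rw [show eJ blk J1 = ∑ j' ∈ J1, eb blk j' * eb blk j' by simp only [eb_mul_self]; rfl]
    rw [Finset.mul_sum, Finset.sum_mul, Finset.sum_mul]
    refine Finset.sum_congr rfl fun j' hj' => ?_
    have := eb_bt_eb (blk := blk) hj' hj (x t)
    rw [← mul_assoc _ (eb blk j') (eb blk j'), this]
    simp only [Matrix.smul_mul, mul_assoc]
    rw [← mul_assoc (eb blk j') (eb blk j'), eb_mul_self]
  simp only [e]
  unfold mom
  rw [Finset.sum_union s.disj, Finset.sum_comm (s := Finset.range (K - 2)), add_comm]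
  congr 1
  refine Finset.sum_congr rfl fun j' hj' => ?_
  rw [s.dq_eq' hj' hj, ← Finset.smul_sum]

end Step

end Blocks

section Blocks

variable {ι : Type} [Fintype ι] [DecidableEq ι]

variable {m : ℕ} {q : Fin m → Polynomial ℂ} {blk : ι → Fin m} {J J1 J2 : Finset (Fin m)} {j0 : Fin m}
  {K : ℕ} {Ψ Ψ1 Ψ2 : (ℕ → Matrix ι ι ℂ) → Matrix ι ι (LaurentSeries ℂ)}

/-- The diagonal subalgebra. -/
def diagSub (ι : Type) [Fintype ι] [DecidableEq ι] : Subalgebra ℂ (Matrix ι ι ℂ × Matrix ι ι ℂ) :=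
  AlgHom.equalizer (AlgHom.fst ℂ (Matrix ι ι ℂ) (Matrix ι ι ℂ))
    (AlgHom.snd ℂ (Matrix ι ι ℂ) (Matrix ι ι ℂ))

theorem mem_diagSub {a b : Matrix ι ι ℂ} : (a, b) ∈ diagSub ι ↔ a = b := Iff.rfl

theorem IsPara.congr (h : IsPara q blk J Ψ) {x x' : ℕ → Matrix ι ι ℂ}
    (hx : ∀ j ∈ J, ∀ j' ∈ J, j ≠ j' → ∀ t < dq q j j',
      eb blk j * x t * eb blk j' = eb blk j * x' t * eb blk j') : Ψ x = Ψ x' :=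
  cf_ext fun k => mem_diagSub.1 ((h.rel (diagSub ι) (mem_diagSub.2 rfl) x x').2
    ⟨fun _ _ => mem_diagSub.2 rfl, fun j hj j' hj' hne t ht =>
      mem_diagSub.2 (hx j hj j' hj' hne t ht)⟩ k)

theorem dq_self (j : Fin m) : dq q j j = 0 := by simp [dq]

theorem dq_comm (j j' : Fin m) : dq q j j' = dq q j' j := by
  rw [dq, dq, ← Polynomial.natDegree_neg, neg_sub]

theorem mom_congr {x x' : ℕ → Matrix ι ι ℂ}
    (hx : ∀ j ∈ J, ∀ j' ∈ J, j ≠ j' → ∀ t < dq q j j',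
      eb blk j * x t * eb blk j' = eb blk j * x' t * eb blk j') {j : Fin m} (hj : j ∈ J) :
    mom q blk J x j = mom q blk J x' j := by
  unfold mom
  refine Finset.sum_congr rfl fun j' hj' => ?_
  by_cases hne : j = j'
  · subst hne; simp [dq_self]
  congr 1
  refine Finset.sum_congr rfl fun t ht => ?_
  rw [Finset.mem_range] at ht
  have e : ∀ y : Matrix ι ι ℂ, eb blk j * y * eb blk j' * y * eb blk j =
      (eb blk j * y * eb blk j') * (eb blk j' * y * eb blk j) := fun y => by
    rw [mul_assoc (eb blk j' ), ← mul_assoc _ (eb blk j'), mul_assoc _ (eb blk j') (eb blk j'),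
      eb_mul_self, ← mul_assoc]
  rw [e, e, hx j hj j' hj' hne t ht, hx j' hj' j hj (Ne.symm hne) t (dq_comm (q := q) j j' ▸ ht)]

/-- The block-diagonal part of the residue of a matrix of the form `FS` close to the standard
one. -/
theorem Split.cf_mul_eq (s : Split q J1 J2 j0 K) {p b : Matrix ι ι (LaurentSeries ℂ)}
    {x : ℕ → Matrix ι ι ℂ} (vb : Vge 1 b)
    (dp : Vge (-1) (p - pS blk J1 J2 (K - 2) x))
    (db : Vge (K - 1) (b - bS blk J1 J2 (K - 2) x)) :
    cf (p * b) (-1) = cf (pS blk J1 J2 (K - 2) x * bS blk J1 J2 (K - 2) x) (-1) ∧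
    cf (b * p) (-1) = cf (bS blk J1 J2 (K - 2) x * pS blk J1 J2 (K - 2) x) (-1) := by
  have hK := s.hK
  have vpS : Vge (-K + 1) (pS blk J1 J2 (K - 2) x) := (Vge_pS J1 J2 (K - 2) x).mono (by omega)
  constructor
  · have e : p * b - pS blk J1 J2 (K - 2) x * bS blk J1 J2 (K - 2) x =
        (p - pS blk J1 J2 (K - 2) x) * b + pS blk J1 J2 (K - 2) x *
          (b - bS blk J1 J2 (K - 2) x) := by
      rw [sub_mul, mul_sub]; abel
    have := (((dp.mul vb).mono (d' := 0) (by omega)).add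
      ((vpS.mul db).mono (d' := 0) (by omega))) (-1) (by omega)
    rwa [← e, cf_sub, sub_eq_zero] at this
  · have e : b * p - bS blk J1 J2 (K - 2) x * pS blk J1 J2 (K - 2) x =
        b * (p - pS blk J1 J2 (K - 2) x) + 
          (b - bS blk J1 J2 (K - 2) x) * pS blk J1 J2 (K - 2) x := by
      rw [sub_mul, mul_sub]; abel
    have := (((vb.mul dp).mono (d' := 0) (by omega)).add
      ((db.mul vpS).mono (d' := 0) (by omega))) (-1) (by omega)
    rwa [← e, cf_sub, sub_eq_zero] at this

theorem Split.orb_mp (s : Split q J1 J2 j0 K) (h1 : IsPara q blk J1 Ψ1) (h2 : IsPara q blk J2 Ψ2)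
    {Y : Matrix ι ι (LaurentSeries ℂ)} (hY : InOrb q blk (J1 ∪ J2) Y) :
    ∃ x, (∀ k ≤ -2, cf Y k = cf (PsiStep blk J1 J2 (K - 2) Ψ1 Ψ2 x) k) ∧
      ∀ j ∈ J1 ∪ J2, eb blk j * cf Y (-1) * eb blk j = mom q blk (J1 ∪ J2) x j := by
  have hK := s.hK
  obtain ⟨u, hu, hv⟩ := hY
  rw [eJ_union s.disj] at hu
  rw [Tm_union s.disj] at hv
  obtain ⟨u1, u2, a, b, hu1, hu2, ka, va, kb, vb, hfac⟩ :=
    hu.exists_factor s.e11 s.e22 s.e12 s.e21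
  have hconj := (CornerUnip.conj_eq_FS s.e11 s.e22 s.e12 s.e21 hu1 hu2 ka va kb vb
    (Blk_Tm q blk J1) (Blk_Tm q blk J2) hfac).2
  have kD1 := hu1.blk_conj s.e11 (Blk_Tm q blk J1)
  have kD2 := hu2.blk_conj s.e22 (Blk_Tm q blk J2)
  have vD1 := Vge_conj_sub s.le_K1 hu1
  have vD2 := Vge_conj_sub s.le_K2 hu2
  have oD1 : InOrb q blk J1 (tr 0 (u1.val * Tm q blk J1 * u1⁻¹.val)) :=
    ⟨u1, hu1, by rw [← neg_sub]; exact (Vge_sub_tr _ _).neg⟩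
  have oD2 : InOrb q blk J2 (tr 0 (u2.val * Tm q blk J2 * u2⁻¹.val)) :=
    ⟨u2, hu2, by rw [← neg_sub]; exact (Vge_sub_tr _ _).neg⟩
  set D1 := u1.val * Tm q blk J1 * u1⁻¹.val
  set D2 := u2.val * Tm q blk J2 * u2⁻¹.val
  have kp : Blk (eJ blk J1) (eJ blk J2) (a * D2 - D1 * a) := (ka.mul kD2).sub (kD1.mul ka)
  have vp : Vge (-K + 1) (a * D2 - D1 * a) := by
    have n0 := s.nrm kD1 kD2 (p := 0) ⟨mul_zero _, zero_mul _⟩ kb vD1 vD2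
      (fun k _ => rfl) vb
    have e : a * D2 - D1 * a = a * (D2 - polyZinv (q j0) • sg 0 (eJ blk J2)) -
        (D1 - polyZinv (q j0) • sg 0 (eJ blk J1)) * a := by
      rw [mul_sub, sub_mul, mul_laurent_smul, laurent_smul_mul, ka.1, ka.2]; abel
    rw [e]
    exact ((va.mul n0.vD2').mono (by omega)).sub ((n0.vD1.mul va).mono (by omega))
  set p := a * D2 - D1 * a
  have n := s.nrm kD1 kD2 kp kb vD1 vD2 vp vb
  rw [hconj] at hv
  obtain ⟨x1, hx1, hr1⟩ := (h1.orb _ (fun k hk => by rw [cf_tr, if_neg (by omega)]) (kD1.tr 0)).1 oD1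
  obtain ⟨x2, hx2, hr2⟩ := (h2.orb _ (fun k hk => by rw [cf_tr, if_neg (by omega)]) (kD2.tr 0)).1 oD2
  set x : ℕ → Matrix ι ι ℂ := fun t => eJ blk J1 * x1 t * eJ blk J1 + eJ blk J2 * x2 t * eJ blk J2 +
    cf p (-2 - t) + bt blk J1 J2 (cf b (t + 1)) with hx
  have not12 : ∀ j ∈ J1, j ∉ J2 := fun j h h' => Finset.disjoint_left.1 s.disj h h'
  have not21 : ∀ j ∈ J2, j ∉ J1 := fun j h h' => Finset.disjoint_left.1 s.disj h' h
  have eJe : ∀ {J : Finset (Fin m)} {j : Fin m}, j ∉ J → eJ blk J * eb blk j = 0 := by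
    intro J j hj
    unfold eJ; rw [Finset.sum_mul]
    exact Finset.sum_eq_zero fun i hi => by rw [eb_mul_eb, if_neg (by rintro rfl; exact hj hi)]
  have hcp : ∀ k, eJ blk J1 * cf p k = cf p k ∧ cf p k * eJ blk J2 = cf p k := fun k => kp.cf k
  have hcb : ∀ k, eJ blk J2 * cf b k = cf b k ∧ cf b k * eJ blk J1 = cf b k := fun k => kb.cf k
  have x11 : ∀ j ∈ J1, ∀ j' ∈ J1, ∀ t, eb blk j * x1 t * eb blk j' = eb blk j * x t * eb blk j' := by
    intro j hj j' hj' t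
    have z1 : eb blk j * (eJ blk J1 * x1 t * eJ blk J1) * eb blk j' = eb blk j * x1 t * eb blk j' := by
      rw [← mul_assoc, ← mul_assoc, eb_mul_eJ hj, mul_assoc _ (eJ blk J1), eJ_mul_eb hj']
    have z2 : eb blk j * (eJ blk J2 * x2 t * eJ blk J2) * eb blk j' = 0 := by
      rw [← mul_assoc, ← mul_assoc, eb_mul_eJ_zero (blk := blk) (not12 j hj)]; simp
    have z3 : eb blk j * cf p (-2 - t) * eb blk j' = 0 := by
      rw [← (hcp _).2, mul_assoc, mul_assoc, eJe (not12 j' hj')]; simp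
    have z4 : eb blk j * bt blk J1 J2 (cf b (t + 1)) * eb blk j' = 0 := by
      rw [← eJ_mul_bt, ← mul_assoc, eb_mul_eJ_zero (blk := blk) (not12 j hj)]; simp
    simp only [hx, mul_add, add_mul, z1, z2, z3, z4, add_zero]
  have x22 : ∀ j ∈ J2, ∀ j' ∈ J2, ∀ t, eb blk j * x2 t * eb blk j' = eb blk j * x t * eb blk j' := by
    intro j hj j' hj' t
    have z1 : eb blk j * (eJ blk J1 * x1 t * eJ blk J1) * eb blk j' = 0 := by
      rw [← mul_assoc, ← mul_assoc, eb_mul_eJ_zero (blk := blk) (not21 j hj)]; simp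
    have z2 : eb blk j * (eJ blk J2 * x2 t * eJ blk J2) * eb blk j' = eb blk j * x2 t * eb blk j' := by
      rw [← mul_assoc, ← mul_assoc, eb_mul_eJ hj, mul_assoc _ (eJ blk J2), eJ_mul_eb hj']
    have z3 : eb blk j * cf p (-2 - t) * eb blk j' = 0 := by
      rw [← (hcp _).1, ← mul_assoc, eb_mul_eJ_zero (blk := blk) (not21 j hj)]; simp
    have z4 : eb blk j * bt blk J1 J2 (cf b (t + 1)) * eb blk j' = 0 := by
      rw [← bt_mul_eJ, mul_assoc, mul_assoc, eJe (not21 j' hj')]; simp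
    simp only [hx, mul_add, add_mul, z1, z2, z3, z4, add_zero, zero_add]
  have x12 : ∀ t, eJ blk J1 * x t * eJ blk J2 = cf p (-2 - t) := by
    intro t
    have z1 : eJ blk J1 * (eJ blk J1 * x1 t * eJ blk J1) * eJ blk J2 = 0 := by
      rw [mul_assoc, mul_assoc _ (eJ blk J1) (eJ blk J2), s.e12]; simp
    have z2 : eJ blk J1 * (eJ blk J2 * x2 t * eJ blk J2) * eJ blk J2 = 0 := by
      rw [← mul_assoc, ← mul_assoc, s.e12]; simp
    have z4 : eJ blk J1 * bt blk J1 J2 (cf b (t + 1)) * eJ blk J2 = 0 := by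
      rw [← bt_mul_eJ, mul_assoc, mul_assoc, s.e12]; simp
    simp only [hx, mul_add, add_mul, z1, z2, z4, add_zero, zero_add]
    rw [(hcp _).1, (hcp _).2]
  have x21 : ∀ j ∈ J1, ∀ j' ∈ J2, ∀ t : ℕ, eb blk j' * x t * eb blk j =
      sgn j j' • (eb blk j' * cf b (t + 1) * eb blk j) := by
    intro j hj j' hj' t
    have z1 : eb blk j' * (eJ blk J1 * x1 t * eJ blk J1) * eb blk j = 0 := by
      rw [← mul_assoc, ← mul_assoc, eb_mul_eJ_zero (blk := blk) (not21 j' hj')]; simp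
    have z2 : eb blk j' * (eJ blk J2 * x2 t * eJ blk J2) * eb blk j = 0 := by
      rw [mul_assoc, mul_assoc _ (eJ blk J2), eJe (not12 j hj)]; simp
    have z3 : eb blk j' * cf p (-2 - t) * eb blk j = 0 := by
      rw [← (hcp _).1, ← mul_assoc, eb_mul_eJ_zero (blk := blk) (not21 j' hj')]; simp
    simp only [hx, mul_add, add_mul, z1, z2, z3, add_zero, zero_add]
    exact eb_bt_eb hj hj' _
  have hbt : ∀ t : ℕ, bt blk J1 J2 (x t) = cf b (t + 1) := by
    intro t
    have e1 : cf b (t + 1) = ∑ j ∈ J1, ∑ j' ∈ J2, eb blk j' * cf b (t + 1) * eb blk j := by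
      conv_lhs => rw [← (hcb _).1, ← (hcb _).2]
      unfold eJ
      rw [Finset.mul_sum, Finset.mul_sum]
      refine Finset.sum_congr rfl fun j _ => ?_
      rw [← mul_assoc, Finset.sum_mul, Finset.sum_mul]
    rw [e1]
    unfold bt
    refine Finset.sum_congr rfl fun j hj => Finset.sum_congr rfl fun j' hj' => ?_
    rw [x21 j hj j' hj' t, smul_smul, sgn_mul_self, one_smul]
  have dp : Vge (-1) (p - pS blk J1 J2 (K - 2) x) := by
    intro k hk
    rw [cf_sub, cf_pS]
    split_ifs with h
    · rw [x12, show (-2 - ((-2 - k).toNat : ℤ)) = k by omega, sub_self]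
    · rw [vp k (by omega), sub_zero]
  have db : Vge (K - 1) (b - bS blk J1 J2 (K - 2) x) := by
    intro k hk
    rw [cf_sub, cf_bS]
    split_ifs with h
    · rw [hbt, show (((k - 1).toNat : ℤ) + 1) = k by omega, sub_self]
    · rw [vb k (by omega), sub_zero]
  have hΨ1 : Ψ1 x1 = Ψ1 x := h1.congr fun j hj j' hj' _ t _ => x11 j hj j' hj' t
  have hΨ2 : Ψ2 x2 = Ψ2 x := h2.congr fun j hj j' hj' _ t _ => x22 j hj j' hj' t
  have nS := s.nrmS h1 h2 x
  have dD1 : Vge (-1) (D1 - Ψ1 x) := by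
    intro k hk
    have := hx1 k (by omega)
    rw [cf_tr, if_pos (by omega)] at this
    rw [cf_sub, this, hΨ1, sub_self]
  have dD2 : Vge (-1) (D2 - Ψ2 x) := by
    intro k hk
    have := hx2 k (by omega)
    rw [cf_tr, if_pos (by omega)] at this
    rw [cf_sub, this, hΨ2, sub_self]
  have dF := n.sub_FS nS dD1 dD2 dp (db.mono (by omega))
  obtain ⟨pb, bp⟩ := s.cf_mul_eq vb dp db
  obtain ⟨c11, -, -, c22⟩ := fs_corners s.e12 s.e21 kD1 kD2 kp kb
  have hYF : ∀ k < 0, cf Y k = cf (FS D1 D2 p b) k := fun k hk => by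
    have := hv k hk
    rwa [cf_sub, sub_eq_zero] at this
  refine ⟨x, fun k hk => ?_, fun j hj => ?_⟩
  · have := dF k (by omega)
    rw [cf_sub, sub_eq_zero] at this
    rw [PsiStep, cf_tr, if_pos (by omega), hYF k (by omega), this]
  · rw [hYF (-1) (by omega)]
    rcases Finset.mem_union.1 hj with hj | hj
    · have e := congrArg (fun f => eb blk j * cf f (-1) * eb blk j) c11
      simp only [cf_corner] at e
      rw [← mul_assoc, ← mul_assoc, eb_mul_eJ hj, mul_assoc _ (eJ blk J1), eJ_mul_eb hj] at e
      rw [e, cf_sub, mul_sub, sub_mul, s.mom_left x hj, pb,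
        ← mom_congr (fun j hj j' hj' _ t _ => x11 j hj j' hj' t) hj, ← hr1 j hj, cf_tr,
        if_pos (by omega)]
    · have e := congrArg (fun f => eb blk j * cf f (-1) * eb blk j) c22
      simp only [cf_corner] at e
      rw [← mul_assoc, ← mul_assoc, eb_mul_eJ hj, mul_assoc _ (eJ blk J2), eJ_mul_eb hj] at e
      rw [e, cf_add, mul_add, add_mul, s.mom_right x hj, bp,
        ← mom_congr (fun j hj j' hj' _ t _ => x22 j hj j' hj' t) hj, ← hr2 j hj, cf_tr,
        if_pos (by omega)]

theorem Split.orb_mpr (s : Split q J1 J2 j0 K) (h1 : IsPara q blk J1 Ψ1) (h2 : IsPara q blk J2 Ψ2)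
    {Y : Matrix ι ι (LaurentSeries ℂ)}
    (hYB : Blk (eJ blk (J1 ∪ J2)) (eJ blk (J1 ∪ J2)) Y) {x : ℕ → Matrix ι ι ℂ}
    (hx : ∀ k ≤ -2, cf Y k = cf (PsiStep blk J1 J2 (K - 2) Ψ1 Ψ2 x) k)
    (hr : ∀ j ∈ J1 ∪ J2, eb blk j * cf Y (-1) * eb blk j = mom q blk (J1 ∪ J2) x j) :
    InOrb q blk (J1 ∪ J2) Y := by
  have hK := s.hK
  rw [eJ_union s.disj] at hYB
  have nS := s.nrmS h1 h2 x
  have vp0 := nS.vp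
  have vb0 := nS.vb
  have hY1 := hYB.cf (-1)
  set R := cf Y (-1) with hR
  set c1 := cf (pS blk J1 J2 (K - 2) x * bS blk J1 J2 (K - 2) x) (-1) with hc1
  set c2 := cf (bS blk J1 J2 (K - 2) x * pS blk J1 J2 (K - 2) x) (-1) with hc2
  have kc1 := (nS.hp.mul nS.hb).cf (-1)
  have kc2 := (nS.hb.mul nS.hp).cf (-1)
  rw [← hc1] at kc1
  rw [← hc2] at kc2
  set E1 := eJ blk J1 with hE1
  set E2 := eJ blk J2 with hE2
  set r1 := E1 * R * E1 + c1 with hr1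
  set r2 := E2 * R * E2 - c2 with hr2
  set D1 := Ψ1 x + sg (-1) r1 with hD1
  set D2 := Ψ2 x + sg (-1) r2 with hD2
  set p := pS blk J1 J2 (K - 2) x + sg (-1) (E1 * R * E2) with hp
  have kr1 : Blk E1 E1 (sg (-1) r1) := Blk.sg _
    (by rw [hr1, mul_add, kc1.1, ← mul_assoc, ← mul_assoc, s.e11])
    (by rw [hr1, add_mul, kc1.2, mul_assoc, s.e11])
  have kr2 : Blk E2 E2 (sg (-1) r2) := Blk.sg _
    (by rw [hr2, mul_sub, kc2.1, ← mul_assoc, ← mul_assoc, s.e22])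
    (by rw [hr2, sub_mul, kc2.2, mul_assoc, s.e22])
  have kD1 : Blk E1 E1 D1 := (h1.corner x).add kr1
  have kD2 : Blk E2 E2 D2 := (h2.corner x).add kr2
  have kp : Blk E1 E2 p := nS.hp.add (Blk.sg _ (by rw [← mul_assoc, ← mul_assoc, s.e11])
    (by rw [mul_assoc, s.e22]))
  have vp : Vge (-K + 1) p := vp0.add (Vge.sg (by omega) _)
  have dD1 : Vge (-1) (D1 - Ψ1 x) := by rw [hD1, add_sub_cancel_left]; exact Vge.sg le_rfl _
  have dD2 : Vge (-1) (D2 - Ψ2 x) := by rw [hD2, add_sub_cancel_left]; exact Vge.sg le_rfl _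
  have dp : Vge (-1) (p - pS blk J1 J2 (K - 2) x) := by
    rw [hp, add_sub_cancel_left]; exact Vge.sg le_rfl _
  have vD1 : Vge (-K + 1) (D1 - Tm q blk J1) := by
    have := (dD1.mono (d' := -K + 1) (by omega)).add (h1.Vge_sub s.hK s.le_K1 x)
    rwa [sub_add_sub_cancel] at this
  have vD2 : Vge (-K + 1) (D2 - Tm q blk J2) := by
    have := (dD2.mono (d' := -K + 1) (by omega)).add (h2.Vge_sub s.hK s.le_K2 x)
    rwa [sub_add_sub_cancel] at this
  have n' := s.nrm kD1 kD2 kp nS.hb vD1 vD2 vp vb0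
  set Δi : Matrix ι ι ℂ := Dl q blk J2 j0 K (·⁻¹) with hΔi
  set bs := bS blk J1 J2 (K - 2) x with hbs
  set g := cf (bs * D1 - D2 * bs - bs * p * bs) (-1) with hg
  have kg := (Blk.fs21 kD1 kD2 kp nS.hb).cf (-1)
  rw [← hg] at kg
  set β := Δi * (g - E2 * R * E1) with hβ
  have kβ : Blk E2 E1 (sg (K - 1) β) := Blk.sg _
    (by
      rw [hβ, ← mul_assoc]
      congr 1
      rw [hΔi, hE2, ← s.Dl_one, Dl_mul]
      simp only [one_mul])
    (by rw [hβ, mul_assoc, sub_mul, kg.2, mul_assoc _ E1, s.e11])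
  set b := bs + sg (K - 1) β with hb
  have kb : Blk E2 E1 b := nS.hb.add kβ
  have vb : Vge 1 b := vb0.add (Vge.sg (by omega) _)
  have db : Vge (K - 1) (b - bs) := by rw [hb, add_sub_cancel_left]; exact Vge.sg le_rfl _
  have n := s.nrm kD1 kD2 kp kb vD1 vD2 vp vb
  have g21 : cf (b * D1 - D2 * b - b * p * b) (-1) = E2 * R * E1 := by
    rw [n.cf_g21 n' hb, ← hg, hβ, ← mul_assoc, s.Dl_mul_inv, mul_sub, kg.1, ← mul_assoc,
      ← mul_assoc, s.e22, sub_sub_cancel]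
  have dF := n.sub_FS nS dD1 dD2 dp (db.mono (by omega))
  obtain ⟨pb, bp⟩ := s.cf_mul_eq vb dp db
  have hYF : Vge 0 (Y - FS D1 D2 p b) := by
    intro k hk
    rw [cf_sub, sub_eq_zero]
    rcases eq_or_ne k (-1) with rfl | hk1
    · have q1 : cf D1 (-1) = r1 := by
        rw [hD1, cf_add, h1.supp x _ le_rfl, cf_sg, if_pos rfl, zero_add]
      have q2 : cf D2 (-1) = r2 := by
        rw [hD2, cf_add, h2.supp x _ le_rfl, cf_sg, if_pos rfl, zero_add]
      have q3 : cf p (-1) = E1 * R * E2 := by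
        rw [hp, cf_add, cf_pS, if_neg (by omega), cf_sg, if_pos rfl, zero_add]
      have : cf (FS D1 D2 p b) (-1) = (E1 + E2) * R * (E1 + E2) := by
        unfold FS
        rw [cf_add, cf_add, cf_add, g21, cf_sub D1, cf_add D2, q1, q2, q3, pb, bp, hr1, hr2]
        simp only [add_mul, mul_add]
        abel
      rw [this, hY1.1, hY1.2]
    · have := dF k (by omega)
      rw [cf_sub, sub_eq_zero] at this
      rw [hx k (by omega), PsiStep, cf_tr, if_pos (by omega), this]
  have o1 : InOrb q blk J1 D1 := by
    refine (h1.orb D1 (fun k hk => ?_) kD1).2 ⟨x, fun k hk => ?_, fun j hj => ?_⟩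
    · rw [hD1, cf_add, h1.supp x k (by omega), cf_sg, if_neg (by omega), add_zero]
    · rw [hD1, cf_add, cf_sg, if_neg (by omega), add_zero]
    · rw [hD1, cf_add, h1.supp x _ le_rfl, cf_sg, if_pos rfl, zero_add, hr1, mul_add, add_mul,
        ← mul_assoc, ← mul_assoc, eb_mul_eJ hj, mul_assoc _ E1, eJ_mul_eb hj,
        hr j (Finset.mem_union_left _ hj), s.mom_left x hj, ← hbs, ← hc1, sub_add_cancel]
  have o2 : InOrb q blk J2 D2 := by
    refine (h2.orb D2 (fun k hk => ?_) kD2).2 ⟨x, fun k hk => ?_, fun j hj => ?_⟩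
    · rw [hD2, cf_add, h2.supp x k (by omega), cf_sg, if_neg (by omega), add_zero]
    · rw [hD2, cf_add, cf_sg, if_neg (by omega), add_zero]
    · rw [hD2, cf_add, h2.supp x _ le_rfl, cf_sg, if_pos rfl, zero_add, hr2, mul_sub, sub_mul,
        ← mul_assoc, ← mul_assoc, eb_mul_eJ hj, mul_assoc _ E2, eJ_mul_eb hj,
        hr j (Finset.mem_union_right _ hj), s.mom_right x hj, ← hbs, ← hc2, add_sub_cancel_right]
  obtain ⟨u1, hu1, w1⟩ := o1
  obtain ⟨u2, hu2, w2⟩ := o2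
  obtain ⟨a, ka, va, ha⟩ := s.exists_sylvester hu1 hu2 kp vp
  have haa : a * a = 0 := ka.mul_eq_zero ka s.e21
  have hbb : b * b = 0 := kb.mul_eq_zero kb s.e12
  obtain ⟨hu, hconj⟩ := CornerUnip.conj_eq_FS (u := oneAdd b hbb * (oneAdd a haa * (u1 * u2)))
    s.e11 s.e22 s.e12 s.e21 hu1 hu2 ka va kb vb (Blk_Tm q blk J1) (Blk_Tm q blk J2) rfl
  refine ⟨_, by rw [eJ_union s.disj]; exact hu, ?_⟩
  rw [Tm_union s.disj, hconj, ha]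
  have n2 := s.nrm (hu1.blk_conj s.e11 (Blk_Tm q blk J1)) (hu2.blk_conj s.e22 (Blk_Tm q blk J2))
    kp kb (Vge_conj_sub s.le_K1 hu1) (Vge_conj_sub s.le_K2 hu2) vp vb
  have := n.sub_FS n2 w1 w2 (by rw [sub_self]; exact fun k _ => rfl)
    (by rw [sub_self]; exact fun k _ => rfl)
  have := hYF.add this
  rwa [sub_add_sub_cancel] at this

theorem Split.isPara (s : Split q J1 J2 j0 K) (h1 : IsPara q blk J1 Ψ1) (h2 : IsPara q blk J2 Ψ2) :
    IsPara q blk (J1 ∪ J2) (PsiStep blk J1 J2 (K - 2) Ψ1 Ψ2) where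
  supp x k hk := by rw [PsiStep, cf_tr, if_neg (by omega)]
  corner x := by
    have n := s.nrmS h1 h2 x
    rw [eJ_union s.disj]
    exact (fs_blk s.e12 s.e21 s.e11 s.e22 n.hD1 n.hD2 n.hp n.hb).tr _
  rel S hE x x' := ⟨fun h => s.rel_mp h1 h2 hE h, fun h => s.rel_mpr h1 h2 h.1 h.2⟩
  orb Y _ hYB := ⟨fun h => s.orb_mp h1 h2 h, fun ⟨_, hx, hr⟩ => s.orb_mpr h1 h2 hYB hx hr⟩

end Blocks

section Blocks

variable {ι : Type} [Fintype ι] [DecidableEq ι]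

variable {m : ℕ} {q : Fin m → Polynomial ℂ} {blk : ι → Fin m}

theorem eJ_singleton (j : Fin m) : eJ blk {j} = eb blk j := by simp [eJ]

theorem CornerUnip.conj_scalar {e : Matrix ι ι ℂ} {u : (Matrix ι ι (LaurentSeries ℂ))ˣ}
    (h : CornerUnip e u) (f : LaurentSeries ℂ) :
    u.val * f • sg 0 e * u⁻¹.val = f • sg 0 e := by
  have h1 : u.val * sg 0 e = sg 0 e * u.val := by
    have a := h.2.1
    have b := h.2.2
    rw [mul_sub, mul_one] at a
    rw [sub_mul, one_mul] at b
    have := a.trans b.symm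
    rw [sub_left_inj] at this
    exact this.symm
  rw [mul_laurent_smul, h1, laurent_smul_mul, mul_assoc, Units.mul_inv, mul_one]

theorem isPara_singleton (hq0 : ∀ j, (q j).coeff 0 = 0) (hq1 : ∀ j, (q j).coeff 1 = 0)
    (j : Fin m) : IsPara q blk {j} (fun _ => Tm q blk {j}) := by
  have hc : ∀ k, -1 ≤ k → cf (Tm q blk {j}) k = 0 := by
    intro k hk
    rw [cf_Tm, Finset.sum_singleton]
    rcases lt_trichotomy k 0 with h | h | h
    · obtain rfl : k = -1 := by omega
      rw [show (-1 : ℤ) = -((1 : ℕ) : ℤ) by rfl, coeff_polyZinv_neg, hq1, zero_smul]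
    · rw [h, show (0 : ℤ) = -((0 : ℕ) : ℤ) by rfl, coeff_polyZinv_neg, hq0, zero_smul]
    · rw [coeff_polyZinv, if_neg (by omega), zero_smul]
  refine ⟨fun _ => hc, fun _ => Blk_Tm q blk _, ?_, ?_⟩
  · intro S hE x x'
    rw [eJ_singleton] at hE
    refine ⟨fun _ => ⟨fun j' hj' => ?_, fun a ha b hb hab => ?_⟩, fun _ k => ?_⟩
    · rw [Finset.mem_singleton] at hj'; subst hj'; exact hE
    · rw [Finset.mem_singleton] at ha hb
      exact absurd (ha.trans hb.symm) hab
    · rw [cf_Tm, Finset.sum_singleton]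
      exact S.smul_mem hE _
  · intro Y hY0 hYB
    have hm : ∀ x, mom q blk {j} x j = 0 := fun x => by
      rw [mom, Finset.sum_singleton, dq_self, Finset.sum_range_zero, smul_zero]
    have hT : Tm q blk {j} = polyZinv (q j) • sg 0 (eJ blk {j}) := by
      rw [Tm, Finset.sum_singleton, eJ_singleton]
    have hYc := hYB.cf (-1)
    rw [eJ_singleton] at hYc
    constructor
    · rintro ⟨u, hu, hv⟩
      rw [hT, hu.conj_scalar, ← hT] at hv
      have hv' : ∀ k < 0, cf Y k = cf (Tm q blk {j}) k := fun k hk => by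
        have := hv k hk
        rwa [cf_sub, sub_eq_zero] at this
      refine ⟨0, fun k hk => hv' k (by omega), fun j' hj' => ?_⟩
      rw [Finset.mem_singleton] at hj'; subst hj'
      rw [hm, hv' _ (by omega), hc _ le_rfl, mul_zero, zero_mul]
    · rintro ⟨x, h1, h2⟩
      refine ⟨1, ⟨⟨?_, ?_⟩, ?_⟩, ?_⟩
      · simp only [Units.val_one, sub_self]; exact Vge.zero
      · simp only [inv_one, Units.val_one, sub_self]; exact Vge.zero
      · simp only [Units.val_one, sub_self]; exact ⟨mul_zero _, zero_mul _⟩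
      · rw [inv_one, Units.val_one, one_mul, mul_one]
        intro k hk
        rw [cf_sub, sub_eq_zero]
        rcases eq_or_ne k (-1) with rfl | hk1
        · have := h2 j (Finset.mem_singleton_self j)
          rw [hc _ le_rfl, ← hm x, ← this, hYc.1, hYc.2]
        · exact h1 k (by omega)

theorem exists_split (hq0 : ∀ j, (q j).coeff 0 = 0) (hq1 : ∀ j, (q j).coeff 1 = 0)
    (hqd : ∀ j j', j ≠ j' → q j ≠ q j') {J : Finset (Fin m)} {a b : Fin m} (ha : a ∈ J)
    (hb : b ∈ J) (hab : a ≠ b) :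
    ∃ J1 J2 j0 K, Split q J1 J2 j0 K ∧ J1 ∪ J2 = J ∧ J1.Nonempty ∧ J2.Nonempty := by
  obtain ⟨⟨j0, j1⟩, hmem, hmax⟩ := Finset.exists_max_image (J ×ˢ J)
    (fun y => (q y.1 - q y.2).natDegree) ⟨(a, b), Finset.mk_mem_product ha hb⟩
  rw [Finset.mem_product] at hmem
  have hmax' : ∀ j ∈ J, ∀ j' ∈ J, (q j - q j').natDegree ≤ (q j0 - q j1).natDegree :=
    fun j hj j' hj' => hmax (j, j') (Finset.mk_mem_product hj hj')
  set K := (q j0 - q j1).natDegree with hK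
  have h2 : ∀ j j', j ≠ j' → 2 ≤ (q j - q j').natDegree := by
    intro j j' h
    by_contra! hlt
    apply sub_ne_zero.2 (hqd j j' h)
    have hz : (q j - q j').coeff (q j - q j').natDegree = 0 := by
      rw [Polynomial.coeff_sub]
      interval_cases (q j - q j').natDegree
      · rw [hq0, hq0, sub_zero]
      · rw [hq1, hq1, sub_zero]
    rwa [Polynomial.coeff_natDegree, Polynomial.leadingCoeff_eq_zero] at hz
  have hK2 : 2 ≤ K := (h2 a b hab).trans (hmax' a ha b hb)
  refine ⟨J.filter fun j => (q j).coeff K = (q j0).coeff K,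
    J.filter fun j => ¬ (q j).coeff K = (q j0).coeff K, j0, K, ⟨hK2, ?_, ?_, ?_, ?_⟩, ?_, ?_, ?_⟩
  · simp [hmem.1]
  · exact Finset.disjoint_filter_filter_not _ _ _
  · intro j hj
    rw [Finset.mem_filter] at hj
    have h1 := hmax' j hj.1 j0 hmem.1
    by_contra! hlt
    have e : (q j - q j0).natDegree = K := by omega
    have : (q j - q j0).leadingCoeff = 0 := by
      rw [Polynomial.leadingCoeff, e, Polynomial.coeff_sub, hj.2, sub_self]
    rw [Polynomial.leadingCoeff_eq_zero] at this
    rw [this, Polynomial.natDegree_zero] at e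
    omega
  · intro j hj j' hj'
    rw [Finset.mem_filter] at hj hj'
    refine le_antisymm (hmax' j hj.1 j' hj'.1) (Polynomial.le_natDegree_of_ne_zero ?_)
    rw [Polynomial.coeff_sub, hj.2, sub_ne_zero]
    exact Ne.symm hj'.2
  · exact Finset.filter_union_filter_not_eq _ _
  · exact ⟨j0, by simp [hmem.1]⟩
  · refine ⟨j1, Finset.mem_filter.2 ⟨hmem.2, fun h => ?_⟩⟩
    have : (q j0 - q j1).leadingCoeff = 0 := by
      rw [Polynomial.leadingCoeff, ← hK, Polynomial.coeff_sub, h, sub_self]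
    rw [Polynomial.leadingCoeff_eq_zero] at this
    rw [this, Polynomial.natDegree_zero] at hK
    omega

theorem exists_isPara (hq0 : ∀ j, (q j).coeff 0 = 0) (hq1 : ∀ j, (q j).coeff 1 = 0)
    (hqd : ∀ j j', j ≠ j' → q j ≠ q j') (J : Finset (Fin m)) (hJ : J.Nonempty) :
    ∃ Ψ, IsPara q blk J Ψ := by
  induction J using Finset.strongInduction with
  | H J ih =>
    rcases hJ.exists_eq_singleton_or_nontrivial with ⟨j, rfl⟩ | ⟨a, ha, b, hb, hab⟩
    · exact ⟨_, isPara_singleton hq0 hq1 j⟩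
    · obtain ⟨J1, J2, j0, K, s, rfl, h1, h2⟩ := exists_split hq0 hq1 hqd ha hb hab
      obtain ⟨Ψ1, H1⟩ := ih J1 (Finset.ssubset_iff_subset_ne.2 ⟨Finset.subset_union_left, fun h => by
        obtain ⟨c, hc⟩ := h2
        exact Finset.disjoint_left.1 s.disj (h ▸ Finset.mem_union_right _ hc) hc⟩) h1
      obtain ⟨Ψ2, H2⟩ := ih J2 (Finset.ssubset_iff_subset_ne.2 ⟨Finset.subset_union_right, fun h => by
        obtain ⟨c, hc⟩ := h1
        exact Finset.disjoint_left.1 s.disj hc (h ▸ Finset.mem_union_left _ hc)⟩) h2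
      exact ⟨_, s.isPara H1 H2⟩

end Blocks

section Cong

variable {ι κ ν : Type} [Fintype ι] [DecidableEq ι] [Fintype κ] [DecidableEq κ] [Fintype ν]
  [DecidableEq ν]

theorem cf_mul_zero {f : Matrix ι κ (LaurentSeries ℂ)} {g : Matrix κ ν (LaurentSeries ℂ)}
    (hf : Vge 0 f) (hg : Vge 0 g) : cf (f * g) 0 = cf f 0 * cf g 0 := by
  rw [cf_mul hf hg]; simp

theorem cf_one_zero : cf (1 : Matrix ι ι (LaurentSeries ℂ)) 0 = 1 := by
  rw [← sg_zero_one, cf_sg, if_pos rfl]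

theorem Vge.conj' {f : Matrix ι κ (LaurentSeries ℂ)} {g : Matrix κ κ (LaurentSeries ℂ)}
    {h : Matrix κ ν (LaurentSeries ℂ)} (hf : Vge 0 f) (hg : Vge 0 g) (hh : Vge 0 h) :
    Vge 0 (f * g * h) := by
  have := (hf.mul hg).mul hh
  simpa using this

/-- `A` is congruent modulo power series to a conjugate of `B` by an invertible matrix of power
series. -/
def Cong (A : Matrix κ κ (LaurentSeries ℂ)) (B : Matrix ι ι (LaurentSeries ℂ)) : Prop :=
  ∃ (G : Matrix κ ι (LaurentSeries ℂ)) (G' : Matrix ι κ (LaurentSeries ℂ)),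
    Vge 0 G ∧ Vge 0 G' ∧ G * G' = 1 ∧ G' * G = 1 ∧ Vge 0 (A - G * B * G')

theorem Cong.trans {A : Matrix κ κ (LaurentSeries ℂ)} {B : Matrix ι ι (LaurentSeries ℂ)}
    {C : Matrix ν ν (LaurentSeries ℂ)} (h : Cong A B) (h' : Cong B C) : Cong A C := by
  obtain ⟨G, G', g, g', e, e', v⟩ := h
  obtain ⟨H, H', k, k', f, f', w⟩ := h'
  refine ⟨G * H, H' * G', by simpa using g.mul k, by simpa using k'.mul g', ?_, ?_, ?_⟩
  · rw [Matrix.mul_assoc, ← Matrix.mul_assoc H, f, Matrix.one_mul, e]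
  · rw [Matrix.mul_assoc, ← Matrix.mul_assoc G', e', Matrix.one_mul, f']
  · have : A - G * H * C * (H' * G') = (A - G * B * G') + G * (B - H * C * H') * G' := by
      rw [Matrix.mul_sub, Matrix.sub_mul]
      simp only [Matrix.mul_assoc]
      abel
    rw [this]
    exact v.add (g.conj' w g')

/-- Conjugation by constant matrices. -/
theorem Cong.of_const {A : Matrix κ κ (LaurentSeries ℂ)} {B : Matrix ι ι (LaurentSeries ℂ)}
    {P : Matrix ι κ ℂ} {P' : Matrix κ ι ℂ} (h : P * P' = 1) (h' : P' * P = 1)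
    (e : Vge 0 (A - sg 0 P' * B * sg 0 P)) : Cong A B :=
  ⟨sg 0 P', sg 0 P, Vge.sg le_rfl _, Vge.sg le_rfl _,
    by rw [sg_mul_sg, h', add_zero, sg_zero_one], by rw [sg_mul_sg, h, add_zero, sg_zero_one], e⟩

variable {m : ℕ} {q : Fin m → Polynomial ℂ} {blk : ι → Fin m}
  {Ψ : (ℕ → Matrix ι ι ℂ) → Matrix ι ι (LaurentSeries ℂ)}

theorem IsPara.unip_iff (hΨ : IsPara q blk Finset.univ Ψ) {Y : Matrix ι ι (LaurentSeries ℂ)}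
    (hY : ∀ k, 0 ≤ k → cf Y k = 0) (R : Matrix ι ι ℂ) :
    (∃ u : (Matrix ι ι (LaurentSeries ℂ))ˣ, Unip u ∧
      Vge 0 (Y - u.val * (Tm q blk Finset.univ + sg (-1) R) * u⁻¹.val)) ↔
    ∃ x, (∀ k ≤ -2, cf Y k = cf (Ψ x) k) ∧ ∀ j, eb blk j * cf Y (-1) * eb blk j =
      mom q blk Finset.univ x j + eb blk j * R * eb blk j := by
  have h1 : ∀ f : Matrix ι ι (LaurentSeries ℂ), Blk (eJ blk Finset.univ) (eJ blk Finset.univ) f := by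
    intro f
    rw [eJ_univ]
    exact ⟨by rw [sg_zero_one, one_mul], by rw [sg_zero_one, mul_one]⟩
  have key := hΨ.orb (Y - sg (-1) R)
    (fun k hk => by rw [cf_sub, hY k hk, cf_sg, if_neg (by omega), sub_zero]) (h1 _)
  have hl : InOrb q blk Finset.univ (Y - sg (-1) R) ↔
      ∃ u : (Matrix ι ι (LaurentSeries ℂ))ˣ, Unip u ∧
        Vge 0 (Y - u.val * (Tm q blk Finset.univ + sg (-1) R) * u⁻¹.val) := by
    refine exists_congr fun u => ?_
    rw [CornerUnip, and_iff_left (h1 _)]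
    refine and_congr_right fun hu => ?_
    have hs : Vge 0 (u.val * sg (-1) R * u⁻¹.val - sg (-1) R) := by
      have e : u.val * sg (-1) R * u⁻¹.val - sg (-1) R =
          (u.val - 1) * sg (-1) R * u⁻¹.val + sg (-1) R * (u⁻¹.val - 1) := by
        rw [sub_mul, sub_mul, mul_sub, one_mul, mul_one]; abel
      rw [e]
      exact (((hu.1.mul (Vge.sg (le_refl (-1)) R)).mul hu.vge_inv).mono (by omega)).add
        (((Vge.sg (le_refl (-1)) R).mul hu.2).mono (by omega))
    have e : Y - u.val * (Tm q blk Finset.univ + sg (-1) R) * u⁻¹.val =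
        (Y - sg (-1) R - u.val * Tm q blk Finset.univ * u⁻¹.val) -
          (u.val * sg (-1) R * u⁻¹.val - sg (-1) R) := by
      rw [mul_add, add_mul]; abel
    rw [e]
    exact ⟨fun h => h.sub hs, fun h => by simpa using h.add hs⟩
  rw [← hl, key]
  refine exists_congr fun x => and_congr ?_ ?_
  · refine forall₂_congr fun k hk => ?_
    rw [cf_sub, cf_sg, if_neg (by omega), sub_zero]
  · simp only [Finset.mem_univ, true_implies]
    refine forall_congr' fun j => ?_
    rw [cf_sub, cf_sg, if_pos rfl, mul_sub, sub_mul, sub_eq_iff_eq_add]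

theorem cf_conj_sg (P : Matrix ι κ ℂ) (A : Matrix κ κ (LaurentSeries ℂ)) (P' : Matrix κ ι ℂ)
    (k : ℤ) : cf (sg 0 P * A * sg 0 P') k = P * cf A k * P' := by
  rw [cf_mul_sg, sub_zero, cf_sg_mul, sub_zero]

theorem sg_conj_cancel {P : Matrix ι κ ℂ} {P' : Matrix κ ι ℂ} (h : P' * P = 1)
    (f : Matrix κ ν (LaurentSeries ℂ)) : sg 0 P' * (sg 0 P * f) = f := by
  rw [← Matrix.mul_assoc, sg_mul_sg, h, add_zero, sg_zero_one, Matrix.one_mul]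

theorem sg_conj_cancel_right {P : Matrix ι κ ℂ} {P' : Matrix κ ι ℂ} (h : P' * P = 1)
    (f : Matrix ν κ (LaurentSeries ℂ)) : f * sg 0 P' * sg 0 P = f := by
  rw [Matrix.mul_assoc, sg_mul_sg, h, add_zero, sg_zero_one, Matrix.mul_one]

/-- Description of the truncated orbit in terms of frames and off-diagonal blocks. -/
theorem IsPara.cong_iff (hΨ : IsPara q blk Finset.univ Ψ) {A : Matrix κ κ (LaurentSeries ℂ)}
    (hA : ∀ k, 0 ≤ k → cf A k = 0) (R : Matrix ι ι ℂ) :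
    Cong A (Tm q blk Finset.univ + sg (-1) R) ↔
    ∃ (P : Matrix ι κ ℂ) (P' : Matrix κ ι ℂ), P * P' = 1 ∧ P' * P = 1 ∧
      ∃ x, (∀ k ≤ -2, P * cf A k * P' = cf (Ψ x) k) ∧
        ∀ j, eb blk j * (P * cf A (-1) * P') * eb blk j =
          mom q blk Finset.univ x j + eb blk j * R * eb blk j := by
  constructor
  · rintro ⟨G, G', g, g', e, e', v⟩
    set P' := cf G 0 with hP'
    set P := cf G' 0 with hP
    have p1 : P * P' = 1 := by rw [hP, hP', ← cf_mul_zero g' g, e', cf_one_zero]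
    have p2 : P' * P = 1 := by rw [hP, hP', ← cf_mul_zero g g', e, cf_one_zero]
    refine ⟨P, P', p1, p2, ?_⟩
    have := hΨ.unip_iff (Y := sg 0 P * A * sg 0 P')
      (fun k hk => by rw [cf_conj_sg, hA k hk, Matrix.mul_zero, Matrix.zero_mul]) R
    simp only [cf_conj_sg] at this
    refine this.1 ?_
    obtain ⟨u, hu, hu1⟩ := exists_unip (f := sg 0 P * G) (Vge_one_iff.2
      ⟨by simpa using (Vge.sg le_rfl P).mul g, by rw [cf_sg_mul, sub_zero, ← hP', p1]⟩)
    have hui : u⁻¹.val = G' * sg 0 P' := by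
      have : u.val * (G' * sg 0 P') = 1 := by
        rw [hu, Matrix.mul_assoc, ← Matrix.mul_assoc G, e, Matrix.one_mul, sg_mul_sg, p1, add_zero,
          sg_zero_one]
      exact Units.inv_eq_of_mul_eq_one_right this
    refine ⟨u, hu1, ?_⟩
    have : sg 0 P * A * sg 0 P' - u.val * (Tm q blk Finset.univ + sg (-1) R) * u⁻¹.val =
        sg 0 P * (A - G * (Tm q blk Finset.univ + sg (-1) R) * G') * sg 0 P' := by
      rw [hu, hui, Matrix.mul_sub, Matrix.sub_mul]
      simp only [Matrix.mul_assoc]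
    rw [this]
    exact (Vge.sg le_rfl P).conj' v (Vge.sg le_rfl P')
  · rintro ⟨P, P', p1, p2, x, h1, h2⟩
    obtain ⟨u, hu, v⟩ := (hΨ.unip_iff (Y := sg 0 P * A * sg 0 P')
      (fun k hk => by rw [cf_conj_sg, hA k hk, Matrix.mul_zero, Matrix.zero_mul]) R).2
      ⟨x, by simpa only [cf_conj_sg] using h1, by simpa only [cf_conj_sg] using h2⟩
    have c1 : Cong A (sg 0 P * A * sg 0 P') := by
      refine Cong.of_const p1 p2 ?_
      rw [Matrix.mul_assoc, sg_conj_cancel_right p2, sg_conj_cancel p2,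
        sub_self]
      exact Vge.zero
    exact c1.trans ⟨u.val, u⁻¹.val, hu.vge, hu.vge_inv, Units.mul_inv u, Units.inv_mul u, v⟩

/-- Replacing the residue by a conjugate under a block diagonal matrix. -/
theorem cong_conj_residue {h h' R R' : Matrix ι ι ℂ} (h1 : h * h' = 1)
    (hc : ∀ j, h * eb blk j = eb blk j * h) (hR : h * R = R' * h) :
    Cong (Tm q blk Finset.univ + sg (-1) R') (Tm q blk Finset.univ + sg (-1) R) := by
  have h2 : h' * h = 1 := _root_.mul_eq_one_comm.1 h1
  refine Cong.of_const h2 h1 ?_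
  have hT : sg 0 h * Tm q blk Finset.univ = Tm q blk Finset.univ * sg 0 h := by
    unfold Tm
    rw [Finset.mul_sum, Finset.sum_mul]
    refine Finset.sum_congr rfl fun j _ => ?_
    rw [mul_laurent_smul, laurent_smul_mul, sg_mul_sg, sg_mul_sg, hc]
  rw [mul_add, hT, sg_mul_sg, hR, add_mul, mul_assoc, sg_mul_sg, sg_mul_sg, h1, add_zero,
    sg_zero_one, mul_one, zero_add, add_zero, mul_assoc, h1, mul_one, sub_self]
  exact Vge.zero

end Cong

namespace ConnData

variable (D : ConnData)

/-- The index set of the standard frame at a point. -/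
abbrev Idx (i : Fin (D.p+1)) := Σ j : Fin (D.m i), Fin (D.nb i j)

/-- The block of a basis index. -/
abbrev blk (i : Fin (D.p+1)) : D.Idx i → Fin (D.m i) := Sigma.fst

/-- The normal form on the standard index set. -/
def normalForm (i : Fin (D.p+1)) : Matrix (D.Idx i) (D.Idx i) (LaurentSeries ℂ) :=
  Tm (D.q i) (D.blk i) Finset.univ + sg (-1) (Matrix.blockDiagonal' (D.R i))

theorem cf_Tm_apply {ι : Type} [Fintype ι] [DecidableEq ι] {m : ℕ} (q : Fin m → Polynomial ℂ)
    (blk : ι → Fin m) (k : ℤ) (a b : ι) : cf (Tm q blk Finset.univ) k a b =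
      if a = b then (polyZinv (q (blk a))).coeff k else 0 := by
  rw [cf_Tm, Matrix.sum_apply]
  simp only [Matrix.smul_apply, eb, Matrix.diagonal_apply, smul_eq_mul]
  split_ifs with h
  · simp
  · simp

theorem BmatAt_eq (i : Fin (D.p+1)) :
    D.BmatAt i = (D.normalForm i).submatrix (D.sigmaEquiv i).symm (D.sigmaEquiv i).symm := by
  unfold BmatAt
  rw [Matrix.reindex_apply]
  congr 1
  apply cf_ext
  intro k
  ext a b
  rw [normalForm, cf_add, cf_sg, Matrix.add_apply, cf_Tm_apply]
  obtain ⟨j, a⟩ := a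
  obtain ⟨j', b⟩ := b
  change (Matrix.blockDiagonal' (fun j => Matrix.of fun a b =>
    (if a = b then polyZinv (D.q i j) else 0) + HahnSeries.single (-1 : ℤ) (D.R i j a b))
      ⟨j, a⟩ ⟨j', b⟩).coeff k = _
  by_cases h : j = j'
  · subst h
    have h1 : ((⟨j, a⟩ : D.Idx i) = ⟨j, b⟩) = (a = b) := by simp
    rw [Matrix.blockDiagonal'_apply_eq, Matrix.of_apply, HahnSeries.coeff_add, HahnSeries.coeff_single]
    simp only [h1]
    congr 1
    · split_ifs <;> simp
    · split_ifs <;> simp [Matrix.blockDiagonal'_apply_eq]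
  · rw [Matrix.blockDiagonal'_apply_ne _ _ _ h, if_neg (by rintro ⟨⟩; exact h rfl)]
    split_ifs <;> simp [Matrix.blockDiagonal'_apply_ne _ _ _ h]

theorem tame_iff_Vge {ι : Type} {f : Matrix ι ι (LaurentSeries ℂ)} :
    (∀ a b, Tame (f a b)) ↔ Vge 0 f :=
  ⟨fun h k hk => by ext a b; exact h a b k hk, fun h a b k hk => congrFun (congrFun (h k hk) a) b⟩

theorem isPrincipal_iff_cf {ι : Type} {f : Matrix ι ι (LaurentSeries ℂ)} :
    (∀ a b, IsPrincipal (f a b)) ↔ ∀ k : ℤ, 0 ≤ k → cf f k = 0 :=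
  ⟨fun h k hk => by ext a b; exact h a b k hk, fun h a b k hk => congrFun (congrFun (h k hk) a) b⟩

/-- Membership in the truncated orbit as a congruence. -/
theorem orbit_iff_cong (i : Fin (D.p+1)) (A : Matrix (Fin D.n) (Fin D.n) (LaurentSeries ℂ)) :
    (∃ X : GLps D.n, ∀ a b, Tame ((A - conjPS X (D.BmatAt i)) a b)) ↔
      Cong A (D.normalForm i) := by
  simp only [tame_iff_Vge]
  set s := D.sigmaEquiv i
  constructor
  · rintro ⟨X, hX⟩
    refine ⟨(glMap X).val.submatrix id s, ((glMap X)⁻¹).val.submatrix s id, ?_, ?_, ?_, ?_, ?_⟩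
    · intro k hk
      have := Vge_mapMatrix X.val k hk
      ext a b
      exact congrFun (congrFun this a) (s b)
    · intro k hk
      have := Vge_mapMatrix (X⁻¹).val k hk
      ext a b
      exact congrFun (congrFun this (s a)) b
    · rw [Matrix.submatrix_mul_equiv _ _ id s id, Units.mul_inv, Matrix.submatrix_id_id]
    · rw [← Matrix.submatrix_mul _ _ s id s Function.bijective_id, Units.inv_mul,
        Matrix.submatrix_one_equiv]
    · rw [conjPS, BmatAt_eq] at hX
      convert hX using 2
      have e : D.normalForm i = ((D.normalForm i).submatrix s.symm s.symm).submatrix s s := by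
        ext a b; simp
      conv_lhs => rw [e]
      rw [Matrix.submatrix_mul_equiv _ _ id s s, Matrix.submatrix_mul_equiv _ _ id s id]
      rfl
  · rintro ⟨G, G', g, g', e, e', v⟩
    have hu : (G.submatrix id s.symm) * (G'.submatrix s.symm id) = 1 := by
      rw [Matrix.submatrix_mul_equiv _ _ id s.symm id, e, Matrix.submatrix_id_id]
    have hg : Vge 0 (G.submatrix id s.symm) := fun k hk => by
      ext a b
      exact congrFun (congrFun (g k hk) a) (s.symm b)
    have hg' : Vge 0 (G'.submatrix s.symm id) := fun k hk => by
      ext a b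
      exact congrFun (congrFun (g' k hk) (s.symm a)) b
    obtain ⟨X, hX⟩ := exists_unit_of_cf_zero hg
      (IsUnit.of_mul_eq_one (cf (G'.submatrix s.symm id) 0)
        (by rw [← cf_mul_zero hg hg', hu, cf_one_zero]))
    refine ⟨X, ?_⟩
    have h1 : (glMap X).val = G.submatrix id s.symm := hX
    have h2 : ((glMap X)⁻¹).val = G'.submatrix s.symm id :=
      Units.inv_eq_of_mul_eq_one_right (by rw [h1, hu])
    rw [conjPS, BmatAt_eq, h1, h2, Matrix.submatrix_mul_equiv _ _ id s.symm s.symm,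
      Matrix.submatrix_mul_equiv _ _ id s.symm id]
    exact v

end ConnData

section Extension

open Module

/-- Extending an isomorphism along an injection and a surjection. -/
theorem exists_equiv_extension {U U' E E' : Type} [AddCommGroup U] [Module ℂ U] [AddCommGroup U']
    [Module ℂ U'] [AddCommGroup E] [Module ℂ E] [AddCommGroup E'] [Module ℂ E']
    [FiniteDimensional ℂ E] [FiniteDimensional ℂ E'] (a : U →ₗ[ℂ] E) (b : E →ₗ[ℂ] U)
    (a' : U' →ₗ[ℂ] E') (b' : E' →ₗ[ℂ] U') (ha : Function.Injective a) (hb : Function.Surjective b)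
    (ha' : Function.Injective a') (hb' : Function.Surjective b') (g1 : U ≃ₗ[ℂ] U')
    (hc : ∀ u, g1 (b (a u)) = b' (a' (g1 u))) (hd : finrank ℂ E = finrank ℂ E') :
    ∃ g : E ≃ₗ[ℂ] E', (∀ u, g (a u) = a' (g1 u)) ∧ ∀ e, b' (g e) = g1 (b e) := by
  obtain ⟨s, hs⟩ := b'.exists_rightInverse_of_surjective (LinearMap.range_eq_top.2 hb')
  obtain ⟨r, hr⟩ := a.exists_leftInverse_of_injective (LinearMap.ker_eq_bot.2 ha)
  have hs' : ∀ u, b' (s u) = u := fun u => LinearMap.congr_fun hs u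
  have hr' : ∀ u, r (a u) = u := fun u => LinearMap.congr_fun hr u
  set h : E →ₗ[ℂ] E' := s ∘ₗ g1.toLinearMap ∘ₗ b +
    (a' ∘ₗ g1.toLinearMap - s ∘ₗ g1.toLinearMap ∘ₗ b ∘ₗ a) ∘ₗ r with hh
  have h_a : ∀ u, h (a u) = a' (g1 u) := fun u => by simp [hh, hr']
  have h_b : ∀ e, b' (h e) = g1 (b e) := fun e => by simp [hh, hs', hc]
  clear_value h
  set K := LinearMap.ker b
  set K' := LinearMap.ker b'
  set D := K ⊓ LinearMap.range a
  have hK : finrank ℂ K = finrank ℂ K' := by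
    have e1 := b.finrank_range_add_finrank_ker
    have e2 := b'.finrank_range_add_finrank_ker
    change _ + finrank ℂ K = _ at e1
    change _ + finrank ℂ K' = _ at e2
    rw [LinearMap.range_eq_top.2 hb, finrank_top] at e1
    rw [LinearMap.range_eq_top.2 hb', finrank_top, ← g1.finrank_eq] at e2
    omega
  have hhK : D.map h ≤ K' := by
    rintro _ ⟨x, hx, rfl⟩
    rw [LinearMap.mem_ker, h_b, LinearMap.mem_ker.1 hx.1, map_zero]
  have hinj : ∀ x ∈ D, h x = 0 → x = 0 := by
    rintro x ⟨-, u, rfl⟩ h0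
    rw [h_a] at h0
    rw [g1.map_eq_zero_iff.1 ((map_eq_zero_iff a' ha').1 h0), map_zero]
  have hDfin : finrank ℂ (D.map h) = finrank ℂ D := by
    have hi : Function.Injective (h.domRestrict D) := by
      rw [← LinearMap.ker_eq_bot, LinearMap.ker_eq_bot']
      exact fun x hx => Subtype.ext (hinj x x.2 hx)
    rw [← LinearMap.finrank_range_of_inj hi, LinearMap.range_domRestrict]
  have relc : ∀ {F : Type} [AddCommGroup F] [Module ℂ F] [FiniteDimensional ℂ F]
      (A B : Submodule ℂ F), A ≤ B → ∃ C, C ≤ B ∧ Disjoint A C ∧ A ⊔ C = B ∧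
        finrank ℂ A + finrank ℂ C = finrank ℂ B := by
    intro F _ _ _ A B hAB
    obtain ⟨C0, hC0⟩ := A.exists_isCompl
    have h1 : Disjoint A (C0 ⊓ B) := hC0.disjoint.mono_right inf_le_left
    have h2 : A ⊔ C0 ⊓ B = B := by rw [← sup_inf_assoc_of_le C0 hAB, hC0.sup_eq_top, top_inf_eq]
    refine ⟨C0 ⊓ B, inf_le_right, h1, h2, ?_⟩
    have := Submodule.finrank_sup_add_finrank_inf_eq A (C0 ⊓ B)
    rw [h2, h1.eq_bot, finrank_bot] at this
    omega
  obtain ⟨C, hCK, hDC, hDCK, hCf⟩ := relc D K inf_le_left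
  obtain ⟨C', hCK', hDC', -, hCf'⟩ := relc (D.map h) K' hhK
  have γ : C ≃ₗ[ℂ] C' := LinearEquiv.ofFinrankEq _ _ (by omega)
  have hCI : Disjoint C (LinearMap.range a) := by
    rw [Submodule.disjoint_def]
    intro x hx hx'
    exact Submodule.disjoint_def.1 hDC x ⟨hCK hx, hx'⟩ hx
  obtain ⟨T, hT1, hT2⟩ := hCI.symm.exists_isCompl
  set π := C.projectionOnto T hT2.symm
  set κ : E →ₗ[ℂ] E' := (C'.subtype ∘ₗ γ.toLinearMap - h ∘ₗ C.subtype) ∘ₗ π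
  have hκT : ∀ x ∈ T, κ x = 0 := fun x hx => by
    have : π x = 0 := (Submodule.projectionOnto_apply_eq_zero_iff _).2 hx
    simp [κ, this]
  have hκC : ∀ x : C, κ x = γ x - h x := fun x => by
    have : π x = x := Submodule.projectionOnto_apply_left _ x
    simp [κ, this]
  have hκb : ∀ x, b' (κ x) = 0 := fun x => by
    have h1 : b' (γ (π x) : E') = 0 := LinearMap.mem_ker.1 (hCK' (γ (π x)).2)
    have h2 : b (π x : E) = 0 := LinearMap.mem_ker.1 (hCK (π x).2)
    simp [κ, h1, h2, h_b]
  have hb_g : ∀ x, b' ((h + κ) x) = g1 (b x) := fun x => by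
    rw [LinearMap.add_apply, map_add, hκb, add_zero, h_b]
  have hg : Function.Injective (h + κ) := by
    rw [← LinearMap.ker_eq_bot, LinearMap.ker_eq_bot']
    intro x hx
    have hxK : x ∈ K := by
      have := hb_g x
      rw [hx, map_zero] at this
      exact LinearMap.mem_ker.2 (g1.map_eq_zero_iff.1 this.symm)
    rw [← hDCK] at hxK
    obtain ⟨d, hdD, c, hcC, rfl⟩ := Submodule.mem_sup.1 hxK
    have e1 : (h + κ) (d + c) = h d + γ ⟨c, hcC⟩ := by
      rw [LinearMap.add_apply, map_add, map_add, hκT d (hT1 hdD.2), hκC ⟨c, hcC⟩]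
      simp
    rw [e1] at hx
    have e2 : h d = 0 := by
      refine Submodule.disjoint_def.1 hDC' _ ⟨d, hdD, rfl⟩ ?_
      rw [eq_neg_of_add_eq_zero_left hx]
      exact C'.neg_mem (γ ⟨c, hcC⟩).2
    rw [e2, zero_add] at hx
    have e3 : (⟨c, hcC⟩ : C) = 0 := γ.map_eq_zero_iff.1 (Subtype.ext hx)
    rw [hinj d hdD e2, show c = 0 from congrArg Subtype.val e3, add_zero]
  refine ⟨LinearMap.linearEquivOfInjective _ hg hd, fun u => ?_, fun x => hb_g x⟩
  rw [LinearMap.linearEquivOfInjective_apply, LinearMap.add_apply, h_a,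
    hκT _ (hT1 ⟨u, rfl⟩), add_zero]

/-- The annihilating polynomials `∏_{l<k} (X - ξ_l)`. -/
def rootProd (ξ : ℕ → ℂ) (k : ℕ) : Polynomial ℂ :=
  ∏ l ∈ Finset.range k, (Polynomial.X - Polynomial.C (ξ l))

theorem rootProd_succ (ξ : ℕ → ℂ) (k : ℕ) :
    rootProd ξ (k+1) = rootProd ξ k * (Polynomial.X - Polynomial.C (ξ k)) :=
  Finset.prod_range_succ _ _

theorem rootProd_succ' (ξ : ℕ → ℂ) (k : ℕ) :
    rootProd ξ (k+1) = rootProd (fun l => ξ (l+1)) k * (Polynomial.X - Polynomial.C (ξ 0)) :=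
  Finset.prod_range_succ' _ _

open Polynomial in
/-- Endomorphisms annihilated by the same polynomial with the same ranks are conjugate. -/
theorem exists_conj_of_finrank (e : ℕ) : ∀ (ξ : ℕ → ℂ) {E E' : Type} [AddCommGroup E] [Module ℂ E]
    [AddCommGroup E'] [Module ℂ E'] [FiniteDimensional ℂ E] [FiniteDimensional ℂ E']
    (N : Module.End ℂ E) (N' : Module.End ℂ E'),
    (∀ k ≤ e, finrank ℂ (LinearMap.range (aeval N (rootProd ξ k))) =
      finrank ℂ (LinearMap.range (aeval N' (rootProd ξ k)))) →
    aeval N (rootProd ξ e) = 0 → aeval N' (rootProd ξ e) = 0 →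
    ∃ g : E ≃ₗ[ℂ] E', ∀ v, g (N v) = N' (g v) := by
  have hE : ∀ (ξ : ℕ → ℂ) {E : Type} [AddCommGroup E] [Module ℂ E] (N : Module.End ℂ E),
      finrank ℂ (LinearMap.range (aeval N (rootProd ξ 0))) = finrank ℂ E := by
    intro ξ E _ _ N
    rw [show rootProd ξ 0 = 1 from Finset.prod_range_zero _, map_one, Module.End.one_eq_id,
      LinearMap.range_id, finrank_top]
  induction e with
  | zero =>
    intro ξ E E' _ _ _ _ _ _ N N' hr h0 h0'
    have hd := hr 0 le_rfl
    rw [hE, hE] at hd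
    refine ⟨LinearEquiv.ofFinrankEq _ _ hd, fun v => ?_⟩
    have : ∀ w : E', w = 0 := fun w => by
      rw [show rootProd ξ 0 = 1 from Finset.prod_range_zero _, map_one] at h0'
      exact LinearMap.congr_fun h0' w
    exact (this _).trans (this _).symm
  | succ e ih =>
    intro ξ E E' _ _ _ _ _ _ N N' hr h0 h0'
    have hd := hr 0 (by omega)
    rw [hE, hE] at hd
    have key : ∀ {E : Type} [AddCommGroup E] [Module ℂ E] [FiniteDimensional ℂ E]
        (N : Module.End ℂ E), ∃ N1 : Module.End ℂ (LinearMap.range (N - algebraMap ℂ _ (ξ 0))),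
        (∀ u, (LinearMap.rangeRestrict (N - algebraMap ℂ (Module.End ℂ E) (ξ 0))) u.1 =
          N1 u - ξ 0 • u) ∧
        ∀ k, finrank ℂ (LinearMap.range (aeval N1 (rootProd (fun l => ξ (l+1)) k))) =
          finrank ℂ (LinearMap.range (aeval N (rootProd ξ (k+1)))) ∧
          (aeval N (rootProd ξ (k+1)) = 0 → aeval N1 (rootProd (fun l => ξ (l+1)) k) = 0) := by
      intro E _ _ _ N
      set T := N - algebraMap ℂ (Module.End ℂ E) (ξ 0)
      set N1 : Module.End ℂ (LinearMap.range T) :=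
        T.rangeRestrict ∘ₗ (LinearMap.range T).subtype + algebraMap ℂ _ (ξ 0)
      have hN1 : ∀ u, ((N1 u : LinearMap.range T) : E) = N u := fun u => by
        simp [N1, T, Module.algebraMap_end_apply]
      have hp : ∀ (p : ℂ[X]) u, ((aeval N1 p u : LinearMap.range T) : E) = aeval N p u := by
        intro p
        induction p using Polynomial.induction_on' with
        | add p q hp hq => intro u; simp [hp, hq]
        | monomial n c =>
          intro u
          rw [aeval_monomial, aeval_monomial]
          simp only [Module.End.mul_apply, Module.algebraMap_end_apply, Submodule.coe_smul]
          congr 1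
          induction n with
          | zero => simp
          | succ n ih => rw [pow_succ', pow_succ', Module.End.mul_apply, Module.End.mul_apply,
              hN1, ih]
      have hT : ∀ k v, aeval N (rootProd ξ (k+1)) v =
          aeval N1 (rootProd (fun l => ξ (l+1)) k) (T.rangeRestrict v) := fun k v => by
        rw [hp, rootProd_succ', map_mul, Module.End.mul_apply, map_sub, aeval_X, aeval_C]
        rfl
      refine ⟨N1, fun u => ?_, fun k => ⟨?_, fun h => ?_⟩⟩
      · simp only [N1, LinearMap.add_apply, Module.algebraMap_end_apply, add_sub_cancel_right]
        rfl
      · rw [← LinearMap.finrank_range_of_inj (f := (LinearMap.range T).subtype ∘ₗ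
          (LinearMap.range (aeval N1 (rootProd (fun l => ξ (l+1)) k))).subtype)
          ((Submodule.injective_subtype _).comp (Submodule.injective_subtype _))]
        have : LinearMap.range ((LinearMap.range T).subtype ∘ₗ
          (LinearMap.range (aeval N1 (rootProd (fun l => ξ (l+1)) k))).subtype) =
            LinearMap.range (aeval N (rootProd ξ (k+1))) := by
          apply le_antisymm
          · rintro _ ⟨⟨_, ⟨u, rfl⟩⟩, rfl⟩
            obtain ⟨v, hv⟩ := T.surjective_rangeRestrict u
            exact ⟨v, by rw [hT, hv]; rfl⟩
          · rintro _ ⟨v, rfl⟩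
            exact ⟨⟨_, ⟨T.rangeRestrict v, rfl⟩⟩, (hT k v).symm⟩
        rw [this]
      · ext u
        obtain ⟨v, rfl⟩ := T.surjective_rangeRestrict u
        rw [← hT, h]
        rfl
    obtain ⟨N1, hN1, hk⟩ := key N
    obtain ⟨N1', hN1', hk'⟩ := key N'
    obtain ⟨g1, hg1⟩ := ih (fun l => ξ (l+1)) N1 N1'
      (fun k hke => by rw [(hk k).1, (hk' k).1]; exact hr (k+1) (by omega))
      ((hk e).2 h0) ((hk' e).2 h0')
    obtain ⟨g, ga, gb⟩ := exists_equiv_extension (Submodule.subtype _)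
      (LinearMap.rangeRestrict (N - algebraMap ℂ (Module.End ℂ E) (ξ 0))) (Submodule.subtype _)
      (LinearMap.rangeRestrict (N' - algebraMap ℂ (Module.End ℂ E') (ξ 0)))
      (Submodule.injective_subtype _) (LinearMap.surjective_rangeRestrict _)
      (Submodule.injective_subtype _) (LinearMap.surjective_rangeRestrict _) g1
      (fun u => by
        rw [Submodule.subtype_apply, Submodule.subtype_apply, hN1, hN1', map_sub, hg1, map_smul]) hd
    refine ⟨g, fun v => ?_⟩
    have h1 := ga (LinearMap.rangeRestrict (N - algebraMap ℂ (Module.End ℂ E) (ξ 0)) v)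
    rw [← gb] at h1
    have h2 : g ((N - algebraMap ℂ (Module.End ℂ E) (ξ 0)) v) =
      (N' - algebraMap ℂ (Module.End ℂ E') (ξ 0)) (g v) := h1
    simpa [Module.algebraMap_end_apply] using h2

open Polynomial in
/-- Square matrices annihilated by the same polynomial with the same ranks are conjugate. -/
theorem exists_conj_of_rank {ι : Type} [Fintype ι] [DecidableEq ι] (e : ℕ) (ξ : ℕ → ℂ)
    (N N' : Matrix ι ι ℂ)
    (hr : ∀ k ≤ e, (aeval N (rootProd ξ k)).rank = (aeval N' (rootProd ξ k)).rank)
    (h0 : aeval N (rootProd ξ e) = 0) (h0' : aeval N' (rootProd ξ e) = 0) :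
    ∃ g g' : Matrix ι ι ℂ, g * g' = 1 ∧ g' * g = 1 ∧ g * N = N' * g := by
  have ha : ∀ (N : Matrix ι ι ℂ) p, aeval (Matrix.toLinAlgEquiv' N) p =
    Matrix.toLinAlgEquiv' (aeval N p) := fun N p => aeval_algHom_apply _ _ _
  obtain ⟨g, hg⟩ := exists_conj_of_finrank e ξ (Matrix.toLinAlgEquiv' N)
    (Matrix.toLinAlgEquiv' N') (fun k hk => by rw [ha, ha]; exact hr k hk)
    (by rw [ha, h0, map_zero]) (by rw [ha, h0', map_zero])
  refine ⟨LinearMap.toMatrixAlgEquiv' g.toLinearMap, LinearMap.toMatrixAlgEquiv' g.symm.toLinearMap,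
    ?_, ?_, ?_⟩
  · apply Matrix.toLinAlgEquiv'.injective
    rw [map_mul, Matrix.toLinAlgEquiv'_toMatrixAlgEquiv', Matrix.toLinAlgEquiv'_toMatrixAlgEquiv',
      map_one]
    exact LinearMap.ext fun v => g.apply_symm_apply v
  · apply Matrix.toLinAlgEquiv'.injective
    rw [map_mul, Matrix.toLinAlgEquiv'_toMatrixAlgEquiv', Matrix.toLinAlgEquiv'_toMatrixAlgEquiv',
      map_one]
    exact LinearMap.ext fun v => g.symm_apply_apply v
  · apply Matrix.toLinAlgEquiv'.injective
    rw [map_mul, map_mul, Matrix.toLinAlgEquiv'_toMatrixAlgEquiv']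
    exact LinearMap.ext hg

end Extension

section RankFactorization

/-- Rank factorization of a matrix. -/
theorem exists_rank_factorization {β ν : Type} [Fintype β] [DecidableEq β] [Fintype ν]
    [DecidableEq ν] (M : Matrix β β ℂ) (h : M.rank = Fintype.card ν) :
    ∃ (A : Matrix β ν ℂ) (B : Matrix ν β ℂ) (L : Matrix ν β ℂ) (T : Matrix β ν ℂ),
      A * B = M ∧ L * A = 1 ∧ B * T = 1 := by
  have hd : Module.finrank ℂ (ν → ℂ) = Module.finrank ℂ (LinearMap.range M.mulVecLin) := by
    rw [Module.finrank_fintype_fun_eq_card, ← h]; rfl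
  have φ : (ν → ℂ) ≃ₗ[ℂ] LinearMap.range M.mulVecLin := LinearEquiv.ofFinrankEq _ _ hd
  set A := (LinearMap.range M.mulVecLin).subtype ∘ₗ φ.toLinearMap with hA
  set B := φ.symm.toLinearMap ∘ₗ M.mulVecLin.rangeRestrict with hB
  obtain ⟨L, hL⟩ := A.exists_leftInverse_of_injective (LinearMap.ker_eq_bot.2
    ((Submodule.injective_subtype _).comp φ.injective))
  obtain ⟨T, hT⟩ := B.exists_rightInverse_of_surjective (LinearMap.range_eq_top.2
    (φ.symm.surjective.comp (LinearMap.surjective_rangeRestrict _)))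
  refine ⟨LinearMap.toMatrix' A, LinearMap.toMatrix' B, LinearMap.toMatrix' L,
    LinearMap.toMatrix' T, ?_, ?_, ?_⟩
  · rw [← LinearMap.toMatrix'_comp]
    apply Matrix.toLin'.injective
    rw [Matrix.toLin'_toMatrix']
    refine LinearMap.ext fun v => ?_
    simp [hA, hB]
  · rw [← LinearMap.toMatrix'_comp, hL, LinearMap.toMatrix'_id]
  · rw [← LinearMap.toMatrix'_comp, hT, LinearMap.toMatrix'_id]

end RankFactorization

/-- A representation of a doubled leg attached to a base space. -/
structure Leg (β : Type) (V : ℕ → Type) where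
  a0 : Matrix β (V 0) ℂ
  b0 : Matrix (V 0) β ℂ
  a : ∀ k, Matrix (V k) (V (k+1)) ℂ
  b : ∀ k, Matrix (V (k+1)) (V k) ℂ

namespace Leg

variable {β : Type} {V : ℕ → Type} [Fintype β] [DecidableEq β] [∀ k, Fintype (V k)]
  [∀ k, DecidableEq (V k)]

/-- The moment map equations along a leg. -/
structure IsMom (l : Leg β V) (ξ : ℕ → ℂ) : Prop where
  zero : l.a 0 * l.b 0 - l.b0 * l.a0 = (ξ 0 - ξ 1) • (1 : Matrix (V 0) (V 0) ℂ)
  succ : ∀ k, l.a (k+1) * l.b (k+1) - l.b k * l.a k =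
    (ξ (k+1) - ξ (k+2)) • (1 : Matrix (V (k+1)) (V (k+1)) ℂ)

/-- The composite from a vertex of the leg to the base. -/
def A (l : Leg β V) : ∀ k, Matrix β (V k) ℂ
  | 0 => l.a0
  | k+1 => l.A k * l.a k

/-- The composite from the base to a vertex of the leg. -/
def B (l : Leg β V) : ∀ k, Matrix (V k) β ℂ
  | 0 => l.b0
  | k+1 => l.b k * l.B k

/-- The endomorphism of the base determined by a leg. -/
def N (l : Leg β V) (ξ : ℕ → ℂ) : Matrix β β ℂ := ξ 0 • (1 : Matrix β β ℂ) + l.a0 * l.b0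

/-- Nondegeneracy of a leg. -/
structure Good (l : Leg β V) : Prop where
  inj : ∀ k, ∃ L : Matrix (V k) β ℂ, L * l.A k = 1
  surj : ∀ k, ∃ T : Matrix β (V k) ℂ, l.B k * T = 1

variable {l : Leg β V} {ξ : ℕ → ℂ}

theorem IsMom.A_mul_b (h : l.IsMom ξ) (k : ℕ) :
    l.A (k+1) * l.b k = l.N ξ * l.A k - ξ (k+1) • l.A k := by
  induction k with
  | zero =>
    change l.a0 * l.a 0 * l.b 0 = l.N ξ * l.a0 - ξ 1 • l.a0
    rw [Matrix.mul_assoc, sub_eq_iff_eq_add.1 h.zero]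
    simp only [N, Matrix.mul_add, Matrix.add_mul, Matrix.mul_smul, Matrix.smul_mul,
      Matrix.mul_one, Matrix.one_mul, Matrix.mul_assoc]
    rw [sub_smul]
    abel
  | succ k ih =>
    rw [A, Matrix.mul_assoc, sub_eq_iff_eq_add.1 (h.succ k), Matrix.mul_add,
      ← Matrix.mul_assoc _ (l.b k), ih, Matrix.sub_mul, Matrix.mul_assoc, Matrix.smul_mul,
      Matrix.mul_smul, Matrix.mul_one, show l.A k * l.a k = l.A (k+1) from rfl, sub_smul]
    abel

theorem IsMom.a_mul_B (h : l.IsMom ξ) (k : ℕ) :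
    l.a k * l.B (k+1) = l.B k * l.N ξ - ξ (k+1) • l.B k := by
  induction k with
  | zero =>
    change l.a 0 * (l.b 0 * l.b0) = l.b0 * l.N ξ - ξ 1 • l.b0
    rw [← Matrix.mul_assoc, sub_eq_iff_eq_add.1 h.zero]
    simp only [N, Matrix.mul_add, Matrix.add_mul, Matrix.mul_smul, Matrix.smul_mul,
      Matrix.mul_one, Matrix.one_mul, Matrix.mul_assoc]
    rw [sub_smul]
    abel
  | succ k ih =>
    rw [B, ← Matrix.mul_assoc, sub_eq_iff_eq_add.1 (h.succ k), Matrix.add_mul,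
      Matrix.mul_assoc (l.b k), ih, Matrix.mul_sub, ← Matrix.mul_assoc, Matrix.mul_smul,
      Matrix.smul_mul, Matrix.one_mul, show l.b k * l.B k = l.B (k+1) from rfl, sub_smul]
    abel

open Polynomial in
theorem aeval_rootProd_succ {N : Matrix β β ℂ} (k : ℕ) : aeval N (rootProd ξ (k+1)) =
    N * aeval N (rootProd ξ k) - ξ k • aeval N (rootProd ξ k) := by
  rw [rootProd_succ, mul_comm, map_mul, map_sub, aeval_X, aeval_C, sub_mul, Algebra.smul_def]

open Polynomial in
theorem aeval_rootProd_one {N : Matrix β β ℂ} : aeval N (rootProd ξ 1) = N - ξ 0 • 1 := by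
  rw [show rootProd ξ 1 = X - C (ξ 0) by simp [rootProd], map_sub, aeval_X, aeval_C,
    Algebra.smul_def, mul_one]

open Polynomial in
theorem IsMom.A_mul_B (h : l.IsMom ξ) (k : ℕ) :
    l.A k * l.B k = aeval (l.N ξ) (rootProd ξ (k+1)) := by
  induction k with
  | zero =>
    rw [zero_add, aeval_rootProd_one, N]
    simp [A, B]
  | succ k ih =>
    rw [aeval_rootProd_succ, ← ih, B, ← Matrix.mul_assoc, h.A_mul_b, Matrix.sub_mul,
      Matrix.smul_mul, Matrix.mul_assoc]

open Polynomial in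
theorem Good.rank_eq (hl : l.Good) (h : l.IsMom ξ) (k : ℕ) :
    (aeval (l.N ξ) (rootProd ξ (k+1))).rank = Fintype.card (V k) := by
  obtain ⟨L, hL⟩ := hl.inj k
  obtain ⟨T, hT⟩ := hl.surj k
  rw [← h.A_mul_B]
  apply le_antisymm
  · exact (Matrix.rank_mul_le_left _ _).trans (Matrix.rank_le_card_width _)
  · have : (1 : Matrix (V k) (V k) ℂ) = L * (l.A k * l.B k) * T := by
      rw [← Matrix.mul_assoc, hL, Matrix.one_mul, hT]
    calc Fintype.card (V k) = (1 : Matrix (V k) (V k) ℂ).rank := (Matrix.rank_one).symm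
      _ ≤ (L * (l.A k * l.B k)).rank := by rw [this]; exact Matrix.rank_mul_le_left _ _
      _ ≤ _ := Matrix.rank_mul_le_right _ _

theorem cancel_left {κ μ ν : Type} [Fintype κ] [Fintype μ] [DecidableEq μ] {A : Matrix κ μ ℂ}
    {L : Matrix μ κ ℂ} (h : L * A = 1) {X Y : Matrix μ ν ℂ} (e : A * X = A * Y) : X = Y := by
  rw [← Matrix.one_mul X, ← h, Matrix.mul_assoc, e, ← Matrix.mul_assoc, h, Matrix.one_mul]

theorem cancel_right {κ μ ν : Type} [Fintype κ] [Fintype μ] [DecidableEq μ] {B : Matrix μ κ ℂ}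
    {T : Matrix κ μ ℂ} (h : B * T = 1) {X Y : Matrix ν μ ℂ} (e : X * B = Y * B) : X = Y := by
  rw [← Matrix.mul_one X, ← h, ← Matrix.mul_assoc, e, Matrix.mul_assoc, h, Matrix.mul_one]

open Polynomial in
/-- Every endomorphism with the prescribed ranks comes from a nondegenerate leg. -/
theorem exists_good (N0 : Matrix β β ℂ)
    (hr : ∀ k, (aeval N0 (rootProd ξ (k+1))).rank = Fintype.card (V k)) :
    ∃ l : Leg β V, l.IsMom ξ ∧ l.Good ∧ l.N ξ = N0 := by
  choose A B L T hAB hLA hBT using fun k => exists_rank_factorization _ (hr k)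
  have hM : ∀ k, A (k+1) * B (k+1) = (N0 - ξ (k+1) • 1) * (A k * B k) := fun k => by
    rw [hAB, hAB, aeval_rootProd_succ, Matrix.sub_mul, Matrix.smul_mul, Matrix.one_mul]
  have hM' : ∀ k, A (k+1) * B (k+1) = (A k * B k) * (N0 - ξ (k+1) • 1) := fun k => by
    rw [hAB, hAB, rootProd_succ, map_mul, map_sub, aeval_X, aeval_C, Algebra.smul_def, mul_one]
  have hM0 : A 0 * B 0 = N0 - ξ 0 • 1 := by rw [hAB, zero_add, aeval_rootProd_one]
  let l : Leg β V := ⟨A 0, B 0, fun k => L k * A (k+1), fun k => B (k+1) * T k⟩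
  have hA1 : ∀ k, A k * (L k * A (k+1)) = A (k+1) := fun k => by
    refine cancel_right (hBT (k+1)) ?_
    rw [Matrix.mul_assoc, Matrix.mul_assoc (L k), hM', Matrix.mul_assoc (A k),
      ← Matrix.mul_assoc (L k), hLA, Matrix.one_mul]
  have hB1 : ∀ k, B (k+1) * T k * B k = B (k+1) := fun k => by
    refine cancel_left (hLA (k+1)) ?_
    rw [← Matrix.mul_assoc, ← Matrix.mul_assoc, hM, Matrix.mul_assoc, Matrix.mul_assoc (N0 - _),
      Matrix.mul_assoc (A k), ← Matrix.mul_assoc (B k), hBT, Matrix.one_mul]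
  have hA : ∀ k, l.A k = A k := fun k => by
    induction k with
    | zero => rfl
    | succ k ih => rw [Leg.A, ih]; exact hA1 k
  have hB : ∀ k, l.B k = B k := fun k => by
    induction k with
    | zero => rfl
    | succ k ih => rw [Leg.B, ih]; exact hB1 k
  have hAb : ∀ k, A (k+1) * (B (k+1) * T k) = (N0 - ξ (k+1) • 1) * A k := fun k => by
    rw [← Matrix.mul_assoc, hM, Matrix.mul_assoc, Matrix.mul_assoc, hBT, Matrix.mul_one]
  have haB : ∀ k, L k * A (k+1) * B (k+1) = B k * (N0 - ξ (k+1) • 1) := fun k => by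
    rw [Matrix.mul_assoc, hM', ← Matrix.mul_assoc, ← Matrix.mul_assoc, hLA, Matrix.one_mul]
  have hN : l.N ξ = N0 := by
    change ξ 0 • (1 : Matrix β β ℂ) + A 0 * B 0 = N0
    rw [hM0]; abel
  refine ⟨l, ⟨?_, fun k => ?_⟩, ⟨fun k => ⟨L k, by rw [hA, hLA]⟩, fun k => ⟨T k, by rw [hB, hBT]⟩⟩,
    hN⟩
  · change L 0 * A 1 * (B 1 * T 0) - B 0 * A 0 = _
    refine cancel_left (hLA 0) (cancel_right (hBT 0) ?_)
    have e : A 0 * (L 0 * A 1 * (B 1 * T 0) - B 0 * A 0) * B 0 =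
        A 0 * (L 0 * A 1) * (B 1 * T 0 * B 0) - (A 0 * B 0) * (A 0 * B 0) := by
      rw [Matrix.mul_sub, Matrix.sub_mul]
      simp only [Matrix.mul_assoc]
    have e' : N0 - ξ (0 + 1) • 1 - A 0 * B 0 = (ξ 0 - ξ 1) • (1 : Matrix β β ℂ) := by
      rw [hM0, zero_add, sub_smul]; abel
    rw [e, hA1, hB1, hM 0, ← Matrix.sub_mul, Matrix.mul_smul, Matrix.mul_one, e', Matrix.smul_mul,
      Matrix.smul_mul, Matrix.one_mul]
  · change L (k+1) * A (k+2) * (B (k+2) * T (k+1)) - B (k+1) * T k * (L k * A (k+1)) = _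
    refine cancel_left (hLA (k+1)) (cancel_right (hBT (k+1)) ?_)
    have e : A (k+1) * (L (k+1) * A (k+2) * (B (k+2) * T (k+1)) -
        B (k+1) * T k * (L k * A (k+1))) * B (k+1) =
        A (k+1) * (L (k+1) * A (k+2)) * (B (k+2) * T (k+1) * B (k+1)) -
          A (k+1) * (B (k+1) * T k) * (L k * A (k+1) * B (k+1)) := by
      rw [Matrix.mul_sub, Matrix.sub_mul]
      simp only [Matrix.mul_assoc]
    rw [e, hA1 (k+1), hB1 (k+1), hAb, haB, Matrix.mul_assoc _ (A k), ← Matrix.mul_assoc (A k),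
      ← hM', hM (k+1), ← Matrix.sub_mul, Matrix.mul_smul, Matrix.mul_one, Matrix.smul_mul,
      show N0 - ξ (k+1+1) • 1 - (N0 - ξ (k+1) • 1) = (ξ (k+1) - ξ (k+2)) • (1 : Matrix β β ℂ) by
        rw [sub_smul]; abel, Matrix.smul_mul, Matrix.one_mul]

open Polynomial in
/-- Nondegenerate legs are determined by the endomorphism of the base. -/
theorem Good.exists_iso {l l' : Leg β V} (hl : l.Good) (hl' : l'.Good) (h : l.IsMom ξ)
    (h' : l'.IsMom ξ) {g g' : Matrix β β ℂ} (e1 : g * g' = 1) (e2 : g' * g = 1)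
    (hg : g * (l.a0 * l.b0) = l'.a0 * l'.b0 * g) :
    ∃ c c' : ∀ k, Matrix (V k) (V k) ℂ, (∀ k, c k * c' k = 1) ∧ (∀ k, c' k * c k = 1) ∧
      g * l.a0 = l'.a0 * c 0 ∧ c 0 * l.b0 = l'.b0 * g ∧
      (∀ k, c k * l.a k = l'.a k * c (k+1)) ∧ ∀ k, c (k+1) * l.b k = l'.b k * c k := by
  have hN : g * l.N ξ = l'.N ξ * g := by
    rw [N, N, Matrix.mul_add, Matrix.add_mul, hg, Matrix.mul_smul, Matrix.smul_mul, Matrix.mul_one,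
      Matrix.one_mul]
  choose L hL using hl.inj
  choose T hT using hl.surj
  choose L' hL' using hl'.inj
  choose T' hT' using hl'.surj
  have hM : ∀ k, g * (l.A k * l.B k) = l'.A k * l'.B k * g := fun k => by
    rw [h.A_mul_B, h'.A_mul_B]
    induction k with
    | zero => rw [zero_add, aeval_rootProd_one, aeval_rootProd_one, mul_sub, sub_mul, hN]; simp
    | succ k ih =>
      have s1 := aeval_rootProd_succ (ξ := ξ) (N := l.N ξ) (k+1)
      have s2 := aeval_rootProd_succ (ξ := ξ) (N := l'.N ξ) (k+1)
      rw [s1, s2, mul_sub, sub_mul, ← mul_assoc, hN, mul_assoc,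
        ih, Matrix.mul_smul, ih, Matrix.smul_mul, mul_assoc]
  have hM' : ∀ k, g' * (l'.A k * l'.B k) = l.A k * l.B k * g' := fun k => by
    rw [← mul_one (l'.A k * l'.B k), ← e1, ← mul_assoc (l'.A k * l'.B k), ← hM, ← mul_assoc,
      ← mul_assoc, e2, one_mul]
  set c : ∀ k, Matrix (V k) (V k) ℂ := fun k => L' k * (g * l.A k)
  set c' : ∀ k, Matrix (V k) (V k) ℂ := fun k => L k * (g' * l'.A k)
  have hc : ∀ k, l'.A k * c k = g * l.A k := fun k => by
    refine cancel_right (hT k) ?_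
    rw [Matrix.mul_assoc, Matrix.mul_assoc (L' k), Matrix.mul_assoc g, hM, Matrix.mul_assoc (l'.A k),
      ← Matrix.mul_assoc (L' k), hL', Matrix.one_mul]
  have hc' : ∀ k, l.A k * c' k = g' * l'.A k := fun k => by
    refine cancel_right (hT' k) ?_
    rw [Matrix.mul_assoc, Matrix.mul_assoc (L k), Matrix.mul_assoc g', hM', Matrix.mul_assoc (l.A k),
      ← Matrix.mul_assoc (L k), hL, Matrix.one_mul]
  have hcB : ∀ k, c k * l.B k = l'.B k * g := fun k => by
    refine cancel_left (hL' k) ?_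
    rw [← Matrix.mul_assoc, hc, Matrix.mul_assoc, hM, Matrix.mul_assoc]
  refine ⟨c, c', fun k => ?_, fun k => ?_, (hc 0).symm, hcB 0, fun k => ?_, fun k => ?_⟩
  · refine cancel_left (hL' k) ?_
    rw [← Matrix.mul_assoc, hc, Matrix.mul_assoc, hc', ← Matrix.mul_assoc, e1, Matrix.one_mul,
      Matrix.mul_one]
  · refine cancel_left (hL k) ?_
    rw [← Matrix.mul_assoc, hc', Matrix.mul_assoc, hc, ← Matrix.mul_assoc, e2, Matrix.one_mul,
      Matrix.mul_one]
  · refine cancel_left (hL' k) ?_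
    rw [← Matrix.mul_assoc, hc, ← Matrix.mul_assoc, Matrix.mul_assoc g,
      show l.A k * l.a k = l.A (k+1) from rfl, show l'.A k * l'.a k = l'.A (k+1) from rfl, hc]
  · refine cancel_right (hT k) ?_
    calc c (k+1) * l.b k * l.B k = c (k+1) * l.B (k+1) := Matrix.mul_assoc _ _ _
      _ = l'.b k * (l'.B k * g) := by rw [hcB]; exact Matrix.mul_assoc _ _ _
      _ = l'.b k * c k * l.B k := by rw [← hcB]; exact (Matrix.mul_assoc _ _ _).symm

end Leg

section Subalgebras

variable {ι : Type} [Fintype ι] [DecidableEq ι]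

/-- Pairs of matrices whose first component preserves a subspace. -/
def stabSub (W : Submodule ℂ (ι → ℂ)) : Subalgebra ℂ (Matrix ι ι ℂ × Matrix ι ι ℂ) where
  carrier := {p | ∀ w ∈ W, p.1 *ᵥ w ∈ W}
  mul_mem' {p p'} hp hp' w hw := by
    change (p.1 * p'.1) *ᵥ w ∈ W
    rw [← Matrix.mulVec_mulVec]
    exact hp _ (hp' _ hw)
  add_mem' {p p'} hp hp' w hw := by
    change (p.1 + p'.1) *ᵥ w ∈ W
    rw [Matrix.add_mulVec]
    exact W.add_mem (hp _ hw) (hp' _ hw)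
  algebraMap_mem' c w hw := by
    change (algebraMap ℂ (Matrix ι ι ℂ) c) *ᵥ w ∈ W
    rw [Algebra.algebraMap_eq_smul_one, Matrix.smul_mulVec, Matrix.one_mulVec]
    exact W.smul_mem _ hw

/-- Pairs of matrices intertwined by a given matrix. -/
def intertwineSub (g : Matrix ι ι ℂ) : Subalgebra ℂ (Matrix ι ι ℂ × Matrix ι ι ℂ) where
  carrier := {p | g * p.1 = p.2 * g}
  mul_mem' {p p'} hp hp' := by
    change g * (p.1 * p'.1) = p.2 * p'.2 * g
    rw [← mul_assoc, show g * p.1 = p.2 * g from hp, mul_assoc,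
      show g * p'.1 = p'.2 * g from hp', mul_assoc]
  add_mem' {p p'} hp hp' := by
    change g * (p.1 + p'.1) = (p.2 + p'.2) * g
    rw [mul_add, add_mul, show g * p.1 = p.2 * g from hp, show g * p'.1 = p'.2 * g from hp']
  algebraMap_mem' c := by
    change g * (algebraMap ℂ (Matrix ι ι ℂ) c) = (algebraMap ℂ (Matrix ι ι ℂ) c) * g
    exact (Algebra.commutes c g).symm

end Subalgebras

namespace ConnData

variable (D : ConnData)

/-- The parametrization of irregular parts at a point. -/
def Psi (i : Fin (D.p+1)) :
    (ℕ → Matrix (D.Idx i) (D.Idx i) ℂ) → Matrix (D.Idx i) (D.Idx i) (LaurentSeries ℂ) :=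
  Classical.choose (exists_isPara (blk := D.blk i) (D.hq0 i) (D.hq1 i) (D.hqd i) Finset.univ
    ⟨⟨0, D.hm i⟩, Finset.mem_univ _⟩)

theorem isPara_Psi (i : Fin (D.p+1)) : IsPara (D.q i) (D.blk i) Finset.univ (D.Psi i) :=
  Classical.choose_spec (exists_isPara (blk := D.blk i) (D.hq0 i) (D.hq1 i) (D.hqd i) Finset.univ
    ⟨⟨0, D.hm i⟩, Finset.mem_univ _⟩)

/-- The index set of a leg vertex, extended by empty sets beyond the end of the leg. -/
abbrev LV (i : Fin (D.p+1)) (j : Fin (D.m i)) (k : ℕ) : Type :=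
  Σ' h : k < D.e i j - 1, Fin (D.alphaV (D.vleg i j ⟨k, h⟩))

/-- The eigenvalue data extended by zero. -/
def xe (i : Fin (D.p+1)) (j : Fin (D.m i)) (k : ℕ) : ℂ :=
  if h : k < D.e i j then D.xi i j ⟨k, h⟩ else 0

/-- Global representation data: frames, residues and off-diagonal blocks in the frames, legs. -/
structure GRep where
  P : ∀ i, Matrix (D.Idx i) (D.Idx 0) ℂ
  P' : ∀ i, Matrix (D.Idx 0) (D.Idx i) ℂ
  Z : ∀ i, Matrix (D.Idx i) (D.Idx i) ℂ
  X : ∀ i, ℕ → Matrix (D.Idx i) (D.Idx i) ℂ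
  leg : ∀ i j, Leg (Fin (D.nb i j)) (D.LV i j)

variable {D}

/-- Abbreviation for the block projections. -/
abbrev pr (D : ConnData) (i : Fin (D.p+1)) (j : Fin (D.m i)) : Matrix (D.Idx i) (D.Idx i) ℂ :=
  eb (D.blk i) j

namespace GRep

variable (G : D.GRep)

/-- The block diagonal matrix of the endomorphisms determined by the legs. -/
def N (i : Fin (D.p+1)) : Matrix (D.Idx i) (D.Idx i) ℂ :=
  Matrix.blockDiagonal' fun j => (G.leg i j).N (D.xe i j)

/-- The equations satisfied by global representation data. -/
structure Valid : Prop where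
  PP' : ∀ i, G.P i * G.P' i = 1
  P'P : ∀ i, G.P' i * G.P i = 1
  P0 : G.P 0 = 1
  res : ∑ i, G.P' i * G.Z i * G.P i = 0
  diag : ∀ i j, pr D i j * G.Z i * pr D i j =
    mom (D.q i) (D.blk i) Finset.univ (G.X i) j + pr D i j * G.N i * pr D i j
  legMom : ∀ i j, (G.leg i j).IsMom (D.xe i j)

/-- Nondegeneracy of all the legs. -/
def Good : Prop := ∀ i j, (G.leg i j).Good

/-- Families of subspaces invariant under the non-leg part of the data. -/
structure BaseInv (W : ∀ i, Submodule ℂ (D.Idx i → ℂ)) : Prop where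
  P : ∀ i, ∀ w ∈ W 0, G.P i *ᵥ w ∈ W i
  P' : ∀ i, ∀ w ∈ W i, G.P' i *ᵥ w ∈ W 0
  e : ∀ i j, ∀ w ∈ W i, pr D i j *ᵥ w ∈ W i
  Z : ∀ i, ∀ w ∈ W i, G.Z i *ᵥ w ∈ W i
  X : ∀ i j j', j ≠ j' → ∀ t < dq (D.q i) j j', ∀ w ∈ W i, (pr D i j * G.X i t * pr D i j') *ᵥ w ∈ W i

/-- Irreducibility of global representation data. -/
def BaseIrred : Prop := ∀ W, G.BaseInv W → W 0 = ⊥ ∨ W 0 = ⊤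

/-- Isomorphism of the non-leg parts of global representation data. -/
def BaseIso (G G' : D.GRep) : Prop :=
  ∃ g g' : ∀ i, Matrix (D.Idx i) (D.Idx i) ℂ, (∀ i, g i * g' i = 1) ∧ (∀ i, g' i * g i = 1) ∧
    (∀ i, g i * G.P i = G'.P i * g 0) ∧ (∀ i j, g i * pr D i j = pr D i j * g i) ∧
    (∀ i, g i * G.Z i = G'.Z i * g i) ∧
    ∀ i j j', j ≠ j' → ∀ t < dq (D.q i) j j',
      g i * (pr D i j * G.X i t * pr D i j') = (pr D i j * G'.X i t * pr D i j') * g i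

/-- The principal parts in the standard frames. -/
def Y (i : Fin (D.p+1)) : Matrix (D.Idx i) (D.Idx i) (LaurentSeries ℂ) :=
  D.Psi i (G.X i) + sg (-1) (G.Z i)

theorem cf_Y_neg_one (i : Fin (D.p+1)) : cf (G.Y i) (-1) = G.Z i := by
  rw [Y, cf_add, (D.isPara_Psi i).supp _ _ le_rfl, cf_sg, if_pos rfl, zero_add]

theorem cf_Y_of_nonneg (i : Fin (D.p+1)) {k : ℤ} (hk : 0 ≤ k) : cf (G.Y i) k = 0 := by
  rw [Y, cf_add, (D.isPara_Psi i).supp _ _ (by omega), cf_sg, if_neg (by omega), zero_add]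

theorem cf_Y_of_le (i : Fin (D.p+1)) {k : ℤ} (hk : k ≤ -2) :
    cf (G.Y i) k = cf (D.Psi i (G.X i)) k := by
  rw [Y, cf_add, cf_sg, if_neg (by omega), add_zero]

/-- Membership of the coefficients of the principal parts in a subalgebra. -/
theorem cf_Y_mem_iff (G G' : D.GRep) (i : Fin (D.p+1))
    (S : Subalgebra ℂ (Matrix (D.Idx i) (D.Idx i) ℂ × Matrix (D.Idx i) (D.Idx i) ℂ)) :
    (∀ k, (cf (G.Y i) k, cf (G'.Y i) k) ∈ S) ↔ (G.Z i, G'.Z i) ∈ S ∧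
      (∀ j, (pr D i j, pr D i j) ∈ S) ∧ ∀ j j', j ≠ j' → ∀ t < dq (D.q i) j j',
        (pr D i j * G.X i t * pr D i j', pr D i j * G'.X i t * pr D i j') ∈ S := by
  have h := (D.isPara_Psi i).rel S (by rw [eJ_univ]; exact S.one_mem) (G.X i) (G'.X i)
  simp only [Finset.mem_univ, true_imp_iff] at h
  rw [← h]
  constructor
  · intro H
    refine ⟨by simpa only [cf_Y_neg_one] using H (-1), fun k => ?_⟩
    by_cases hk : k ≤ -2
    · simpa only [cf_Y_of_le _ _ hk] using H k
    · rw [(D.isPara_Psi i).supp _ _ (by omega), (D.isPara_Psi i).supp _ _ (by omega)]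
      exact S.zero_mem
  · rintro ⟨hZ, H⟩ k
    rcases lt_trichotomy k (-1) with hk | rfl | hk
    · rw [cf_Y_of_le _ _ (by omega), cf_Y_of_le _ _ (by omega)]; exact H k
    · rwa [cf_Y_neg_one, cf_Y_neg_one]
    · rw [cf_Y_of_nonneg _ _ (by omega), cf_Y_of_nonneg _ _ (by omega)]; exact S.zero_mem

end GRep

variable (D) in
/-- The standard frame at `0`. -/
def F0 : Matrix (D.Idx 0) (Fin D.n) ℂ :=
  (1 : Matrix (Fin D.n) (Fin D.n) ℂ).submatrix (D.sigmaEquiv 0) id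

variable (D) in
/-- The inverse of the standard frame at `0`. -/
def F0' : Matrix (Fin D.n) (D.Idx 0) ℂ :=
  (1 : Matrix (Fin D.n) (Fin D.n) ℂ).submatrix id (D.sigmaEquiv 0)

theorem F0_mul_F0' : D.F0 * D.F0' = 1 := by
  rw [F0, F0', ← Matrix.submatrix_mul _ _ _ id _ Function.bijective_id, mul_one,
    Matrix.submatrix_one_equiv]

theorem F0'_mul_F0 : D.F0' * D.F0 = 1 := by
  rw [F0, F0', Matrix.submatrix_mul_equiv _ _ id _ id, mul_one, Matrix.submatrix_id_id]

theorem cf_conjC {n : ℕ} (g : GLc n) (A : Matrix (Fin n) (Fin n) (LaurentSeries ℂ)) :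
    conjC g A = sg 0 g.val * A * sg 0 (g⁻¹).val := rfl

theorem conjC_eq_iff {n : ℕ} (g : GLc n) (A A' : Matrix (Fin n) (Fin n) (LaurentSeries ℂ)) :
    conjC g A = A' ↔ ∀ k, g.val * cf A k = cf A' k * g.val := by
  rw [cf_conjC]
  constructor
  · rintro rfl k
    rw [cf_conj_sg, mul_assoc _ (g⁻¹).val, Units.inv_mul, mul_one]
  · intro h
    apply cf_ext
    intro k
    rw [cf_conj_sg, h, mul_assoc, Units.mul_inv, mul_one]

/-- Simultaneous conjugacy by constant matrices. -/
def SimConj (A A' : Fin (D.p+1) → Matrix (Fin D.n) (Fin D.n) (LaurentSeries ℂ)) : Prop :=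
  ∃ g : GLc D.n, ∀ i, conjC g (A i) = A' i

theorem SimConj.symm {A A' : Fin (D.p+1) → Matrix (Fin D.n) (Fin D.n) (LaurentSeries ℂ)}
    (h : SimConj A A') : SimConj A' A := by
  obtain ⟨g, h⟩ := h
  refine ⟨g⁻¹, fun i => ?_⟩
  have := (conjC_eq_iff _ _ _).1 (h i)
  rw [conjC_eq_iff]
  intro k
  rw [← mul_one (cf (A' i) k), ← Units.mul_inv g, ← mul_assoc (cf (A' i) k), ← this, ← mul_assoc,
    ← mul_assoc, Units.inv_mul, one_mul]

theorem SimConj.trans {A A' A'' : Fin (D.p+1) → Matrix (Fin D.n) (Fin D.n) (LaurentSeries ℂ)}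
    (h : SimConj A A') (h' : SimConj A' A'') : SimConj A A'' := by
  obtain ⟨g, h⟩ := h
  obtain ⟨g', h'⟩ := h'
  refine ⟨g' * g, fun i => ?_⟩
  have h := (conjC_eq_iff _ _ _).1 (h i)
  have h' := (conjC_eq_iff _ _ _).1 (h' i)
  rw [conjC_eq_iff]
  intro k
  rw [Units.val_mul, mul_assoc, h, ← mul_assoc, h', mul_assoc]

namespace GRep

variable (G : D.GRep)

/-- The tuple of principal parts determined by global representation data. -/
def conn (i : Fin (D.p+1)) : Matrix (Fin D.n) (Fin D.n) (LaurentSeries ℂ) :=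
  sg 0 (D.F0' * G.P' i) * G.Y i * sg 0 (G.P i * D.F0)

theorem cf_conn (i : Fin (D.p+1)) (k : ℤ) :
    cf (G.conn i) k = D.F0' * G.P' i * cf (G.Y i) k * (G.P i * D.F0) := cf_conj_sg _ _ _ _

variable {G}

theorem Valid.frame (h : G.Valid) (i : Fin (D.p+1)) :
    (G.P i * D.F0) * (D.F0' * G.P' i) = 1 := by
  rw [Matrix.mul_assoc, ← Matrix.mul_assoc D.F0, F0_mul_F0', Matrix.one_mul, h.PP']

theorem Valid.frame' (h : G.Valid) (i : Fin (D.p+1)) :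
    (D.F0' * G.P' i) * (G.P i * D.F0) = 1 := by
  rw [Matrix.mul_assoc, ← Matrix.mul_assoc (G.P' i), h.P'P, Matrix.one_mul, F0'_mul_F0]

theorem Valid.P'0 (h : G.Valid) : G.P' 0 = 1 := by
  have := h.P'P 0
  rwa [h.P0, Matrix.mul_one] at this

theorem Valid.cf_conn_comp (h : G.Valid) (i : Fin (D.p+1)) (k : ℤ) :
    G.P i * D.F0 * cf (G.conn i) k * (D.F0' * G.P' i) = cf (G.Y i) k := by
  rw [cf_conn]
  calc _ = (G.P i * D.F0 * (D.F0' * G.P' i)) * cf (G.Y i) k *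
        (G.P i * D.F0 * (D.F0' * G.P' i)) := by simp only [Matrix.mul_assoc]
    _ = _ := by rw [h.frame, Matrix.one_mul, Matrix.mul_one]

theorem conn_isPrincipal (i : Fin (D.p+1)) {k : ℤ} (hk : 0 ≤ k) : cf (G.conn i) k = 0 := by
  rw [cf_conn, cf_Y_of_nonneg _ _ hk, Matrix.mul_zero, Matrix.zero_mul]

theorem Valid.sum_res (h : G.Valid) : ∑ i, cf (G.conn i) (-1) = 0 := by
  have : ∀ i, cf (G.conn i) (-1) = D.F0' * (G.P' i * G.Z i * G.P i) * D.F0 := fun i => by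
    rw [cf_conn, cf_Y_neg_one]
    simp only [Matrix.mul_assoc]
  simp only [this]
  rw [← Matrix.sum_mul, ← Matrix.mul_sum, h.res, Matrix.mul_zero, Matrix.zero_mul]

theorem Valid.irred_iff (h : G.Valid) : (∀ W : Submodule ℂ (Fin D.n → ℂ),
    (∀ i (k : ℤ), ∀ v ∈ W, (cf (G.conn i) k).mulVec v ∈ W) → W = ⊥ ∨ W = ⊤) ↔ G.BaseIrred := by
  constructor
  · intro H W hW
    have key := H ((W 0).comap D.F0.mulVecLin) (fun i k v hv => by
      have hm := (cf_Y_mem_iff G G i (stabSub (W i))).2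
        ⟨hW.Z i, hW.e i, fun j j' hj t ht => hW.X i j j' hj t ht⟩ k
      have h1 : D.F0 *ᵥ v ∈ W 0 := hv
      change D.F0 *ᵥ (_ *ᵥ v) ∈ W 0
      rw [cf_conn]
      simp only [← Matrix.mulVec_mulVec]
      rw [Matrix.mulVec_mulVec _ D.F0, F0_mul_F0', Matrix.one_mulVec]
      exact hW.P' i _ (hm _ (hW.P i _ h1)))
    have e : ∀ w, D.F0 *ᵥ (D.F0' *ᵥ w) = w := fun w => by
      rw [Matrix.mulVec_mulVec, F0_mul_F0', Matrix.one_mulVec]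
    refine key.imp (fun hb => ?_) (fun ht => ?_)
    · refine (Submodule.eq_bot_iff _).2 fun w hw => ?_
      have : D.F0' *ᵥ w ∈ (W 0).comap D.F0.mulVecLin := by
        change D.F0 *ᵥ (D.F0' *ᵥ w) ∈ W 0
        rwa [e]
      rw [hb, Submodule.mem_bot] at this
      rw [← e w, this, Matrix.mulVec_zero]
    · refine (Submodule.eq_top_iff').2 fun w => ?_
      have : D.F0' *ᵥ w ∈ (W 0).comap D.F0.mulVecLin := ht ▸ Submodule.mem_top
      have : D.F0 *ᵥ (D.F0' *ᵥ w) ∈ W 0 := this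
      rwa [e] at this
  · intro H W hW
    set U : ∀ i, Submodule ℂ (D.Idx i → ℂ) := fun i => W.comap (D.F0' * G.P' i).mulVecLin with hU
    have hmem : ∀ i w, w ∈ U i ↔ (D.F0' * G.P' i) *ᵥ w ∈ W := fun i w => Iff.rfl
    have hst : ∀ i k, (cf (G.Y i) k, cf (G.Y i) k) ∈ stabSub (U i) := fun i k w hw => by
      rw [hmem] at hw ⊢
      have := hW i k _ hw
      rw [cf_conn, ← Matrix.mulVec_mulVec, ← Matrix.mulVec_mulVec, Matrix.mulVec_mulVec w, h.frame,
        Matrix.one_mulVec] at this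
      exact this
    have hst' := fun i => (cf_Y_mem_iff G G i (stabSub (U i))).1 (hst i)
    have hUi := H U
      { P := fun i w hw => by
          rw [hmem] at hw ⊢
          rwa [Matrix.mulVec_mulVec, Matrix.mul_assoc, h.P'P, Matrix.mul_one, ← Matrix.mul_one D.F0',
            ← h.P'0]
        P' := fun i w hw => by
          rw [hmem] at hw ⊢
          rwa [h.P'0, Matrix.mul_one, Matrix.mulVec_mulVec]
        e := fun i => (hst' i).2.1
        Z := fun i => (hst' i).1
        X := fun i => (hst' i).2.2 }
    have e : ∀ w, D.F0' *ᵥ (D.F0 *ᵥ w) = w := fun w => by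
      rw [Matrix.mulVec_mulVec, F0'_mul_F0, Matrix.one_mulVec]
    have hmem0 : ∀ w, D.F0 *ᵥ w ∈ U 0 ↔ w ∈ W := fun w => by
      rw [hmem, h.P'0, Matrix.mul_one, e]
    refine hUi.imp (fun hb => ?_) (fun ht => ?_)
    · refine (Submodule.eq_bot_iff _).2 fun w hw => ?_
      have := (hmem0 w).2 hw
      rw [hb, Submodule.mem_bot] at this
      rw [← e w, this, Matrix.mulVec_zero]
    · exact (Submodule.eq_top_iff').2 fun w => (hmem0 w).1 (ht ▸ Submodule.mem_top)

theorem simConj_conn_iff {G G' : D.GRep} (h : G.Valid) (h' : G'.Valid) :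
    SimConj G.conn G'.conn ↔ BaseIso G G' := by
  constructor
  · rintro ⟨u, hu⟩
    have hu : ∀ i k, u.val * cf (G.conn i) k = cf (G'.conn i) k * u.val :=
      fun i => (conjC_eq_iff _ _ _).1 (hu i)
    have e : ∀ i, D.F0' * G.P' i * (G.P i * D.F0) = 1 := h.frame'
    set g : ∀ i, Matrix (D.Idx i) (D.Idx i) ℂ := fun i =>
      G'.P i * D.F0 * u.val * (D.F0' * G.P' i) with hg
    have hY : ∀ i k, (cf (G.Y i) k, cf (G'.Y i) k) ∈ intertwineSub (g i) := fun i k => by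
      change g i * cf (G.Y i) k = cf (G'.Y i) k * g i
      rw [hg, ← h.cf_conn_comp, ← h'.cf_conn_comp]
      have e1 : (D.F0' * G.P' i) * (G.P i * D.F0 * cf (G.conn i) k * (D.F0' * G.P' i)) =
          cf (G.conn i) k * (D.F0' * G.P' i) := by
        rw [Matrix.mul_assoc (G.P i * D.F0), ← Matrix.mul_assoc (D.F0' * G.P' i), h.frame',
          Matrix.one_mul]
      have e2 : G'.P i * D.F0 * cf (G'.conn i) k * (D.F0' * G'.P' i) * (G'.P i * D.F0 * u.val *
          (D.F0' * G.P' i)) = G'.P i * D.F0 * (cf (G'.conn i) k * u.val) * (D.F0' * G.P' i) := by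
        rw [Matrix.mul_assoc (G'.P i * D.F0 * cf (G'.conn i) k), Matrix.mul_assoc _ u.val,
          ← Matrix.mul_assoc (D.F0' * G'.P' i), h'.frame', Matrix.one_mul]
        simp only [Matrix.mul_assoc]
      change G'.P i * D.F0 * u.val * (D.F0' * G.P' i) * _ = _ * (G'.P i * D.F0 * u.val *
          (D.F0' * G.P' i))
      rw [e2, ← hu, Matrix.mul_assoc, e1]
      simp only [Matrix.mul_assoc]
    have hY' := fun i => (cf_Y_mem_iff G G' i _).1 (hY i)
    refine ⟨g, fun i => G.P i * D.F0 * (u⁻¹).val * (D.F0' * G'.P' i), fun i => ?_, fun i => ?_,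
      fun i => ?_, fun i => (hY' i).2.1, fun i => (hY' i).1, fun i => (hY' i).2.2⟩
    · change G'.P i * D.F0 * u.val * (D.F0' * G.P' i) * (G.P i * D.F0 * (u⁻¹).val *
        (D.F0' * G'.P' i)) = 1
      rw [Matrix.mul_assoc _ (D.F0' * G.P' i), ← Matrix.mul_assoc (D.F0' * G.P' i),
        ← Matrix.mul_assoc (D.F0' * G.P' i), h.frame', Matrix.one_mul, Matrix.mul_assoc _ u.val,
        ← Matrix.mul_assoc u.val, Units.mul_inv, Matrix.one_mul, h'.frame]
    · change G.P i * D.F0 * (u⁻¹).val * (D.F0' * G'.P' i) * (G'.P i * D.F0 * u.val *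
        (D.F0' * G.P' i)) = 1
      rw [Matrix.mul_assoc _ (D.F0' * G'.P' i), ← Matrix.mul_assoc (D.F0' * G'.P' i),
        ← Matrix.mul_assoc (D.F0' * G'.P' i), h'.frame', Matrix.one_mul,
        Matrix.mul_assoc _ (u⁻¹).val, ← Matrix.mul_assoc (u⁻¹).val, Units.inv_mul, Matrix.one_mul,
        h.frame]
    · simp only [hg]
      rw [h'.P0, h.P'0, Matrix.one_mul, Matrix.mul_one]
      simp only [Matrix.mul_assoc]
      rw [h.P'P, Matrix.mul_one]
  · rintro ⟨g, g', e1, e2, hP, he, hZ, hX⟩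
    have hP' : ∀ i, g 0 * G.P' i = G'.P' i * g i := fun i => by
      refine Leg.cancel_left (h'.P'P i) ?_
      rw [← Matrix.mul_assoc, ← hP, ← Matrix.mul_assoc, h'.PP', Matrix.one_mul, Matrix.mul_assoc,
        h.PP', Matrix.mul_one]
    have hY : ∀ i k, g i * cf (G.Y i) k = cf (G'.Y i) k * g i := fun i k =>
      (cf_Y_mem_iff G G' i (intertwineSub (g i))).2 ⟨hZ i, he i, hX i⟩ k
    refine ⟨⟨D.F0' * g 0 * D.F0, D.F0' * g' 0 * D.F0, ?_, ?_⟩, fun i => ?_⟩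
    · calc D.F0' * g 0 * D.F0 * (D.F0' * g' 0 * D.F0) =
            D.F0' * (g 0 * (D.F0 * D.F0') * g' 0) * D.F0 := by simp only [Matrix.mul_assoc]
        _ = 1 := by rw [F0_mul_F0', Matrix.mul_one, e1, Matrix.mul_one, F0'_mul_F0]
    · calc D.F0' * g' 0 * D.F0 * (D.F0' * g 0 * D.F0) =
            D.F0' * (g' 0 * (D.F0 * D.F0') * g 0) * D.F0 := by simp only [Matrix.mul_assoc]
        _ = 1 := by rw [F0_mul_F0', Matrix.mul_one, e2, Matrix.mul_one, F0'_mul_F0]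
    · rw [conjC_eq_iff]
      intro k
      change D.F0' * g 0 * D.F0 * _ = _ * (D.F0' * g 0 * D.F0)
      rw [cf_conn, cf_conn]
      calc D.F0' * g 0 * D.F0 * (D.F0' * G.P' i * cf (G.Y i) k * (G.P i * D.F0)) =
            D.F0' * g 0 * (D.F0 * D.F0') * G.P' i * cf (G.Y i) k * (G.P i * D.F0) := by
            simp only [Matrix.mul_assoc]
        _ = D.F0' * (g 0 * G.P' i) * cf (G.Y i) k * (G.P i * D.F0) := by
            rw [F0_mul_F0', Matrix.mul_one]; simp only [Matrix.mul_assoc]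
        _ = D.F0' * G'.P' i * (g i * cf (G.Y i) k) * (G.P i * D.F0) := by
            rw [hP']; simp only [Matrix.mul_assoc]
        _ = D.F0' * G'.P' i * cf (G'.Y i) k * (g i * G.P i) * D.F0 := by
            rw [hY]; simp only [Matrix.mul_assoc]
        _ = D.F0' * G'.P' i * cf (G'.Y i) k * G'.P i * ((D.F0 * D.F0') * g 0) * D.F0 := by
            rw [hP, F0_mul_F0', Matrix.one_mul]; simp only [Matrix.mul_assoc]
        _ = _ := by simp only [Matrix.mul_assoc]

end GRep

end ConnData

namespace ConnData

variable {D : ConnData}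

open Polynomial in
theorem aeval_rootProd_xe (i : Fin (D.p+1)) (j : Fin (D.m i)) {k : ℕ} (hk : k ≤ D.e i j) :
    aeval (D.R i j) (rootProd (D.xe i j) k) = (List.ofFn fun l : Fin k =>
      D.R i j - D.xi i j ⟨l.1, lt_of_lt_of_le l.2 hk⟩ •
        (1 : Matrix (Fin (D.nb i j)) (Fin (D.nb i j)) ℂ)).prod := by
  rw [rootProd, Finset.prod_range, ← List.prod_ofFn, map_list_prod, List.map_ofFn]
  congr 2
  funext l
  simp only [Function.comp_apply, map_sub, aeval_X, aeval_C, xe,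
    dif_pos (lt_of_lt_of_le l.2 hk), Algebra.algebraMap_eq_smul_one]

open Polynomial in
theorem aeval_rootProd_xe_eq_zero (i : Fin (D.p+1)) (j : Fin (D.m i)) :
    aeval (D.R i j) (rootProd (D.xe i j) (D.e i j)) = 0 := by
  rw [aeval_rootProd_xe i j le_rfl]; exact D.hxi i j

open Polynomial in
theorem rank_aeval_R (i : Fin (D.p+1)) (j : Fin (D.m i)) (k : ℕ) :
    (aeval (D.R i j) (rootProd (D.xe i j) (k+1))).rank = Fintype.card (D.LV i j k) := by
  by_cases h : k < D.e i j - 1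
  · have e : D.LV i j k ≃ Fin (D.alphaV (D.vleg i j ⟨k, h⟩)) :=
      ⟨fun c => c.2, fun c => ⟨h, c⟩, fun _ => rfl, fun _ => rfl⟩
    rw [Fintype.card_congr e, Fintype.card_fin, aeval_rootProd_xe i j (by omega)]
    rfl
  · have : IsEmpty (D.LV i j k) := ⟨fun c => h c.1⟩
    rw [Fintype.card_eq_zero]
    have : aeval (D.R i j) (rootProd (D.xe i j) (k+1)) = 0 := by
      have hle : D.e i j ≤ k + 1 := by omega
      obtain ⟨d, hd⟩ := Nat.exists_eq_add_of_le hle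
      rw [hd, rootProd, Finset.prod_range_add, map_mul]
      change aeval _ (rootProd _ _) * _ = 0
      rw [aeval_rootProd_xe_eq_zero, zero_mul]
    rw [this, Matrix.rank_zero]

theorem eb_commute_blockDiagonal (i : Fin (D.p+1))
    (M : ∀ j, Matrix (Fin (D.nb i j)) (Fin (D.nb i j)) ℂ) (j : Fin (D.m i)) :
    Matrix.blockDiagonal' M * pr D i j = pr D i j * Matrix.blockDiagonal' M := by
  ext ⟨a, r⟩ ⟨b, s⟩
  rw [pr, eb, Matrix.mul_diagonal, Matrix.diagonal_mul]
  by_cases h : a = b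
  · subst h; simp only [mul_comm]
  · rw [Matrix.blockDiagonal'_apply_ne _ _ _ h, zero_mul, mul_zero]

namespace GRep

variable {G : D.GRep}

open Polynomial in
theorem exists_conj_R (h : G.Valid) (hg : G.Good) (i : Fin (D.p+1)) (j : Fin (D.m i)) :
    ∃ g g' : Matrix (Fin (D.nb i j)) (Fin (D.nb i j)) ℂ, g * g' = 1 ∧ g' * g = 1 ∧
      g * D.R i j = (G.leg i j).N (D.xe i j) * g := by
  have hr : ∀ k, (aeval ((G.leg i j).N (D.xe i j)) (rootProd (D.xe i j) (k+1))).rank =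
      (aeval (D.R i j) (rootProd (D.xe i j) (k+1))).rank := fun k => by
    rw [(hg i j).rank_eq (h.legMom i j), rank_aeval_R]
  have h0 : aeval (D.R i j) (rootProd (D.xe i j) (D.e i j)) = 0 := aeval_rootProd_xe_eq_zero i j
  refine exists_conj_of_rank (D.e i j) (D.xe i j) _ _ (fun k _ => ?_) h0 ?_
  · cases k with
    | zero => simp [rootProd]
    | succ k => rw [hr]
  · have := hr (D.e i j - 1)
    rw [Nat.sub_add_cancel (D.he i j), h0, Matrix.rank_zero] at this
    have hb := LinearMap.range_eq_bot.1 (Submodule.finrank_eq_zero.1 this)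
    exact Matrix.toLin'.injective (by rw [map_zero]; exact hb)

theorem Valid.orbit (h : G.Valid) (hg : G.Good) (i : Fin (D.p+1)) :
    Cong (G.conn i) (D.normalForm i) := by
  choose u u' e1 e2 e3 using exists_conj_R h hg i
  refine Cong.trans ?_ (cong_conj_residue (h := Matrix.blockDiagonal' u)
    (h' := Matrix.blockDiagonal' u') (R' := G.N i) ?_ (eb_commute_blockDiagonal i u) ?_)
  · refine ((D.isPara_Psi i).cong_iff (fun _ hk => conn_isPrincipal i hk) _).2
      ⟨G.P i * D.F0, D.F0' * G.P' i, h.frame i, h.frame' i, G.X i, fun k hk => ?_, fun j => ?_⟩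
    · rw [h.cf_conn_comp, cf_Y_of_le _ _ hk]
    · rw [h.cf_conn_comp, cf_Y_neg_one]
      exact h.diag i j
  · rw [← Matrix.blockDiagonal'_mul]
    simp only [e1]
    exact Matrix.blockDiagonal'_one
  · rw [N, ← Matrix.blockDiagonal'_mul, ← Matrix.blockDiagonal'_mul]
    simp only [e3]

theorem Valid.mbMem (h : G.Valid) (hg : G.Good) (hi : G.BaseIrred) : D.MBMem G.conn :=
  ⟨fun i => isPrincipal_iff_cf.2 fun _ hk => conn_isPrincipal i hk,
    fun i => (D.orbit_iff_cong i _).2 (h.orbit hg i), h.sum_res, h.irred_iff.2 hi⟩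

end GRep

/-- Every point of the moduli space comes from global representation data. -/
theorem exists_gRep {A : Fin (D.p+1) → Matrix (Fin D.n) (Fin D.n) (LaurentSeries ℂ)}
    (hA : D.MBMem A) : ∃ G : D.GRep, G.Valid ∧ G.Good ∧ G.BaseIrred ∧ SimConj A G.conn := by
  obtain ⟨h1, h2, h3, h4⟩ := hA
  have h1 := fun i => isPrincipal_iff_cf.1 (h1 i)
  choose F F' f f' X hX hd using fun i =>
    ((D.isPara_Psi i).cong_iff (h1 i) _).1 ((D.orbit_iff_cong i _).1 (h2 i))
  choose l hl hlg hlN using fun i j => Leg.exists_good (ξ := D.xe i j) (V := D.LV i j) (D.R i j)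
    (rank_aeval_R i j)
  let G : D.GRep :=
    { P := fun i => F i * F' 0
      P' := fun i => F 0 * F' i
      Z := fun i => F i * cf (A i) (-1) * F' i
      X := X
      leg := l }
  have hN : ∀ i, G.N i = Matrix.blockDiagonal' (D.R i) := fun i => by
    unfold GRep.N
    congr 1
    funext j
    exact hlN i j
  have hV : G.Valid :=
    { PP' := fun i => by
        change F i * F' 0 * (F 0 * F' i) = 1
        rw [Matrix.mul_assoc, ← Matrix.mul_assoc (F' 0), f', Matrix.one_mul, f]
      P'P := fun i => by
        change F 0 * F' i * (F i * F' 0) = 1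
        rw [Matrix.mul_assoc, ← Matrix.mul_assoc (F' i), f', Matrix.one_mul, f]
      P0 := f 0
      res := by
        have : ∀ i, F 0 * F' i * (F i * cf (A i) (-1) * F' i) * (F i * F' 0) =
            F 0 * cf (A i) (-1) * F' 0 := fun i => by
          calc _ = F 0 * (F' i * F i) * cf (A i) (-1) * (F' i * F i) * F' 0 := by
                simp only [Matrix.mul_assoc]
            _ = _ := by rw [f', Matrix.mul_one, Matrix.mul_one]
        change ∑ i, F 0 * F' i * (F i * cf (A i) (-1) * F' i) * (F i * F' 0) = 0
        simp only [this]
        rw [← Matrix.sum_mul, ← Matrix.mul_sum, show ∑ i, cf (A i) (-1) = 0 from h3,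
          Matrix.mul_zero, Matrix.zero_mul]
      diag := fun i j => by rw [hN]; exact hd i j
      legMom := hl }
  have hS : SimConj A G.conn := by
    refine ⟨⟨D.F0' * F 0, F' 0 * D.F0, ?_, ?_⟩, fun i => (conjC_eq_iff _ _ _).2 fun k => ?_⟩
    · rw [Matrix.mul_assoc, ← Matrix.mul_assoc (F 0), f, Matrix.one_mul, F0'_mul_F0]
    · rw [Matrix.mul_assoc, ← Matrix.mul_assoc D.F0, F0_mul_F0', Matrix.one_mul, f']
    · have hY : cf (G.Y i) k = F i * cf (A i) k * F' i := by
        rcases lt_trichotomy k (-1) with hk | rfl | hk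
        · rw [GRep.cf_Y_of_le _ _ (by omega), hX i k (by omega)]
        · rw [GRep.cf_Y_neg_one]
        · rw [GRep.cf_Y_of_nonneg _ _ (by omega), h1 i k (by omega), Matrix.mul_zero,
            Matrix.zero_mul]
      rw [GRep.cf_conn, hY]
      change D.F0' * F 0 * _ = D.F0' * (F 0 * F' i) * _ * (F i * F' 0 * D.F0) * (D.F0' * F 0)
      symm
      calc _ = D.F0' * F 0 * (F' i * F i) * cf (A i) k * (F' i * F i) * (F' 0 * (D.F0 * D.F0') * F 0)
            := by simp only [Matrix.mul_assoc]
        _ = _ := by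
          rw [F0_mul_F0', Matrix.mul_one, f', f', Matrix.mul_one, Matrix.mul_one, Matrix.mul_one]
  refine ⟨G, hV, hlg, hV.irred_iff.1 fun W hW => ?_, hS⟩
  obtain ⟨g, hg⟩ := hS
  have hg := fun i => (conjC_eq_iff _ _ _).1 (hg i)
  have key := h4 (W.comap g.val.mulVecLin) fun i k v hv => by
    change g.val *ᵥ (cf (A i) k *ᵥ v) ∈ W
    rw [Matrix.mulVec_mulVec, hg, ← Matrix.mulVec_mulVec]
    exact hW i k _ hv
  have e : ∀ w, g.val *ᵥ ((g⁻¹).val *ᵥ w) = w := fun w => by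
    rw [Matrix.mulVec_mulVec, Units.mul_inv, Matrix.one_mulVec]
  refine key.imp (fun hb => ?_) (fun ht => ?_)
  · refine (Submodule.eq_bot_iff _).2 fun w hw => ?_
    have : (g⁻¹).val *ᵥ w ∈ W.comap g.val.mulVecLin := by
      change g.val *ᵥ _ ∈ W
      rwa [e]
    rw [hb, Submodule.mem_bot] at this
    rw [← e w, this, Matrix.mulVec_zero]
  · refine (Submodule.eq_top_iff').2 fun w => ?_
    have : (g⁻¹).val *ᵥ w ∈ W.comap g.val.mulVecLin := ht ▸ Submodule.mem_top
    have : g.val *ᵥ ((g⁻¹).val *ᵥ w) ∈ W := this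
    rwa [e] at this

end ConnData

theorem sum_dite_param {A K M : Type*} [Fintype A] [Fintype K] [AddCommMonoid M] {p : A → Prop}
    [DecidablePred p] (F : ∀ a, p a → M) (φ : K → A) (hi : Function.Injective φ)
    (hp : ∀ k, p (φ k)) (hs : ∀ a, p a → ∃ k, φ k = a) :
    (∑ a, if h : p a then F a h else 0) = ∑ k, F (φ k) (hp k) := by
  classical
  rw [← Finset.sum_subset (Finset.subset_univ (Finset.univ.image φ)) (fun a _ ha => dif_neg fun h =>
    ha (by obtain ⟨k, rfl⟩ := hs a h; exact Finset.mem_image_of_mem _ (Finset.mem_univ _))),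
    Finset.sum_image fun _ _ _ _ h => hi h]
  exact Finset.sum_congr rfl fun k _ => dif_pos (hp k)

namespace ConnData

variable {D : ConnData}

/-- Extensionality of the moment map formula along a definitional equality of vertices. -/
theorem reindex_finCongr_rfl {n : ℕ} (M : Matrix (Fin n) (Fin n) ℂ) (h h' : n = n) :
    Matrix.reindex (finCongr h) (finCongr h') M = M := by
  ext a b; rfl

variable (x : D.quiv.Rep D.alphaV)

theorem two_le_of_pos {i : Fin (D.p+1)} {j : Fin (D.m i)} (h : 0 < D.e i j - 1) : 2 ≤ D.e i j := by
  omega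

section Accessors

def a1 (j : Fin (D.m 0)) (i : D.IrrNz) (j' : Fin (D.m i.1)) :
    Matrix (Fin (D.nb i.1 j')) (Fin (D.nb 0 j)) ℂ := (x (Sum.inl (j, ⟨i, j'⟩))).1

def b1 (j : Fin (D.m 0)) (i : D.IrrNz) (j' : Fin (D.m i.1)) :
    Matrix (Fin (D.nb 0 j)) (Fin (D.nb i.1 j')) ℂ := (x (Sum.inl (j, ⟨i, j'⟩))).2

def a2 (i : Fin (D.p+1)) (hi : D.isIrr i) (j j' : Fin (D.m i)) (h : j < j') (t : Fin (D.dd i j j')) :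
    Matrix (Fin (D.nb i j')) (Fin (D.nb i j)) ℂ :=
  (x (Sum.inr (Sum.inl ⟨⟨i, hi⟩, ⟨(j, j'), h⟩, t⟩))).1

def b2 (i : Fin (D.p+1)) (hi : D.isIrr i) (j j' : Fin (D.m i)) (h : j < j') (t : Fin (D.dd i j j')) :
    Matrix (Fin (D.nb i j)) (Fin (D.nb i j')) ℂ :=
  (x (Sum.inr (Sum.inl ⟨⟨i, hi⟩, ⟨(j, j'), h⟩, t⟩))).2

def a3 (i : Fin (D.p+1)) (j : Fin (D.m i)) (t : ℕ) (h : t + 1 < D.e i j - 1) :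
    Matrix (Fin (D.alphaV (D.vleg i j ⟨t, by omega⟩))) (Fin (D.alphaV (D.vleg i j ⟨t+1, h⟩))) ℂ :=
  (x (Sum.inr (Sum.inr (Sum.inl ⟨i, j, ⟨t, by omega⟩⟩)))).1

def b3 (i : Fin (D.p+1)) (j : Fin (D.m i)) (t : ℕ) (h : t + 1 < D.e i j - 1) :
    Matrix (Fin (D.alphaV (D.vleg i j ⟨t+1, h⟩))) (Fin (D.alphaV (D.vleg i j ⟨t, by omega⟩))) ℂ :=
  (x (Sum.inr (Sum.inr (Sum.inl ⟨i, j, ⟨t, by omega⟩⟩)))).2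

def a4 (i : Fin (D.p+1)) (hi : D.isIrr i) (j : Fin (D.m i)) (h : 0 < D.e i j - 1) :
    Matrix (Fin (D.nb i j)) (Fin (D.alphaV (D.vleg i j ⟨0, h⟩))) ℂ :=
  (x (Sum.inr (Sum.inr (Sum.inr (Sum.inl ⟨⟨i, hi⟩, ⟨j, two_le_of_pos h⟩⟩))))).1

def b4 (i : Fin (D.p+1)) (hi : D.isIrr i) (j : Fin (D.m i)) (h : 0 < D.e i j - 1) :
    Matrix (Fin (D.alphaV (D.vleg i j ⟨0, h⟩))) (Fin (D.nb i j)) ℂ :=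
  (x (Sum.inr (Sum.inr (Sum.inr (Sum.inl ⟨⟨i, hi⟩, ⟨j, two_le_of_pos h⟩⟩))))).2

def a5 (i : Fin (D.p+1)) (hi : ¬ D.isIrr i) (h : 0 < D.e i (D.j1 i) - 1) (j : Fin (D.m 0)) :
    Matrix (Fin (D.nb 0 j)) (Fin (D.alphaV (D.vleg i (D.j1 i) ⟨0, h⟩))) ℂ :=
  (x (Sum.inr (Sum.inr (Sum.inr (Sum.inr (⟨i, hi, by omega⟩, j)))))).1

def b5 (i : Fin (D.p+1)) (hi : ¬ D.isIrr i) (h : 0 < D.e i (D.j1 i) - 1) (j : Fin (D.m 0)) :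
    Matrix (Fin (D.alphaV (D.vleg i (D.j1 i) ⟨0, h⟩))) (Fin (D.nb 0 j)) ℂ :=
  (x (Sum.inr (Sum.inr (Sum.inr (Sum.inr (⟨i, hi, by omega⟩, j)))))).2

end Accessors

theorem vmid_inj {i i' : D.IrrIdx} {j : Fin (D.m i.1)} {j' : Fin (D.m i'.1)}
    (h : D.vmid i j = D.vmid i' j') : (⟨i, j⟩ : Σ i : D.IrrIdx, Fin (D.m i.1)) = ⟨i', j'⟩ :=
  Sum.inl.inj h

theorem vleg_inj {i i' : Fin (D.p+1)} {j : Fin (D.m i)} {j' : Fin (D.m i')}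
    {k : Fin (D.e i j - 1)} {k' : Fin (D.e i' j' - 1)}
    (h : D.vleg i j k = D.vleg i' j' k') :
    (⟨i, j, k⟩ : Σ i : Fin (D.p+1), Σ j : Fin (D.m i), Fin (D.e i j - 1)) = ⟨i', j', k'⟩ :=
  Sum.inr.inj h

theorem vmid_ne_vleg {i : D.IrrIdx} {j : Fin (D.m i.1)} {i' : Fin (D.p+1)} {j' : Fin (D.m i')}
    {k' : Fin (D.e i' j' - 1)} : D.vmid i j ≠ D.vleg i' j' k' := fun h => by cases h

/-- The contribution to the moment map of the arrows pointing to a vertex. -/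
def muIn (a : D.Vq) : Matrix (Fin (D.alphaV a)) (Fin (D.alphaV a)) ℂ :=
  ∑ e : D.Arr, if h : D.qtgt e = a then
      (Matrix.reindex (finCongr (congrArg D.alphaV h)) (finCongr (congrArg D.alphaV h))
        ((x e).1 * (x e).2)) else 0

/-- The contribution to the moment map of the arrows starting at a vertex. -/
def muOut (a : D.Vq) : Matrix (Fin (D.alphaV a)) (Fin (D.alphaV a)) ℂ :=
  ∑ e : D.Arr, if h : D.qsrc e = a then
      (Matrix.reindex (finCongr (congrArg D.alphaV h)) (finCongr (congrArg D.alphaV h))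
        ((x e).2 * (x e).1)) else 0

theorem mu_eq (a : D.Vq) : FinQuiver.mu (Q := D.quiv) (α := D.alphaV) x a = muIn x a - muOut x a :=
  rfl

theorem muIn_split (a : D.Vq) : muIn x a =
  (∑ e : D.Arr1, if h : D.qtgt (Sum.inl e) = a then
      (Matrix.reindex (finCongr (congrArg D.alphaV h)) (finCongr (congrArg D.alphaV h))
        ((x (Sum.inl e)).1 * (x (Sum.inl e)).2)) else 0) +
  ((∑ e : D.Arr2, if h : D.qtgt (Sum.inr (Sum.inl e)) = a then
      (Matrix.reindex (finCongr (congrArg D.alphaV h)) (finCongr (congrArg D.alphaV h))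
        ((x (Sum.inr (Sum.inl e))).1 * (x (Sum.inr (Sum.inl e))).2)) else 0) +
  ((∑ e : D.Arr3, if h : D.qtgt (Sum.inr (Sum.inr (Sum.inl e))) = a then
      (Matrix.reindex (finCongr (congrArg D.alphaV h)) (finCongr (congrArg D.alphaV h))
        ((x (Sum.inr (Sum.inr (Sum.inl e)))).1 * (x (Sum.inr (Sum.inr (Sum.inl e)))).2)) else 0) +
  ((∑ e : D.Arr4, if h : D.qtgt (Sum.inr (Sum.inr (Sum.inr (Sum.inl e)))) = a then
      (Matrix.reindex (finCongr (congrArg D.alphaV h)) (finCongr (congrArg D.alphaV h))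
        ((x (Sum.inr (Sum.inr (Sum.inr (Sum.inl e))))).1 *
          (x (Sum.inr (Sum.inr (Sum.inr (Sum.inl e))))).2)) else 0) +
  (∑ e : D.Arr5, if h : D.qtgt (Sum.inr (Sum.inr (Sum.inr (Sum.inr e)))) = a then
      (Matrix.reindex (finCongr (congrArg D.alphaV h)) (finCongr (congrArg D.alphaV h))
        ((x (Sum.inr (Sum.inr (Sum.inr (Sum.inr e))))).1 *
          (x (Sum.inr (Sum.inr (Sum.inr (Sum.inr e))))).2)) else 0)))) := by
  unfold muIn
  rw [Fintype.sum_sum_type, Fintype.sum_sum_type, Fintype.sum_sum_type, Fintype.sum_sum_type]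

theorem muOut_split (a : D.Vq) : muOut x a =
  (∑ e : D.Arr1, if h : D.qsrc (Sum.inl e) = a then
      (Matrix.reindex (finCongr (congrArg D.alphaV h)) (finCongr (congrArg D.alphaV h))
        ((x (Sum.inl e)).2 * (x (Sum.inl e)).1)) else 0) +
  ((∑ e : D.Arr2, if h : D.qsrc (Sum.inr (Sum.inl e)) = a then
      (Matrix.reindex (finCongr (congrArg D.alphaV h)) (finCongr (congrArg D.alphaV h))
        ((x (Sum.inr (Sum.inl e))).2 * (x (Sum.inr (Sum.inl e))).1)) else 0) +
  ((∑ e : D.Arr3, if h : D.qsrc (Sum.inr (Sum.inr (Sum.inl e))) = a then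
      (Matrix.reindex (finCongr (congrArg D.alphaV h)) (finCongr (congrArg D.alphaV h))
        ((x (Sum.inr (Sum.inr (Sum.inl e)))).2 * (x (Sum.inr (Sum.inr (Sum.inl e)))).1)) else 0) +
  ((∑ e : D.Arr4, if h : D.qsrc (Sum.inr (Sum.inr (Sum.inr (Sum.inl e)))) = a then
      (Matrix.reindex (finCongr (congrArg D.alphaV h)) (finCongr (congrArg D.alphaV h))
        ((x (Sum.inr (Sum.inr (Sum.inr (Sum.inl e))))).2 *
          (x (Sum.inr (Sum.inr (Sum.inr (Sum.inl e))))).1)) else 0) +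
  (∑ e : D.Arr5, if h : D.qsrc (Sum.inr (Sum.inr (Sum.inr (Sum.inr e)))) = a then
      (Matrix.reindex (finCongr (congrArg D.alphaV h)) (finCongr (congrArg D.alphaV h))
        ((x (Sum.inr (Sum.inr (Sum.inr (Sum.inr e))))).2 *
          (x (Sum.inr (Sum.inr (Sum.inr (Sum.inr e))))).1)) else 0)))) := by
  unfold muOut
  rw [Fintype.sum_sum_type, Fintype.sum_sum_type, Fintype.sum_sum_type, Fintype.sum_sum_type]

/-- The part of the moment map coming from the arrows inside an irregular point. -/
def mu2 (i : Fin (D.p+1)) (hi : D.isIrr i) (j : Fin (D.m i)) : Matrix (Fin (D.nb i j)) (Fin (D.nb i j)) ℂ :=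
  (∑ c : {j' // j' < j}, ∑ t, a2 x i hi c.1 j c.2 t * b2 x i hi c.1 j c.2 t) -
    ∑ c : {j' // j < j'}, ∑ t, b2 x i hi j c.1 c.2 t * a2 x i hi j c.1 c.2 t

/-- The part of the moment map coming from the leg at an irregular point. -/
def mu4 (i : Fin (D.p+1)) (hi : D.isIrr i) (j : Fin (D.m i)) : Matrix (Fin (D.nb i j)) (Fin (D.nb i j)) ℂ :=
  if h : 0 < D.e i j - 1 then a4 x i hi j h * b4 x i hi j h else 0

/-- The part of the moment map coming from the legs at the regular points. -/
def mu5 (j : Fin (D.m 0)) : Matrix (Fin (D.nb 0 j)) (Fin (D.nb 0 j)) ℂ :=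
  ∑ i, if h : ¬ D.isIrr i ∧ 0 < D.e i (D.j1 i) - 1 then a5 x i h.1 h.2 j * b5 x i h.1 h.2 j else 0

theorem sum2_in (i : Fin (D.p+1)) (hi : D.isIrr i) (j : Fin (D.m i)) :
    (∑ e : D.Arr2, if h : D.qtgt (Sum.inr (Sum.inl e)) = D.vmid ⟨i, hi⟩ j then
      (Matrix.reindex (finCongr (congrArg D.alphaV h)) (finCongr (congrArg D.alphaV h))
        ((x (Sum.inr (Sum.inl e))).1 * (x (Sum.inr (Sum.inl e))).2)) else 0) =
    ∑ c : {j' // j' < j}, ∑ t, a2 x i hi c.1 j c.2 t * b2 x i hi c.1 j c.2 t := by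
  rw [← Fintype.sum_sigma' (fun (c : {j' // j' < j}) t => a2 x i hi c.1 j c.2 t * b2 x i hi c.1 j c.2 t)]
  refine (sum_dite_param _ (fun c : (Σ c : {j' // j' < j}, Fin (D.dd i c.1 j)) =>
    (⟨⟨i, hi⟩, ⟨(c.1.1, j), c.1.2⟩, c.2⟩ : D.Arr2)) ?_ (fun _ => rfl) ?_).trans ?_
  · rintro ⟨⟨c, hc⟩, t⟩ ⟨⟨c', hc'⟩, t'⟩ h
    cases h
    rfl
  · rintro ⟨i', ⟨⟨j1, j2⟩, hj⟩, t⟩ h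
    cases vmid_inj h
    exact ⟨⟨⟨j1, hj⟩, t⟩, rfl⟩
  · exact Finset.sum_congr rfl fun _ _ => reindex_finCongr_rfl _ _ _

theorem sum2_out (i : Fin (D.p+1)) (hi : D.isIrr i) (j : Fin (D.m i)) :
    (∑ e : D.Arr2, if h : D.qsrc (Sum.inr (Sum.inl e)) = D.vmid ⟨i, hi⟩ j then
      (Matrix.reindex (finCongr (congrArg D.alphaV h)) (finCongr (congrArg D.alphaV h))
        ((x (Sum.inr (Sum.inl e))).2 * (x (Sum.inr (Sum.inl e))).1)) else 0) =
    ∑ c : {j' // j < j'}, ∑ t, b2 x i hi j c.1 c.2 t * a2 x i hi j c.1 c.2 t := by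
  rw [← Fintype.sum_sigma' (fun (c : {j' // j < j'}) t => b2 x i hi j c.1 c.2 t * a2 x i hi j c.1 c.2 t)]
  refine (sum_dite_param _ (fun c : (Σ c : {j' // j < j'}, Fin (D.dd i j c.1)) =>
    (⟨⟨i, hi⟩, ⟨(j, c.1.1), c.1.2⟩, c.2⟩ : D.Arr2)) ?_ (fun _ => rfl) ?_).trans ?_
  · rintro ⟨⟨c, hc⟩, t⟩ ⟨⟨c', hc'⟩, t'⟩ h
    cases h
    rfl
  · rintro ⟨i', ⟨⟨j1, j2⟩, hj⟩, t⟩ h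
    cases vmid_inj h
    exact ⟨⟨⟨j2, hj⟩, t⟩, rfl⟩
  · exact Finset.sum_congr rfl fun _ _ => reindex_finCongr_rfl _ _ _

theorem sum4_in (i : Fin (D.p+1)) (hi : D.isIrr i) (j : Fin (D.m i)) :
    (∑ e : D.Arr4, if h : D.qtgt (Sum.inr (Sum.inr (Sum.inr (Sum.inl e)))) = D.vmid ⟨i, hi⟩ j then
      (Matrix.reindex (finCongr (congrArg D.alphaV h)) (finCongr (congrArg D.alphaV h))
        ((x (Sum.inr (Sum.inr (Sum.inr (Sum.inl e))))).1 *
          (x (Sum.inr (Sum.inr (Sum.inr (Sum.inl e))))).2)) else 0) = mu4 x i hi j := by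
  unfold mu4
  split_ifs with he
  · have h2 := two_le_of_pos he
    refine (sum_dite_param (p := fun e : D.Arr4 =>
      D.qtgt (Sum.inr (Sum.inr (Sum.inr (Sum.inl e)))) = D.vmid ⟨i, hi⟩ j) _ (fun _ : Unit => (⟨⟨i, hi⟩, ⟨j, h2⟩⟩ : D.Arr4))
      (fun _ _ _ => rfl) (fun _ => rfl) ?_).trans ?_
    · rintro ⟨i', ⟨j', hj⟩⟩ h
      cases vmid_inj h
      exact ⟨(), rfl⟩
    · rw [Fintype.sum_unique]
      exact reindex_finCongr_rfl _ _ _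
  · refine Finset.sum_eq_zero fun e _ => dif_neg fun h => ?_
    obtain ⟨i', ⟨j', hj⟩⟩ := e
    cases vmid_inj h
    exact he (Nat.sub_pos_of_lt hj)

theorem mu_nz (i : D.IrrNz) (j : Fin (D.m i.1)) :
    FinQuiver.mu (Q := D.quiv) (α := D.alphaV) x (D.vmid ⟨i.1, i.2.1⟩ j) =
      ∑ j0, a1 x j0 i j * b1 x j0 i j + mu2 x i.1 i.2.1 j + mu4 x i.1 i.2.1 j := by
  rw [mu_eq, muIn_split, muOut_split, sum2_in, sum2_out, sum4_in, mu2]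
  have h1 : (∑ e : D.Arr1, if h : D.qtgt (Sum.inl e) = D.vmid ⟨i.1, i.2.1⟩ j then
      (Matrix.reindex (finCongr (congrArg D.alphaV h)) (finCongr (congrArg D.alphaV h))
        ((x (Sum.inl e)).1 * (x (Sum.inl e)).2)) else 0) =
      ∑ j0, a1 x j0 i j * b1 x j0 i j := by
    refine (sum_dite_param _ (fun j0 => ((j0, ⟨i, j⟩) : D.Arr1)) ?_ (fun _ => rfl) ?_).trans ?_
    · intro j0 j0' h
      cases h
      rfl
    · rintro ⟨j0, ⟨⟨i', hi'⟩, j'⟩⟩ h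
      cases vmid_inj h
      exact ⟨j0, rfl⟩
    · exact Finset.sum_congr rfl fun _ _ => reindex_finCongr_rfl _ _ _
  rw [h1]
  rw [Finset.sum_eq_zero (s := (Finset.univ : Finset D.Arr3)) fun e _ => dif_neg fun h =>
      vmid_ne_vleg h.symm,
    Finset.sum_eq_zero (s := (Finset.univ : Finset D.Arr5)) fun e _ => dif_neg fun h => by
      have := congrArg (fun s => s.1.1) (vmid_inj h)
      exact i.2.2 this.symm,
    Finset.sum_eq_zero (s := (Finset.univ : Finset D.Arr1)) fun e _ => dif_neg fun h => by
      have := congrArg (fun s => s.1.1) (vmid_inj h)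
      exact i.2.2 this.symm,
    Finset.sum_eq_zero (s := (Finset.univ : Finset D.Arr3)) fun e _ => dif_neg fun h =>
      vmid_ne_vleg h.symm,
    Finset.sum_eq_zero (s := (Finset.univ : Finset D.Arr4)) fun e _ => dif_neg fun h =>
      vmid_ne_vleg h.symm,
    Finset.sum_eq_zero (s := (Finset.univ : Finset D.Arr5)) fun e _ => dif_neg fun h =>
      vmid_ne_vleg h.symm]
  abel

theorem mu_zero (j : Fin (D.m 0)) :
    FinQuiver.mu (Q := D.quiv) (α := D.alphaV) x (D.vmid0 j) =
      mu2 x 0 (Or.inr rfl) j + mu4 x 0 (Or.inr rfl) j + mu5 x j -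
        ∑ i : D.IrrNz, ∑ j', b1 x j i j' * a1 x j i j' := by
  change FinQuiver.mu (Q := D.quiv) (α := D.alphaV) x (D.vmid ⟨0, Or.inr rfl⟩ j) = _
  rw [mu_eq, muIn_split, muOut_split, sum2_in x 0 (Or.inr rfl) j,
    sum2_out x 0 (Or.inr rfl) j, sum4_in x 0 (Or.inr rfl) j]
  unfold mu2
  have h1 : (∑ e : D.Arr1, if h : D.qsrc (Sum.inl e) = D.vmid ⟨0, Or.inr rfl⟩ j then
      (Matrix.reindex (finCongr (congrArg D.alphaV h)) (finCongr (congrArg D.alphaV h))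
        ((x (Sum.inl e)).2 * (x (Sum.inl e)).1)) else 0) =
      ∑ i : D.IrrNz, ∑ j', b1 x j i j' * a1 x j i j' := by
    rw [← Fintype.sum_sigma' (fun (i : D.IrrNz) j' => b1 x j i j' * a1 x j i j')]
    refine (sum_dite_param _ (fun c => ((j, c) : D.Arr1)) ?_ (fun _ => rfl) ?_).trans ?_
    · intro j0 j0' h
      cases h
      rfl
    · rintro ⟨j0, c⟩ h
      cases vmid_inj h
      exact ⟨c, rfl⟩
    · exact Finset.sum_congr rfl fun _ _ => reindex_finCongr_rfl _ _ _
  have h5 : (∑ e : D.Arr5, if h : D.qtgt (Sum.inr (Sum.inr (Sum.inr (Sum.inr e)))) =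
        D.vmid ⟨0, Or.inr rfl⟩ j then
      (Matrix.reindex (finCongr (congrArg D.alphaV h)) (finCongr (congrArg D.alphaV h))
        ((x (Sum.inr (Sum.inr (Sum.inr (Sum.inr e))))).1 *
          (x (Sum.inr (Sum.inr (Sum.inr (Sum.inr e))))).2)) else 0) = mu5 x j := by
    unfold mu5
    have e1 := sum_dite_param (p := fun i => ¬ D.isIrr i ∧ 0 < D.e i (D.j1 i) - 1)
      (fun i h => a5 x i h.1 h.2 j * b5 x i h.1 h.2 j)
      (fun c : {i : Fin (D.p+1) // ¬ D.isIrr i ∧ 2 ≤ D.e i (D.j1 i)} => c.1)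
      Subtype.val_injective (fun c => ⟨c.2.1, by have := c.2.2; omega⟩)
      (fun i h => ⟨⟨i, h.1, by omega⟩, rfl⟩)
    rw [e1]
    refine (sum_dite_param _ (fun c => ((c, j) : D.Arr5)) ?_ (fun _ => rfl) ?_).trans ?_
    · intro j0 j0' h
      cases h
      rfl
    · rintro ⟨c, j'⟩ h
      cases vmid_inj h
      exact ⟨c, rfl⟩
    · exact Finset.sum_congr rfl fun _ _ => reindex_finCongr_rfl _ _ _
  rw [h1, h5]
  rw [Finset.sum_eq_zero (s := (Finset.univ : Finset D.Arr1)) fun e _ => dif_neg fun h => by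
      have := congrArg (fun s => s.1.1) (vmid_inj h)
      exact e.2.1.2.2 this,
    Finset.sum_eq_zero (s := (Finset.univ : Finset D.Arr3)) fun e _ => dif_neg fun h =>
      vmid_ne_vleg h.symm,
    Finset.sum_eq_zero (s := (Finset.univ : Finset D.Arr3)) fun e _ => dif_neg fun h =>
      vmid_ne_vleg h.symm,
    Finset.sum_eq_zero (s := (Finset.univ : Finset D.Arr4)) fun e _ => dif_neg fun h =>
      vmid_ne_vleg h.symm,
    Finset.sum_eq_zero (s := (Finset.univ : Finset D.Arr5)) fun e _ => dif_neg fun h =>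
      vmid_ne_vleg h.symm]
  abel

end ConnData

namespace ConnData

variable {D : ConnData} (x : D.quiv.Rep D.alphaV)

theorem muIn_leg (i : Fin (D.p+1)) (j : Fin (D.m i)) (k : ℕ) (hk : k < D.e i j - 1) :
    muIn x (D.vleg i j ⟨k, hk⟩) =
      if h : k + 1 < D.e i j - 1 then a3 x i j k h * b3 x i j k h else 0 := by
  rw [muIn_split,
    Finset.sum_eq_zero (s := (Finset.univ : Finset D.Arr1)) fun e _ => dif_neg vmid_ne_vleg,
    Finset.sum_eq_zero (s := (Finset.univ : Finset D.Arr2)) fun e _ => dif_neg vmid_ne_vleg,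
    Finset.sum_eq_zero (s := (Finset.univ : Finset D.Arr4)) fun e _ => dif_neg vmid_ne_vleg,
    Finset.sum_eq_zero (s := (Finset.univ : Finset D.Arr5)) fun e _ => dif_neg vmid_ne_vleg,
    zero_add, zero_add, add_zero, add_zero]
  split_ifs with he
  · refine (sum_dite_param (p := fun e : D.Arr3 =>
      D.qtgt (Sum.inr (Sum.inr (Sum.inl e))) = D.vleg i j ⟨k, hk⟩) _
      (fun _ : Unit => (⟨i, j, ⟨k, by omega⟩⟩ : D.Arr3))
      (fun _ _ _ => rfl) (fun _ => rfl) ?_).trans ?_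
    · rintro ⟨i', j', t⟩ h
      cases vleg_inj h
      exact ⟨(), rfl⟩
    · rw [Fintype.sum_unique]
      exact reindex_finCongr_rfl _ _ _
  · refine Finset.sum_eq_zero fun e _ => dif_neg fun h => ?_
    obtain ⟨i', j', t, ht⟩ := e
    cases vleg_inj h
    omega

theorem src4_ne_succ (e : D.Arr4) {i : Fin (D.p+1)} {j : Fin (D.m i)} {k : ℕ}
    (hk : k + 1 < D.e i j - 1) : D.qsrc (Sum.inr (Sum.inr (Sum.inr (Sum.inl e)))) ≠ D.vleg i j ⟨k + 1, hk⟩ := fun h => by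
  obtain ⟨i', j'⟩ := e
  cases vleg_inj h

theorem src5_ne_succ (e : D.Arr5) {i : Fin (D.p+1)} {j : Fin (D.m i)} {k : ℕ}
    (hk : k + 1 < D.e i j - 1) : D.qsrc (Sum.inr (Sum.inr (Sum.inr (Sum.inr e)))) ≠ D.vleg i j ⟨k + 1, hk⟩ := fun h => by
  obtain ⟨i', j'⟩ := e
  cases vleg_inj h

theorem src3_ne_zero (e : D.Arr3) {i : Fin (D.p+1)} {j : Fin (D.m i)} (hk : 0 < D.e i j - 1) :
    D.qsrc (Sum.inr (Sum.inr (Sum.inl e))) ≠ D.vleg i j ⟨0, hk⟩ := fun h => by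
  obtain ⟨i', j', t⟩ := e
  cases vleg_inj h

theorem src5_ne (e : D.Arr5) {i : Fin (D.p+1)} (hi : D.isIrr i) {j : Fin (D.m i)}
    (k : Fin (D.e i j - 1)) : D.qsrc (Sum.inr (Sum.inr (Sum.inr (Sum.inr e)))) ≠ D.vleg i j k := fun h => by
  obtain ⟨⟨i', hi'⟩, j'⟩ := e
  have := congrArg Sigma.fst (vleg_inj h)
  exact hi'.1 (by rw [show i' = i from this]; exact hi)

theorem src4_ne (e : D.Arr4) {i : Fin (D.p+1)} (hi : ¬ D.isIrr i) {j : Fin (D.m i)}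
    (k : Fin (D.e i j - 1)) : D.qsrc (Sum.inr (Sum.inr (Sum.inr (Sum.inl e)))) ≠ D.vleg i j k := fun h => by
  obtain ⟨⟨i', hi'⟩, j'⟩ := e
  have := congrArg Sigma.fst (vleg_inj h)
  exact hi (by rw [← show i' = i from this]; exact hi')

theorem muOut_leg_succ (i : Fin (D.p+1)) (j : Fin (D.m i)) (k : ℕ) (hk : k + 1 < D.e i j - 1) :
    muOut x (D.vleg i j ⟨k + 1, hk⟩) = b3 x i j k hk * a3 x i j k hk := by
  rw [muOut_split,
    Finset.sum_eq_zero (s := (Finset.univ : Finset D.Arr1)) fun e _ => dif_neg vmid_ne_vleg,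
    Finset.sum_eq_zero (s := (Finset.univ : Finset D.Arr2)) fun e _ => dif_neg vmid_ne_vleg,
    Finset.sum_eq_zero (s := (Finset.univ : Finset D.Arr4)) fun e _ => dif_neg (src4_ne_succ e hk),
    Finset.sum_eq_zero (s := (Finset.univ : Finset D.Arr5)) fun e _ => dif_neg (src5_ne_succ e hk),
    zero_add, zero_add, add_zero, add_zero]
  refine (sum_dite_param (p := fun e : D.Arr3 =>
      D.qsrc (Sum.inr (Sum.inr (Sum.inl e))) = D.vleg i j ⟨k + 1, hk⟩) _
      (fun _ : Unit => (⟨i, j, ⟨k, by omega⟩⟩ : D.Arr3))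
      (fun _ _ _ => rfl) (fun _ => rfl) ?_).trans ?_
  · rintro ⟨i', j', t⟩ h
    cases vleg_inj h
    exact ⟨(), rfl⟩
  · rw [Fintype.sum_unique]
    exact reindex_finCongr_rfl _ _ _

theorem muOut_leg_irr (i : Fin (D.p+1)) (hi : D.isIrr i) (j : Fin (D.m i))
    (hk : 0 < D.e i j - 1) :
    muOut x (D.vleg i j ⟨0, hk⟩) = b4 x i hi j hk * a4 x i hi j hk := by
  rw [muOut_split,
    Finset.sum_eq_zero (s := (Finset.univ : Finset D.Arr1)) fun e _ => dif_neg vmid_ne_vleg,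
    Finset.sum_eq_zero (s := (Finset.univ : Finset D.Arr2)) fun e _ => dif_neg vmid_ne_vleg,
    Finset.sum_eq_zero (s := (Finset.univ : Finset D.Arr3)) fun e _ => dif_neg (src3_ne_zero e hk),
    Finset.sum_eq_zero (s := (Finset.univ : Finset D.Arr5)) fun e _ => dif_neg (src5_ne e hi _),
    zero_add, zero_add, zero_add, add_zero]
  have h2 := two_le_of_pos hk
  refine (sum_dite_param (p := fun e : D.Arr4 =>
      D.qsrc (Sum.inr (Sum.inr (Sum.inr (Sum.inl e)))) = D.vleg i j ⟨0, hk⟩) _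
      (fun _ : Unit => (⟨⟨i, hi⟩, ⟨j, h2⟩⟩ : D.Arr4))
      (fun _ _ _ => rfl) (fun _ => rfl) ?_).trans ?_
  · rintro ⟨⟨i', hi'⟩, ⟨j', hj⟩⟩ h
    cases vleg_inj h
    exact ⟨(), rfl⟩
  · rw [Fintype.sum_unique]
    exact reindex_finCongr_rfl _ _ _

theorem muOut_leg_reg (i : Fin (D.p+1)) (hi : ¬ D.isIrr i) (hk : 0 < D.e i (D.j1 i) - 1) :
    muOut x (D.vleg i (D.j1 i) ⟨0, hk⟩) = ∑ j, b5 x i hi hk j * a5 x i hi hk j := by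
  rw [muOut_split,
    Finset.sum_eq_zero (s := (Finset.univ : Finset D.Arr1)) fun e _ => dif_neg vmid_ne_vleg,
    Finset.sum_eq_zero (s := (Finset.univ : Finset D.Arr2)) fun e _ => dif_neg vmid_ne_vleg,
    Finset.sum_eq_zero (s := (Finset.univ : Finset D.Arr3)) fun e _ => dif_neg (src3_ne_zero e hk),
    Finset.sum_eq_zero (s := (Finset.univ : Finset D.Arr4)) fun e _ => dif_neg (src4_ne e hi _),
    zero_add, zero_add, zero_add, zero_add]
  have h2 := two_le_of_pos hk
  refine (sum_dite_param (p := fun e : D.Arr5 =>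
      D.qsrc (Sum.inr (Sum.inr (Sum.inr (Sum.inr e)))) = D.vleg i (D.j1 i) ⟨0, hk⟩) _
      (fun j => ((⟨i, hi, h2⟩, j) : D.Arr5)) ?_ (fun _ => rfl) ?_).trans ?_
  · intro j0 j0' h
    cases h
    rfl
  · rintro ⟨⟨i', hi'⟩, j'⟩ h
    have : i' = i := congrArg Sigma.fst (vleg_inj h)
    subst this
    exact ⟨j', rfl⟩
  · exact Finset.sum_congr rfl fun _ _ => reindex_finCongr_rfl _ _ _

end ConnData

section BlockInclusions

variable {κ : Type} [Fintype κ] [DecidableEq κ] {ν : κ → Type} [∀ j, Fintype (ν j)]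
  [∀ j, DecidableEq (ν j)]

variable (ν) in
/-- The inclusion of a block. -/
def ic (j : κ) : Matrix (Σ j, ν j) (ν j) ℂ := (1 : Matrix (Σ j, ν j) _ ℂ).submatrix id (Sigma.mk j)

variable (ν) in
/-- The projection to a block. -/
def ic' (j : κ) : Matrix (ν j) (Σ j, ν j) ℂ := (1 : Matrix (Σ j, ν j) _ ℂ).submatrix (Sigma.mk j) id

theorem mul_ic {α : Type} [Fintype α] (M : Matrix α (Σ j, ν j) ℂ) (j : κ) :
    M * ic ν j = M.submatrix id (Sigma.mk j) := by
  ext a b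
  simp [ic, Matrix.mul_apply, Matrix.one_apply]

theorem ic'_mul {α : Type} [Fintype α] (M : Matrix (Σ j, ν j) α ℂ) (j : κ) :
    ic' ν j * M = M.submatrix (Sigma.mk j) id := by
  ext a b
  simp [ic', Matrix.mul_apply, Matrix.one_apply]

theorem ic'_mul_ic (j : κ) : ic' ν j * ic ν j = (1 : Matrix (ν j) (ν j) ℂ) := by
  rw [mul_ic, ic']
  ext a b
  simp [Matrix.one_apply]

theorem ic'_mul_ic_of_ne {j j' : κ} (h : j ≠ j') : ic' ν j * ic ν j' = (0 : Matrix (ν j) (ν j') ℂ) := by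
  rw [mul_ic, ic']
  ext a b
  simp [h]

theorem ic_mul_ic'_apply (j : κ) (a b : Σ j, ν j) :
    (ic ν j * ic' ν j) a b = if a = b ∧ a.1 = j then 1 else 0 := by
  obtain ⟨j1, a⟩ := a
  rw [Matrix.mul_apply]
  simp only [ic, ic', Matrix.submatrix_apply, id, Matrix.one_apply]
  by_cases h : j1 = j
  · subst h
    rw [Finset.sum_eq_single a]
    · simp
    · intro c _ hc
      rw [if_neg (by simpa using hc.symm), zero_mul]
    · simp
  · rw [if_neg (by simp [h]), Finset.sum_eq_zero]
    intro c _
    rw [if_neg (by simp [h]), zero_mul]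

theorem ic_mul_ic' {m : ℕ} {ν : Fin m → Type} [∀ j, Fintype (ν j)] [∀ j, DecidableEq (ν j)]
    (j : Fin m) : ic ν j * ic' ν j = eb (Sigma.fst : (Σ j, ν j) → Fin m) j := by
  ext a b
  rw [ic_mul_ic'_apply, eb, Matrix.diagonal_apply]
  by_cases h : a = b <;> simp [h]

theorem sum_ic_mul_ic' : ∑ j, ic ν j * ic' ν j = (1 : Matrix (Σ j, ν j) (Σ j, ν j) ℂ) := by
  ext a b
  rw [Matrix.sum_apply]
  simp only [ic_mul_ic'_apply, Matrix.one_apply]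
  by_cases h : a = b <;> simp [h]

theorem ext_ic_left {α : Type} [Fintype α] {M M' : Matrix (Σ j, ν j) α ℂ}
    (h : ∀ j, ic' ν j * M = ic' ν j * M') : M = M' := by
  ext ⟨j, a⟩ b
  have := congrFun (congrFun (h j) a) b
  rwa [ic'_mul, ic'_mul] at this

theorem ext_ic_right {α : Type} [Fintype α] {M M' : Matrix α (Σ j, ν j) ℂ}
    (h : ∀ j, M * ic ν j = M' * ic ν j) : M = M' := by
  ext a ⟨j, b⟩
  have := congrFun (congrFun (h j) a) b
  rwa [mul_ic, mul_ic] at this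

variable {κ' : Type} [Fintype κ'] [DecidableEq κ'] {ν' : κ' → Type} [∀ j, Fintype (ν' j)]
  [∀ j, DecidableEq (ν' j)]

theorem exists_blocks (F : ∀ j j', Matrix (ν j) (ν' j') ℂ) :
    ∃ M : Matrix (Σ j, ν j) (Σ j, ν' j) ℂ, ∀ j j', ic' ν j * M * ic ν' j' = F j j' :=
  ⟨Matrix.of fun a b => F a.1 b.1 a.2 b.2, fun j j' => by rw [ic'_mul, mul_ic]; rfl⟩

theorem exists_rows {α : Type} [Fintype α] (F : ∀ j, Matrix (ν j) α ℂ) :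
    ∃ M : Matrix (Σ j, ν j) α ℂ, ∀ j, ic' ν j * M = F j :=
  ⟨Matrix.of fun a b => F a.1 a.2 b, fun j => by rw [ic'_mul]; rfl⟩

theorem exists_cols {α : Type} [Fintype α] (F : ∀ j, Matrix α (ν j) ℂ) :
    ∃ M : Matrix α (Σ j, ν j) ℂ, ∀ j, M * ic ν j = F j :=
  ⟨Matrix.of fun a b => F b.1 a b.2, fun j => by rw [mul_ic]; rfl⟩

theorem ic'_mul_blockDiagonal (F : ∀ j, Matrix (ν j) (ν j) ℂ) (j : κ) :
    ic' ν j * Matrix.blockDiagonal' F = F j * ic' ν j := by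
  refine ext_ic_right fun j' => ?_
  rw [Matrix.mul_assoc (F j)]
  by_cases h : j = j'
  · subst h
    rw [ic'_mul_ic, Matrix.mul_one, ic'_mul, mul_ic]
    ext a b
    simp
  · rw [ic'_mul_ic_of_ne h, Matrix.mul_zero, ic'_mul, mul_ic]
    ext a b
    simp [Matrix.blockDiagonal'_apply, h]

theorem blockDiagonal_mul_ic (F : ∀ j, Matrix (ν j) (ν j) ℂ) (j : κ) :
    Matrix.blockDiagonal' F * ic ν j = ic ν j * F j := by
  refine ext_ic_left fun j' => ?_
  rw [← Matrix.mul_assoc, ic'_mul_blockDiagonal, Matrix.mul_assoc, ← Matrix.mul_assoc (ic' ν j')]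
  by_cases h : j' = j
  · subst h
    rw [ic'_mul_ic, Matrix.mul_one, Matrix.one_mul]
  · rw [ic'_mul_ic_of_ne h, Matrix.mul_zero, Matrix.zero_mul]

/-- Vectors are determined by their blocks. -/
theorem sum_ic_mulVec (w : (Σ j, ν j) → ℂ) : ∑ j, ic ν j *ᵥ (ic' ν j *ᵥ w) = w := by
  simp only [Matrix.mulVec_mulVec]
  rw [← Matrix.sum_mulVec, sum_ic_mul_ic', Matrix.one_mulVec]

end BlockInclusions

section ConjugationByCoordinates

variable {A : Prop} {τ : A → Type} [∀ h, Fintype (τ h)] [∀ h, DecidableEq (τ h)] [Decidable A]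

variable (τ) in
/-- Coordinates on a leg vertex. -/
def lm (h : A) : Matrix (Σ' h, τ h) (τ h) ℂ := fun a b => if a = ⟨h, b⟩ then 1 else 0

variable (τ) in
/-- Inverse coordinates on a leg vertex. -/
def lm' (h : A) : Matrix (τ h) (Σ' h, τ h) ℂ := fun a b => if ⟨h, a⟩ = b then 1 else 0

theorem lm'_mul_lm (h : A) : lm' τ h * lm τ h = 1 := by
  ext a b
  rw [Matrix.mul_apply]
  rw [Finset.sum_eq_single ⟨h, a⟩]
  · simp [lm, lm', Matrix.one_apply]
  · intro c _ hc
    simp [lm', hc.symm]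
  · simp

theorem lm_mul_lm' (h : A) : lm τ h * lm' τ h = 1 := by
  ext ⟨_, a⟩ ⟨_, b⟩
  rw [Matrix.mul_apply]
  rw [Finset.sum_eq_single a]
  · simp [lm, lm', Matrix.one_apply]
  · intro c _ hc
    simp [lm, hc.symm]
  · simp

end ConjugationByCoordinates

namespace ConnData

variable {D : ConnData}

variable (D) in
/-- The inclusion of a block of the standard frame. -/
abbrev inc (i : Fin (D.p+1)) (j : Fin (D.m i)) : Matrix (D.Idx i) (Fin (D.nb i j)) ℂ :=
  ic (fun j => Fin (D.nb i j)) j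

variable (D) in
/-- The projection to a block of the standard frame. -/
abbrev inc' (i : Fin (D.p+1)) (j : Fin (D.m i)) : Matrix (Fin (D.nb i j)) (D.Idx i) ℂ :=
  ic' (fun j => Fin (D.nb i j)) j

variable (D) in
/-- Coordinates on a leg vertex. -/
abbrev lg (i : Fin (D.p+1)) (j : Fin (D.m i)) (k : ℕ) (h : k < D.e i j - 1) :
    Matrix (D.LV i j k) (Fin (D.alphaV (D.vleg i j ⟨k, h⟩))) ℂ :=
  lm (fun h => Fin (D.alphaV (D.vleg i j ⟨k, h⟩))) h

variable (D) in
/-- Inverse coordinates on a leg vertex. -/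
abbrev lg' (i : Fin (D.p+1)) (j : Fin (D.m i)) (k : ℕ) (h : k < D.e i j - 1) :
    Matrix (Fin (D.alphaV (D.vleg i j ⟨k, h⟩))) (D.LV i j k) ℂ :=
  lm' (fun h => Fin (D.alphaV (D.vleg i j ⟨k, h⟩))) h

theorem isEmpty_LV {i : Fin (D.p+1)} {j : Fin (D.m i)} {k : ℕ} (h : ¬ k < D.e i j - 1) :
    IsEmpty (D.LV i j k) := ⟨fun a => h a.1⟩

theorem mul_eq_zero_of_leg {i : Fin (D.p+1)} {j : Fin (D.m i)} {k : ℕ} (h : ¬ k < D.e i j - 1)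
    {α β : Type} (M : Matrix α (D.LV i j k) ℂ) (M' : Matrix (D.LV i j k) β ℂ) : M * M' = 0 := by
  have := isEmpty_LV h
  ext a b
  simp [Matrix.mul_apply]

theorem m_eq_one {i : Fin (D.p+1)} (hi : ¬ D.isIrr i) : D.m i = 1 := by
  have := D.hm i
  have : ¬ 1 < D.m i := fun h => hi (Or.inl h)
  omega

theorem eq_j1 {i : Fin (D.p+1)} (hi : ¬ D.isIrr i) (j : Fin (D.m i)) : j = D.j1 i := by
  have h := m_eq_one hi
  have := j.isLt
  exact Fin.ext (show j.1 = 0 by omega)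

theorem ne_zero_of_not_isIrr {i : Fin (D.p+1)} (hi : ¬ D.isIrr i) : i ≠ 0 := fun h => hi (Or.inr h)

theorem inc_mul_inc' (i : Fin (D.p+1)) (j : Fin (D.m i)) : D.inc i j * D.inc' i j = pr D i j :=
  ic_mul_ic' j

theorem inc'_mul_inc (i : Fin (D.p+1)) (j : Fin (D.m i)) : D.inc' i j * D.inc i j = 1 :=
  ic'_mul_ic j

theorem sum_inc_mul_inc' (i : Fin (D.p+1)) : ∑ j, D.inc i j * D.inc' i j = 1 :=
  sum_ic_mul_ic'

theorem inc_mul_inc'_reg {i : Fin (D.p+1)} (hi : ¬ D.isIrr i) :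
    D.inc i (D.j1 i) * D.inc' i (D.j1 i) = 1 := by
  rw [← sum_inc_mul_inc' i]
  exact (Fintype.sum_eq_single (f := fun j => D.inc i j * D.inc' i j) (D.j1 i)
    fun j hj => (hj (eq_j1 hi j)).elim).symm

theorem pr_reg {i : Fin (D.p+1)} (hi : ¬ D.isIrr i) (j : Fin (D.m i)) : pr D i j = 1 := by
  rw [eq_j1 hi j, ← inc_mul_inc', inc_mul_inc'_reg hi]

variable (D) in
/-- The shift parameters indexed by all points. -/
def ve (v : Fin D.p → ℂ) (i : Fin (D.p+1)) : ℂ := if h : i = 0 then 0 else v (i.pred h)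

/-- The maps in the direction opposite to the frames. -/
def GRep.Q (G : D.GRep) (v : Fin D.p → ℂ) (i : Fin (D.p+1)) : Matrix (D.Idx 0) (D.Idx i) ℂ :=
  G.P' i * (D.ve v i • 1 - G.Z i)

/-- A quiver representation is given by global representation data. -/
structure Realizes (v : Fin D.p → ℂ) (x : D.quiv.Rep D.alphaV) (G : D.GRep) : Prop where
  protected a1 : ∀ (i : D.IrrNz) j j', a1 x j i j' = D.inc' i.1 j' * G.P i.1 * D.inc 0 j
  protected b1 : ∀ (i : D.IrrNz) j j', b1 x j i j' = D.inc' 0 j * G.Q v i.1 * D.inc i.1 j'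
  protected a2 : ∀ i hi j j' h t, a2 x i hi j j' h t = D.inc' i j' * G.X i t * D.inc i j
  protected b2 : ∀ i hi j j' h t, b2 x i hi j j' h t = D.inc' i j * G.X i t * D.inc i j'
  protected a3 : ∀ i j k h, a3 x i j k h = D.lg' i j k (by omega) * (G.leg i j).a k * D.lg i j (k+1) h
  protected b3 : ∀ i j k h, b3 x i j k h = D.lg' i j (k+1) h * (G.leg i j).b k * D.lg i j k (by omega)
  protected a4 : ∀ i hi j h, a4 x i hi j h = (G.leg i j).a0 * D.lg i j 0 h
  protected b4 : ∀ i hi j h, b4 x i hi j h = D.lg' i j 0 h * (G.leg i j).b0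
  protected a5 : ∀ i hi h j, a5 x i hi h j =
    D.inc' 0 j * (G.P' i * D.inc i (D.j1 i) * (G.leg i (D.j1 i)).a0) * D.lg i (D.j1 i) 0 h
  protected b5 : ∀ i hi h j, b5 x i hi h j =
    D.lg' i (D.j1 i) 0 h * ((G.leg i (D.j1 i)).b0 * D.inc' i (D.j1 i) * G.P i) * D.inc 0 j

/-- The equations on global representation data that do not involve the moment map. -/
structure GRep.Frames (G : D.GRep) : Prop where
  PP' : ∀ i, G.P i * G.P' i = 1
  P'P : ∀ i, G.P' i * G.P i = 1
  P0 : G.P 0 = 1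
  res : ∑ i, G.P' i * G.Z i * G.P i = 0
  reg : ∀ i, ¬ D.isIrr i → G.Z i = G.N i

theorem sum_mul_inc {α β : Type} [Fintype α] [Fintype β] (i : Fin (D.p+1)) (M : Matrix α (D.Idx i) ℂ)
    (M' : Matrix (D.Idx i) β ℂ) :
    ∑ j, (M * D.inc i j) * (D.inc' i j * M') = M * M' := by
  calc _ = ∑ j, M * (D.inc i j * D.inc' i j * M') := by simp only [Matrix.mul_assoc]
    _ = M * ((∑ j, D.inc i j * D.inc' i j) * M') := by rw [Matrix.sum_mul, Matrix.mul_sum]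
    _ = _ := by rw [sum_inc_mul_inc', Matrix.one_mul]

theorem inc_block_injective {i : Fin (D.p+1)} {j : Fin (D.m i)}
    {M M' : Matrix (Fin (D.nb i j)) (Fin (D.nb i j)) ℂ}
    (h : D.inc i j * M * D.inc' i j = D.inc i j * M' * D.inc' i j) : M = M' := by
  have h' := congrArg (fun K : Matrix (D.Idx i) (D.Idx i) ℂ => D.inc' i j * K * D.inc i j) h
  have key : ∀ K : Matrix (Fin (D.nb i j)) (Fin (D.nb i j)) ℂ,
      D.inc' i j * (D.inc i j * K * D.inc' i j) * D.inc i j = K := fun K => by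
    calc _ = (D.inc' i j * D.inc i j) * K * (D.inc' i j * D.inc i j) := by
          simp only [Matrix.mul_assoc]
      _ = K := by rw [inc'_mul_inc, Matrix.one_mul, Matrix.mul_one]
  simpa only [key] using h'

theorem block_one (i : Fin (D.p+1)) (j : Fin (D.m i)) (c : ℂ) :
    D.inc' i j * (c • (1 : Matrix (D.Idx i) (D.Idx i) ℂ)) * D.inc i j = c • 1 := by
  rw [Matrix.mul_smul, Matrix.mul_one, Matrix.smul_mul, inc'_mul_inc]

theorem GRep.block_N (G : D.GRep) (i : Fin (D.p+1)) (j : Fin (D.m i)) :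
    D.inc' i j * G.N i * D.inc i j = D.xe i j 0 • 1 + (G.leg i j).a0 * (G.leg i j).b0 := by
  rw [GRep.N, ic'_mul_blockDiagonal, Matrix.mul_assoc, inc'_mul_inc, Matrix.mul_one, Leg.N]

/-- The diagonal equation read off on blocks. -/
theorem GRep.diag_iff (G : D.GRep) (i : Fin (D.p+1)) (j : Fin (D.m i)) :
    pr D i j * G.Z i * pr D i j =
      mom (D.q i) (D.blk i) Finset.univ (G.X i) j + pr D i j * G.N i * pr D i j ↔
    D.inc' i j * G.Z i * D.inc i j =
      D.inc' i j * mom (D.q i) (D.blk i) Finset.univ (G.X i) j * D.inc i j +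
        (D.xe i j 0 • 1 + (G.leg i j).a0 * (G.leg i j).b0) := by
  have hm : mom (D.q i) (D.blk i) Finset.univ (G.X i) j =
      pr D i j * mom (D.q i) (D.blk i) Finset.univ (G.X i) j * pr D i j := by
    rw [eb_mul_mom, mom_mul_eb]
  have key : ∀ M : Matrix (D.Idx i) (D.Idx i) ℂ, pr D i j * M * pr D i j =
      D.inc i j * (D.inc' i j * M * D.inc i j) * D.inc' i j := fun M => by
    rw [← inc_mul_inc']; simp only [Matrix.mul_assoc]
  rw [← G.block_N]
  constructor
  · intro h
    rw [hm, key, key, key, ← Matrix.add_mul, ← Matrix.mul_add] at h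
    exact inc_block_injective h
  · intro h
    rw [hm, key, key, key, h, Matrix.mul_add, Matrix.add_mul]

theorem ve_eq_sum (v : Fin D.p → ℂ) : ∑ i : D.IrrNz, D.ve v i.1 =
    (∑ i', v i') - ∑ i' : Fin D.p, (if ¬ D.isIrr i'.succ then v i' else 0) := by
  have h1 : ∑ i : D.IrrNz, D.ve v i.1 = ∑ i, if D.isIrr i ∧ i ≠ 0 then D.ve v i else 0 := by
    rw [← Finset.sum_filter]
    exact (Finset.sum_subtype _ (by simp) _).symm
  rw [h1, Fin.sum_univ_succ, if_neg (by simp), zero_add, ← Finset.sum_sub_distrib]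
  refine Finset.sum_congr rfl fun i _ => ?_
  have : D.ve v i.succ = v i := by simp [ve, Fin.succ_ne_zero]
  by_cases h : D.isIrr i.succ
  · rw [if_pos ⟨h, Fin.succ_ne_zero i⟩, if_neg (not_not.2 h), this, sub_zero]
  · rw [if_neg (fun h' => h h'.1), if_pos h, sub_self]

theorem sum_points {M : Type} [AddCommMonoid M] (F : Fin (D.p+1) → M) :
    ∑ i, F i = F 0 + ((∑ i : D.IrrNz, F i.1) + ∑ i, if D.isIrr i then 0 else F i) := by
  have h1 : ∑ i : D.IrrNz, F i.1 = ∑ i, if D.isIrr i ∧ i ≠ 0 then F i else 0 := by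
    rw [← Finset.sum_filter]
    exact (Finset.sum_subtype _ (by simp) _).symm
  rw [h1, Fin.sum_univ_succ, Fin.sum_univ_succ, Fin.sum_univ_succ, if_neg (by simp), zero_add,
    if_pos (show D.isIrr 0 from Or.inr rfl), zero_add, ← Finset.sum_add_distrib]
  congr 1
  refine Finset.sum_congr rfl fun i _ => ?_
  by_cases h : D.isIrr i.succ
  · rw [if_pos ⟨h, Fin.succ_ne_zero i⟩, if_pos h, add_zero]
  · rw [if_neg (fun h' => h h'.1), if_neg h, zero_add]

end ConnData

namespace ConnData

variable {D : ConnData} {v : Fin D.p → ℂ} {x : D.quiv.Rep D.alphaV} {G : D.GRep}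

theorem sum_subtype_ite {κ M : Type} [Fintype κ] [AddCommMonoid M] (p : κ → Prop) [DecidablePred p]
    (f : κ → M) : ∑ c : {k // p k}, f c.1 = ∑ k, if p k then f k else 0 := by
  rw [← Finset.sum_filter]
  exact (Finset.sum_subtype _ (by simp) _).symm

theorem sub_add_add_eq_sub_iff {M : Type} [AddCommGroup M] (s z m n c : M) :
    s - z + m + n = s - c ↔ z = m + (c + n) := by
  rw [← sub_eq_zero, ← sub_eq_zero (a := z), ← neg_eq_zero (a := z - _)]
  refine Eq.congr ?_ rfl
  abel

theorem add_add_sub_eq_iff {M : Type} [AddCommGroup M] (m n r g s A c : M) :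
    m + n + (r - g) - (s - A) = -c - g - s ↔ -(A + r) = m + (c + n) := by
  rw [← sub_eq_zero, ← sub_eq_zero (a := -(A + r)), ← neg_eq_zero (a := -(A + r) - _)]
  refine Eq.congr ?_ rfl
  abel

theorem inc'_mul_pr (i : Fin (D.p+1)) (j : Fin (D.m i)) : D.inc' i j * pr D i j = D.inc' i j := by
  rw [← inc_mul_inc', ← Matrix.mul_assoc, inc'_mul_inc, Matrix.one_mul]

theorem pr_mul_inc (i : Fin (D.p+1)) (j : Fin (D.m i)) : pr D i j * D.inc i j = D.inc i j := by
  rw [← inc_mul_inc', Matrix.mul_assoc, inc'_mul_inc, Matrix.mul_one]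

theorem GRep.block_mom (G : D.GRep) (i : Fin (D.p+1)) (j : Fin (D.m i)) :
    D.inc' i j * mom (D.q i) (D.blk i) Finset.univ (G.X i) j * D.inc i j =
      ∑ j', sgn j' j • ∑ t ∈ Finset.range (dq (D.q i) j j'),
        (D.inc' i j * G.X i t * D.inc i j') * (D.inc' i j' * G.X i t * D.inc i j) := by
  have key : ∀ j' t, D.inc' i j * (pr D i j * G.X i t * pr D i j' * G.X i t * pr D i j) * D.inc i j =
      (D.inc' i j * G.X i t * D.inc i j') * (D.inc' i j' * G.X i t * D.inc i j) := fun j' t => by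
    calc _ = (D.inc' i j * pr D i j) * G.X i t * pr D i j' * G.X i t * (pr D i j * D.inc i j) := by
          simp only [Matrix.mul_assoc]
      _ = _ := by
          rw [inc'_mul_pr, pr_mul_inc, ← inc_mul_inc' i j']; simp only [Matrix.mul_assoc]
  unfold mom
  rw [Matrix.mul_sum, Matrix.sum_mul]
  refine Finset.sum_congr rfl fun j' _ => ?_
  rw [Matrix.mul_smul, Matrix.smul_mul, Matrix.mul_sum, Matrix.sum_mul]
  exact congrArg _ (Finset.sum_congr rfl fun t _ => key j' t)

namespace Realizes

variable (hR : Realizes v x G)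
include hR

theorem mu2_eq (i : Fin (D.p+1)) (hi : D.isIrr i) (j : Fin (D.m i)) :
    mu2 x i hi j = D.inc' i j * mom (D.q i) (D.blk i) Finset.univ (G.X i) j * D.inc i j := by
  rw [G.block_mom, mu2]
  set S : Fin (D.m i) → Matrix (Fin (D.nb i j)) (Fin (D.nb i j)) ℂ := fun j' =>
    ∑ t ∈ Finset.range (dq (D.q i) j j'),
      (D.inc' i j * G.X i t * D.inc i j') * (D.inc' i j' * G.X i t * D.inc i j) with hS
  have h1 : ∑ c : {j' // j' < j}, ∑ t, a2 x i hi c.1 j c.2 t * b2 x i hi c.1 j c.2 t =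
      ∑ c : {j' // j' < j}, S c.1 := by
    refine Finset.sum_congr rfl fun c _ => ?_
    simp only [hS, hR.a2, hR.b2]
    rw [dq_comm]
    exact Fin.sum_univ_eq_sum_range (fun t =>
      (D.inc' i j * G.X i t * D.inc i c.1) * (D.inc' i c.1 * G.X i t * D.inc i j)) _
  have h2 : ∑ c : {j' // j < j'}, ∑ t, b2 x i hi j c.1 c.2 t * a2 x i hi j c.1 c.2 t =
      ∑ c : {j' // j < j'}, S c.1 := by
    refine Finset.sum_congr rfl fun c _ => ?_
    simp only [hS, hR.a2, hR.b2]
    exact Fin.sum_univ_eq_sum_range (fun t =>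
      (D.inc' i j * G.X i t * D.inc i c.1) * (D.inc' i c.1 * G.X i t * D.inc i j)) _
  rw [h1, h2, sum_subtype_ite, sum_subtype_ite, ← Finset.sum_sub_distrib]
  refine Finset.sum_congr rfl fun j' _ => ?_
  rcases lt_trichotomy j' j with h | h | h
  · rw [if_pos h, if_neg h.asymm, sgn, if_pos h, one_smul, sub_zero]
  · subst h
    rw [if_neg (lt_irrefl _), dq_self, Finset.sum_range_zero, smul_zero, sub_zero]
  · rw [if_pos h, if_neg h.asymm, sgn, if_neg h.asymm, neg_one_smul, zero_sub]

theorem mu4_eq (i : Fin (D.p+1)) (hi : D.isIrr i) (j : Fin (D.m i)) :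
    mu4 x i hi j = (G.leg i j).a0 * (G.leg i j).b0 := by
  unfold mu4
  split_ifs with h
  · rw [hR.a4, hR.b4]
    calc _ = (G.leg i j).a0 * (D.lg i j 0 h * D.lg' i j 0 h) * (G.leg i j).b0 := by
          simp only [Matrix.mul_assoc]
      _ = _ := by rw [lm_mul_lm', Matrix.mul_one]
  · rw [mul_eq_zero_of_leg h]

theorem sum_a1_mul_b1 (hF : G.Frames) (i : D.IrrNz) (j : Fin (D.m i.1)) :
    ∑ j0, a1 x j0 i j * b1 x j0 i j = D.ve v i.1 • 1 - D.inc' i.1 j * G.Z i.1 * D.inc i.1 j := by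
  simp only [hR.a1, hR.b1]
  calc _ = ∑ j0, (D.inc' i.1 j * G.P i.1 * D.inc 0 j0) * (D.inc' 0 j0 * (G.Q v i.1 * D.inc i.1 j)) := by
        simp only [Matrix.mul_assoc]
    _ = D.inc' i.1 j * (G.P i.1 * G.P' i.1) * (D.ve v i.1 • 1 - G.Z i.1) * D.inc i.1 j := by
        rw [sum_mul_inc, GRep.Q]; simp only [Matrix.mul_assoc]
    _ = _ := by rw [hF.PP', Matrix.mul_one, Matrix.mul_sub, Matrix.sub_mul, block_one]

theorem sum_b1_mul_a1 (hF : G.Frames) (i : D.IrrNz) (j : Fin (D.m 0)) :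
    ∑ j', b1 x j i j' * a1 x j i j' =
      D.ve v i.1 • 1 - D.inc' 0 j * (G.P' i.1 * G.Z i.1 * G.P i.1) * D.inc 0 j := by
  simp only [hR.a1, hR.b1]
  calc _ = ∑ j', (D.inc' 0 j * G.Q v i.1 * D.inc i.1 j') * (D.inc' i.1 j' * (G.P i.1 * D.inc 0 j)) := by
        simp only [Matrix.mul_assoc]
    _ = D.inc' 0 j * (G.P' i.1 * (D.ve v i.1 • 1 - G.Z i.1) * G.P i.1) * D.inc 0 j := by
        rw [sum_mul_inc, GRep.Q]; simp only [Matrix.mul_assoc]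
    _ = _ := by
        rw [Matrix.mul_sub, Matrix.mul_smul, Matrix.mul_one, Matrix.sub_mul, Matrix.smul_mul,
          hF.P'P, Matrix.mul_sub, Matrix.sub_mul, block_one]

theorem mu5_eq (hF : G.Frames) (j : Fin (D.m 0)) :
    mu5 x j = D.inc' 0 j * (∑ i, if D.isIrr i then 0 else G.P' i * G.Z i * G.P i) * D.inc 0 j -
      D.regSumXi • 1 := by
  unfold mu5 regSumXi
  rw [Finset.sum_smul, Matrix.mul_sum, Matrix.sum_mul, ← Finset.sum_sub_distrib]
  refine Finset.sum_congr rfl fun i _ => ?_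
  by_cases hi : D.isIrr i
  · rw [if_pos hi, if_pos hi, dif_neg (fun h => h.1 hi), Matrix.mul_zero, Matrix.zero_mul, zero_smul,
      sub_zero]
  rw [if_neg hi, if_neg hi]
  have hxe : D.xi i (D.j1 i) ⟨0, D.he _ _⟩ = D.xe i (D.j1 i) 0 := by
    rw [xe, dif_pos (D.he _ _)]
  have hZ : G.Z i = D.xe i (D.j1 i) 0 • 1 + D.inc i (D.j1 i) *
      ((G.leg i (D.j1 i)).a0 * (G.leg i (D.j1 i)).b0) * D.inc' i (D.j1 i) := by
    rw [hF.reg i hi]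
    calc _ = (D.inc i (D.j1 i) * D.inc' i (D.j1 i)) * G.N i * (D.inc i (D.j1 i) * D.inc' i (D.j1 i)) := by
          rw [inc_mul_inc'_reg hi, Matrix.mul_one, Matrix.one_mul]
      _ = D.inc i (D.j1 i) * (D.inc' i (D.j1 i) * G.N i * D.inc i (D.j1 i)) * D.inc' i (D.j1 i) := by
          simp only [Matrix.mul_assoc]
      _ = _ := by
          rw [G.block_N, Matrix.mul_add, Matrix.add_mul, Matrix.mul_smul, Matrix.mul_one, Matrix.smul_mul,
            inc_mul_inc'_reg hi]
  have hPZP : D.inc' 0 j * (G.P' i * G.Z i * G.P i) * D.inc 0 j - D.xe i (D.j1 i) 0 • 1 =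
      D.inc' 0 j * (G.P' i * D.inc i (D.j1 i) * (G.leg i (D.j1 i)).a0) *
      (((G.leg i (D.j1 i)).b0 * D.inc' i (D.j1 i) * G.P i) * D.inc 0 j) := by
    rw [hZ, Matrix.mul_add, Matrix.add_mul, Matrix.mul_add, Matrix.add_mul, Matrix.mul_smul,
      Matrix.mul_one, Matrix.smul_mul, hF.P'P, block_one]
    simp only [Matrix.mul_assoc, add_sub_cancel_left]
  rw [hxe, hPZP]
  split_ifs with h
  · rw [hR.a5, hR.b5]
    calc _ = D.inc' 0 j * (G.P' i * D.inc i (D.j1 i) * (G.leg i (D.j1 i)).a0) *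
        (D.lg i (D.j1 i) 0 h.2 * D.lg' i (D.j1 i) 0 h.2) *
        (((G.leg i (D.j1 i)).b0 * D.inc' i (D.j1 i) * G.P i) * D.inc 0 j) := by
          simp only [Matrix.mul_assoc]
      _ = _ := by rw [lm_mul_lm', Matrix.mul_one]
  · have h' : ¬ 0 < D.e i (D.j1 i) - 1 := fun h' => h ⟨hi, h'⟩
    calc _ = D.inc' 0 j * (G.P' i * D.inc i (D.j1 i) *
        ((G.leg i (D.j1 i)).a0 * (G.leg i (D.j1 i)).b0) * D.inc' i (D.j1 i) * G.P i) * D.inc 0 j := by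
          rw [mul_eq_zero_of_leg h', Matrix.mul_zero, Matrix.zero_mul, Matrix.zero_mul, Matrix.mul_zero,
            Matrix.zero_mul]
      _ = _ := by simp only [Matrix.mul_assoc]

theorem lam_nz (i : D.IrrNz) (j : Fin (D.m i.1)) :
    D.lamV (D.vmid ⟨i.1, i.2.1⟩ j) + D.vbar v (D.vmid ⟨i.1, i.2.1⟩ j) =
      D.ve v i.1 - D.xe i.1 j 0 := by
  simp only [vmid, lamV, vbar, ve, xe, dif_neg i.2.2, dif_pos (D.he _ _)]
  ring

theorem lam_zero (j : Fin (D.m 0)) :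
    D.lamV (D.vmid0 j) + D.vbar v (D.vmid0 j) =
      - D.xe 0 j 0 - D.regSumXi - ∑ i : D.IrrNz, D.ve v i.1 := by
  rw [ve_eq_sum]
  simp only [vmid0, irr0, lamV, vbar, xe, dif_pos, dif_pos (D.he _ _)]
  ring

theorem mu_nz_iff (hF : G.Frames) (i : D.IrrNz) (j : Fin (D.m i.1)) :
    FinQuiver.mu (Q := D.quiv) (α := D.alphaV) x (D.vmid ⟨i.1, i.2.1⟩ j) =
      (D.lamV (D.vmid ⟨i.1, i.2.1⟩ j) + D.vbar v (D.vmid ⟨i.1, i.2.1⟩ j)) • 1 ↔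
    pr D i.1 j * G.Z i.1 * pr D i.1 j =
      mom (D.q i.1) (D.blk i.1) Finset.univ (G.X i.1) j + pr D i.1 j * G.N i.1 * pr D i.1 j := by
  rw [G.diag_iff, mu_nz, hR.lam_nz, hR.sum_a1_mul_b1 hF, hR.mu2_eq, hR.mu4_eq, sub_smul]
  exact sub_add_add_eq_sub_iff _ _ _ _ _

theorem mu_zero_iff (hF : G.Frames) (j : Fin (D.m 0)) :
    FinQuiver.mu (Q := D.quiv) (α := D.alphaV) x (D.vmid0 j) =
      (D.lamV (D.vmid0 j) + D.vbar v (D.vmid0 j)) • 1 ↔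
    pr D 0 j * G.Z 0 * pr D 0 j =
      mom (D.q 0) (D.blk 0) Finset.univ (G.X 0) j + pr D 0 j * G.N 0 * pr D 0 j := by
  have hP0' : G.P' 0 = 1 := by
    have := hF.PP' 0
    rwa [hF.P0, Matrix.one_mul] at this
  have h0 : G.P' 0 * G.Z 0 * G.P 0 = G.Z 0 := by
    rw [hF.P0, hP0', Matrix.one_mul, Matrix.mul_one]
  have hs := hF.res
  rw [sum_points, h0] at hs
  have hs' := congrArg (fun M : Matrix (D.Idx 0) (D.Idx 0) ℂ => D.inc' 0 j * M * D.inc 0 j) hs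
  simp only [Matrix.mul_add, Matrix.add_mul, Matrix.mul_zero, Matrix.zero_mul] at hs'
  have hsum : ∑ i : D.IrrNz, ∑ j', b1 x j i j' * a1 x j i j' = (∑ i : D.IrrNz, D.ve v i.1) • 1 -
      D.inc' 0 j * (∑ i : D.IrrNz, G.P' i.1 * G.Z i.1 * G.P i.1) * D.inc 0 j := by
    rw [Finset.sum_congr rfl fun i _ => hR.sum_b1_mul_a1 hF i j, Finset.sum_sub_distrib,
      Finset.sum_smul, Matrix.mul_sum, Matrix.sum_mul]
  rw [G.diag_iff, mu_zero, hR.lam_zero, hsum, hR.mu2_eq 0 (Or.inr rfl) j, hR.mu4_eq 0 (Or.inr rfl) j, hR.mu5_eq hF, sub_smul, sub_smul,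
    neg_smul]
  have hs2 := eq_neg_of_add_eq_zero_left hs'
  rw [hs2]
  exact add_add_sub_eq_iff _ _ _ _ _ _ _

theorem lam_leg (i : Fin (D.p+1)) (j : Fin (D.m i)) (k : ℕ) (hk : k < D.e i j - 1) :
    D.lamV (D.vleg i j ⟨k, hk⟩) + D.vbar v (D.vleg i j ⟨k, hk⟩) = D.xe i j k - D.xe i j (k+1) := by
  simp only [vleg, lamV, vbar, xe, dif_pos (show k < D.e i j by omega),
    dif_pos (show k + 1 < D.e i j by omega), add_zero]

theorem muIn_leg_eq (i : Fin (D.p+1)) (j : Fin (D.m i)) (k : ℕ) (hk : k < D.e i j - 1) :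
    muIn x (D.vleg i j ⟨k, hk⟩) =
      D.lg' i j k hk * ((G.leg i j).a k * (G.leg i j).b k) * D.lg i j k hk := by
  rw [muIn_leg]
  split_ifs with h
  · rw [hR.a3, hR.b3]
    calc _ = D.lg' i j k hk * (G.leg i j).a k * (D.lg i j (k+1) h * D.lg' i j (k+1) h) *
        (G.leg i j).b k * D.lg i j k hk := by simp only [Matrix.mul_assoc]
      _ = _ := by rw [lm_mul_lm', Matrix.mul_one]; simp only [Matrix.mul_assoc]
  · rw [mul_eq_zero_of_leg h, Matrix.mul_zero, Matrix.zero_mul]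

theorem muOut_leg_succ_eq (i : Fin (D.p+1)) (j : Fin (D.m i)) (k : ℕ) (hk : k + 1 < D.e i j - 1) :
    muOut x (D.vleg i j ⟨k + 1, hk⟩) =
      D.lg' i j (k+1) hk * ((G.leg i j).b k * (G.leg i j).a k) * D.lg i j (k+1) hk := by
  rw [muOut_leg_succ, hR.a3, hR.b3]
  calc _ = D.lg' i j (k+1) hk * (G.leg i j).b k * (D.lg i j k (Nat.lt_of_succ_lt hk) * D.lg' i j k (Nat.lt_of_succ_lt hk)) *
      (G.leg i j).a k * D.lg i j (k+1) hk := by simp only [Matrix.mul_assoc]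
    _ = _ := by rw [lm_mul_lm', Matrix.mul_one]; simp only [Matrix.mul_assoc]

theorem muOut_leg_zero_eq (hF : G.Frames) (i : Fin (D.p+1)) (j : Fin (D.m i)) (hk : 0 < D.e i j - 1) :
    muOut x (D.vleg i j ⟨0, hk⟩) =
      D.lg' i j 0 hk * ((G.leg i j).b0 * (G.leg i j).a0) * D.lg i j 0 hk := by
  by_cases hi : D.isIrr i
  · rw [muOut_leg_irr x i hi, hR.a4, hR.b4]
    simp only [Matrix.mul_assoc]
  · obtain rfl := eq_j1 hi j
    rw [muOut_leg_reg x i hi]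
    simp only [hR.a5, hR.b5]
    set l := G.leg i (D.j1 i)
    calc _ = ∑ j0, (D.lg' i (D.j1 i) 0 hk * (l.b0 * D.inc' i (D.j1 i) * G.P i) * D.inc 0 j0) *
          (D.inc' 0 j0 * ((G.P' i * D.inc i (D.j1 i) * l.a0) * D.lg i (D.j1 i) 0 hk)) := by
          simp only [Matrix.mul_assoc]
      _ = D.lg' i (D.j1 i) 0 hk * (l.b0 * (D.inc' i (D.j1 i) * (G.P i * G.P' i) * D.inc i (D.j1 i)) *
          l.a0) * D.lg i (D.j1 i) 0 hk := by
          rw [sum_mul_inc]; simp only [Matrix.mul_assoc]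
      _ = _ := by rw [hF.PP', Matrix.mul_one, inc'_mul_inc, Matrix.mul_one]

omit hR in
theorem leg_conj_iff (i : Fin (D.p+1)) (j : Fin (D.m i)) (k : ℕ)
    (M : Matrix (D.LV i j k) (D.LV i j k) ℂ) (c : ℂ) :
    M = c • 1 ↔ ∀ hk : k < D.e i j - 1, D.lg' i j k hk * M * D.lg i j k hk = c • 1 := by
  constructor
  · rintro rfl hk
    rw [Matrix.mul_smul, Matrix.mul_one, Matrix.smul_mul, lm'_mul_lm]
  · intro h
    by_cases hk : k < D.e i j - 1
    · calc M = (D.lg i j k hk * D.lg' i j k hk) * M * (D.lg i j k hk * D.lg' i j k hk) := by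
            rw [lm_mul_lm', Matrix.one_mul, Matrix.mul_one]
        _ = D.lg i j k hk * (D.lg' i j k hk * M * D.lg i j k hk) * D.lg' i j k hk := by
            simp only [Matrix.mul_assoc]
        _ = _ := by rw [h hk, Matrix.mul_smul, Matrix.mul_one, Matrix.smul_mul, lm_mul_lm']
    · have := isEmpty_LV hk
      ext a
      exact this.elim a

theorem mu_leg_iff (hF : G.Frames) (i : Fin (D.p+1)) (j : Fin (D.m i)) :
    (∀ k, FinQuiver.mu (Q := D.quiv) (α := D.alphaV) x (D.vleg i j k) =
      (D.lamV (D.vleg i j k) + D.vbar v (D.vleg i j k)) • 1) ↔ (G.leg i j).IsMom (D.xe i j) := by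
  have h0 : (∀ hk, FinQuiver.mu (Q := D.quiv) (α := D.alphaV) x (D.vleg i j ⟨0, hk⟩) =
      (D.lamV (D.vleg i j ⟨0, hk⟩) + D.vbar v (D.vleg i j ⟨0, hk⟩)) • 1) ↔
      (G.leg i j).a 0 * (G.leg i j).b 0 - (G.leg i j).b0 * (G.leg i j).a0 =
        (D.xe i j 0 - D.xe i j 1) • 1 := by
    rw [leg_conj_iff]
    refine forall_congr' fun hk => ?_
    rw [mu_eq, hR.muIn_leg_eq, hR.muOut_leg_zero_eq hF, hR.lam_leg, Matrix.mul_sub, Matrix.sub_mul]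
  have h1 : ∀ k, (∀ hk, FinQuiver.mu (Q := D.quiv) (α := D.alphaV) x (D.vleg i j ⟨k+1, hk⟩) =
      (D.lamV (D.vleg i j ⟨k+1, hk⟩) + D.vbar v (D.vleg i j ⟨k+1, hk⟩)) • 1) ↔
      (G.leg i j).a (k+1) * (G.leg i j).b (k+1) - (G.leg i j).b k * (G.leg i j).a k =
        (D.xe i j (k+1) - D.xe i j (k+2)) • 1 := fun k => by
    rw [leg_conj_iff]
    refine forall_congr' fun hk => ?_
    rw [mu_eq, hR.muIn_leg_eq, hR.muOut_leg_succ_eq, hR.lam_leg, Matrix.mul_sub, Matrix.sub_mul]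
  constructor
  · exact fun h => ⟨h0.1 fun hk => h _, fun k => (h1 k).1 fun hk => h _⟩
  · rintro ⟨hz, hs⟩ ⟨k, hk⟩
    cases k with
    | zero => exact h0.2 hz hk
    | succ k => exact (h1 k).2 (hs k) hk

/-- The moment map equation in terms of global representation data. -/
theorem mu_iff (hF : G.Frames) :
    (∀ a, FinQuiver.mu (Q := D.quiv) (α := D.alphaV) x a = (D.lamV a + D.vbar v a) • 1) ↔ G.Valid := by
  constructor
  · intro h
    refine ⟨hF.PP', hF.P'P, hF.P0, hF.res, fun i j => ?_, fun i j => (hR.mu_leg_iff hF i j).1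
      fun k => h _⟩
    by_cases hi : D.isIrr i
    · by_cases h0 : i = 0
      · subst h0
        exact (hR.mu_zero_iff hF j).1 (h _)
      · exact (hR.mu_nz_iff hF ⟨i, hi, h0⟩ j).1 (h _)
    · have hm : mom (D.q i) (D.blk i) Finset.univ (G.X i) j = 0 := by
        unfold mom
        refine Finset.sum_eq_zero fun j' _ => ?_
        rw [eq_j1 hi j, eq_j1 hi j', dq_self, Finset.sum_range_zero, smul_zero]
      rw [hm, zero_add, hF.reg i hi]
  · intro h a
    obtain ⟨⟨i, hi⟩, j⟩ | ⟨i, j, k⟩ := a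
    · by_cases h0 : i = 0
      · subst h0
        exact (hR.mu_zero_iff hF j).2 (h.diag 0 j)
      · exact (hR.mu_nz_iff hF ⟨i, hi, h0⟩ j).2 (h.diag i j)
    · exact (hR.mu_leg_iff hF i j).2 (h.legMom i j) k

end Realizes

theorem GRep.Valid.frames (h : G.Valid) : G.Frames where
  PP' := h.PP'
  P'P := h.P'P
  P0 := h.P0
  res := h.res
  reg i hi := by
    have hd := h.diag i (D.j1 i)
    have hm : mom (D.q i) (D.blk i) Finset.univ (G.X i) (D.j1 i) = 0 := by
      unfold mom
      refine Finset.sum_eq_zero fun j' _ => ?_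
      rw [eq_j1 hi j', dq_self, Finset.sum_range_zero, smul_zero]
    rwa [hm, zero_add, pr_reg hi, Matrix.one_mul, Matrix.one_mul, Matrix.mul_one, Matrix.mul_one] at hd

end ConnData

theorem exists_projection_matrix {n : ℕ} (U : Submodule ℂ (Fin n → ℂ)) :
    ∃ E : Matrix (Fin n) (Fin n) ℂ, (∀ w, E *ᵥ w ∈ U) ∧ (∀ w ∈ U, E *ᵥ w = w) ∧
      E.trace = Module.finrank ℂ U := by
  obtain ⟨f, hf⟩ := LinearMap.exists_leftInverse_of_injective U.subtype (Submodule.ker_subtype U)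
  have hp : LinearMap.IsProj U (U.subtype ∘ₗ f) :=
    ⟨fun w => (f w).2, fun w hw => congrArg Subtype.val (LinearMap.congr_fun hf ⟨w, hw⟩)⟩
  refine ⟨LinearMap.toMatrix' (U.subtype ∘ₗ f), fun w => ?_, fun w hw => ?_, ?_⟩
  · rw [LinearMap.toMatrix'_mulVec]; exact hp.map_mem w
  · rw [LinearMap.toMatrix'_mulVec]; exact hp.map_id w hw
  · rw [← hp.trace, ← Matrix.trace_toLin'_eq, Matrix.toLin'_toMatrix']

namespace FinQuiver

variable {Q : FinQuiver} {α : Q.V → ℕ}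

/-- The dimension vector of an invariant family is orthogonal to the parameter. -/
theorem sum_mul_finrank_eq_zero (x : Q.Rep α) (lam : Q.V → ℂ)
    (h : ∀ a, mu x a = lam a • (1 : Matrix (Fin (α a)) (Fin (α a)) ℂ))
    (U : ∀ a : Q.V, Submodule ℂ (Fin (α a) → ℂ)) (hU : InvFamily x U) :
    ∑ a, lam a * Module.finrank ℂ (U a) = 0 := by
  choose E hE1 hE2 hE3 using fun a => exists_projection_matrix (U a)
  have e1 : ∀ a, lam a * Module.finrank ℂ (U a) = (mu x a * E a).trace := fun a => by
    rw [h, Matrix.smul_mul, Matrix.one_mul, Matrix.trace_smul, hE3, smul_eq_mul]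
  have e2 : ∀ a, (mu x a * E a).trace =
      (∑ e : Q.E, if Q.tgt e = a then ((x e).1 * (x e).2 * E (Q.tgt e)).trace else 0) -
      ∑ e : Q.E, if Q.src e = a then ((x e).2 * (x e).1 * E (Q.src e)).trace else 0 := fun a => by
    rw [mu, Matrix.sub_mul, Matrix.trace_sub, Matrix.sum_mul, Matrix.sum_mul, Matrix.trace_sum,
      Matrix.trace_sum]
    congr 1
    · refine Finset.sum_congr rfl fun e _ => ?_
      by_cases he : Q.tgt e = a
      · subst he
        rw [dif_pos rfl, if_pos rfl]
        rfl
      · rw [dif_neg he, if_neg he, Matrix.zero_mul, Matrix.trace_zero]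
    · refine Finset.sum_congr rfl fun e _ => ?_
      by_cases he : Q.src e = a
      · subst he
        rw [dif_pos rfl, if_pos rfl]
        rfl
      · rw [dif_neg he, if_neg he, Matrix.zero_mul, Matrix.trace_zero]
  rw [Finset.sum_congr rfl fun a _ => (e1 a).trans (e2 a), Finset.sum_sub_distrib, Finset.sum_comm,
    Finset.sum_comm (γ := Q.V) (s := Finset.univ) (t := Finset.univ) (f := fun a e =>
      if Q.src e = a then ((x e).2 * (x e).1 * E (Q.src e)).trace else 0), ← Finset.sum_sub_distrib]
  refine Finset.sum_eq_zero fun e _ => ?_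
  rw [Finset.sum_ite_eq, Finset.sum_ite_eq, if_pos (Finset.mem_univ _), if_pos (Finset.mem_univ _)]
  have h1 : E (Q.tgt e) * ((x e).1 * E (Q.src e)) = (x e).1 * E (Q.src e) := by
    refine Matrix.ext_of_mulVec_single fun i => ?_
    rw [← Matrix.mulVec_mulVec]
    refine hE2 _ _ ?_
    rw [← Matrix.mulVec_mulVec]
    exact (hU e).1 _ (hE1 _ _)
  have h2 : E (Q.src e) * ((x e).2 * E (Q.tgt e)) = (x e).2 * E (Q.tgt e) := by
    refine Matrix.ext_of_mulVec_single fun i => ?_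
    rw [← Matrix.mulVec_mulVec]
    refine hE2 _ _ ?_
    rw [← Matrix.mulVec_mulVec]
    exact (hU e).2 _ (hE1 _ _)
  rw [sub_eq_zero]
  calc ((x e).1 * (x e).2 * E (Q.tgt e)).trace = ((x e).1 * ((x e).2 * E (Q.tgt e))).trace := by
        rw [Matrix.mul_assoc]
    _ = (((x e).1 * E (Q.src e)) * ((x e).2 * E (Q.tgt e))).trace := by
        rw [← h2, ← Matrix.mul_assoc (x e).1, h2]
    _ = ((x e).2 * E (Q.tgt e) * ((x e).1 * E (Q.src e))).trace := Matrix.trace_mul_comm _ _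
    _ = ((x e).2 * (E (Q.tgt e) * ((x e).1 * E (Q.src e)))).trace := by rw [Matrix.mul_assoc]
    _ = _ := by rw [h1, Matrix.mul_assoc]

end FinQuiver

namespace ConnData

variable {D : ConnData}

theorem sum_irrIdx (F : D.IrrIdx → ℂ) :
    ∑ i, F i = F D.irr0 + ∑ i : D.IrrNz, F ⟨i.1, i.2.1⟩ := by
  classical
  rw [← Finset.add_sum_erase _ _ (Finset.mem_univ D.irr0)]
  congr 1
  refine (Finset.sum_bij (fun (i : D.IrrNz) _ => (⟨i.1, i.2.1⟩ : D.IrrIdx)) ?_ ?_ ?_ ?_).symm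
  · intro i _
    exact Finset.mem_erase.2 ⟨fun h => i.2.2 (congrArg Subtype.val h), Finset.mem_univ _⟩
  · intro i _ i' _ h
    exact Subtype.ext (congrArg (Subtype.val : D.IrrIdx → Fin (D.p+1)) h)
  · intro i hi
    exact ⟨⟨i.1, i.2, fun h => (Finset.mem_erase.1 hi).1 (Subtype.ext h)⟩, Finset.mem_univ _, rfl⟩
  · exact fun _ _ => rfl

/-- The defect of a dimension vector at an irregular point. -/
def defect (β : D.Vq → ℕ) (i : D.IrrNz) : ℂ :=
  ∑ j, (β (D.vmid ⟨i.1, i.2.1⟩ j) : ℂ) - ∑ j, (β (D.vmid0 j) : ℂ)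

theorem sum_vbar_mul (v : Fin D.p → ℂ) (β : D.Vq → ℕ) :
    ∑ a, D.vbar v a * β a = ∑ i : D.IrrNz, D.ve v i.1 * defect β i := by
  have h0 : ∀ j, D.vbar v (D.vmid0 j) = - ∑ i : D.IrrNz, D.ve v i.1 := fun j => by
    rw [ve_eq_sum]
    simp only [vmid0, irr0, vbar, dif_pos]
    ring
  have hnz : ∀ (i : D.IrrNz) j, D.vbar v (D.vmid ⟨i.1, i.2.1⟩ j) = D.ve v i.1 := fun i j => by
    simp only [vmid, vbar, ve, dif_neg i.2.2]
  rw [Fintype.sum_sum_type, Finset.sum_eq_zero (s := Finset.univ)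
    (f := fun a => D.vbar v (Sum.inr a) * β (Sum.inr a)) fun a _ => by rw [vbar, zero_mul], add_zero,
    Fintype.sum_sigma, sum_irrIdx]
  have e0 : ∑ j, D.vbar v (D.vmid0 j) * (β (D.vmid0 j) : ℂ) =
      ∑ i : D.IrrNz, - (D.ve v i.1 * ∑ j, (β (D.vmid0 j) : ℂ)) := by
    simp only [h0]
    rw [← Finset.mul_sum, _root_.neg_mul, Finset.sum_mul, Finset.sum_neg_distrib]
  have e1 : ∀ i : D.IrrNz, ∑ j, D.vbar v (D.vmid ⟨i.1, i.2.1⟩ j) * (β (D.vmid ⟨i.1, i.2.1⟩ j) : ℂ) =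
      D.ve v i.1 * ∑ j, (β (D.vmid ⟨i.1, i.2.1⟩ j) : ℂ) := fun i => by
    simp only [hnz]
    rw [Finset.mul_sum]
  refine (congrArg₂ (· + ·) e0 (Finset.sum_congr rfl fun i _ => e1 i)).trans ?_
  rw [← Finset.sum_add_distrib]
  exact Finset.sum_congr rfl fun i _ => by rw [defect]; ring

variable (D) in
/-- Genericity of the shift parameters. -/
def IsGeneric (v : Fin D.p → ℂ) : Prop :=
  ∀ β : D.Vq → ℕ, (∀ a, β a ≤ D.alphaV a) → ∑ a, (D.lamV a + D.vbar v a) * β a = 0 →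
    ∀ i : D.IrrNz, defect β i = 0

variable (D) in
theorem exists_isGeneric :
    ∃ v : Fin D.p → ℂ, D.IsGeneric v ∧ ((∀ i, D.isIrr i → i = 0) → v = 0) := by
  by_cases hI : ∀ i, D.isIrr i → i = 0
  · exact ⟨0, fun β _ _ i => (i.2.2 (hI i.1 i.2.1)).elim, fun _ => rfl⟩
  let pol : (∀ a, Fin (D.alphaV a + 1)) → Polynomial ℂ := fun β =>
    Polynomial.C (∑ a, D.lamV a * ((β a : ℕ) : ℂ)) +
      ∑ i : D.IrrNz, Polynomial.C (defect (fun a => (β a : ℕ)) i) * Polynomial.X ^ (i.1.val)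
  obtain ⟨t, ht⟩ := Infinite.exists_notMem_finset
    (Finset.univ.biUnion fun β => (pol β).roots.toFinset)
  refine ⟨fun i => t ^ (i.val + 1), fun β hβ h0 i => ?_, fun h => (hI h).elim⟩
  let β' : ∀ a, Fin (D.alphaV a + 1) := fun a => ⟨β a, Nat.lt_succ_of_le (hβ a)⟩
  have hve : ∀ i : D.IrrNz, D.ve (fun i => t ^ (i.val + 1)) i.1 = t ^ i.1.val := fun i => by
    rw [ve, dif_neg i.2.2, Fin.val_pred, Nat.sub_add_cancel]
    exact Nat.pos_of_ne_zero fun h => i.2.2 (Fin.ext h)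
  have heval : (pol β').eval t = 0 := by
    simp only [add_mul] at h0
    rw [Finset.sum_add_distrib, sum_vbar_mul] at h0
    simp only [pol, Polynomial.eval_add, Polynomial.eval_C, Polynomial.eval_finsetSum,
      Polynomial.eval_mul, Polynomial.eval_pow, Polynomial.eval_X]
    rw [← h0]
    congr 1
    exact Finset.sum_congr rfl fun i _ => by rw [hve, mul_comm]
  by_contra hd
  have hne : pol β' ≠ 0 := fun hz => hd (by
    have hc := congrArg (fun P => Polynomial.coeff P i.1.val) hz
    simp only [pol, Polynomial.coeff_add, Polynomial.finsetSum_coeff, Polynomial.coeff_C_mul,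
      Polynomial.coeff_X_pow, Polynomial.coeff_zero] at hc
    rw [Polynomial.coeff_C, if_neg (fun h : (i.1 : Fin (D.p+1)).val = 0 => i.2.2 (Fin.ext h)), zero_add,
      Finset.sum_eq_single i (fun i' _ hi' => by
        rw [if_neg fun h : i.1.val = i'.1.val => hi' (Subtype.ext (Fin.ext h.symm)), mul_zero])
        (fun h => (h (Finset.mem_univ _)).elim), if_pos rfl, mul_one] at hc
    exact hc)
  exact ht (Finset.mem_biUnion.2 ⟨β', Finset.mem_univ _, Multiset.mem_toFinset.2
    ((Polynomial.mem_roots hne).2 heval)⟩)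

end ConnData

theorem exists_inverse_matrix {α β : Type} [Fintype α] [Fintype β] [DecidableEq α] [DecidableEq β]
    (M : Matrix α β ℂ) (h : Function.Bijective M.mulVecLin) :
    ∃ M' : Matrix β α ℂ, M * M' = 1 ∧ M' * M = 1 := by
  let f := LinearEquiv.ofBijective M.mulVecLin h
  have hM : M.mulVecLin = f.toLinearMap := rfl
  refine ⟨LinearMap.toMatrix' f.symm.toLinearMap, ?_, ?_⟩
  · refine Matrix.ext_of_mulVec_single fun i => ?_
    rw [← Matrix.mulVec_mulVec, LinearMap.toMatrix'_mulVec, Matrix.one_mulVec]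
    exact f.apply_symm_apply _
  · refine Matrix.ext_of_mulVec_single fun i => ?_
    rw [← Matrix.mulVec_mulVec, LinearMap.toMatrix'_mulVec, Matrix.one_mulVec]
    exact f.symm_apply_apply _

theorem bijective_mulVecLin {α β : Type} [Fintype α] [Fintype β] [DecidableEq α] [DecidableEq β]
    (M : Matrix α β ℂ) (M' : Matrix β α ℂ) (h : M * M' = 1) (h' : M' * M = 1) :
    Function.Bijective M.mulVecLin := by
  refine Function.bijective_iff_has_inverse.2 ⟨fun w => M' *ᵥ w, fun w => ?_, fun w => ?_⟩
  · change M' *ᵥ (M *ᵥ w) = w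
    rw [Matrix.mulVec_mulVec, h', Matrix.one_mulVec]
  · change M *ᵥ (M' *ᵥ w) = w
    rw [Matrix.mulVec_mulVec, h, Matrix.one_mulVec]

namespace ConnData

variable {D : ConnData} {v : Fin D.p → ℂ} {x : D.quiv.Rep D.alphaV} {G : D.GRep}

theorem detMat_eq_iff (x : D.quiv.Rep D.alphaV) (i : D.IrrNz) (M : Matrix (D.Idx i.1) (D.Idx 0) ℂ) :
    D.detMat x i = M ↔ ∀ j j', a1 x j i j' = D.inc' i.1 j' * M * D.inc 0 j := by
  constructor
  · intro h j j'
    rw [ic'_mul, mul_ic, ← h]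
    rfl
  · intro h
    refine Matrix.ext fun a b => ?_
    have := congrFun (congrFun (h b.1 a.1) a.2) b.2
    rw [ic'_mul, mul_ic] at this
    exact this

theorem Realizes.detCond (hR : Realizes v x G) (hF : G.Frames) : D.DetCond x := fun i => by
  rw [(detMat_eq_iff x i (G.P i.1)).2 (hR.a1 i)]
  exact bijective_mulVecLin (G.P i.1) (G.P' i.1) (hF.PP' _) (hF.P'P _)

theorem exists_frame (hd : D.DetCond x) (i : Fin (D.p+1)) :
    ∃ (P : Matrix (D.Idx i) (D.Idx 0) ℂ) (P' : Matrix (D.Idx 0) (D.Idx i) ℂ),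
      P * P' = 1 ∧ P' * P = 1 ∧
      (∀ h : 0 = i, P = Eq.rec (motive := fun i _ => Matrix (D.Idx i) (D.Idx 0) ℂ) 1 h) ∧
      ∀ (hi : D.isIrr i ∧ i ≠ 0) j j', a1 x j ⟨i, hi⟩ j' = D.inc' i j' * P * D.inc 0 j := by
  by_cases h0 : 0 = i
  · subst h0
    exact ⟨1, 1, Matrix.mul_one _, Matrix.mul_one _, fun _ => rfl, fun hi => (hi.2 rfl).elim⟩
  by_cases hi : D.isIrr i
  · obtain ⟨P', h1, h2⟩ := exists_inverse_matrix _ (hd ⟨i, hi, fun h => h0 h.symm⟩)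
    exact ⟨_, P', h1, h2, fun h => (h0 h).elim, fun _ => (detMat_eq_iff x _ _).1 rfl⟩
  · let e : D.Idx i ≃ D.Idx 0 := (D.sigmaEquiv i).trans (D.sigmaEquiv 0).symm
    refine ⟨(1 : Matrix (D.Idx 0) (D.Idx 0) ℂ).submatrix e id,
      (1 : Matrix (D.Idx 0) (D.Idx 0) ℂ).submatrix id e, ?_, ?_, fun h => (h0 h).elim,
      fun h => (hi h.1).elim⟩
    · rw [← Matrix.submatrix_mul _ _ _ _ _ Function.bijective_id, Matrix.mul_one,
        Matrix.submatrix_one_equiv]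
    · rw [← Matrix.submatrix_mul _ _ _ _ _ e.bijective, Matrix.mul_one, Matrix.submatrix_id_id]

theorem exists_backward (x : D.quiv.Rep D.alphaV) (i : Fin (D.p+1)) :
    ∃ M : Matrix (D.Idx 0) (D.Idx i) ℂ, ∀ (hi : D.isIrr i ∧ i ≠ 0) j j',
      b1 x j ⟨i, hi⟩ j' = D.inc' 0 j * M * D.inc i j' := by
  by_cases hi : D.isIrr i ∧ i ≠ 0
  · obtain ⟨M, hM⟩ := exists_blocks fun j j' => b1 x j ⟨i, hi⟩ j'
    exact ⟨M, fun _ j j' => (hM j j').symm⟩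
  · exact ⟨0, fun h => (hi h).elim⟩

theorem exists_inner (x : D.quiv.Rep D.alphaV) (i : Fin (D.p+1)) (t : ℕ) :
    ∃ X : Matrix (D.Idx i) (D.Idx i) ℂ, ∀ hi j j' h (ht : t < D.dd i j j'),
      a2 x i hi j j' h ⟨t, ht⟩ = D.inc' i j' * X * D.inc i j ∧
      b2 x i hi j j' h ⟨t, ht⟩ = D.inc' i j * X * D.inc i j' := by
  by_cases hi : D.isIrr i
  · obtain ⟨X, hX⟩ := exists_blocks (ν := fun j => Fin (D.nb i j)) (ν' := fun j => Fin (D.nb i j))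
      fun j j' =>
      if h : j' < j ∧ t < D.dd i j' j then a2 x i hi j' j h.1 ⟨t, h.2⟩
      else if h : j < j' ∧ t < D.dd i j j' then b2 x i hi j j' h.1 ⟨t, h.2⟩ else 0
    refine ⟨X, fun _ j j' h ht => ⟨?_, ?_⟩⟩
    · rw [hX, dif_pos ⟨h, ht⟩]
    · rw [hX, dif_neg fun h' => h.asymm h'.1, dif_pos ⟨h, ht⟩]
  · exact ⟨0, fun h => (hi h).elim⟩

theorem exists_legBase (x : D.quiv.Rep D.alphaV) (i : Fin (D.p+1)) (P : Matrix (D.Idx i) (D.Idx 0) ℂ)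
    (P' : Matrix (D.Idx 0) (D.Idx i) ℂ) (hP : P' * P = 1) :
    ∃ (a0 : ∀ j, Matrix (Fin (D.nb i j)) (D.LV i j 0) ℂ)
      (b0 : ∀ j, Matrix (D.LV i j 0) (Fin (D.nb i j)) ℂ),
      (∀ hi j h, a4 x i hi j h = a0 j * D.lg i j 0 h ∧ b4 x i hi j h = D.lg' i j 0 h * b0 j) ∧
      ∀ hi h j, a5 x i hi h j = D.inc' 0 j * (P' * D.inc i (D.j1 i) * a0 (D.j1 i)) * D.lg i (D.j1 i) 0 h ∧
        b5 x i hi h j = D.lg' i (D.j1 i) 0 h * (b0 (D.j1 i) * D.inc' i (D.j1 i) * P) * D.inc 0 j := by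
  by_cases hi : D.isIrr i
  · refine ⟨fun j => if h : 0 < D.e i j - 1 then a4 x i hi j h * D.lg' i j 0 h else 0,
      fun j => if h : 0 < D.e i j - 1 then D.lg i j 0 h * b4 x i hi j h else 0,
      fun _ j h => ⟨?_, ?_⟩, fun h => (h hi).elim⟩
    · beta_reduce
      rw [dif_pos h, Matrix.mul_assoc, lm'_mul_lm, Matrix.mul_one]
    · beta_reduce
      rw [dif_pos h, ← Matrix.mul_assoc, lm'_mul_lm, Matrix.one_mul]
  · suffices H : ∃ (a0 : Matrix (Fin (D.nb i (D.j1 i))) (D.LV i (D.j1 i) 0) ℂ)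
        (b0 : Matrix (D.LV i (D.j1 i) 0) (Fin (D.nb i (D.j1 i))) ℂ),
        ∀ h j, a5 x i hi h j = D.inc' 0 j * (P' * D.inc i (D.j1 i) * a0) * D.lg i (D.j1 i) 0 h ∧
        b5 x i hi h j = D.lg' i (D.j1 i) 0 h * (b0 * D.inc' i (D.j1 i) * P) * D.inc 0 j by
      obtain ⟨a0, b0, H⟩ := H
      exact ⟨fun j => Eq.rec (motive := fun j _ => Matrix (Fin (D.nb i j)) (D.LV i j 0) ℂ) a0
          (eq_j1 hi j).symm,
        fun j => Eq.rec (motive := fun j _ => Matrix (D.LV i j 0) (Fin (D.nb i j)) ℂ) b0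
          (eq_j1 hi j).symm, fun h => (hi h).elim, fun _ => H⟩
    by_cases h : 0 < D.e i (D.j1 i) - 1
    · obtain ⟨C, hC⟩ := exists_rows fun j => a5 x i hi h j
      obtain ⟨R, hR⟩ := exists_cols fun j => b5 x i hi h j
      refine ⟨D.inc' i (D.j1 i) * P * C * D.lg' i (D.j1 i) 0 h,
        D.lg i (D.j1 i) 0 h * R * P' * D.inc i (D.j1 i), fun _ j => ⟨?_, ?_⟩⟩
      · calc a5 x i hi h j = D.inc' 0 j * C := (hC j).symm
          _ = D.inc' 0 j * ((P' * (D.inc i (D.j1 i) * D.inc' i (D.j1 i)) * P) * C) *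
              (D.lg' i (D.j1 i) 0 h * D.lg i (D.j1 i) 0 h) := by
            rw [inc_mul_inc'_reg hi, Matrix.mul_one, hP, Matrix.one_mul, lm'_mul_lm, Matrix.mul_one]
          _ = _ := by simp only [Matrix.mul_assoc]
      · calc b5 x i hi h j = R * D.inc 0 j := (hR j).symm
          _ = (D.lg' i (D.j1 i) 0 h * D.lg i (D.j1 i) 0 h) *
              (R * (P' * (D.inc i (D.j1 i) * D.inc' i (D.j1 i)) * P)) * D.inc 0 j := by
            rw [inc_mul_inc'_reg hi, Matrix.mul_one, hP, Matrix.mul_one, lm'_mul_lm, Matrix.one_mul]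
          _ = _ := by simp only [Matrix.mul_assoc]
    · exact ⟨0, 0, fun h' => (h h').elim⟩

/-- Representations satisfying the determinant conditions come from global representation data. -/
theorem exists_realizes (v : Fin D.p → ℂ) (hd : D.DetCond x) :
    ∃ G : D.GRep, G.Frames ∧ Realizes v x G := by
  choose P P' hPP' hP'P hP0 hPx using fun i => exists_frame hd i
  choose M hM using exists_backward x
  choose X hX using exists_inner x
  choose a0 b0 h4 h5 using fun i => exists_legBase x i (P i) (P' i) (hP'P i)
  let leg : ∀ i j, Leg (Fin (D.nb i j)) (D.LV i j) := fun i j =>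
    { a0 := a0 i j
      b0 := b0 i j
      a := fun k => if h : k + 1 < D.e i j - 1 then
        D.lg i j k (Nat.lt_of_succ_lt h) * a3 x i j k h * D.lg' i j (k+1) h else 0
      b := fun k => if h : k + 1 < D.e i j - 1 then
        D.lg i j (k+1) h * b3 x i j k h * D.lg' i j k (Nat.lt_of_succ_lt h) else 0 }
  let N : ∀ i, Matrix (D.Idx i) (D.Idx i) ℂ := fun i =>
    Matrix.blockDiagonal' fun j => (leg i j).N (D.xe i j)
  let Z1 : ∀ i, Matrix (D.Idx i) (D.Idx i) ℂ := fun i =>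
    if D.isIrr i then D.ve v i • 1 - P i * M i else N i
  let Z0 : Matrix (D.Idx 0) (D.Idx 0) ℂ := -∑ i : Fin D.p, P' i.succ * Z1 i.succ * P i.succ
  let Z : ∀ i, Matrix (D.Idx i) (D.Idx i) ℂ := Fin.cons Z0 fun i => Z1 i.succ
  have hZ : ∀ i, i ≠ 0 → Z i = Z1 i := fun i hi => by
    obtain ⟨i', rfl⟩ := Fin.exists_succ_eq.2 hi
    rfl
  refine ⟨⟨P, P', Z, X, leg⟩, ⟨hPP', hP'P, hP0 0 rfl, ?_, fun i hi => ?_⟩, ?_⟩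
  · have h1 : P 0 = 1 := hP0 0 rfl
    have h2 : P' 0 = 1 := by
      have := hPP' 0
      rwa [h1, Matrix.one_mul] at this
    change ∑ i, P' i * Z i * P i = 0
    rw [Fin.sum_univ_succ, h1, h2, Matrix.one_mul, Matrix.mul_one]
    exact neg_add_cancel _
  · change Z i = N i
    rw [hZ i (ne_zero_of_not_isIrr hi)]
    exact if_neg hi
  · constructor
    · exact fun i j j' => hPx i.1 i.2 j j'
    · intro i j j'
      rw [hM i.1 i.2 j j']
      have : P' i.1 * (D.ve v i.1 • 1 - Z i.1) = M i.1 := by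
        rw [hZ i.1 i.2.2, show Z1 i.1 = D.ve v i.1 • 1 - P i.1 * M i.1 from if_pos i.2.1,
          sub_sub_cancel, ← Matrix.mul_assoc, hP'P, Matrix.one_mul]
      rw [← this]
      rfl
    · exact fun i hi j j' h t => (hX i t.1 hi j j' h t.2).1
    · exact fun i hi j j' h t => (hX i t.1 hi j j' h t.2).2
    · intro i j k h
      change _ = D.lg' i j k _ * (if h : k + 1 < D.e i j - 1 then
        D.lg i j k (Nat.lt_of_succ_lt h) * a3 x i j k h * D.lg' i j (k+1) h else 0) * _
      rw [dif_pos h]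
      calc a3 x i j k h = (D.lg' i j k (Nat.lt_of_succ_lt h) * D.lg i j k (Nat.lt_of_succ_lt h)) *
            a3 x i j k h * (D.lg' i j (k+1) h * D.lg i j (k+1) h) := by
            rw [lm'_mul_lm, lm'_mul_lm, Matrix.one_mul, Matrix.mul_one]
        _ = _ := by simp only [Matrix.mul_assoc]
    · intro i j k h
      change _ = D.lg' i j (k+1) h * (if h : k + 1 < D.e i j - 1 then
        D.lg i j (k+1) h * b3 x i j k h * D.lg' i j k (Nat.lt_of_succ_lt h) else 0) * _
      rw [dif_pos h]
      calc b3 x i j k h = (D.lg' i j (k+1) h * D.lg i j (k+1) h) * b3 x i j k h *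
            (D.lg' i j k (Nat.lt_of_succ_lt h) * D.lg i j k (Nat.lt_of_succ_lt h)) := by
            rw [lm'_mul_lm, lm'_mul_lm, Matrix.one_mul, Matrix.mul_one]
        _ = _ := by simp only [Matrix.mul_assoc]
    · exact fun i hi j h => (h4 i hi j h).1
    · exact fun i hi j h => (h4 i hi j h).2
    · exact fun i hi h j => (h5 i hi h j).1
    · exact fun i hi h j => (h5 i hi h j).2

/-- Every global representation data gives rise to a representation. -/
theorem exists_rep (v : Fin D.p → ℂ) (G : D.GRep) : ∃ x, Realizes v x G := by
  let x : D.quiv.Rep D.alphaV := fun e => match e with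
    | .inl (j, ⟨i, j'⟩) => (D.inc' i.1 j' * G.P i.1 * D.inc 0 j, D.inc' 0 j * G.Q v i.1 * D.inc i.1 j')
    | .inr (.inl ⟨i, jj, t⟩) => (D.inc' i.1 jj.1.2 * G.X i.1 t * D.inc i.1 jj.1.1,
        D.inc' i.1 jj.1.1 * G.X i.1 t * D.inc i.1 jj.1.2)
    | .inr (.inr (.inl ⟨i, j, t⟩)) =>
        (D.lg' i j t.1 (by have := t.2; omega) * (G.leg i j).a t.1 *
          D.lg i j (t.1+1) (by have := t.2; omega),
         D.lg' i j (t.1+1) (by have := t.2; omega) * (G.leg i j).b t.1 *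
          D.lg i j t.1 (by have := t.2; omega))
    | .inr (.inr (.inr (.inl ⟨i, j⟩))) =>
        ((G.leg i.1 j.1).a0 * D.lg i.1 j.1 0 (by have := j.2; omega),
          D.lg' i.1 j.1 0 (by have := j.2; omega) * (G.leg i.1 j.1).b0)
    | .inr (.inr (.inr (.inr (i, j)))) =>
        (D.inc' 0 j * (G.P' i.1 * D.inc i.1 (D.j1 i.1) * (G.leg i.1 (D.j1 i.1)).a0) *
          D.lg i.1 (D.j1 i.1) 0 (by have := i.2.2; omega),
         D.lg' i.1 (D.j1 i.1) 0 (by have := i.2.2; omega) *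
          ((G.leg i.1 (D.j1 i.1)).b0 * D.inc' i.1 (D.j1 i.1) * G.P i.1) * D.inc 0 j)
  exact ⟨x, fun _ _ _ => rfl, fun _ _ _ => rfl, fun _ _ _ _ _ _ => rfl, fun _ _ _ _ _ _ => rfl,
    fun _ _ _ _ => rfl, fun _ _ _ _ => rfl, fun _ _ _ _ => rfl, fun _ _ _ _ => rfl,
    fun _ _ _ _ => rfl, fun _ _ _ _ => rfl⟩

end ConnData

theorem exists_left_inverse_matrix {α β : Type} [Fintype α] [Fintype β] [DecidableEq α]
    [DecidableEq β] (M : Matrix α β ℂ) (h : ∀ u, M *ᵥ u = 0 → u = 0) :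
    ∃ L : Matrix β α ℂ, L * M = 1 := by
  obtain ⟨f, hf⟩ := LinearMap.exists_leftInverse_of_injective M.mulVecLin
    (LinearMap.ker_eq_bot'.2 fun u hu => h u hu)
  refine ⟨LinearMap.toMatrix' f, ?_⟩
  have := congrArg LinearMap.toMatrix' hf
  rwa [LinearMap.toMatrix'_comp, LinearMap.toMatrix'_id, ← Matrix.toLin'_apply',
    LinearMap.toMatrix'_toLin'] at this

theorem exists_right_inverse_matrix {α β : Type} [Fintype α] [Fintype β] [DecidableEq α]
    [DecidableEq β] (M : Matrix α β ℂ) (h : ∀ u, ∃ w, M *ᵥ w = u) :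
    ∃ L : Matrix β α ℂ, M * L = 1 := by
  obtain ⟨f, hf⟩ := LinearMap.exists_rightInverse_of_surjective M.mulVecLin
    (LinearMap.range_eq_top.2 h)
  refine ⟨LinearMap.toMatrix' f, ?_⟩
  have := congrArg LinearMap.toMatrix' hf
  rwa [LinearMap.toMatrix'_comp, LinearMap.toMatrix'_id, ← Matrix.toLin'_apply',
    LinearMap.toMatrix'_toLin'] at this

namespace ConnData

variable {D : ConnData} {v : Fin D.p → ℂ} {x : D.quiv.Rep D.alphaV} {G : D.GRep}

/-- The subspace at a vertex `[i,j]`. -/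
def midSub (U : ∀ a : D.Vq, Submodule ℂ (Fin (D.alphaV a) → ℂ)) (i : Fin (D.p+1)) (hi : D.isIrr i)
    (j : Fin (D.m i)) : Submodule ℂ (Fin (D.nb i j) → ℂ) := U (D.vmid ⟨i, hi⟩ j)

/-- Invariance of a family of subspaces, arrow by arrow. -/
structure ArrInv (x : D.quiv.Rep D.alphaV) (U : ∀ a : D.Vq, Submodule ℂ (Fin (D.alphaV a) → ℂ)) :
    Prop where
  protected a1 : ∀ (j : Fin (D.m 0)) (i : D.IrrNz) (j' : Fin (D.m i.1)), ∀ u ∈ midSub U 0 (Or.inr rfl) j, a1 x j i j' *ᵥ u ∈ midSub U i.1 i.2.1 j'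
  protected b1 : ∀ (j : Fin (D.m 0)) (i : D.IrrNz) (j' : Fin (D.m i.1)), ∀ u ∈ midSub U i.1 i.2.1 j', b1 x j i j' *ᵥ u ∈ midSub U 0 (Or.inr rfl) j
  protected a2 : ∀ i hi j j' h t, ∀ u ∈ midSub U i hi j, a2 x i hi j j' h t *ᵥ u ∈ midSub U i hi j'
  protected b2 : ∀ i hi j j' h t, ∀ u ∈ midSub U i hi j', b2 x i hi j j' h t *ᵥ u ∈ midSub U i hi j
  protected a3 : ∀ i j k h, ∀ u ∈ U (D.vleg i j ⟨k+1, h⟩),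
    a3 x i j k h *ᵥ u ∈ U (D.vleg i j ⟨k, Nat.lt_of_succ_lt h⟩)
  protected b3 : ∀ i j k h, ∀ u ∈ U (D.vleg i j ⟨k, Nat.lt_of_succ_lt h⟩),
    b3 x i j k h *ᵥ u ∈ U (D.vleg i j ⟨k+1, h⟩)
  protected a4 : ∀ i hi j h, ∀ u ∈ U (D.vleg i j ⟨0, h⟩), a4 x i hi j h *ᵥ u ∈ midSub U i hi j
  protected b4 : ∀ i hi j h, ∀ u ∈ midSub U i hi j, b4 x i hi j h *ᵥ u ∈ U (D.vleg i j ⟨0, h⟩)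
  protected a5 : ∀ i hi h j, ∀ u ∈ U (D.vleg i (D.j1 i) ⟨0, h⟩),
    a5 x i hi h j *ᵥ u ∈ midSub U 0 (Or.inr rfl) j
  protected b5 : ∀ i hi h j, ∀ u ∈ midSub U 0 (Or.inr rfl) j,
    b5 x i hi h j *ᵥ u ∈ U (D.vleg i (D.j1 i) ⟨0, h⟩)

theorem invFamily_iff (x : D.quiv.Rep D.alphaV) (U : ∀ a : D.Vq, Submodule ℂ (Fin (D.alphaV a) → ℂ)) :
    FinQuiver.InvFamily (Q := D.quiv) (α := D.alphaV) x U ↔ ArrInv x U := by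
  constructor
  · intro h
    exact ⟨fun j i j' => (h (.inl (j, ⟨i, j'⟩))).1, fun j i j' => (h (.inl (j, ⟨i, j'⟩))).2,
      fun i hi j j' hj t => (h (.inr (.inl ⟨⟨i, hi⟩, ⟨(j, j'), hj⟩, t⟩))).1,
      fun i hi j j' hj t => (h (.inr (.inl ⟨⟨i, hi⟩, ⟨(j, j'), hj⟩, t⟩))).2,
      fun i j k hk => (h (.inr (.inr (.inl ⟨i, j, ⟨k, by omega⟩⟩)))).1,
      fun i j k hk => (h (.inr (.inr (.inl ⟨i, j, ⟨k, by omega⟩⟩)))).2,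
      fun i hi j hj => (h (.inr (.inr (.inr (.inl ⟨⟨i, hi⟩, ⟨j, two_le_of_pos hj⟩⟩))))).1,
      fun i hi j hj => (h (.inr (.inr (.inr (.inl ⟨⟨i, hi⟩, ⟨j, two_le_of_pos hj⟩⟩))))).2,
      fun i hi hj j => (h (.inr (.inr (.inr (.inr (⟨i, hi, two_le_of_pos hj⟩, j)))))).1,
      fun i hi hj j => (h (.inr (.inr (.inr (.inr (⟨i, hi, two_le_of_pos hj⟩, j)))))).2⟩
  · intro h
    rintro (⟨j, i, j'⟩ | ⟨⟨i, hi⟩, ⟨⟨j, j'⟩, hj⟩, t⟩ | ⟨i, j, k⟩ | ⟨⟨i, hi⟩, ⟨j, hj⟩⟩ | ⟨⟨i, hi, hj⟩, j⟩)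
    · exact ⟨h.a1 j i j', h.b1 j i j'⟩
    · exact ⟨h.a2 i hi j j' hj t, h.b2 i hi j j' hj t⟩
    · have hk : k.1 + 1 < D.e i j - 1 := by have := k.2; omega
      exact ⟨h.a3 i j k.1 hk, h.b3 i j k.1 hk⟩
    · have h' : 0 < D.e i j - 1 := by have : 2 ≤ D.e i j := hj; omega
      exact ⟨h.a4 i hi j h', h.b4 i hi j h'⟩
    · have h' : 0 < D.e i (D.j1 i) - 1 := by have : 2 ≤ D.e i (D.j1 i) := hj; omega
      exact ⟨h.a5 i hi h' j, h.b5 i hi h' j⟩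

/-- The family of subspaces of the vertex spaces determined by subspaces in the standard frames
and on the legs. -/
def fam (W : ∀ i, Submodule ℂ (D.Idx i → ℂ)) (S : ∀ i j k, Submodule ℂ (D.LV i j k → ℂ)) :
    ∀ a : D.Vq, Submodule ℂ (Fin (D.alphaV a) → ℂ)
  | .inl ⟨i, j⟩ => (W i.1).comap (D.inc i.1 j).mulVecLin
  | .inr ⟨i, j, k⟩ => (S i j k.1).comap (D.lg i j k.1 k.2).mulVecLin

/-- Subspaces on the legs compatible with subspaces in the standard frames. -/
structure LegInv (G : D.GRep) (W : ∀ i, Submodule ℂ (D.Idx i → ℂ))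
    (S : ∀ i j k, Submodule ℂ (D.LV i j k → ℂ)) : Prop where
  a0 : ∀ i j, ∀ s ∈ S i j 0, D.inc i j *ᵥ ((G.leg i j).a0 *ᵥ s) ∈ W i
  b0 : ∀ i j, ∀ w ∈ W i, (G.leg i j).b0 *ᵥ (D.inc' i j *ᵥ w) ∈ S i j 0
  a : ∀ i j k, ∀ s ∈ S i j (k+1), (G.leg i j).a k *ᵥ s ∈ S i j k
  b : ∀ i j k, ∀ s ∈ S i j k, (G.leg i j).b k *ᵥ s ∈ S i j (k+1)

theorem mulVec_of_mul_eq {α β γ : Type} [Fintype α] [Fintype β] [Fintype γ] {M : Matrix α β ℂ}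
    {M' : Matrix β γ ℂ} {K : Matrix α γ ℂ} (h : M * M' = K) (u : γ → ℂ) :
    M *ᵥ (M' *ᵥ u) = K *ᵥ u := by
  rw [Matrix.mulVec_mulVec, h]

theorem lg_mul_lg' {i : Fin (D.p+1)} {j : Fin (D.m i)} {k : ℕ} (h : k < D.e i j - 1) :
    D.lg i j k h * D.lg' i j k h = 1 := lm_mul_lm' h

theorem lg'_mul_lg {i : Fin (D.p+1)} {j : Fin (D.m i)} {k : ℕ} (h : k < D.e i j - 1) :
    D.lg' i j k h * D.lg i j k h = 1 := lm'_mul_lm h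

theorem GRep.BaseInv.inc {W : ∀ i, Submodule ℂ (D.Idx i → ℂ)} (hW : G.BaseInv W)
    {i : Fin (D.p+1)} (j : Fin (D.m i)) {w : D.Idx i → ℂ} (hw : w ∈ W i) :
    D.inc i j *ᵥ (D.inc' i j *ᵥ w) ∈ W i := by
  rw [mulVec_of_mul_eq (inc_mul_inc' i j)]
  exact hW.e i j w hw

theorem GRep.BaseInv.Q {W : ∀ i, Submodule ℂ (D.Idx i → ℂ)} (hW : G.BaseInv W)
    (i : Fin (D.p+1)) {w : D.Idx i → ℂ} (hw : w ∈ W i) : G.Q v i *ᵥ w ∈ W 0 := by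
  rw [GRep.Q, ← Matrix.mulVec_mulVec]
  refine hW.P' i _ ?_
  rw [Matrix.sub_mulVec, Matrix.smul_mulVec, Matrix.one_mulVec]
  exact (W i).sub_mem ((W i).smul_mem _ hw) (hW.Z i w hw)

theorem GRep.BaseInv.X_inc {W : ∀ i, Submodule ℂ (D.Idx i → ℂ)} (hW : G.BaseInv W)
    {i : Fin (D.p+1)} {j j' : Fin (D.m i)} (h : j ≠ j') {t : ℕ} (ht : t < dq (D.q i) j j')
    {u : Fin (D.nb i j') → ℂ} (hu : D.inc i j' *ᵥ u ∈ W i) :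
    D.inc i j *ᵥ ((D.inc' i j * G.X i t * D.inc i j') *ᵥ u) ∈ W i := by
  have h1 := hW.X i j j' h t ht _ hu
  rw [← inc_mul_inc', ← inc_mul_inc'] at h1
  have : D.inc i j * D.inc' i j * G.X i t * (D.inc i j' * D.inc' i j') * D.inc i j' =
      D.inc i j * (D.inc' i j * G.X i t * D.inc i j') := by
    calc _ = D.inc i j * D.inc' i j * G.X i t * (D.inc i j' * (D.inc' i j' * D.inc i j')) := by
          simp only [Matrix.mul_assoc]
      _ = _ := by rw [inc'_mul_inc, Matrix.mul_one]; simp only [Matrix.mul_assoc]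
  rw [Matrix.mulVec_mulVec, this] at h1
  rwa [Matrix.mulVec_mulVec]

theorem Realizes.invFamily (hR : Realizes v x G) {W : ∀ i, Submodule ℂ (D.Idx i → ℂ)}
    {S : ∀ i j k, Submodule ℂ (D.LV i j k → ℂ)} (hW : G.BaseInv W) (hS : LegInv G W S) :
    FinQuiver.InvFamily (Q := D.quiv) (α := D.alphaV) x (fam W S) := by
  have hlg : ∀ i j k (h : k < D.e i j - 1) (s : D.LV i j k → ℂ), s ∈ S i j k →
      D.lg i j k h *ᵥ (D.lg' i j k h *ᵥ s) ∈ S i j k := fun i j k h s hs => by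
    rw [mulVec_of_mul_eq (lg_mul_lg' h), Matrix.one_mulVec]; exact hs
  refine (invFamily_iff x _).2 ⟨fun j i j' u hu => ?_, fun j i j' u hu => ?_,
    fun i hi j j' h t u hu => ?_, fun i hi j j' h t u hu => ?_, fun i j k h u hu => ?_,
    fun i j k h u hu => ?_, fun i hi j h u hu => ?_, fun i hi j h u hu => ?_,
    fun i hi h j u hu => ?_, fun i hi h j u hu => ?_⟩
  · change D.inc i.1 j' *ᵥ (a1 x j i j' *ᵥ u) ∈ W i.1
    rw [hR.a1, ← Matrix.mulVec_mulVec, ← Matrix.mulVec_mulVec]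
    exact hW.inc j' (hW.P _ _ hu)
  · change D.inc 0 j *ᵥ (b1 x j i j' *ᵥ u) ∈ W 0
    rw [hR.b1, ← Matrix.mulVec_mulVec, ← Matrix.mulVec_mulVec]
    exact hW.inc j (hW.Q _ hu)
  · change D.inc i j' *ᵥ (a2 x i hi j j' h t *ᵥ u) ∈ W i
    rw [hR.a2]
    exact hW.X_inc (ne_of_gt h) (by rw [dq_comm]; exact t.2) hu
  · change D.inc i j *ᵥ (b2 x i hi j j' h t *ᵥ u) ∈ W i
    rw [hR.b2]
    exact hW.X_inc (ne_of_lt h) t.2 hu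
  · change D.lg i j k (Nat.lt_of_succ_lt h) *ᵥ (a3 x i j k h *ᵥ u) ∈ S i j k
    rw [hR.a3, ← Matrix.mulVec_mulVec, ← Matrix.mulVec_mulVec]
    exact hlg _ _ _ _ _ (hS.a _ _ _ _ hu)
  · change D.lg i j (k+1) h *ᵥ (b3 x i j k h *ᵥ u) ∈ S i j (k+1)
    rw [hR.b3, ← Matrix.mulVec_mulVec, ← Matrix.mulVec_mulVec]
    exact hlg _ _ _ _ _ (hS.b _ _ _ _ hu)
  · change D.inc i j *ᵥ (a4 x i hi j h *ᵥ u) ∈ W i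
    rw [hR.a4, ← Matrix.mulVec_mulVec]
    exact hS.a0 _ _ _ hu
  · change D.lg i j 0 h *ᵥ (b4 x i hi j h *ᵥ u) ∈ S i j 0
    rw [hR.b4, ← Matrix.mulVec_mulVec]
    refine hlg _ _ _ _ _ ?_
    have := hS.b0 i j _ hu
    change (G.leg i j).b0 *ᵥ (D.inc' i j *ᵥ (D.inc i j *ᵥ u)) ∈ _ at this
    rwa [mulVec_of_mul_eq (inc'_mul_inc i j), Matrix.one_mulVec] at this
  · change D.inc 0 j *ᵥ (a5 x i hi h j *ᵥ u) ∈ W 0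
    rw [hR.a5, ← Matrix.mulVec_mulVec, ← Matrix.mulVec_mulVec, ← Matrix.mulVec_mulVec,
      ← Matrix.mulVec_mulVec]
    exact hW.inc j (hW.P' _ _ (hS.a0 _ _ _ hu))
  · change D.lg i (D.j1 i) 0 h *ᵥ (b5 x i hi h j *ᵥ u) ∈ S i (D.j1 i) 0
    rw [hR.b5, ← Matrix.mulVec_mulVec, ← Matrix.mulVec_mulVec, ← Matrix.mulVec_mulVec,
      ← Matrix.mulVec_mulVec]
    exact hlg _ _ _ _ _ (hS.b0 _ _ _ (hW.P _ _ hu))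

theorem pr_N_pr (G : D.GRep) (i : Fin (D.p+1)) (j : Fin (D.m i)) :
    pr D i j * G.N i * pr D i j = D.inc i j * (G.leg i j).N (D.xe i j) * D.inc' i j := by
  rw [← inc_mul_inc', GRep.N]
  calc _ = D.inc i j * ((D.inc' i j * Matrix.blockDiagonal' fun j => (G.leg i j).N (D.xe i j)) *
        D.inc i j) * D.inc' i j := by simp only [Matrix.mul_assoc]
    _ = _ := by rw [ic'_mul_blockDiagonal, Matrix.mul_assoc _ (D.inc' i j), inc'_mul_inc, Matrix.mul_one]

theorem pr_mul_pr (i : Fin (D.p+1)) (j : Fin (D.m i)) : pr D i j * pr D i j = pr D i j :=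
  eb_mul_self _ j

/-- An invariant family is invariant under the endomorphisms determined by the legs. -/
theorem GRep.BaseInv.legN {W : ∀ i, Submodule ℂ (D.Idx i → ℂ)} (hW : G.BaseInv W) (hG : G.Valid)
    (i : Fin (D.p+1)) (j : Fin (D.m i)) {w : D.Idx i → ℂ} (hw : w ∈ W i) :
    D.inc i j *ᵥ ((G.leg i j).N (D.xe i j) *ᵥ (D.inc' i j *ᵥ w)) ∈ W i := by
  rw [Matrix.mulVec_mulVec, Matrix.mulVec_mulVec, ← pr_N_pr,
    eq_sub_of_add_eq' (hG.diag i j).symm, Matrix.sub_mulVec]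
  refine (W i).sub_mem ?_ ?_
  · rw [← Matrix.mulVec_mulVec, ← Matrix.mulVec_mulVec]
    exact hW.e _ _ _ (hW.Z _ _ (hW.e _ _ _ hw))
  · rw [mom, Matrix.sum_mulVec]
    refine Submodule.sum_mem _ fun j' _ => ?_
    rw [Matrix.smul_mulVec, Matrix.sum_mulVec]
    refine Submodule.smul_mem _ _ (Submodule.sum_mem _ fun t ht => ?_)
    have ht := Finset.mem_range.1 ht
    by_cases h : j = j'
    · subst h
      rw [dq_self] at ht
      omega
    · have key : pr D i j * G.X i t * pr D i j' * G.X i t * pr D i j =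
          (pr D i j * G.X i t * pr D i j') * (pr D i j' * G.X i t * pr D i j) := by
        calc _ = pr D i j * G.X i t * (pr D i j' * pr D i j') * G.X i t * pr D i j := by
              rw [pr_mul_pr]
          _ = _ := by simp only [Matrix.mul_assoc]
      change (pr D i j * G.X i t * pr D i j' * G.X i t * pr D i j) *ᵥ w ∈ W i
      rw [key, ← Matrix.mulVec_mulVec]
      exact hW.X _ _ _ h _ ht _ (hW.X _ _ _ (Ne.symm h) _ (by rw [dq_comm]; exact ht) _ hw)

/-- The largest subspaces on the legs compatible with an invariant family. -/
theorem GRep.BaseInv.legInv_comap {W : ∀ i, Submodule ℂ (D.Idx i → ℂ)} (hW : G.BaseInv W)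
    (hG : G.Valid) : LegInv G W fun i j k => (W i).comap (D.inc i j * (G.leg i j).A k).mulVecLin where
  a0 i j s hs := by
    rw [Matrix.mulVec_mulVec]
    exact hs
  b0 i j w hw := by
    change (D.inc i j * (G.leg i j).A 0) *ᵥ _ ∈ W i
    have h := hW.legN hG i j hw
    rw [Leg.N, Matrix.add_mulVec, Matrix.mulVec_add, Matrix.smul_mulVec, Matrix.one_mulVec,
      Matrix.mulVec_smul, Submodule.add_mem_iff_right _ ((W i).smul_mem _ (hW.inc j hw))] at h
    rw [← Matrix.mulVec_mulVec, Matrix.mulVec_mulVec _ ((G.leg i j).A 0)]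
    exact h
  a i j k s hs := by
    change (D.inc i j * (G.leg i j).A k) *ᵥ _ ∈ W i
    rw [Matrix.mulVec_mulVec, Matrix.mul_assoc]
    exact hs
  b i j k s hs := by
    change (D.inc i j * (G.leg i j).A (k+1)) *ᵥ _ ∈ W i
    have hs : (D.inc i j * (G.leg i j).A k) *ᵥ s ∈ W i := hs
    rw [Matrix.mulVec_mulVec, Matrix.mul_assoc, (hG.legMom i j).A_mul_b, Matrix.mul_sub,
      Matrix.sub_mulVec, Matrix.mul_smul, Matrix.smul_mulVec]
    refine (W i).sub_mem ?_ ((W i).smul_mem _ hs)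
    have h := hW.legN hG i j hs
    rwa [Matrix.mulVec_mulVec _ (D.inc' i j), ← Matrix.mul_assoc (D.inc' i j), inc'_mul_inc, Matrix.one_mul,
      Matrix.mulVec_mulVec, Matrix.mulVec_mulVec, Matrix.mul_assoc] at h

theorem baseInv_top (G : D.GRep) : G.BaseInv fun _ => ⊤ where
  P _ _ _ := trivial
  P' _ _ _ := trivial
  e _ _ _ _ := trivial
  Z _ _ _ := trivial
  X _ _ _ _ _ _ _ _ := trivial

theorem baseInv_bot (G : D.GRep) : G.BaseInv fun _ => ⊥ where
  P _ w hw := by rw [(Submodule.mem_bot ℂ).1 hw, Matrix.mulVec_zero]; exact Submodule.zero_mem _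
  P' _ w hw := by rw [(Submodule.mem_bot ℂ).1 hw, Matrix.mulVec_zero]; exact Submodule.zero_mem _
  e _ _ w hw := by rw [(Submodule.mem_bot ℂ).1 hw, Matrix.mulVec_zero]; exact Submodule.zero_mem _
  Z _ w hw := by rw [(Submodule.mem_bot ℂ).1 hw, Matrix.mulVec_zero]; exact Submodule.zero_mem _
  X _ _ _ _ _ _ w hw := by
    rw [(Submodule.mem_bot ℂ).1 hw, Matrix.mulVec_zero]; exact Submodule.zero_mem _

theorem legInv_range (hG : G.Valid) :
    LegInv G (fun _ => ⊤) fun i j k => LinearMap.range ((G.leg i j).B k).mulVecLin where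
  a0 _ _ _ _ := trivial
  b0 _ _ _ _ := ⟨_, rfl⟩
  a i j k s hs := by
    obtain ⟨y, rfl⟩ := hs
    refine ⟨(G.leg i j).N (D.xe i j) *ᵥ y - D.xe i j (k+1) • y, ?_⟩
    change (G.leg i j).B k *ᵥ _ = (G.leg i j).a k *ᵥ ((G.leg i j).B (k+1) *ᵥ y)
    rw [Matrix.mulVec_mulVec, (hG.legMom i j).a_mul_B, Matrix.mulVec_sub, Matrix.sub_mulVec,
      Matrix.mulVec_mulVec, Matrix.mulVec_smul, Matrix.smul_mulVec]
  b i j k s hs := by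
    obtain ⟨y, rfl⟩ := hs
    refine ⟨y, ?_⟩
    change (G.leg i j).B (k+1) *ᵥ y = (G.leg i j).b k *ᵥ ((G.leg i j).B k *ᵥ y)
    rw [Matrix.mulVec_mulVec]
    rfl

theorem inc_mulVec_injective {i : Fin (D.p+1)} {j : Fin (D.m i)} {u : Fin (D.nb i j) → ℂ}
    (h : D.inc i j *ᵥ u = 0) : u = 0 := by
  rw [← Matrix.one_mulVec u, ← inc'_mul_inc, ← Matrix.mulVec_mulVec, h, Matrix.mulVec_zero]

theorem lg_mulVec_injective {i : Fin (D.p+1)} {j : Fin (D.m i)} {k : ℕ} {hk : k < D.e i j - 1}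
    {s : D.LV i j k → ℂ} (h : D.lg' i j k hk *ᵥ s = 0) : s = 0 := by
  rw [← Matrix.one_mulVec s, ← lg_mul_lg' hk, ← Matrix.mulVec_mulVec, h, Matrix.mulVec_zero]

theorem not_fam_top (i : Fin (D.p+1)) (j : Fin (D.m i)) :
    (⊥ : Submodule ℂ (D.Idx i → ℂ)).comap (D.inc i j).mulVecLin ≠ ⊤ := fun h => by
  have h1 : (fun _ => 1 : Fin (D.nb i j) → ℂ) ∈
    (⊥ : Submodule ℂ (D.Idx i → ℂ)).comap (D.inc i j).mulVecLin := h ▸ trivial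
  exact one_ne_zero (congrFun (inc_mulVec_injective ((Submodule.mem_bot ℂ).1 h1)) ⟨0, D.hnb i j⟩)

theorem Realizes.baseIrred (hR : Realizes v x G) (hG : G.Valid)
    (hx : FinQuiver.Irred (Q := D.quiv) (α := D.alphaV) x) : G.BaseIrred := fun W hW => by
  rcases hx _ (hR.invFamily hW (hW.legInv_comap hG)) with h | h
  · refine Or.inl (le_bot_iff.1 fun w hw => ?_)
    have key : ∀ j, D.inc' 0 j *ᵥ w = 0 := fun j => by
      have h1 : (W 0).comap (D.inc 0 j).mulVecLin = ⊥ := h (D.vmid0 j)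
      exact (Submodule.mem_bot ℂ).1 (h1 ▸ (hW.inc j hw :))
    rw [Submodule.mem_bot, ← sum_ic_mulVec w]
    exact Finset.sum_eq_zero fun j _ => by rw [key, Matrix.mulVec_zero]
  · refine Or.inr (top_le_iff.1 fun w _ => ?_)
    rw [← sum_ic_mulVec w]
    refine Submodule.sum_mem _ fun j _ => ?_
    have h1 : (W 0).comap (D.inc 0 j).mulVecLin = ⊤ := h (D.vmid0 j)
    exact (h1.symm ▸ trivial : D.inc' 0 j *ᵥ w ∈ (W 0).comap (D.inc 0 j).mulVecLin)

theorem Realizes.good (hR : Realizes v x G) (hG : G.Valid)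
    (hx : FinQuiver.Irred (Q := D.quiv) (α := D.alphaV) x) : G.Good := fun i j =>
  { inj := fun k => by
      refine exists_left_inverse_matrix _ fun s hs => ?_
      by_cases hk : k < D.e i j - 1
      · rcases hx _ (hR.invFamily (baseInv_bot G) ((baseInv_bot G).legInv_comap hG)) with h | h
        · have h1 : ((⊥ : Submodule ℂ (D.Idx i → ℂ)).comap
              (D.inc i j * (G.leg i j).A k).mulVecLin).comap (D.lg i j k hk).mulVecLin = ⊥ :=
            h (D.vleg i j ⟨k, hk⟩)
          refine lg_mulVec_injective (hk := hk) ((Submodule.mem_bot ℂ).1 (h1 ▸ ?_))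
          change (D.inc i j * (G.leg i j).A k) *ᵥ (D.lg i j k hk *ᵥ (D.lg' i j k hk *ᵥ s)) = 0
          rw [mulVec_of_mul_eq (lg_mul_lg' hk), Matrix.one_mulVec, ← Matrix.mulVec_mulVec, hs,
            Matrix.mulVec_zero]
        · exact (not_fam_top 0 (D.j1 0) (h (D.vmid0 (D.j1 0)))).elim
      · have := isEmpty_LV hk
        exact Subsingleton.elim _ _
    surj := fun k => by
      refine exists_right_inverse_matrix _ fun s => ?_
      by_cases hk : k < D.e i j - 1
      · rcases hx _ (hR.invFamily (baseInv_top G) (legInv_range hG)) with h | h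
        · have h1 : (⊤ : Submodule ℂ (D.Idx 0 → ℂ)).comap (D.inc 0 (D.j1 0)).mulVecLin = ⊥ :=
            h (D.vmid0 (D.j1 0))
          refine (not_fam_top 0 (D.j1 0) ?_).elim
          rw [eq_top_iff, ← Submodule.comap_top (D.inc 0 (D.j1 0)).mulVecLin, h1]
          exact bot_le
        · have h1 : (LinearMap.range ((G.leg i j).B k).mulVecLin).comap (D.lg i j k hk).mulVecLin = ⊤ :=
            h (D.vleg i j ⟨k, hk⟩)
          have h2 : D.lg' i j k hk *ᵥ s ∈
            (LinearMap.range ((G.leg i j).B k).mulVecLin).comap (D.lg i j k hk).mulVecLin := h1 ▸ trivial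
          obtain ⟨y, hy⟩ := h2
          refine ⟨y, hy.trans ?_⟩
          change D.lg i j k hk *ᵥ (D.lg' i j k hk *ᵥ s) = s
          rw [mulVec_of_mul_eq (lg_mul_lg' hk), Matrix.one_mulVec]
      · have := isEmpty_LV hk
        exact ⟨0, Subsingleton.elim _ _⟩ }

end ConnData

namespace ConnData

variable {D : ConnData} {v : Fin D.p → ℂ} {x : D.quiv.Rep D.alphaV} {G : D.GRep}
  {U : ∀ a : D.Vq, Submodule ℂ (Fin (D.alphaV a) → ℂ)}

/-- The subspace of a standard frame determined by subspaces of its blocks. -/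
def frameSub (U : ∀ a : D.Vq, Submodule ℂ (Fin (D.alphaV a) → ℂ)) (i : Fin (D.p+1))
    (hi : D.isIrr i) : Submodule ℂ (D.Idx i → ℂ) :=
  ⨅ j, (midSub U i hi j).comap (D.inc' i j).mulVecLin

theorem mem_frameSub {i : Fin (D.p+1)} {hi : D.isIrr i} {w : D.Idx i → ℂ} :
    w ∈ frameSub U i hi ↔ ∀ j, D.inc' i j *ᵥ w ∈ midSub U i hi j := by
  rw [frameSub, Submodule.mem_iInf]
  rfl

theorem inc_mem_frameSub {i : Fin (D.p+1)} {hi : D.isIrr i} {j : Fin (D.m i)}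
    {u : Fin (D.nb i j) → ℂ} (hu : u ∈ midSub U i hi j) : D.inc i j *ᵥ u ∈ frameSub U i hi := by
  refine mem_frameSub.2 fun j' => ?_
  rw [Matrix.mulVec_mulVec]
  by_cases h : j' = j
  · subst h
    rwa [inc'_mul_inc, Matrix.one_mulVec]
  · rw [show D.inc' i j' * D.inc i j = 0 from ic'_mul_ic_of_ne h, Matrix.zero_mulVec]
    exact Submodule.zero_mem _

theorem finrank_frameSub (U : ∀ a : D.Vq, Submodule ℂ (Fin (D.alphaV a) → ℂ)) (i : Fin (D.p+1))
    (hi : D.isIrr i) :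
    Module.finrank ℂ (frameSub U i hi) = ∑ j, Module.finrank ℂ (midSub U i hi j) := by
  rw [← Module.finrank_pi_fintype ℂ]
  refine LinearEquiv.finrank_eq (LinearEquiv.ofBijective
    (LinearMap.pi fun j => LinearMap.codRestrict (midSub U i hi j)
      ((D.inc' i j).mulVecLin ∘ₗ (frameSub U i hi).subtype) fun w => mem_frameSub.1 w.2 j) ⟨?_, ?_⟩)
  · refine LinearMap.ker_eq_bot.1 (LinearMap.ker_eq_bot'.2 fun w hw => Subtype.ext ?_)
    have h : ∀ j, D.inc' i j *ᵥ w.1 = 0 := fun j => congrArg Subtype.val (congrFun hw j)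
    rw [← sum_ic_mulVec w.1]
    exact Finset.sum_eq_zero fun j _ => by rw [h, Matrix.mulVec_zero]
  · intro u
    refine ⟨⟨∑ j, D.inc i j *ᵥ (u j).1, Submodule.sum_mem _ fun j _ => inc_mem_frameSub (u j).2⟩,
      funext fun j => Subtype.ext ?_⟩
    change D.inc' i j *ᵥ (∑ j', D.inc i j' *ᵥ (u j').1) = (u j).1
    rw [Matrix.mulVec_sum, Finset.sum_eq_single j, mulVec_of_mul_eq (inc'_mul_inc i j),
      Matrix.one_mulVec]
    · intro j' _ h
      rw [mulVec_of_mul_eq (ic'_mul_ic_of_ne h.symm), Matrix.zero_mulVec]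
    · exact fun h => (h (Finset.mem_univ _)).elim

/-- A matrix given by blocks maps subspaces given by blocks into each other. -/
theorem mulVec_mem_of_blocks {i : Fin (D.p+1)} {hi : D.isIrr i} {α : Type} [Fintype α]
    {S : Submodule ℂ (α → ℂ)} {M : Matrix α (D.Idx i) ℂ}
    (h : ∀ j, ∀ u ∈ midSub U i hi j, (M * D.inc i j) *ᵥ u ∈ S) {w : D.Idx i → ℂ}
    (hw : w ∈ frameSub U i hi) : M *ᵥ w ∈ S := by
  rw [← sum_ic_mulVec w, Matrix.mulVec_sum]
  refine Submodule.sum_mem _ fun j _ => ?_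
  rw [Matrix.mulVec_mulVec]
  exact h j _ (mem_frameSub.1 hw j)

variable (G U) in
/-- The subspaces of all the standard frames determined by an invariant family. -/
def baseSub (i : Fin (D.p+1)) : Submodule ℂ (D.Idx i → ℂ) :=
  if hi : D.isIrr i then frameSub U i hi else (frameSub U 0 (Or.inr rfl)).comap (G.P' i).mulVecLin

theorem baseSub_irr {i : Fin (D.p+1)} (hi : D.isIrr i) : baseSub G U i = frameSub U i hi := dif_pos hi

theorem baseSub_reg {i : Fin (D.p+1)} (hi : ¬ D.isIrr i) :
    baseSub G U i = (frameSub U 0 (Or.inr rfl)).comap (G.P' i).mulVecLin := dif_neg hi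

theorem Realizes.P_mem (hR : Realizes v x G) (hF : G.Frames) (hU : ArrInv x U) (i : Fin (D.p+1)) :
    ∀ w ∈ baseSub G U 0, G.P i *ᵥ w ∈ baseSub G U i := fun w hw => by
  by_cases h0 : i = 0
  · subst h0
    rwa [hF.P0, Matrix.one_mulVec]
  rw [baseSub_irr (Or.inr rfl)] at hw
  by_cases hi : D.isIrr i
  · rw [baseSub_irr hi]
    refine mem_frameSub.2 fun j' => ?_
    rw [Matrix.mulVec_mulVec]
    refine mulVec_mem_of_blocks (fun j u hu => ?_) hw
    rw [← hR.a1 ⟨i, hi, h0⟩]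
    exact hU.a1 j ⟨i, hi, h0⟩ j' u hu
  · rw [baseSub_reg hi]
    change G.P' i *ᵥ (G.P i *ᵥ w) ∈ frameSub U 0 (Or.inr rfl)
    rwa [mulVec_of_mul_eq (hF.P'P i), Matrix.one_mulVec]

theorem Realizes.Q_mem (hR : Realizes v x G) (hU : ArrInv x U) (i : D.IrrNz) :
    ∀ w ∈ baseSub G U i.1, G.Q v i.1 *ᵥ w ∈ baseSub G U 0 := fun w hw => by
  rw [baseSub_irr i.2.1] at hw
  rw [baseSub_irr (Or.inr rfl)]
  refine mem_frameSub.2 fun j => ?_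
  rw [Matrix.mulVec_mulVec]
  refine mulVec_mem_of_blocks (fun j' u hu => ?_) hw
  rw [← hR.b1 i]
  exact hU.b1 j i j' u hu

theorem Realizes.P'_mem (hR : Realizes v x G) (hF : G.Frames) (hU : ArrInv x U)
    (hd : ∀ i : D.IrrNz, defect (fun a => Module.finrank ℂ (U a)) i = 0) (i : Fin (D.p+1)) :
    ∀ w ∈ baseSub G U i, G.P' i *ᵥ w ∈ baseSub G U 0 := fun w hw => by
  by_cases h0 : i = 0
  · subst h0
    have h1 : G.P' 0 = 1 := by rw [← Matrix.one_mul (G.P' 0), ← hF.P0, hF.PP' 0, hF.P0]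
    rwa [h1, Matrix.one_mulVec]
  by_cases hi : D.isIrr i
  · have hle : (baseSub G U 0).map (G.P i).mulVecLin ≤ baseSub G U i :=
      Submodule.map_le_iff_le_comap.2 (hR.P_mem hF hU i)
    have hinj : Function.Injective (G.P i).mulVecLin :=
      (bijective_mulVecLin _ _ (hF.PP' i) (hF.P'P i)).1
    have hdim : Module.finrank ℂ ((baseSub G U 0).map (G.P i).mulVecLin) =
        Module.finrank ℂ (baseSub G U i) := by
      have h1 := sub_eq_zero.1 (hd ⟨i, hi, h0⟩)
      have h2 : ∑ j, Module.finrank ℂ (midSub U 0 (Or.inr rfl) j) =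
          ∑ j, Module.finrank ℂ (midSub U i hi j) := by exact_mod_cast h1.symm
      rw [← (Submodule.equivMapOfInjective _ hinj _).finrank_eq, baseSub_irr hi,
        baseSub_irr (Or.inr rfl), finrank_frameSub]
      exact (finrank_frameSub U 0 (Or.inr rfl)).trans h2
    have heq := Submodule.eq_of_le_of_finrank_eq hle hdim
    rw [← heq] at hw
    obtain ⟨w0, hw0, rfl⟩ := hw
    change G.P' i *ᵥ (G.P i *ᵥ w0) ∈ baseSub G U 0
    rwa [mulVec_of_mul_eq (hF.P'P i), Matrix.one_mulVec]
  · rw [baseSub_reg hi] at hw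
    rw [baseSub_irr (Or.inr rfl)]
    exact hw

/-- The base of a leg at an invariant family: entering the leg. -/
theorem Realizes.b0_mem (hR : Realizes v x G) (hF : G.Frames) (hU : ArrInv x U) (i : Fin (D.p+1))
    (j : Fin (D.m i)) (h : 0 < D.e i j - 1) {w : D.Idx i → ℂ} (hw : w ∈ baseSub G U i) :
    D.lg' i j 0 h *ᵥ ((G.leg i j).b0 *ᵥ (D.inc' i j *ᵥ w)) ∈ U (D.vleg i j ⟨0, h⟩) := by
  by_cases hi : D.isIrr i
  · rw [baseSub_irr hi] at hw
    rw [Matrix.mulVec_mulVec, ← hR.b4 i hi j h]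
    exact hU.b4 i hi j h _ (mem_frameSub.1 hw j)
  · obtain rfl := eq_j1 hi j
    rw [baseSub_reg hi] at hw
    have hw : G.P' i *ᵥ w ∈ frameSub U 0 (Or.inr rfl) := hw
    rw [← Matrix.one_mulVec w, ← hF.PP' i, ← Matrix.mulVec_mulVec, Matrix.mulVec_mulVec _ (D.inc' _ _),
      Matrix.mulVec_mulVec, Matrix.mulVec_mulVec]
    refine mulVec_mem_of_blocks (fun j u hu => ?_) hw
    have := hU.b5 i hi h j u hu
    rw [hR.b5] at this
    simpa only [Matrix.mul_assoc] using this

/-- The base of a leg at an invariant family: leaving the leg. -/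
theorem Realizes.a0_mem (hR : Realizes v x G) (hU : ArrInv x U) (i : Fin (D.p+1))
    (j : Fin (D.m i)) (h : 0 < D.e i j - 1) {u : Fin (D.alphaV (D.vleg i j ⟨0, h⟩)) → ℂ}
    (hu : u ∈ U (D.vleg i j ⟨0, h⟩)) :
    D.inc i j *ᵥ ((G.leg i j).a0 *ᵥ (D.lg i j 0 h *ᵥ u)) ∈ baseSub G U i := by
  by_cases hi : D.isIrr i
  · rw [baseSub_irr hi, Matrix.mulVec_mulVec _ (G.leg i j).a0, ← hR.a4 i hi j h]
    exact inc_mem_frameSub (hU.a4 i hi j h u hu)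
  · obtain rfl := eq_j1 hi j
    rw [baseSub_reg hi]
    refine mem_frameSub.2 fun j => ?_
    change D.inc' 0 j *ᵥ (G.P' i *ᵥ (D.inc i (D.j1 i) *ᵥ ((G.leg i (D.j1 i)).a0 *ᵥ (D.lg i (D.j1 i) 0 h *ᵥ u)))) ∈
      midSub U 0 (Or.inr rfl) j
    rw [Matrix.mulVec_mulVec, Matrix.mulVec_mulVec, Matrix.mulVec_mulVec, Matrix.mulVec_mulVec]
    have := hU.a5 i hi h j u hu
    rw [hR.a5] at this
    simpa only [Matrix.mul_assoc] using this

theorem legN_mem (hR : Realizes v x G) (hF : G.Frames) (hU : ArrInv x U) (i : Fin (D.p+1))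
    (j : Fin (D.m i)) {w : D.Idx i → ℂ} (hw : w ∈ baseSub G U i) :
    D.inc i j *ᵥ ((G.leg i j).a0 *ᵥ ((G.leg i j).b0 *ᵥ (D.inc' i j *ᵥ w))) ∈ baseSub G U i := by
  by_cases h : 0 < D.e i j - 1
  · have := hR.a0_mem hU i j h (hR.b0_mem hF hU i j h hw)
    rwa [mulVec_of_mul_eq (lg_mul_lg' h), Matrix.one_mulVec] at this
  · rw [Matrix.mulVec_mulVec _ (G.leg i j).a0, mul_eq_zero_of_leg h, Matrix.zero_mulVec,
      Matrix.mulVec_zero]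
    exact Submodule.zero_mem _

theorem Realizes.Z_mem_of_ne (hR : Realizes v x G) (hF : G.Frames) (hU : ArrInv x U)
    {i : Fin (D.p+1)} (h0 : i ≠ 0) :
    ∀ w ∈ baseSub G U i, G.Z i *ᵥ w ∈ baseSub G U i := fun w hw => by
  by_cases hi : D.isIrr i
  · have h1 := hR.P_mem hF hU i _ (hR.Q_mem hU ⟨i, hi, h0⟩ w hw)
    change G.P i *ᵥ (G.Q v i *ᵥ w) ∈ baseSub G U i at h1
    rw [GRep.Q, Matrix.mulVec_mulVec, ← Matrix.mul_assoc, hF.PP', Matrix.one_mul, Matrix.sub_mulVec,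
      Matrix.smul_mulVec, Matrix.one_mulVec] at h1
    have := (baseSub G U i).sub_mem ((baseSub G U i).smul_mem (D.ve v i) hw) h1
    rwa [sub_sub_cancel] at this
  · have hN : G.N i = D.inc i (D.j1 i) * (G.leg i (D.j1 i)).N (D.xe i (D.j1 i)) * D.inc' i (D.j1 i) := by
      rw [← pr_N_pr, pr_reg hi, Matrix.one_mul, Matrix.mul_one]
    rw [hF.reg i hi, hN, Leg.N, Matrix.mul_add, Matrix.add_mul, Matrix.mul_smul, Matrix.mul_one,
      Matrix.smul_mul, inc_mul_inc'_reg hi, Matrix.add_mulVec, Matrix.smul_mulVec, Matrix.one_mulVec]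
    refine (baseSub G U i).add_mem ((baseSub G U i).smul_mem _ hw) ?_
    have := legN_mem hR hF hU i (D.j1 i) hw
    rw [Matrix.mulVec_mulVec, Matrix.mulVec_mulVec, Matrix.mulVec_mulVec] at this
    simpa only [Matrix.mul_assoc] using this

theorem Realizes.baseInv_baseSub (hR : Realizes v x G) (hF : G.Frames) (hU : ArrInv x U)
    (hd : ∀ i : D.IrrNz, defect (fun a => Module.finrank ℂ (U a)) i = 0) :
    G.BaseInv (baseSub G U) where
  P := hR.P_mem hF hU
  P' := hR.P'_mem hF hU hd
  e i j w hw := by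
    by_cases hi : D.isIrr i
    · rw [baseSub_irr hi] at hw ⊢
      rw [← inc_mul_inc', ← Matrix.mulVec_mulVec]
      exact inc_mem_frameSub (mem_frameSub.1 hw j)
    · rwa [pr_reg hi, Matrix.one_mulVec]
  Z i w hw := by
    by_cases h0 : i = 0
    · subst h0
      have hres := hF.res
      rw [Fin.sum_univ_succ] at hres
      have h1 : G.P' 0 = 1 := by rw [← Matrix.one_mul (G.P' 0), ← hF.P0, hF.PP' 0, hF.P0]
      rw [h1, hF.P0, Matrix.one_mul, Matrix.mul_one] at hres
      rw [eq_neg_of_add_eq_zero_left hres, Matrix.neg_mulVec, Matrix.sum_mulVec]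
      refine Submodule.neg_mem _ (Submodule.sum_mem _ fun i _ => ?_)
      rw [← Matrix.mulVec_mulVec, ← Matrix.mulVec_mulVec]
      exact hR.P'_mem hF hU hd _ _ (hR.Z_mem_of_ne hF hU (Fin.succ_ne_zero i) _ (hR.P_mem hF hU _ _ hw))
    · exact hR.Z_mem_of_ne hF hU h0 w hw
  X i j j' hjj t ht w hw := by
    by_cases hi : D.isIrr i
    · rw [baseSub_irr hi] at hw ⊢
      rw [← inc_mul_inc', ← inc_mul_inc']
      have key : D.inc i j * D.inc' i j * G.X i t * (D.inc i j' * D.inc' i j') =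
          D.inc i j * ((D.inc' i j * G.X i t * D.inc i j') * D.inc' i j') := by
        simp only [Matrix.mul_assoc]
      rw [key, ← Matrix.mulVec_mulVec]
      refine inc_mem_frameSub ?_
      rw [← Matrix.mulVec_mulVec]
      have hw := mem_frameSub.1 hw j'
      rcases lt_or_gt_of_ne hjj with h | h
      · rw [← hR.b2 i hi j j' h ⟨t, ht⟩]
        exact hU.b2 i hi j j' h ⟨t, ht⟩ _ hw
      · have ht' : t < D.dd i j' j := by rw [dq_comm] at ht; exact ht
        rw [← hR.a2 i hi j' j h ⟨t, ht'⟩]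
        exact hU.a2 i hi j' j h ⟨t, ht'⟩ _ hw
    · exact (hjj ((eq_j1 hi j).trans (eq_j1 hi j').symm)).elim

theorem Realizes.A_mem (hR : Realizes v x G) (hU : ArrInv x U) (i : Fin (D.p+1))
    (j : Fin (D.m i)) : ∀ (k : ℕ) (h : k < D.e i j - 1) (u : Fin (D.alphaV (D.vleg i j ⟨k, h⟩)) → ℂ),
    u ∈ U (D.vleg i j ⟨k, h⟩) → D.inc i j *ᵥ ((G.leg i j).A k *ᵥ (D.lg i j k h *ᵥ u)) ∈ baseSub G U i
  | 0, h, u, hu => hR.a0_mem hU i j h hu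
  | k+1, h, u, hu => by
    have := hR.A_mem hU i j k (Nat.lt_of_succ_lt h) _ (hU.a3 i j k h u hu)
    rw [hR.a3, ← Matrix.mulVec_mulVec, ← Matrix.mulVec_mulVec,
      Matrix.mulVec_mulVec _ (D.lg i j k _) (D.lg' i j k _), lg_mul_lg', Matrix.one_mulVec,
      Matrix.mulVec_mulVec _ ((G.leg i j).A k)] at this
    exact this

theorem Realizes.B_mem (hR : Realizes v x G) (hF : G.Frames) (hU : ArrInv x U) (i : Fin (D.p+1))
    (j : Fin (D.m i)) {w : D.Idx i → ℂ} (hw : w ∈ baseSub G U i) : ∀ (k : ℕ) (h : k < D.e i j - 1),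
    D.lg' i j k h *ᵥ ((G.leg i j).B k *ᵥ (D.inc' i j *ᵥ w)) ∈ U (D.vleg i j ⟨k, h⟩)
  | 0, h => hR.b0_mem hF hU i j h hw
  | k+1, h => by
    have := hU.b3 i j k h _ (hR.B_mem hF hU i j hw k (Nat.lt_of_succ_lt h))
    rw [hR.b3, ← Matrix.mulVec_mulVec, ← Matrix.mulVec_mulVec,
      Matrix.mulVec_mulVec _ (D.lg i j k _) (D.lg' i j k _), lg_mul_lg', Matrix.one_mulVec,
      Matrix.mulVec_mulVec _ ((G.leg i j).b k)] at this
    exact this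

theorem Realizes.eq_bot_or_eq_top (hR : Realizes v x G) (hF : G.Frames) (hg : G.Good)
    (hi : G.BaseIrred) (hU : ArrInv x U)
    (hd : ∀ i : D.IrrNz, defect (fun a => Module.finrank ℂ (U a)) i = 0) :
    (∀ a, U a = ⊥) ∨ (∀ a, U a = ⊤) := by
  have hB := hR.baseInv_baseSub hF hU hd
  rcases hi _ hB with h | h
  · have hbot : ∀ i, baseSub G U i = ⊥ := fun i => le_bot_iff.1 fun w hw => by
      have h1 := hB.P' i w hw
      rw [h, Submodule.mem_bot] at h1
      rw [Submodule.mem_bot, ← Matrix.one_mulVec w, ← hF.PP' i, ← Matrix.mulVec_mulVec, h1,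
        Matrix.mulVec_zero]
    have hmid : ∀ i hi j, midSub U i hi j = ⊥ := fun i hi j =>
      le_bot_iff.1 fun u hu => (Submodule.mem_bot ℂ).2 <| by
        have h1 : D.inc i j *ᵥ u ∈ baseSub G U i := by
          rw [baseSub_irr hi]
          exact inc_mem_frameSub hu
        rw [hbot, Submodule.mem_bot] at h1
        exact inc_mulVec_injective h1
    have hleg : ∀ i j k hk, U (D.vleg i j ⟨k, hk⟩) = ⊥ := fun i j k hk =>
      le_bot_iff.1 fun u hu => (Submodule.mem_bot ℂ).2 <| by
        have h1 := hR.A_mem hU i j k hk u hu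
        rw [hbot, Submodule.mem_bot] at h1
        have h2 := inc_mulVec_injective h1
        obtain ⟨L, hL⟩ := (hg i j).inj k
        have h3 : D.lg i j k hk *ᵥ u = 0 := by
          rw [← Matrix.one_mulVec (D.lg i j k hk *ᵥ u), ← hL, ← Matrix.mulVec_mulVec, h2,
            Matrix.mulVec_zero]
        rw [← Matrix.one_mulVec u, ← lg'_mul_lg hk, ← Matrix.mulVec_mulVec, h3, Matrix.mulVec_zero]
    refine Or.inl ?_
    rintro (⟨⟨i, hi⟩, j⟩ | ⟨i, j, k, hk⟩)
    · exact hmid i hi j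
    · exact hleg i j k hk
  · have htop : ∀ i, baseSub G U i = ⊤ := fun i => top_le_iff.1 fun w _ => by
      rw [← Matrix.one_mulVec w, ← hF.PP' i, ← Matrix.mulVec_mulVec]
      exact hB.P i _ (h ▸ trivial)
    have hmid : ∀ i hi j, midSub U i hi j = ⊤ := fun i hi j => top_le_iff.1 fun u _ => by
      have h1 : D.inc i j *ᵥ u ∈ baseSub G U i := by rw [htop]; trivial
      rw [baseSub_irr hi] at h1
      have h2 := mem_frameSub.1 h1 j
      rwa [mulVec_of_mul_eq (inc'_mul_inc i j), Matrix.one_mulVec] at h2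
    have hleg : ∀ i j k hk, U (D.vleg i j ⟨k, hk⟩) = ⊤ := fun i j k hk => top_le_iff.1 fun u _ => by
      obtain ⟨T, hT⟩ := (hg i j).surj k
      have h1 := hR.B_mem hF hU i j (w := D.inc i j *ᵥ (T *ᵥ (D.lg i j k hk *ᵥ u)))
        (by rw [htop]; trivial) k hk
      rwa [mulVec_of_mul_eq (inc'_mul_inc i j), Matrix.one_mulVec, mulVec_of_mul_eq hT,
        Matrix.one_mulVec, mulVec_of_mul_eq (lg'_mul_lg hk), Matrix.one_mulVec] at h1
    refine Or.inr ?_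
    rintro (⟨⟨i, hi⟩, j⟩ | ⟨i, j, k, hk⟩)
    · exact hmid i hi j
    · exact hleg i j k hk

theorem Realizes.irred (hR : Realizes v x G) (hv : D.IsGeneric v) (hG : G.Valid) (hg : G.Good)
    (hi : G.BaseIrred) : FinQuiver.Irred (Q := D.quiv) (α := D.alphaV) x := fun U hU =>
  hR.eq_bot_or_eq_top (U := U) hG.frames hg hi ((invFamily_iff x U).1 hU)
    (hv (fun a => Module.finrank ℂ (U a))
      (fun _ => (Submodule.finrank_le _).trans (Module.finrank_fin_fun ℂ).le)
      (FinQuiver.sum_mul_finrank_eq_zero (Q := D.quiv) (α := D.alphaV) x _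
        ((hR.mu_iff hG.frames).2 hG) U hU))

end ConnData

/-- The matrices `M` and `M'` are intertwined by `h` and `k`. -/
def Intw {α β : Type} [Fintype α] [Fintype β] (h : Matrix α α ℂ) (k : Matrix β β ℂ)
    (M M' : Matrix α β ℂ) : Prop := h * M = M' * k

namespace Intw

variable {α β γ : Type} [Fintype α] [Fintype β] [Fintype γ] {h : Matrix α α ℂ} {k : Matrix β β ℂ}
  {l : Matrix γ γ ℂ} {M M' : Matrix α β ℂ} {N N' : Matrix β γ ℂ}

theorem comp (hM : Intw h k M M') (hN : Intw k l N N') : Intw h l (M * N) (M' * N') := by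
  rw [Intw, ← Matrix.mul_assoc, hM, Matrix.mul_assoc, hN, Matrix.mul_assoc]

theorem add {K K' : Matrix α β ℂ} (hM : Intw h k M M') (hK : Intw h k K K') :
    Intw h k (M + K) (M' + K') := by
  rw [Intw, Matrix.mul_add, Matrix.add_mul, hM, hK]

theorem sub {K K' : Matrix α β ℂ} (hM : Intw h k M M') (hK : Intw h k K K') :
    Intw h k (M - K) (M' - K') := by
  rw [Intw, Matrix.mul_sub, Matrix.sub_mul, hM, hK]

theorem smul (c : ℂ) (hM : Intw h k M M') : Intw h k (c • M) (c • M') := by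
  rw [Intw, Matrix.mul_smul, Matrix.smul_mul, hM]

theorem sum {A : Type*} {s : Finset A} {F F' : A → Matrix α β ℂ}
    (hF : ∀ a ∈ s, Intw h k (F a) (F' a)) : Intw h k (∑ a ∈ s, F a) (∑ a ∈ s, F' a) := by
  rw [Intw, Matrix.mul_sum, Matrix.sum_mul]
  exact Finset.sum_congr rfl hF

theorem one [DecidableEq α] : Intw h h 1 1 := by rw [Intw, Matrix.mul_one, Matrix.one_mul]

theorem zero : Intw h k 0 0 := by rw [Intw, Matrix.mul_zero, Matrix.zero_mul]

theorem inv [DecidableEq α] [DecidableEq β] {L L' : Matrix β α ℂ} (hM : Intw h k M M')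
    (h1 : L' * M' = 1) (h2 : M * L = 1) : Intw k h L L' := by
  calc k * L = L' * M' * k * L := by rw [h1, Matrix.one_mul]
    _ = L' * (M' * k) * L := by rw [Matrix.mul_assoc L']
    _ = L' * h * (M * L) := by rw [← show h * M = M' * k from hM]; simp only [Matrix.mul_assoc]
    _ = L' * h := by rw [h2, Matrix.mul_one]

end Intw

namespace ConnData

variable {D : ConnData} {v : Fin D.p → ℂ} {x x' : D.quiv.Rep D.alphaV} {G G' : D.GRep}

/-- Intertwining of quiver representations, arrow by arrow. -/
structure ArrIntw (x x' : D.quiv.Rep D.alphaV)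
    (f : ∀ i, D.isIrr i → ∀ j, Matrix (Fin (D.nb i j)) (Fin (D.nb i j)) ℂ)
    (c : ∀ i j k (h : k < D.e i j - 1), Matrix (Fin (D.alphaV (D.vleg i j ⟨k, h⟩)))
      (Fin (D.alphaV (D.vleg i j ⟨k, h⟩))) ℂ) : Prop where
  protected a1 : ∀ (j : Fin (D.m 0)) (i : D.IrrNz) (j' : Fin (D.m i.1)),
    Intw (f i.1 i.2.1 j') (f 0 (Or.inr rfl) j) (a1 x j i j') (a1 x' j i j')
  protected b1 : ∀ (j : Fin (D.m 0)) (i : D.IrrNz) (j' : Fin (D.m i.1)),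
    Intw (f 0 (Or.inr rfl) j) (f i.1 i.2.1 j') (b1 x j i j') (b1 x' j i j')
  protected a2 : ∀ i hi j j' h t, Intw (f i hi j') (f i hi j) (a2 x i hi j j' h t) (a2 x' i hi j j' h t)
  protected b2 : ∀ i hi j j' h t, Intw (f i hi j) (f i hi j') (b2 x i hi j j' h t) (b2 x' i hi j j' h t)
  protected a3 : ∀ i j k h,
    Intw (c i j k (Nat.lt_of_succ_lt h)) (c i j (k+1) h) (a3 x i j k h) (a3 x' i j k h)
  protected b3 : ∀ i j k h,
    Intw (c i j (k+1) h) (c i j k (Nat.lt_of_succ_lt h)) (b3 x i j k h) (b3 x' i j k h)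
  protected a4 : ∀ i hi j h, Intw (f i hi j) (c i j 0 h) (a4 x i hi j h) (a4 x' i hi j h)
  protected b4 : ∀ i hi j h, Intw (c i j 0 h) (f i hi j) (b4 x i hi j h) (b4 x' i hi j h)
  protected a5 : ∀ i hi h j,
    Intw (f 0 (Or.inr rfl) j) (c i (D.j1 i) 0 h) (a5 x i hi h j) (a5 x' i hi h j)
  protected b5 : ∀ i hi h j,
    Intw (c i (D.j1 i) 0 h) (f 0 (Or.inr rfl) j) (b5 x i hi h j) (b5 x' i hi h j)

theorem mul_unit_inv_eq_iff {a b : ℕ} (u : (Matrix (Fin a) (Fin a) ℂ)ˣ)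
    (w : (Matrix (Fin b) (Fin b) ℂ)ˣ) (M M' : Matrix (Fin a) (Fin b) ℂ) :
    u.val * M * (w⁻¹).val = M' ↔ Intw u.val w.val M M' := by
  constructor
  · rintro rfl
    rw [Intw, Matrix.mul_assoc, Units.inv_mul, Matrix.mul_one]
  · intro h
    rw [show u.val * M = M' * w.val from h, Matrix.mul_assoc, Units.mul_inv, Matrix.mul_one]

theorem act_eq_iff (g : D.quiv.GGroup D.alphaV) :
    FinQuiver.act g x = x' ↔ ArrIntw x x' (fun i hi j => (g (D.vmid ⟨i, hi⟩ j)).val)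
      (fun i j k h => (g (D.vleg i j ⟨k, h⟩)).val) := by
  have key : FinQuiver.act g x = x' ↔ ∀ e : D.Arr,
      Intw (g (D.qtgt e)).val (g (D.qsrc e)).val (x e).1 (x' e).1 ∧
      Intw (g (D.qsrc e)).val (g (D.qtgt e)).val (x e).2 (x' e).2 := by
    rw [funext_iff]
    refine forall_congr' fun e => ?_
    rw [Prod.ext_iff]
    exact and_congr (mul_unit_inv_eq_iff _ _ _ _) (mul_unit_inv_eq_iff _ _ _ _)
  rw [key]
  constructor
  · intro h
    exact ⟨fun j i j' => (h (.inl (j, ⟨i, j'⟩))).1, fun j i j' => (h (.inl (j, ⟨i, j'⟩))).2,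
      fun i hi j j' hj t => (h (.inr (.inl ⟨⟨i, hi⟩, ⟨(j, j'), hj⟩, t⟩))).1,
      fun i hi j j' hj t => (h (.inr (.inl ⟨⟨i, hi⟩, ⟨(j, j'), hj⟩, t⟩))).2,
      fun i j k hk => (h (.inr (.inr (.inl ⟨i, j, ⟨k, by omega⟩⟩)))).1,
      fun i j k hk => (h (.inr (.inr (.inl ⟨i, j, ⟨k, by omega⟩⟩)))).2,
      fun i hi j hj => (h (.inr (.inr (.inr (.inl ⟨⟨i, hi⟩, ⟨j, two_le_of_pos hj⟩⟩))))).1,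
      fun i hi j hj => (h (.inr (.inr (.inr (.inl ⟨⟨i, hi⟩, ⟨j, two_le_of_pos hj⟩⟩))))).2,
      fun i hi hj j => (h (.inr (.inr (.inr (.inr (⟨i, hi, two_le_of_pos hj⟩, j)))))).1,
      fun i hi hj j => (h (.inr (.inr (.inr (.inr (⟨i, hi, two_le_of_pos hj⟩, j)))))).2⟩
  · intro h
    rintro (⟨j, i, j'⟩ | ⟨⟨i, hi⟩, ⟨⟨j, j'⟩, hj⟩, t⟩ | ⟨i, j, k⟩ | ⟨⟨i, hi⟩, ⟨j, hj⟩⟩ | ⟨⟨i, hi, hj⟩, j⟩)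
    · exact ⟨h.a1 j i j', h.b1 j i j'⟩
    · exact ⟨h.a2 i hi j j' hj t, h.b2 i hi j j' hj t⟩
    · have hk : k.1 + 1 < D.e i j - 1 := by have := k.2; omega
      exact ⟨h.a3 i j k.1 hk, h.b3 i j k.1 hk⟩
    · have h' : 0 < D.e i j - 1 := by have : 2 ≤ D.e i j := hj; omega
      exact ⟨h.a4 i hi j h', h.b4 i hi j h'⟩
    · have h' : 0 < D.e i (D.j1 i) - 1 := by have : 2 ≤ D.e i (D.j1 i) := hj; omega
      exact ⟨h.a5 i hi h' j, h.b5 i hi h' j⟩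

theorem exists_act_eq {f f' : ∀ i, D.isIrr i → ∀ j, Matrix (Fin (D.nb i j)) (Fin (D.nb i j)) ℂ}
    {c c' : ∀ i j k (h : k < D.e i j - 1), Matrix (Fin (D.alphaV (D.vleg i j ⟨k, h⟩)))
      (Fin (D.alphaV (D.vleg i j ⟨k, h⟩))) ℂ} (hf : ∀ i hi j, f i hi j * f' i hi j = 1)
    (hf' : ∀ i hi j, f' i hi j * f i hi j = 1) (hc : ∀ i j k h, c i j k h * c' i j k h = 1)
    (hc' : ∀ i j k h, c' i j k h * c i j k h = 1) (h : ArrIntw x x' f c) :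
    ∃ g : D.quiv.GGroup D.alphaV, FinQuiver.act g x = x' := by
  let g : ∀ a : D.Vq, (Matrix (Fin (D.alphaV a)) (Fin (D.alphaV a)) ℂ)ˣ := fun
    | .inl ⟨i, j⟩ => ⟨f i.1 i.2 j, f' i.1 i.2 j, hf _ _ _, hf' _ _ _⟩
    | .inr ⟨i, j, k⟩ => ⟨c i j k.1 k.2, c' i j k.1 k.2, hc _ _ _ _, hc' _ _ _ _⟩
  exact ⟨g, (act_eq_iff (x := x) (x' := x') g).2 h⟩

end ConnData

namespace ConnData

variable {D : ConnData} {v : Fin D.p → ℂ} {x x' : D.quiv.Rep D.alphaV} {G G' : D.GRep}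

section Blocks

variable {i : Fin (D.p+1)} {g g' : Matrix (D.Idx i) (D.Idx i) ℂ}

theorem intw_inc (h : ∀ j, g * pr D i j = pr D i j * g) (j : Fin (D.m i)) :
    Intw g (D.inc' i j * g * D.inc i j) (D.inc i j) (D.inc i j) := by
  calc g * D.inc i j = g * (D.inc i j * D.inc' i j) * D.inc i j := by
        rw [Matrix.mul_assoc g, Matrix.mul_assoc (D.inc i j), inc'_mul_inc, Matrix.mul_one]
    _ = D.inc i j * D.inc' i j * g * D.inc i j := by rw [inc_mul_inc', h]
    _ = _ := by simp only [Matrix.mul_assoc]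

theorem intw_inc' (h : ∀ j, g * pr D i j = pr D i j * g) (j : Fin (D.m i)) :
    Intw (D.inc' i j * g * D.inc i j) g (D.inc' i j) (D.inc' i j) := by
  calc D.inc' i j * g * D.inc i j * D.inc' i j = D.inc' i j * (g * (D.inc i j * D.inc' i j)) := by
        simp only [Matrix.mul_assoc]
    _ = D.inc' i j * D.inc i j * (D.inc' i j * g) := by
        rw [inc_mul_inc', h, ← inc_mul_inc']; simp only [Matrix.mul_assoc]
    _ = _ := by rw [inc'_mul_inc, Matrix.one_mul]

theorem block_mul_block (h : ∀ j, g * pr D i j = pr D i j * g) (e : g * g' = 1) (j : Fin (D.m i)) :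
    (D.inc' i j * g * D.inc i j) * (D.inc' i j * g' * D.inc i j) = 1 := by
  calc _ = (D.inc' i j * g * D.inc i j * D.inc' i j) * (g' * D.inc i j) := by
        simp only [Matrix.mul_assoc]
    _ = D.inc' i j * (g * g') * D.inc i j := by
        rw [show D.inc' i j * g * D.inc i j * D.inc' i j = D.inc' i j * g from intw_inc' h j]
        simp only [Matrix.mul_assoc]
    _ = 1 := by rw [e, Matrix.mul_one, inc'_mul_inc]

end Blocks

theorem inc'_pr_inc {i : Fin (D.p+1)} (j j' : Fin (D.m i)) (M : Matrix (D.Idx i) (D.Idx i) ℂ) :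
    D.inc' i j * (pr D i j * M * pr D i j') * D.inc i j' = D.inc' i j * M * D.inc i j' := by
  calc _ = (D.inc' i j * pr D i j) * M * (pr D i j' * D.inc i j') := by
        simp only [Matrix.mul_assoc]
    _ = _ := by rw [inc'_mul_pr, pr_mul_inc]

/-- Intertwining of the off-diagonal blocks intertwines the quadratic expressions in them. -/
theorem intw_mom {i : Fin (D.p+1)} {g : Matrix (D.Idx i) (D.Idx i) ℂ}
    {X X' : ℕ → Matrix (D.Idx i) (D.Idx i) ℂ}
    (h : ∀ j j', j ≠ j' → ∀ t < dq (D.q i) j j',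
      g * (pr D i j * X t * pr D i j') = (pr D i j * X' t * pr D i j') * g) (j : Fin (D.m i)) :
    Intw g g (mom (D.q i) (D.blk i) Finset.univ X j) (mom (D.q i) (D.blk i) Finset.univ X' j) := by
  refine Intw.sum fun j' _ => Intw.smul _ (Intw.sum fun t ht => ?_)
  have ht := Finset.mem_range.1 ht
  have hj : j ≠ j' := fun e => by rw [e, dq_self] at ht; exact absurd ht (Nat.not_lt_zero _)
  have key : ∀ Y : ℕ → Matrix (D.Idx i) (D.Idx i) ℂ,
      pr D i j * Y t * pr D i j' * Y t * pr D i j =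
        pr D i j * Y t * pr D i j' * (pr D i j' * Y t * pr D i j) := fun Y => by
    calc _ = pr D i j * Y t * (pr D i j' * pr D i j') * Y t * pr D i j := by
          rw [eb_mul_self (D.blk i) j']
      _ = _ := by simp only [Matrix.mul_assoc]
  change Intw g g (pr D i j * X t * pr D i j' * X t * pr D i j)
    (pr D i j * X' t * pr D i j' * X' t * pr D i j)
  rw [key, key]
  exact Intw.comp (h j j' hj t ht) (h j' j hj.symm t (by rwa [dq_comm]))

theorem exists_act_of_baseIso (hR : Realizes v x G) (hR' : Realizes v x' G') (hG : G.Valid)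
    (hG' : G'.Valid) (hg : G.Good) (hg' : G'.Good) (h : G.BaseIso G') :
    ∃ g : D.quiv.GGroup D.alphaV, FinQuiver.act g x = x' := by
  obtain ⟨g, g', e1, e2, hP, hpr, hZ, hX⟩ := h
  have hpr' : ∀ i j, g' i * pr D i j = pr D i j * g' i := fun i j => by
    calc g' i * pr D i j = g' i * (pr D i j * g i) * g' i := by
          rw [Matrix.mul_assoc (g' i), Matrix.mul_assoc (pr D i j), e1, Matrix.mul_one]
      _ = (g' i * g i) * pr D i j * g' i := by rw [← hpr]; simp only [Matrix.mul_assoc]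
      _ = _ := by rw [e2, Matrix.one_mul]
  set f : ∀ i j, Matrix (Fin (D.nb i j)) (Fin (D.nb i j)) ℂ :=
    fun i j => D.inc' i j * g i * D.inc i j with hf
  have hinc : ∀ i j, Intw (g i) (f i j) (D.inc i j) (D.inc i j) := fun i j => intw_inc (hpr i) j
  have hinc' : ∀ i j, Intw (f i j) (g i) (D.inc' i j) (D.inc' i j) := fun i j => intw_inc' (hpr i) j
  have hP' : ∀ i, Intw (g 0) (g i) (G.P' i) (G'.P' i) := fun i =>
    Intw.inv (hP i) (hG'.P'P i) (hG.PP' i)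
  have hab : ∀ i j, f i j * ((G.leg i j).a0 * (G.leg i j).b0) =
      (G'.leg i j).a0 * (G'.leg i j).b0 * f i j := fun i j => by
    have d := (GRep.diag_iff G i j).1 (hG.diag i j)
    have d' := (GRep.diag_iff G' i j).1 (hG'.diag i j)
    have key := ((((hinc' i j).comp (hZ i : Intw _ _ _ _)).comp (hinc i j)).sub
      (((hinc' i j).comp (intw_mom (hX i) j)).comp (hinc i j))).sub (Intw.one.smul (D.xe i j 0))
    rw [d, d', add_sub_cancel_left, add_sub_cancel_left, add_sub_cancel_left,
      add_sub_cancel_left] at key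
    exact key
  choose c c' hc hc' ha0 hb0 ha hb using fun i j =>
    (hg i j).exists_iso (hg' i j) (hG.legMom i j) (hG'.legMom i j)
      (block_mul_block (hpr i) (e1 i) j) (block_mul_block (hpr' i) (e2 i) j) (hab i j)
  have hlg : ∀ i j k (hk : k < D.e i j - 1), Intw (c i j k) (D.lg' i j k hk * c i j k * D.lg i j k hk)
      (D.lg i j k hk) (D.lg i j k hk) := fun i j k hk => by
    rw [Intw, ← Matrix.mul_assoc, ← Matrix.mul_assoc, lg_mul_lg', Matrix.one_mul]
  have hlg' : ∀ i j k (hk : k < D.e i j - 1), Intw (D.lg' i j k hk * c i j k * D.lg i j k hk) (c i j k)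
      (D.lg' i j k hk) (D.lg' i j k hk) := fun i j k hk => by
    rw [Intw, Matrix.mul_assoc, lg_mul_lg', Matrix.mul_one]
  have hcc : ∀ {i j k} (hk : k < D.e i j - 1) {M N : Matrix (D.LV i j k) (D.LV i j k) ℂ}, M * N = 1 →
      (D.lg' i j k hk * M * D.lg i j k hk) * (D.lg' i j k hk * N * D.lg i j k hk) = 1 :=
    fun {i j k} hk {M N} e => by
      calc _ = D.lg' i j k hk * M * (D.lg i j k hk * D.lg' i j k hk) * (N * D.lg i j k hk) := by
            simp only [Matrix.mul_assoc]
        _ = D.lg' i j k hk * (M * N) * D.lg i j k hk := by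
            rw [lg_mul_lg', Matrix.mul_one]; simp only [Matrix.mul_assoc]
        _ = 1 := by rw [e, Matrix.mul_one, lg'_mul_lg]
  refine exists_act_eq (f := fun i _ j => f i j) (f' := fun i _ j => D.inc' i j * g' i * D.inc i j)
    (c := fun i j k hk => D.lg' i j k hk * c i j k * D.lg i j k hk)
    (c' := fun i j k hk => D.lg' i j k hk * c' i j k * D.lg i j k hk)
    (fun i _ j => block_mul_block (hpr i) (e1 i) j)
    (fun i _ j => block_mul_block (hpr' i) (e2 i) j)
    (fun i j k hk => hcc hk (hc i j k)) (fun i j k hk => hcc hk (hc' i j k))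
    ⟨fun j i j' => ?_, fun j i j' => ?_,
    fun i hi j j' hjj t => ?_, fun i hi j j' hjj t => ?_, fun i j k hk => ?_, fun i j k hk => ?_,
    fun i hi j hk => ?_, fun i hi j hk => ?_, fun i hi hk j => ?_, fun i hi hk j => ?_⟩
  · rw [hR.a1, hR'.a1]
    exact ((hinc' _ _).comp (hP _)).comp (hinc _ _)
  · rw [hR.b1, hR'.b1]
    exact ((hinc' _ _).comp ((hP' _).comp ((Intw.one.smul _).sub (hZ _)))).comp (hinc _ _)
  · rw [hR.a2, hR'.a2]
    have := ((hinc' i j').comp (hX i j' j (ne_of_gt hjj) t (by rw [dq_comm]; exact t.2))).comp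
      (hinc i j)
    rwa [inc'_pr_inc, inc'_pr_inc] at this
  · rw [hR.b2, hR'.b2]
    have := ((hinc' i j).comp (hX i j j' (ne_of_lt hjj) t t.2)).comp (hinc i j')
    rwa [inc'_pr_inc, inc'_pr_inc] at this
  · rw [hR.a3, hR'.a3]
    exact ((hlg' _ _ _ _).comp (ha i j k)).comp (hlg _ _ _ _)
  · rw [hR.b3, hR'.b3]
    exact ((hlg' _ _ _ _).comp (hb i j k)).comp (hlg _ _ _ _)
  · rw [hR.a4, hR'.a4]
    exact Intw.comp (ha0 i j) (hlg _ _ _ _)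
  · rw [hR.b4, hR'.b4]
    exact (hlg' _ _ _ _).comp (hb0 i j)
  · rw [hR.a5, hR'.a5]
    exact ((hinc' _ _).comp (((hP' _).comp (hinc _ _)).comp (ha0 i _))).comp (hlg _ _ _ _)
  · rw [hR.b5, hR'.b5]
    exact ((hlg' _ _ _ _).comp ((Intw.comp (hb0 i _) (hinc' _ _)).comp (hP _))).comp (hinc _ _)

end ConnData

section BlockIntertwining

variable {κ : Type} [Fintype κ] [DecidableEq κ] {ν : κ → Type} [∀ j, Fintype (ν j)]
  [∀ j, DecidableEq (ν j)]

theorem intw_ic (F : ∀ j, Matrix (ν j) (ν j) ℂ) (j : κ) :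
    Intw (Matrix.blockDiagonal' F) (F j) (ic ν j) (ic ν j) := blockDiagonal_mul_ic F j

theorem intw_ic' (F : ∀ j, Matrix (ν j) (ν j) ℂ) (j : κ) :
    Intw (F j) (Matrix.blockDiagonal' F) (ic' ν j) (ic' ν j) := (ic'_mul_blockDiagonal F j).symm

theorem intw_of_rows {α : Type} [Fintype α] {F : ∀ j, Matrix (ν j) (ν j) ℂ} {k : Matrix α α ℂ}
    {M M' : Matrix (Σ j, ν j) α ℂ} (h : ∀ j, Intw (F j) k (ic' ν j * M) (ic' ν j * M')) :
    Intw (Matrix.blockDiagonal' F) k M M' := by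
  refine ext_ic_left fun j => ?_
  rw [← Matrix.mul_assoc, ← show F j * ic' ν j = ic' ν j * Matrix.blockDiagonal' F from intw_ic' F j,
    Matrix.mul_assoc, ← Matrix.mul_assoc (ic' ν j)]
  exact h j

theorem intw_of_cols {α : Type} [Fintype α] {F : ∀ j, Matrix (ν j) (ν j) ℂ} {k : Matrix α α ℂ}
    {M M' : Matrix α (Σ j, ν j) ℂ} (h : ∀ j, Intw k (F j) (M * ic ν j) (M' * ic ν j)) :
    Intw k (Matrix.blockDiagonal' F) M M' := by
  refine ext_ic_right fun j => ?_
  rw [Matrix.mul_assoc M', show Matrix.blockDiagonal' F * ic ν j = ic ν j * F j from intw_ic F j,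
    Matrix.mul_assoc k, ← Matrix.mul_assoc M']
  exact h j

theorem blockDiagonal_mul_eq_one {F F' : ∀ j, Matrix (ν j) (ν j) ℂ} (h : ∀ j, F j * F' j = 1) :
    Matrix.blockDiagonal' F * Matrix.blockDiagonal' F' = 1 := by
  rw [← Matrix.blockDiagonal'_mul, ← Matrix.blockDiagonal'_one]
  exact congrArg _ (funext h)

end BlockIntertwining

namespace ConnData

variable {D : ConnData} {v : Fin D.p → ℂ} {x x' : D.quiv.Rep D.alphaV} {G G' : D.GRep}

/-- The matrices of the standard frames determined by matrices of the blocks. -/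
def frameMat (G G' : D.GRep)
    (f : ∀ i, D.isIrr i → ∀ j, Matrix (Fin (D.nb i j)) (Fin (D.nb i j)) ℂ) (i : Fin (D.p+1)) :
    Matrix (D.Idx i) (D.Idx i) ℂ :=
  if hi : D.isIrr i then Matrix.blockDiagonal' (f i hi)
  else G'.P i * Matrix.blockDiagonal' (f 0 (Or.inr rfl)) * G.P' i

variable {f f' : ∀ i, D.isIrr i → ∀ j, Matrix (Fin (D.nb i j)) (Fin (D.nb i j)) ℂ}

theorem frameMat_irr {i : Fin (D.p+1)} (hi : D.isIrr i) :
    frameMat G G' f i = Matrix.blockDiagonal' (f i hi) := dif_pos hi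

theorem frameMat_zero : frameMat G G' f 0 = Matrix.blockDiagonal' (f 0 (Or.inr rfl)) :=
  frameMat_irr _

theorem frameMat_reg {i : Fin (D.p+1)} (hi : ¬ D.isIrr i) :
    frameMat G G' f i = G'.P i * frameMat G G' f 0 * G.P' i := by
  rw [frameMat_zero]
  exact dif_neg hi

theorem frameMat_mul (hG : G.Frames) (hG' : G'.Frames) (h : ∀ i hi j, f i hi j * f' i hi j = 1)
    (i : Fin (D.p+1)) : frameMat G G' f i * frameMat G' G f' i = 1 := by
  have h0 : frameMat G G' f 0 * frameMat G' G f' 0 = 1 := by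
    rw [frameMat_zero, frameMat_zero]
    exact blockDiagonal_mul_eq_one (h 0 _)
  by_cases hi : D.isIrr i
  · rw [frameMat_irr hi, frameMat_irr hi]
    exact blockDiagonal_mul_eq_one (h i hi)
  · rw [frameMat_reg hi, frameMat_reg hi]
    calc _ = G'.P i * (frameMat G G' f 0 * (G.P' i * G.P i) * frameMat G' G f' 0) * G'.P' i := by
          simp only [Matrix.mul_assoc]
      _ = 1 := by rw [hG.P'P, Matrix.mul_one, h0, Matrix.mul_one, hG'.PP']

section Intertwining

variable {c : ∀ i j k (h : k < D.e i j - 1), Matrix (Fin (D.alphaV (D.vleg i j ⟨k, h⟩)))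
      (Fin (D.alphaV (D.vleg i j ⟨k, h⟩))) ℂ} (h : ArrIntw x x' f c)
  (hR : Realizes v x G) (hR' : Realizes v x' G') (hG : G.Frames) (hG' : G'.Frames)

include h hR hR' hG hG'

theorem ArrIntw.P (i : Fin (D.p+1)) :
    Intw (frameMat G G' f i) (frameMat G G' f 0) (G.P i) (G'.P i) := by
  by_cases h0 : i = 0
  · subst h0
    rw [hG.P0, hG'.P0]
    exact Intw.one
  by_cases hi : D.isIrr i
  · rw [frameMat_irr hi, frameMat_zero]
    refine intw_of_rows fun j' => intw_of_cols fun j => ?_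
    have := h.a1 j ⟨i, hi, h0⟩ j'
    rwa [hR.a1, hR'.a1] at this
  · rw [frameMat_reg hi, Intw, Matrix.mul_assoc _ (G.P' i), hG.P'P, Matrix.mul_one]

theorem ArrIntw.P' (i : Fin (D.p+1)) :
    Intw (frameMat G G' f 0) (frameMat G G' f i) (G.P' i) (G'.P' i) :=
  (h.P hR hR' hG hG' i).inv (hG'.P'P i) (hG.PP' i)

theorem ArrIntw.leg (i : Fin (D.p+1)) (j : Fin (D.m i)) :
    Intw (frameMat G G' f i) (frameMat G G' f i)
      (D.inc i j * ((G.leg i j).a0 * (G.leg i j).b0) * D.inc' i j)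
      (D.inc i j * ((G'.leg i j).a0 * (G'.leg i j).b0) * D.inc' i j) := by
  by_cases hk : 0 < D.e i j - 1
  · have ha : Intw (frameMat G G' f i) (c i j 0 hk) (D.inc i j * ((G.leg i j).a0 * D.lg i j 0 hk))
        (D.inc i j * ((G'.leg i j).a0 * D.lg i j 0 hk)) := by
      by_cases hi : D.isIrr i
      · rw [frameMat_irr hi, ← hR.a4 i hi j hk, ← hR'.a4 i hi j hk]
        exact (intw_ic _ j).comp (h.a4 i hi j hk)
      · obtain rfl := eq_j1 hi j
        have key : ∀ {G : D.GRep}, G.Frames → D.inc i (D.j1 i) *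
            ((G.leg i (D.j1 i)).a0 * D.lg i (D.j1 i) 0 hk) =
            G.P i * ((G.P' i * D.inc i (D.j1 i) * (G.leg i (D.j1 i)).a0) * D.lg i (D.j1 i) 0 hk) :=
          fun {G} hG => by
            calc _ = (G.P i * G.P' i) * (D.inc i (D.j1 i) *
                  ((G.leg i (D.j1 i)).a0 * D.lg i (D.j1 i) 0 hk)) := by
                  rw [hG.PP', Matrix.one_mul]
              _ = _ := by simp only [Matrix.mul_assoc]
        rw [key hG, key hG']
        refine (h.P hR hR' hG hG' i).comp ?_
        rw [frameMat_zero]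
        refine intw_of_rows fun j => ?_
        have := h.a5 i hi hk j
        rwa [hR.a5, hR'.a5, Matrix.mul_assoc (D.inc' 0 j), Matrix.mul_assoc (D.inc' 0 j)] at this
    have hb : Intw (c i j 0 hk) (frameMat G G' f i) (D.lg' i j 0 hk * (G.leg i j).b0 * D.inc' i j)
        (D.lg' i j 0 hk * (G'.leg i j).b0 * D.inc' i j) := by
      by_cases hi : D.isIrr i
      · rw [frameMat_irr hi, ← hR.b4 i hi j hk, ← hR'.b4 i hi j hk]
        exact Intw.comp (h.b4 i hi j hk) (intw_ic' _ j)
      · obtain rfl := eq_j1 hi j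
        have key : ∀ {G : D.GRep}, G.Frames → D.lg' i (D.j1 i) 0 hk * (G.leg i (D.j1 i)).b0 *
            D.inc' i (D.j1 i) = D.lg' i (D.j1 i) 0 hk *
              ((G.leg i (D.j1 i)).b0 * D.inc' i (D.j1 i) * G.P i) * G.P' i :=
          fun {G} hG => by
            calc _ = D.lg' i (D.j1 i) 0 hk * (G.leg i (D.j1 i)).b0 *
                  D.inc' i (D.j1 i) * (G.P i * G.P' i) := by
                  rw [hG.PP', Matrix.mul_one]
              _ = _ := by simp only [Matrix.mul_assoc]
        rw [key hG, key hG']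
        refine Intw.comp ?_ (h.P' hR hR' hG hG' i)
        rw [frameMat_zero]
        refine intw_of_cols fun j => ?_
        have := h.b5 i hi hk j
        rwa [hR.b5, hR'.b5] at this
    have key : ∀ G : D.GRep, D.inc i j * ((G.leg i j).a0 * (G.leg i j).b0) * D.inc' i j =
        (D.inc i j * ((G.leg i j).a0 * D.lg i j 0 hk)) *
          (D.lg' i j 0 hk * (G.leg i j).b0 * D.inc' i j) := fun G => by
      calc _ = D.inc i j * ((G.leg i j).a0 * (D.lg i j 0 hk * D.lg' i j 0 hk) * (G.leg i j).b0) *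
            D.inc' i j := by rw [lg_mul_lg', Matrix.mul_one]
        _ = _ := by simp only [Matrix.mul_assoc]
    rw [key, key]
    exact ha.comp hb
  · rw [mul_eq_zero_of_leg hk, mul_eq_zero_of_leg hk, Matrix.mul_zero, Matrix.zero_mul]
    exact Intw.zero

theorem ArrIntw.Z_of_ne {i : Fin (D.p+1)} (h0 : i ≠ 0) :
    Intw (frameMat G G' f i) (frameMat G G' f i) (G.Z i) (G'.Z i) := by
  by_cases hi : D.isIrr i
  · have hQ : Intw (frameMat G G' f 0) (frameMat G G' f i) (G.Q v i) (G'.Q v i) := by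
      rw [frameMat_irr hi, frameMat_zero]
      refine intw_of_rows fun j => intw_of_cols fun j' => ?_
      have := h.b1 j ⟨i, hi, h0⟩ j'
      rwa [hR.b1, hR'.b1] at this
    have key : ∀ {G : D.GRep}, G.Frames → G.Z i = D.ve v i • 1 - G.P i * G.Q v i := fun {G} hG => by
      rw [GRep.Q, ← Matrix.mul_assoc, hG.PP', Matrix.one_mul, sub_sub_cancel]
    rw [key hG, key hG']
    exact (Intw.one.smul _).sub ((h.P hR hR' hG hG' i).comp hQ)
  · have key : ∀ {G : D.GRep}, G.Frames → G.Z i = D.xe i (D.j1 i) 0 • 1 +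
        D.inc i (D.j1 i) * ((G.leg i (D.j1 i)).a0 * (G.leg i (D.j1 i)).b0) * D.inc' i (D.j1 i) :=
      fun {G} hG => by
        have hN : G.N i = D.inc i (D.j1 i) * (G.leg i (D.j1 i)).N (D.xe i (D.j1 i)) *
            D.inc' i (D.j1 i) := by
          rw [← pr_N_pr, pr_reg hi, Matrix.one_mul, Matrix.mul_one]
        rw [hG.reg i hi, hN, Leg.N, Matrix.mul_add, Matrix.add_mul, Matrix.mul_smul, Matrix.mul_one,
          Matrix.smul_mul, inc_mul_inc'_reg hi]
    rw [key hG, key hG']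
    exact (Intw.one.smul _).add (h.leg hR hR' hG hG' i _)

theorem ArrIntw.Z (i : Fin (D.p+1)) :
    Intw (frameMat G G' f i) (frameMat G G' f i) (G.Z i) (G'.Z i) := by
  by_cases h0 : i = 0
  · subst h0
    have key : ∀ {G : D.GRep}, G.Frames → G.Z 0 =
        (0 : Matrix _ _ ℂ) - ∑ i : Fin D.p, G.P' i.succ * G.Z i.succ * G.P i.succ := fun {G} hG => by
      have hres := hG.res
      rw [Fin.sum_univ_succ] at hres
      have h1 : G.P' 0 = 1 := by rw [← Matrix.one_mul (G.P' 0), ← hG.P0, hG.PP' 0, hG.P0]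
      rw [h1, hG.P0, Matrix.one_mul, Matrix.mul_one] at hres
      rw [eq_neg_of_add_eq_zero_left hres, zero_sub]
    rw [key hG, key hG']
    exact Intw.zero.sub (Intw.sum fun i _ => ((h.P' hR hR' hG hG' _).comp
      (h.Z_of_ne hR hR' hG hG' (Fin.succ_ne_zero i))).comp (h.P hR hR' hG hG' _))
  · exact h.Z_of_ne hR hR' hG hG' h0

omit hG hG' in
theorem ArrIntw.X {i : Fin (D.p+1)} {j j' : Fin (D.m i)} (hjj : j ≠ j') {t : ℕ}
    (ht : t < dq (D.q i) j j') :
    Intw (frameMat G G' f i) (frameMat G G' f i) (pr D i j * G.X i t * pr D i j')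
      (pr D i j * G'.X i t * pr D i j') := by
  by_cases hi : D.isIrr i
  · have key : ∀ G : D.GRep, pr D i j * G.X i t * pr D i j' =
        D.inc i j * (D.inc' i j * G.X i t * D.inc i j') * D.inc' i j' := fun G => by
      rw [← inc_mul_inc', ← inc_mul_inc']
      simp only [Matrix.mul_assoc]
    rw [key, key, frameMat_irr hi]
    refine ((intw_ic (f i hi) j).comp ?_).comp (intw_ic' (f i hi) j')
    rcases lt_or_gt_of_ne hjj with hlt | hlt
    · have := h.b2 i hi j j' hlt ⟨t, ht⟩
      rwa [hR.b2, hR'.b2] at this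
    · have ht' : t < D.dd i j' j := by rw [dq_comm] at ht; exact ht
      have := h.a2 i hi j' j hlt ⟨t, ht'⟩
      rwa [hR.a2, hR'.a2] at this
  · exact (hjj ((eq_j1 hi j).trans (eq_j1 hi j').symm)).elim

end Intertwining

theorem frameMat_mul_pr (i : Fin (D.p+1)) (j : Fin (D.m i)) :
    frameMat G G' f i * pr D i j = pr D i j * frameMat G G' f i := by
  by_cases hi : D.isIrr i
  · rw [frameMat_irr hi, ← inc_mul_inc']
    exact (intw_ic _ j).comp (intw_ic' _ j)
  · rw [pr_reg hi, Matrix.one_mul, Matrix.mul_one]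

theorem baseIso_of_exists_act (hR : Realizes v x G) (hR' : Realizes v x' G') (hG : G.Frames)
    (hG' : G'.Frames) (h : ∃ g : D.quiv.GGroup D.alphaV, FinQuiver.act g x = x') :
    G.BaseIso G' := by
  obtain ⟨g, hg⟩ := h
  have h := (act_eq_iff (x := x) (x' := x') g).1 hg
  exact ⟨_, frameMat G' G fun i hi j => ((g (D.vmid ⟨i, hi⟩ j))⁻¹).val,
    frameMat_mul hG hG' fun i hi j => (g (D.vmid ⟨i, hi⟩ j)).mul_inv,
    frameMat_mul hG' hG fun i hi j => (g (D.vmid ⟨i, hi⟩ j)).inv_mul,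
    h.P hR hR' hG hG', frameMat_mul_pr, h.Z hR hR' hG hG',
    fun i j j' hjj t ht => h.X hR hR' hjj ht⟩

theorem exists_act_iff (hR : Realizes v x G) (hR' : Realizes v x' G') (hG : G.Valid)
    (hG' : G'.Valid) (hg : G.Good) (hg' : G'.Good) :
    (∃ g : D.quiv.GGroup D.alphaV, FinQuiver.act g x = x') ↔ SimConj G.conn G'.conn :=
  Iff.trans ⟨baseIso_of_exists_act hR hR' hG.frames hG'.frames,
    exists_act_of_baseIso hR hR' hG hG' hg hg'⟩ (GRep.simConj_conn_iff hG hG').symm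

end ConnData

namespace FinQuiver

variable {Q : FinQuiver} {α : Q.V → ℕ}

theorem one_act (x : Q.Rep α) : FinQuiver.act (1 : Q.GGroup α) x = x := by
  funext e
  simp [FinQuiver.act]

theorem mul_act (g h : Q.GGroup α) (x : Q.Rep α) :
    FinQuiver.act (g * h) x = FinQuiver.act g (FinQuiver.act h x) := by
  funext e
  simp only [FinQuiver.act, Pi.mul_apply, Units.val_mul, _root_.mul_inv_rev, Matrix.mul_assoc]

theorem equivalence_exists_act :
    Equivalence fun x y : Q.Rep α => ∃ g : Q.GGroup α, FinQuiver.act g x = y where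
  refl x := ⟨1, one_act x⟩
  symm := by
    rintro x _ ⟨g, rfl⟩
    exact ⟨g⁻¹, by rw [← mul_act, inv_mul_cancel, one_act]⟩
  trans := by
    rintro x _ _ ⟨g, rfl⟩ ⟨h, rfl⟩
    exact ⟨h * g, mul_act h g x⟩

end FinQuiver

namespace ConnData

variable {D : ConnData} {v : Fin D.p → ℂ}

theorem SimConj.refl (A : Fin (D.p+1) → Matrix (Fin D.n) (Fin D.n) (LaurentSeries ℂ)) :
    SimConj A A := ⟨1, fun i => by simp [conjC]⟩

/-- A representation corresponds to a tuple of principal parts, up to conjugacy. -/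
def Corresponds (v : Fin D.p → ℂ) (x : D.quiv.Rep D.alphaV)
    (A : Fin (D.p+1) → Matrix (Fin D.n) (Fin D.n) (LaurentSeries ℂ)) : Prop :=
  ∃ G : D.GRep, G.Valid ∧ G.Good ∧ Realizes v x G ∧ SimConj A G.conn

theorem Corresponds.exists_act_iff {x x' : D.quiv.Rep D.alphaV}
    {A A' : Fin (D.p+1) → Matrix (Fin D.n) (Fin D.n) (LaurentSeries ℂ)}
    (h : Corresponds v x A) (h' : Corresponds v x' A') :
    (∃ g : D.quiv.GGroup D.alphaV, FinQuiver.act g x = x') ↔ SimConj A A' := by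
  obtain ⟨G, hG, hg, hR, hA⟩ := h
  obtain ⟨G', hG', hg', hR', hA'⟩ := h'
  rw [ConnData.exists_act_iff hR hR' hG hG' hg hg']
  exact ⟨fun h => (hA.trans h).trans hA'.symm, fun h => (hA.symm.trans h).trans hA'⟩

theorem exists_rep_corresponds (hv : D.IsGeneric v) (A : D.MBSub) :
    ∃ x : D.MregSub (fun a => D.lamV a + D.vbar v a),
      D.DetCond x.1 ∧ Corresponds v x.1 A.1 := by
  obtain ⟨G, hG, hg, hi, hA⟩ := exists_gRep A.2
  obtain ⟨x, hR⟩ := exists_rep v G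
  exact ⟨⟨x, (hR.mu_iff hG.frames).2 hG, hR.irred hv hG hg hi⟩, hR.detCond hG.frames,
    G, hG, hg, hR, hA⟩

theorem exists_conn_corresponds (x : D.MregSub (fun a => D.lamV a + D.vbar v a))
    (hd : D.DetCond x.1) : ∃ A : D.MBSub, Corresponds v x.1 A.1 := by
  obtain ⟨G, hF, hR⟩ := exists_realizes v hd
  have hG := (hR.mu_iff hF).1 x.2.1
  have hg := hR.good hG x.2.2
  exact ⟨⟨G.conn, hG.mbMem hg (hR.baseIrred hG x.2.2)⟩, G, hG, hg, hR, SimConj.refl _⟩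

end ConnData

end

open ConnData FinQuiver in
/-- STATEMENT 10. -/
theorem open_embedding_of_moduli_into_quiver_variety (D : ConnData) :
    ∃ (v : Fin D.p → ℂ) (Φ : D.MB → D.Mreg (fun a => D.lamV a + D.vbar v a)),
      Function.Injective Φ ∧
      Set.range Φ = {c | ∃ y : D.MregSub (fun a => D.lamV a + D.vbar v a),
        D.DetCond y.1 ∧ Quot.mk _ y = c} ∧
      ((∀ i, D.isIrr i → i = 0) → v = 0 ∧ Function.Bijective Φ) := by
  obtain ⟨v, hv, hv0⟩ := exists_isGeneric D
  choose f hfd hf using exists_rep_corresponds hv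
  let Φ : D.MB → D.Mreg (fun a => D.lamV a + D.vbar v a) :=
    Quot.lift (fun A => Quot.mk _ (f A))
      fun A A' h => Quot.sound (((hf A).exists_act_iff (hf A')).2 h)
  have hinj : Function.Injective Φ := by
    rintro ⟨A⟩ ⟨A'⟩ h
    refine Quot.sound (((hf A).exists_act_iff (hf A')).1 ?_)
    exact (equivalence_exists_act.comap Subtype.val).eqvGen_iff.1 (Quot.eqvGen_exact h)
  have hrange : Set.range Φ = {c | ∃ y : D.MregSub (fun a => D.lamV a + D.vbar v a),
      D.DetCond y.1 ∧ Quot.mk _ y = c} := by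
    ext c
    constructor
    · rintro ⟨⟨A⟩, rfl⟩
      exact ⟨f A, hfd A, rfl⟩
    · rintro ⟨y, hy, rfl⟩
      obtain ⟨A, hA⟩ := exists_conn_corresponds y hy
      exact ⟨Quot.mk _ A, Quot.sound (((hf A).exists_act_iff hA).2 (SimConj.refl _))⟩
  refine ⟨v, Φ, hinj, hrange, fun hI => ⟨hv0 hI, hinj, fun c => ?_⟩⟩
  obtain ⟨y, rfl⟩ := Quot.exists_rep c
  have : Quot.mk _ y ∈ Set.range Φ := by
    rw [hrange]
    exact ⟨y, fun i => (i.2.2 (hI i.1 i.2.1)).elim, rfl⟩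
  exact this
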